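/- Let 1 < p, q ≤ ∞ be exponents, define r by 1/r = 1/p + 1/q, and assume 0 < 1/r < 3/2. Let A ≥ 1 and let 𝓘 = (I_n)_{n∈ℤ} be a countable family of intervals of ℝ satisfying the bounded-overlap condition Σ_{n∈ℤ} 1_{I_n}(ξ) ≤ A for every ξ ∈ ℝ. Then there exists a constant C = C(p,q,r,A) such that for every sequence (f_n)_{n∈ℤ} of Schwartz functions on ℝ with all but finitely many f_n identically zero, and every Schwartz function g on ℝ, ‖ ( Σ_{n∈ℤ} |π_{I_n}(f_n,g)|² )^{1/2} ‖_{L^r(ℝ)} ≤ C ‖ ( Σ_{n∈ℤ} |f_n|² )^{1/2} ‖_{L^p(ℝ)} ‖g‖_{L^q(ℝ)}. -/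

import Mathlib

open MeasureTheory Real Set
open scoped ENNReal

/-- The Fourier transform `f̂(ξ) = ∫ f(t) e^{-2πitξ} dt`. -/
noncomputable def FT (f : ℝ → ℂ) (ξ : ℝ) : ℂ :=
  ∫ t : ℝ, Complex.exp (((-2 * Real.pi * t * ξ : ℝ) : ℂ) * Complex.I) * f t

/-- The bilinear multiplier
`π_A(f,g)(x) = ∫∫ e^{2πix(ξ₁+ξ₂)} f̂(ξ₁) ĝ(ξ₂) 1_A(ξ₂-ξ₁) dξ₁ dξ₂`. -/
noncomputable def biMul (A : Set ℝ) (f g : ℝ → ℂ) (x : ℝ) : ℂ :=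
  ∫ ξ : ℝ × ℝ, Complex.exp (((2 * Real.pi * x * (ξ.1 + ξ.2) : ℝ) : ℂ) * Complex.I) *
    FT f ξ.1 * FT g ξ.2 * A.indicator 1 (ξ.2 - ξ.1)

section
open scoped FourierTransform ComplexConjugate InnerProductSpace

/-- The weight `1 / (1 + ((x - c) / t)²)`. -/
noncomputable def wt (c t x : ℝ) : ℝ := (1 + ((x - c) / t) ^ 2)⁻¹

lemma wt_pos (c t x : ℝ) : 0 < wt c t x := by unfold wt; positivity

lemma wt_le_one (c t x : ℝ) : wt c t x ≤ 1 := by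
  unfold wt
  apply inv_le_one_of_one_le₀
  nlinarith [sq_nonneg ((x - c) / t)]

lemma wt_comm (c t x : ℝ) : wt c t x = wt x t c := by
  unfold wt
  congr 2
  rw [← neg_sub c x, neg_div, neg_sq]

lemma continuous_wt (c t : ℝ) : Continuous (wt c t) := by
  unfold wt
  refine Continuous.inv₀ (by fun_prop) (fun x => by positivity)

lemma wt_comp {c c' t t' : ℝ} (ht' : 0 < t') (htt : t' ≤ t) (hc : |c - c'| ≤ t) (x : ℝ) :
    wt c' t' x ≤ 3 * wt c t x := by
  have ht : 0 < t := lt_of_lt_of_le ht' htt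
  unfold wt
  rw [← div_eq_mul_inv, inv_eq_one_div, div_le_div_iff₀ (by positivity) (by positivity)]
  have h1 : |(x - c) / t| ≤ |(x - c') / t'| + 1 := by
    rw [abs_div, abs_div, abs_of_pos ht, abs_of_pos ht', div_le_iff₀ ht]
    have h2 : |x - c'| ≤ |x - c'| / t' * t := by
      rw [div_mul_eq_mul_div, le_div_iff₀ ht']
      exact mul_le_mul_of_nonneg_left htt (abs_nonneg _)
    have h3 : |x - c| ≤ |x - c'| + |c - c'| := by
      rw [abs_sub_comm c c']; exact abs_sub_le _ _ _
    nlinarith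
  have h4 : ((x - c) / t) ^ 2 ≤ (|(x - c') / t'| + 1) ^ 2 := by
    rw [← sq_abs]; gcongr
  have h5 := sq_abs ((x - c') / t')
  nlinarith [sq_nonneg (|(x - c') / t'| - 1)]

lemma integrable_wt (c : ℝ) {t : ℝ} (ht : 0 < t) : Integrable (wt c t) := by
  have h := (integrable_inv_one_add_sq.comp_sub_right c).comp_div ht.ne'
  have h2 := (integrable_inv_one_add_sq.comp_div ht.ne').comp_sub_right c
  exact h2

lemma integral_wt (c : ℝ) {t : ℝ} (ht : 0 < t) : ∫ x, wt c t x = π * t := by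
  have h1 : ∫ x, wt c t x = ∫ x, (fun y => (1 + (y / t) ^ 2)⁻¹) (x - c) := rfl
  rw [h1, integral_sub_right_eq_self (fun y : ℝ => (1 + (y / t) ^ 2)⁻¹) c]
  have h2 := Measure.integral_comp_div (fun y : ℝ => (1 + y ^ 2)⁻¹) t
  rw [h2, integral_univ_inv_one_add_sq, abs_of_pos ht, smul_eq_mul, mul_comm]

lemma wt_pow_le {c t x : ℝ} {a b : ℕ} (h : a ≤ b) : wt c t x ^ b ≤ wt c t x ^ a :=
  pow_le_pow_of_le_one (wt_pos _ _ _).le (wt_le_one _ _ _) h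

lemma integrable_wt_pow (c : ℝ) {t : ℝ} (ht : 0 < t) {n : ℕ} (hn : 1 ≤ n) :
    Integrable (fun x => wt c t x ^ n) := by
  refine (integrable_wt c ht).mono' ((continuous_wt c t).pow n).aestronglyMeasurable ?_
  filter_upwards with x
  rw [norm_of_nonneg (pow_nonneg (wt_pos _ _ _).le _)]
  simpa using wt_pow_le (c := c) (t := t) (x := x) hn

lemma integral_wt_pow_le (c : ℝ) {t : ℝ} (ht : 0 < t) {n : ℕ} (hn : 1 ≤ n) :
    ∫ x, wt c t x ^ n ≤ π * t := by
  rw [← integral_wt c ht]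
  refine integral_mono (integrable_wt_pow c ht hn) (integrable_wt c ht) fun x => ?_
  simpa using wt_pow_le (c := c) (t := t) (x := x) hn

/-- Length of the dyadic interval indexed by `I = (k, m)`. -/
noncomputable def dlen (I : ℤ × ℤ) : ℝ := (2 : ℝ) ^ I.1

/-- Center of the dyadic interval indexed by `I = (k, m)`. -/
noncomputable def dcen (I : ℤ × ℤ) : ℝ := (2 : ℝ) ^ I.1 * (I.2 + 1 / 2)

/-- The dyadic interval `[2^k m, 2^k (m+1))`. -/
def dint (I : ℤ × ℤ) : Set ℝ := Ico ((2 : ℝ) ^ I.1 * I.2) ((2 : ℝ) ^ I.1 * (I.2 + 1))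

/-- The weight adapted to a dyadic interval. -/
noncomputable def dw (I : ℤ × ℤ) (x : ℝ) : ℝ := wt (dcen I) (dlen I) x

lemma dlen_pos (I : ℤ × ℤ) : 0 < dlen I := by unfold dlen; positivity

lemma dw_pos (I : ℤ × ℤ) (x : ℝ) : 0 < dw I x := wt_pos _ _ _

lemma dw_le_one (I : ℤ × ℤ) (x : ℝ) : dw I x ≤ 1 := wt_le_one _ _ _

lemma mem_dint {I : ℤ × ℤ} {x : ℝ} :
    x ∈ dint I ↔ dcen I - dlen I / 2 ≤ x ∧ x < dcen I + dlen I / 2 := by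
  unfold dint dcen dlen
  rw [mem_Ico]
  ring_nf

lemma dint_eq (I : ℤ × ℤ) : dint I = Ico (dcen I - dlen I / 2) (dcen I + dlen I / 2) := by
  ext x; exact mem_dint

lemma dcen_mem (I : ℤ × ℤ) : dcen I ∈ dint I := by
  rw [mem_dint]; have := dlen_pos I; constructor <;> linarith

lemma measurableSet_dint (I : ℤ × ℤ) : MeasurableSet (dint I) := measurableSet_Ico

lemma volume_dint (I : ℤ × ℤ) : volume (dint I) = ENNReal.ofReal (dlen I) := by
  rw [dint_eq, Real.volume_Ico]; congr 1; ring

lemma volume_real_dint (I : ℤ × ℤ) : volume.real (dint I) = dlen I := by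
  rw [measureReal_def, volume_dint, ENNReal.toReal_ofReal (dlen_pos I).le]

lemma mem_dint_iff_floor {I : ℤ × ℤ} {x : ℝ} : x ∈ dint I ↔ ⌊x / (2 : ℝ) ^ I.1⌋ = I.2 := by
  have h : (0 : ℝ) < (2 : ℝ) ^ I.1 := by positivity
  rw [Int.floor_eq_iff, le_div_iff₀ h, div_lt_iff₀ h, dint, mem_Ico, mul_comm,
    mul_comm ((2 : ℝ) ^ I.1) ((I.2 : ℝ) + 1)]

/-- The dyadic interval of scale `k` containing `x`. -/
noncomputable def dat (k : ℤ) (x : ℝ) : ℤ × ℤ := (k, ⌊x / (2 : ℝ) ^ k⌋)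

lemma mem_dat (k : ℤ) (x : ℝ) : x ∈ dint (dat k x) := mem_dint_iff_floor.2 rfl

lemma eq_dat_of_mem {I : ℤ × ℤ} {x : ℝ} (h : x ∈ dint I) : I = dat I.1 x := by
  rw [mem_dint_iff_floor] at h
  ext <;> simp [dat, h]

lemma dint_subset_of_le {I J : ℤ × ℤ} (hk : I.1 ≤ J.1) {x : ℝ} (hI : x ∈ dint I)
    (hJ : x ∈ dint J) : dint I ⊆ dint J := by
  obtain ⟨n, hn⟩ := Int.eq_ofNat_of_zero_le (sub_nonneg.2 hk)
  have hJk : J.1 = I.1 + n := by linarith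
  have h2 : (2 : ℝ) ^ J.1 = (2 : ℝ) ^ I.1 * ((2 ^ n : ℤ) : ℝ) := by
    rw [hJk, zpow_add₀ two_ne_zero]; push_cast; rw [zpow_natCast]
  have hp : (0 : ℝ) < (2 : ℝ) ^ I.1 := by positivity
  have key : ∀ y, y ∈ dint J ↔ ⌊y / (2 : ℝ) ^ I.1⌋ / (2 ^ n : ℤ) = J.2 := by
    intro y
    rw [mem_dint_iff_floor, h2, ← div_div]
    have := Int.floor_div_natCast (y / (2 : ℝ) ^ I.1) (2 ^ n)
    push_cast at this ⊢
    rw [this]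
  intro y hy
  rw [key]
  rw [key] at hJ
  rw [mem_dint_iff_floor] at hI hy
  rw [hy, ← hI, hJ]

lemma dint_sub_scale {I J : ℤ × ℤ} (h : dint I ⊆ dint J) : I.1 ≤ J.1 := by
  have h1 := measure_mono (μ := volume) h
  rw [volume_dint, volume_dint, ENNReal.ofReal_le_ofReal_iff (dlen_pos J).le] at h1
  exact (zpow_le_zpow_iff_right₀ one_lt_two).1 h1

lemma dlen_le {I J : ℤ × ℤ} (h : I.1 ≤ J.1) : dlen I ≤ dlen J :=
  zpow_le_zpow_right₀ one_le_two h

lemma dint_sub_dlen {I J : ℤ × ℤ} (h : dint I ⊆ dint J) : dlen I ≤ dlen J :=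
  dlen_le (dint_sub_scale h)

lemma abs_sub_dcen {I : ℤ × ℤ} {x : ℝ} (h : x ∈ dint I) : |x - dcen I| ≤ dlen I / 2 := by
  rw [mem_dint] at h
  rw [abs_le]; constructor <;> linarith

lemma dint_sub_dcen {I J : ℤ × ℤ} (h : dint I ⊆ dint J) : |dcen I - dcen J| ≤ dlen J / 2 :=
  abs_sub_dcen (h (dcen_mem I))

lemma dint_sub_or_disjoint {I J : ℤ × ℤ} (hk : I.1 ≤ J.1) :
    dint I ⊆ dint J ∨ Disjoint (dint I) (dint J) := by
  by_cases h : Disjoint (dint I) (dint J)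
  · exact Or.inr h
  · obtain ⟨x, hx, hy⟩ := Set.not_disjoint_iff.1 h
    exact Or.inl (dint_subset_of_le hk hx hy)

lemma disjoint_of_same_scale {I J : ℤ × ℤ} (hk : I.1 = J.1) (h : I ≠ J) :
    Disjoint (dint I) (dint J) := by
  rcases dint_sub_or_disjoint hk.le with h1 | h1
  · exact absurd (by rw [eq_dat_of_mem (dcen_mem I), eq_dat_of_mem (h1 (dcen_mem I)), hk]) h
  · exact h1

lemma dw_le_of_sub {I J : ℤ × ℤ} (h : dint I ⊆ dint J) (x : ℝ) : dw I x ≤ 3 * dw J x := by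
  refine wt_comp (dlen_pos I) (dint_sub_dlen h) ?_ x
  rw [abs_sub_comm]
  have := dint_sub_dcen h
  have := dlen_pos J
  linarith

lemma dlen_mul_wt_le {I : ℤ × ℤ} {t : ℝ} (ht : dlen I ≤ t) (x : ℝ) :
    dlen I * wt (dcen I) t x ≤ 3 * ∫ y in dint I, wt x t y := by
  have htp : 0 < t := (dlen_pos I).trans_le ht
  have h1 : ∫ _y in dint I, wt (dcen I) t x ≤ ∫ y in dint I, 3 * wt x t y := by
    refine setIntegral_mono_on (by simp [volume_dint]) ((integrable_wt x htp).const_mul 3).integrableOn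
      (measurableSet_dint I) fun y hy => ?_
    rw [wt_comm x t y]
    refine wt_comp htp le_rfl ?_ x
    have := abs_sub_dcen hy
    have := dlen_pos I
    linarith
  rw [integral_const_mul] at h1
  simpa [volume_real_dint] using h1

lemma sum_setIntegral_le {α : Type*} (s : Finset α) (I : α → ℤ × ℤ) (f : ℝ → ℝ) (hf : Integrable f)
    (h0 : ∀ x, 0 ≤ f x) (A : Set ℝ) (hA : MeasurableSet A) (hsub : ∀ i ∈ s, dint (I i) ⊆ A)
    (hd : ∀ i ∈ s, ∀ j ∈ s, i ≠ j → Disjoint (dint (I i)) (dint (I j))) :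
    ∑ i ∈ s, ∫ y in dint (I i), f y ≤ ∫ y in A, f y := by
  rw [← integral_biUnion_finset s (fun i _ => measurableSet_dint _) (fun i hi j hj h => hd i hi j hj h)
    (fun i _ => hf.integrableOn)]
  refine setIntegral_mono_set hf.integrableOn (ae_of_all _ h0) ?_
  exact (iUnion₂_subset hsub).eventuallyLE

lemma sum_dw_le (k : ℤ) (s : Finset (ℤ × ℤ)) (hs : ∀ I ∈ s, I.1 = k) (x : ℝ) :
    ∑ I ∈ s, dw I x ≤ 3 * π := by
  have hp : (0 : ℝ) < 2 ^ k := by positivity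
  have hl : ∀ I ∈ s, dlen I = 2 ^ k := fun I hI => by rw [dlen, hs I hI]
  have h1 : ∑ I ∈ s, 2 ^ k * dw I x ≤ ∑ I ∈ s, 3 * ∫ y in dint I, wt x (2 ^ k) y := by
    refine Finset.sum_le_sum fun I hI => ?_
    have := dlen_mul_wt_le (I := I) (t := 2 ^ k) (hl I hI).le x
    rwa [dw, hl I hI] at *
  have h2 := sum_setIntegral_le s id (wt x (2 ^ k)) (integrable_wt x hp) (fun y => (wt_pos _ _ _).le)
    univ MeasurableSet.univ (fun _ _ => subset_univ _)
    (fun i hi j hj h => disjoint_of_same_scale ((hs i hi).trans (hs j hj).symm) h)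
  rw [setIntegral_univ, integral_wt x hp] at h2
  rw [← Finset.mul_sum, ← Finset.mul_sum] at h1
  simp only [id] at h2
  have h3 : 2 ^ k * ∑ I ∈ s, dw I x ≤ 2 ^ k * (3 * π) := by nlinarith
  exact le_of_mul_le_mul_left h3 hp

/-- Two-sided geometric sums over dyadic scales are uniformly bounded. -/
lemma exists_sum_min_rpow_le {δ : ℝ} (hδ : 0 < δ) : ∃ C : ℝ, 0 < C ∧ ∀ ρ : ℝ, 0 < ρ → ∀ F : Finset ℤ,
    ∑ n ∈ F, min (((2 : ℝ) ^ n * ρ) ^ δ) (((2 : ℝ) ^ n * ρ) ^ (-δ)) ≤ C := by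
  set a : ℝ := (2 : ℝ) ^ (-δ) with ha
  have ha0 : 0 < a := by positivity
  have ha1 : a < 1 := Real.rpow_lt_one_of_one_lt_of_neg one_lt_two (by linarith)
  have hsum : Summable fun n : ℤ => a ^ n.natAbs := by
    refine Summable.of_nat_of_neg ?_ ?_ <;> simpa using summable_geometric_of_lt_one ha0.le ha1
  refine ⟨2 ^ δ * (∑' n : ℤ, a ^ n.natAbs) + 1, ?_, fun ρ hρ F => ?_⟩
  · have : 0 ≤ ∑' n : ℤ, a ^ n.natAbs := tsum_nonneg fun n => by positivity
    positivity
  obtain ⟨N, hN1, hN2⟩ := exists_mem_Ico_zpow (x := ρ) (y := 2) hρ one_lt_two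
  have hterm : ∀ n ∈ F, min (((2 : ℝ) ^ n * ρ) ^ δ) (((2 : ℝ) ^ n * ρ) ^ (-δ)) ≤
      2 ^ δ * a ^ (n + N).natAbs := by
    intro n _
    have hb1 : (2 : ℝ) ^ (n + N) ≤ 2 ^ n * ρ := by
      rw [zpow_add₀ two_ne_zero]; gcongr
    have hb2 : 2 ^ n * ρ ≤ (2 : ℝ) ^ (n + N) * 2 := by
      rw [zpow_add₀ two_ne_zero, mul_assoc]
      rw [zpow_add_one₀ two_ne_zero] at hN2
      gcongr
    have hpos : (0 : ℝ) < 2 ^ n * ρ := by positivity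
    rcases le_total 0 (n + N) with h | h
    · refine (min_le_right _ _).trans ?_
      have h1 : (2 ^ n * ρ) ^ (-δ) ≤ ((2 : ℝ) ^ (n + N)) ^ (-δ) :=
        Real.rpow_le_rpow_of_nonpos (by positivity) hb1 (by linarith)
      have h2 : ((2 : ℝ) ^ (n + N)) ^ (-δ) = a ^ (n + N).natAbs := by
        obtain ⟨j, hj⟩ := Int.eq_ofNat_of_zero_le h
        rw [hj, ha, ← Real.rpow_intCast, ← Real.rpow_natCast, ← Real.rpow_mul (by norm_num),
          ← Real.rpow_mul (by norm_num)]
        congr 1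
        simp [mul_comm]
      have h3 : (1 : ℝ) ≤ 2 ^ δ := Real.one_le_rpow one_le_two hδ.le
      rw [h2] at h1
      have : 0 ≤ a ^ (n + N).natAbs := by positivity
      nlinarith
    · refine (min_le_left _ _).trans ?_
      have h1 : (2 ^ n * ρ) ^ δ ≤ ((2 : ℝ) ^ (n + N) * 2) ^ δ :=
        Real.rpow_le_rpow hpos.le hb2 hδ.le
      refine h1.trans (le_of_eq ?_)
      rw [Real.mul_rpow (by positivity) (by norm_num), mul_comm]
      congr 1
      obtain ⟨j, hj⟩ := Int.eq_ofNat_of_zero_le (neg_nonneg.2 h)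
      have hj' : n + N = -(j : ℤ) := by rw [← hj]; ring
      rw [hj', ha, ← Real.rpow_intCast, ← Real.rpow_natCast, ← Real.rpow_mul (by norm_num),
        ← Real.rpow_mul (by norm_num)]
      congr 1
      simp [mul_comm]
  refine (Finset.sum_le_sum hterm).trans ?_
  rw [← Finset.mul_sum]
  have h5 : ∑ n ∈ F, a ^ (n + N).natAbs ≤ ∑' n : ℤ, a ^ n.natAbs := by
    have hs2 : Summable fun n : ℤ => a ^ (n + N).natAbs :=
      hsum.comp_injective (add_left_injective N)
    refine (hs2.sum_le_tsum F (fun n _ => by positivity)).trans (le_of_eq ?_)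
    exact (Equiv.addRight N).tsum_eq (fun n : ℤ => a ^ n.natAbs)
  have : (0 : ℝ) < 2 ^ δ := by positivity
  nlinarith

/-- The character `u ↦ e^{2πiu}`. -/
noncomputable def ee (u : ℝ) : ℂ := Complex.exp (((2 * π * u : ℝ) : ℂ) * Complex.I)

lemma ee_add (u v : ℝ) : ee (u + v) = ee u * ee v := by
  unfold ee; rw [← Complex.exp_add]; congr 1; push_cast; ring

@[simp] lemma norm_ee (u : ℝ) : ‖ee u‖ = 1 := Complex.norm_exp_ofReal_mul_I _

@[simp] lemma ee_zero : ee 0 = 1 := by simp [ee]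

lemma conj_ee (u : ℝ) : conj (ee u) = ee (-u) := by
  unfold ee
  rw [← Complex.exp_conj, map_mul, Complex.conj_ofReal, Complex.conj_I]; congr 1; push_cast; ring

lemma continuous_ee : Continuous ee := by unfold ee; fun_prop

lemma hasDerivAt_ee (u : ℝ) : HasDerivAt ee (2 * π * Complex.I * ee u) u := by
  have h1 : HasDerivAt (fun v : ℝ => ((2 * π * v : ℝ) : ℂ) * Complex.I) (2 * π * Complex.I) u := by
    have := (((hasDerivAt_id u).const_mul (2 * π)).ofReal_comp).mul_const Complex.I
    simpa using this
  have e : 2 * π * Complex.I * ee u = Complex.exp (((2 * π * u : ℝ) : ℂ) * Complex.I) *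
      (2 * π * Complex.I) := by unfold ee; ring
  rw [e]
  exact h1.cexp

lemma fourier_eq_ee {E : Type*} [NormedAddCommGroup E] [NormedSpace ℂ E] (f : ℝ → E) (w : ℝ) :
    𝓕 f w = ∫ v, ee (-(v * w)) • f v := by
  rw [Real.fourier_real_eq_integral_exp_smul]
  unfold ee
  congr 1; ext v; congr 3; push_cast; ring

lemma fourierInv_eq_ee {E : Type*} [NormedAddCommGroup E] [NormedSpace ℂ E] (f : ℝ → E) (w : ℝ) :
    𝓕⁻ f w = ∫ v, ee (v * w) • f v := by
  rw [Real.fourierInv_eq']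
  unfold ee
  congr 1; ext v; congr 3; simp; ring

/-- A wave packet of width `t`, frequency `ν` and position `y`. -/
noncomputable def pkt (φ : ℝ → ℂ) (t ν y x : ℝ) : ℂ :=
  (t⁻¹ : ℝ) * φ ((y - x) / t) * ee (ν * (y - x))

lemma schwartz_decay (φ : SchwartzMap ℝ ℂ) (N : ℕ) :
    ∃ C : ℝ, 0 < C ∧ ∀ u, ‖φ u‖ ≤ C * ((1 + u ^ 2)⁻¹) ^ N := by
  have h := SchwartzMap.one_add_le_sup_seminorm_apply (𝕜 := ℝ) (m := (2 * N, 0)) (k := 2 * N) (n := 0)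
    le_rfl le_rfl φ
  set C := 2 ^ (2 * N, 0).1 * ((Finset.Iic (2 * N, 0)).sup fun m => SchwartzMap.seminorm ℝ m.1 m.2) φ
  refine ⟨|C| + 1, by positivity, fun u => ?_⟩
  have h1 := h u
  rw [norm_iteratedFDeriv_zero, Real.norm_eq_abs, pow_mul] at h1
  rw [inv_pow, ← div_eq_mul_inv, le_div_iff₀ (by positivity), mul_comm]
  have h2 : (1 + u ^ 2) ^ N ≤ ((1 + |u|) ^ 2) ^ N := by
    gcongr
    rw [← sq_abs u]; nlinarith [abs_nonneg u]
  calc (1 + u ^ 2) ^ N * ‖φ u‖ ≤ ((1 + |u|) ^ 2) ^ N * ‖φ u‖ := by gcongr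
    _ ≤ C := h1
    _ ≤ |C| + 1 := by linarith [le_abs_self C]

lemma continuous_pkt (φ : SchwartzMap ℝ ℂ) (t ν y : ℝ) : Continuous (pkt φ t ν y) := by
  unfold pkt
  have := φ.continuous
  have := continuous_ee
  fun_prop

lemma norm_pkt (φ : ℝ → ℂ) {t : ℝ} (ht : 0 < t) (ν y x : ℝ) :
    ‖pkt φ t ν y x‖ = t⁻¹ * ‖φ ((y - x) / t)‖ := by
  unfold pkt
  rw [norm_mul, norm_mul, norm_ee, mul_one, Complex.norm_real, norm_of_nonneg (by positivity)]

lemma norm_pkt_le {φ : ℝ → ℂ} {C : ℝ} {N : ℕ} (hφ : ∀ u, ‖φ u‖ ≤ C * ((1 + u ^ 2)⁻¹) ^ N)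
    {t : ℝ} (ht : 0 < t) (ν y x : ℝ) : ‖pkt φ t ν y x‖ ≤ t⁻¹ * (C * wt y t x ^ N) := by
  rw [norm_pkt φ ht]
  have h := hφ ((y - x) / t)
  rw [wt_comm]
  unfold wt
  gcongr

lemma exists_deriv_pkt_bound (φ : SchwartzMap ℝ ℂ) : ∃ C : ℝ, 0 < C ∧ ∀ t ν y ζ x D : ℝ, 0 < t →
    |ν - ζ| * t ≤ D → ∃ d : ℂ, HasDerivAt (fun x => ee (ζ * x) * pkt φ t ν y x) d x ∧
    ‖d‖ ≤ C * (1 + D) * (t ^ 2)⁻¹ * wt y t x ^ 3 := by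
  obtain ⟨C0, hC0, h0⟩ := schwartz_decay φ 3
  obtain ⟨C1, hC1, h1⟩ := schwartz_decay (SchwartzMap.derivCLM ℝ ℂ φ) 3
  refine ⟨C1 + 2 * π * C0, by positivity, fun t ν y ζ x D ht hD => ?_⟩
  have hrw : (fun x => ee (ζ * x) * pkt φ t ν y x) =
      fun x => (ee (ν * y) * (t⁻¹ : ℝ)) * (φ ((y - x) / t) * ee ((ζ - ν) * x)) := by
    ext x
    unfold pkt
    have : ee (ζ * x) * ee (ν * (y - x)) = ee (ν * y) * ee ((ζ - ν) * x) := by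
      rw [← ee_add, ← ee_add]; congr 1; ring
    linear_combination ((t⁻¹ : ℝ) : ℂ) * φ ((y - x) / t) * this
  have hd1 : HasDerivAt (fun x => φ ((y - x) / t)) ((-1 / t) • deriv φ ((y - x) / t)) x := by
    have hin : HasDerivAt (fun x => (y - x) / t) (-1 / t) x :=
      ((hasDerivAt_id x).const_sub y).div_const t
    exact (φ.differentiableAt.hasDerivAt).scomp x hin
  have hd2 : HasDerivAt (fun x => ee ((ζ - ν) * x))
      ((ζ - ν) • (2 * π * Complex.I * ee ((ζ - ν) * x))) x := by
    have hin : HasDerivAt (fun x => (ζ - ν) * x) (ζ - ν) x := by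
      simpa using (hasDerivAt_id x).const_mul (ζ - ν)
    exact (hasDerivAt_ee _).scomp x hin
  rw [hrw]
  refine ⟨_, (hd1.mul hd2).const_mul _, ?_⟩
  have e1 : ‖(-1 / t) • deriv φ ((y - x) / t) * ee ((ζ - ν) * x)‖ ≤ t⁻¹ * (C1 * wt y t x ^ 3) := by
    rw [norm_mul, norm_ee, mul_one, norm_smul, norm_div, norm_neg, norm_one, norm_of_nonneg ht.le,
      one_div]
    have h := h1 ((y - x) / t)
    rw [SchwartzMap.derivCLM_apply] at h
    rw [wt_comm]; unfold wt
    gcongr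
  have e2 : ‖φ ((y - x) / t) * ((ζ - ν) • (2 * π * Complex.I * ee ((ζ - ν) * x)))‖ ≤
      (C0 * wt y t x ^ 3) * (|ν - ζ| * (2 * π)) := by
    rw [norm_mul, norm_smul, norm_mul, norm_ee, mul_one, Real.norm_eq_abs, abs_sub_comm]
    have h := h0 ((y - x) / t)
    rw [wt_comm]; unfold wt
    have : ‖(2 * π * Complex.I : ℂ)‖ = 2 * π := by
      simp [abs_of_pos pi_pos]
    rw [this]
    gcongr
  have hw := pow_pos (wt_pos y t x) 3
  have hti : 0 < t⁻¹ := by positivity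
  have hD' : |ν - ζ| ≤ D * t⁻¹ := by rwa [← div_eq_mul_inv, le_div_iff₀ ht]
  have hD0 : 0 ≤ D := le_trans (by positivity) hD
  rw [norm_mul, norm_mul, norm_ee, one_mul, Complex.norm_real, norm_of_nonneg hti.le]
  refine (mul_le_mul_of_nonneg_left ((norm_add_le _ _).trans (add_le_add e1 e2)) hti.le).trans ?_
  have e3 : (C0 * wt y t x ^ 3) * (|ν - ζ| * (2 * π)) ≤ (C0 * wt y t x ^ 3) * (D * t⁻¹ * (2 * π)) := by
    gcongr
  refine (mul_le_mul_of_nonneg_left (add_le_add_right e3 _) hti.le).trans ?_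
  have e4 : (t ^ 2)⁻¹ = t⁻¹ * t⁻¹ := by rw [sq, mul_inv]
  rw [e4]
  have e5 : t⁻¹ * (t⁻¹ * (C1 * wt y t x ^ 3) + (C0 * wt y t x ^ 3) * (D * t⁻¹ * (2 * π))) =
    (C1 + D * (2 * π * C0)) * (t⁻¹ * t⁻¹) * wt y t x ^ 3 := by ring
  rw [e5]
  have e6 : C1 + D * (2 * π * C0) ≤ (C1 + 2 * π * C0) * (1 + D) := by
    have : 0 ≤ 2 * π * C0 := by positivity
    nlinarith [mul_nonneg hC1.le hD0]
  gcongr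

lemma fourier_conj_pkt (φ : SchwartzMap ℝ ℂ) {t : ℝ} (ht : 0 < t) (ν y η : ℝ) :
    ∫ x, pkt φ t ν y x * ee (η * x) = ee (η * y) * 𝓕 (φ : ℝ → ℂ) (t * (η - ν)) := by
  have h1 : ∫ x, pkt φ t ν y x * ee (η * x) =
      ∫ x, (fun z => pkt φ t ν y (y - z) * ee (η * (y - z))) (y - x) := by simp
  rw [h1, integral_sub_left_eq_self (fun z => pkt φ t ν y (y - z) * ee (η * (y - z))) volume y]
  have h2 : ∀ z, pkt φ t ν y (y - z) * ee (η * (y - z)) =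
      (fun u => (t⁻¹ : ℝ) * ee (η * y) * (ee (-(u * (t * (η - ν)))) * φ u)) (z / t) := by
    intro z
    unfold pkt
    simp only [sub_sub_cancel]
    have : ee (ν * z) * ee (η * (y - z)) = ee (η * y) * ee (-(z / t * (t * (η - ν)))) := by
      rw [← ee_add, ← ee_add]; congr 1; field_simp; ring
    linear_combination ((t⁻¹ : ℝ) : ℂ) * φ (z / t) * this
  simp_rw [h2]
  rw [Measure.integral_comp_div (fun u => (t⁻¹ : ℝ) * ee (η * y) * (ee (-(u * (t * (η - ν)))) * φ u)),
    abs_of_pos ht, integral_const_mul, fourier_eq_ee]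
  simp only [smul_eq_mul, Complex.real_smul]
  have : (t : ℂ) * (t⁻¹ : ℝ) = 1 := by rw [← Complex.ofReal_mul, mul_inv_cancel₀ ht.ne']; simp
  linear_combination (ee (η * y) * ∫ v, ee (-(v * (t * (η - ν)))) * φ v) * this

lemma pkt_eq_integral (φ : SchwartzMap ℝ ℂ) {t : ℝ} (ν y x : ℝ) :
    pkt φ t ν y x = ∫ ξ, (t⁻¹ : ℝ) * 𝓕 (φ : ℝ → ℂ) ξ * ee ((ξ / t + ν) * (y - x)) := by
  have h : φ ((y - x) / t) = 𝓕⁻ (𝓕 (φ : ℝ → ℂ)) ((y - x) / t) := by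
    have : 𝓕⁻ (𝓕 φ) ((y - x) / t) = φ ((y - x) / t) := by simp
    rw [← this, SchwartzMap.fourierInv_coe, SchwartzMap.fourier_coe]
  unfold pkt
  rw [h, fourierInv_eq_ee, ← integral_const_mul, ← integral_mul_const]
  congr 1; ext ξ
  have : ee ((ξ / t + ν) * (y - x)) = ee (ξ * ((y - x) / t)) * ee (ν * (y - x)) := by
    rw [← ee_add]; congr 1; ring
  rw [this, smul_eq_mul]; ring

lemma integrable_pkt (φ : SchwartzMap ℝ ℂ) {t : ℝ} (ht : 0 < t) (ν y : ℝ) :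
    Integrable (pkt φ t ν y) := by
  obtain ⟨C, hC, h⟩ := schwartz_decay φ 1
  refine (((integrable_wt_pow y ht le_rfl).const_mul C).const_mul t⁻¹).mono'
    (continuous_pkt φ t ν y).aestronglyMeasurable (ae_of_all _ fun x => norm_pkt_le h ht ν y x)

lemma integral_pkt_mul_conj_eq_zero (φ : SchwartzMap ℝ ℂ) (hφ : ∀ ξ, 1 ≤ |ξ| → 𝓕 (φ : ℝ → ℂ) ξ = 0)
    {t t' : ℝ} (ht : 0 < t) (ht' : 0 < t') {ν ν' s : ℝ} (y y' : ℝ)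
    (h : t⁻¹ + t'⁻¹ + |s| ≤ |ν - ν'|) :
    ∫ x, pkt φ t ν y x * (ee (s * x) * conj (pkt φ t' ν' y' x)) = 0 := by
  have hF : Integrable (𝓕 (φ : ℝ → ℂ)) := by
    rw [← SchwartzMap.fourier_coe]; exact (𝓕 φ).integrable
  have hg : Integrable fun x => ee (s * x) * conj (pkt φ t' ν' y' x) := by
    refine ((Complex.conjCLE.toContinuousLinearMap).integrable_comp
      (integrable_pkt φ ht' ν' y')).bdd_mul (c := 1) ?_ ?_
    · exact (continuous_ee.comp (by fun_prop)).aestronglyMeasurable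
    · simp
  have h1 : ∀ x, pkt φ t ν y x * (ee (s * x) * conj (pkt φ t' ν' y' x)) =
      ∫ ξ, ((t⁻¹ : ℝ) * 𝓕 (φ : ℝ → ℂ) ξ * ee ((ξ / t + ν) * (y - x))) *
        (ee (s * x) * conj (pkt φ t' ν' y' x)) := by
    intro x
    rw [integral_mul_const, ← pkt_eq_integral]
  simp_rw [h1]
  rw [integral_integral_swap]
  · refine (integral_congr_ae (ae_of_all _ fun ξ => ?_)).trans (integral_zero _ _)
    have h2 : ∀ x, ((t⁻¹ : ℝ) * 𝓕 (φ : ℝ → ℂ) ξ * ee ((ξ / t + ν) * (y - x))) *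
        (ee (s * x) * conj (pkt φ t' ν' y' x)) = ((t⁻¹ : ℝ) * 𝓕 (φ : ℝ → ℂ) ξ *
        ee ((ξ / t + ν) * y)) * conj (pkt φ t' ν' y' x * ee ((ξ / t + ν - s) * x)) := by
      intro x
      rw [map_mul, conj_ee]
      have : ee ((ξ / t + ν) * (y - x)) * ee (s * x) =
          ee ((ξ / t + ν) * y) * ee (-((ξ / t + ν - s) * x)) := by
        rw [← ee_add, ← ee_add]; congr 1; ring
      linear_combination ((t⁻¹ : ℝ) * 𝓕 (φ : ℝ → ℂ) ξ * conj (pkt φ t' ν' y' x)) * this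
    simp only [h2]
    rw [integral_const_mul, integral_conj, fourier_conj_pkt φ ht']
    by_cases hξ : 1 ≤ |ξ|
    · simp [hφ ξ hξ]
    · rw [hφ (t' * (ξ / t + ν - s - ν'))]
      · simp
      · push Not at hξ
        rw [abs_mul, abs_of_pos ht', ← inv_le_iff_one_le_mul₀' ht']
        have a1 : |ξ / t| ≤ t⁻¹ := by
          rw [abs_div, abs_of_pos ht, div_eq_mul_inv]
          have : 0 < t⁻¹ := by positivity
          nlinarith
        have a2 : |ν - ν'| ≤ |ξ / t + ν - s - ν'| + |ξ / t| + |s| := by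
          have := abs_sub (ξ / t + ν - s - ν') (ξ / t)
          have := abs_add_le (ξ / t + ν - s - ν' - ξ / t) s
          have e : ξ / t + ν - s - ν' - ξ / t + s = ν - ν' := by ring
          rw [e] at this
          linarith
        linarith
  · have := (hg.mul_prod hF).const_mul ((t⁻¹ : ℝ) : ℂ)
    refine Integrable.mono' this.norm ?_ ?_
    · have c1 : Continuous (fun z : ℝ × ℝ => ee ((z.2 / t + ν) * (y - z.1))) :=
        continuous_ee.comp (by fun_prop)
      have m1 : AEStronglyMeasurable (fun z : ℝ × ℝ => 𝓕 (φ : ℝ → ℂ) z.2) (volume.prod volume) :=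
        hF.aestronglyMeasurable.comp_snd
      have m2 := hg.aestronglyMeasurable.comp_fst (ν := (volume : Measure ℝ))
      exact ((m1.const_mul _).mul c1.aestronglyMeasurable).mul m2
    · refine ae_of_all _ fun z => ?_
      simp only [Function.uncurry, norm_mul, norm_ee, mul_one]
      apply le_of_eq; ring

/-- Integrability of polynomial multiples of products of two packets. -/
lemma integrable_pow_mul_pkt (φ : SchwartzMap ℝ ℂ) {t t' : ℝ} (ht : 0 < t) (ht' : 0 < t')
    (ν ν' y y' : ℝ) (n : ℕ) :
    Integrable fun x : ℝ => x ^ n • (pkt φ t ν y x * conj (pkt φ t' ν' y' x)) := by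
  obtain ⟨C, hC, h⟩ := schwartz_decay φ (n + 1)
  obtain ⟨C', hC', h'⟩ := schwartz_decay φ 0
  have hx : ∀ x : ℝ, |x| * wt y t x ≤ |y| + t := by
    intro x
    unfold wt
    rw [← div_eq_mul_inv, div_le_iff₀ (by positivity)]
    have h1 : |x| ≤ |y| + |x - y| := by
      have := abs_add_le y (x - y); simpa using this
    have h2 : |x - y| ≤ t * (1 + ((x - y) / t) ^ 2) := by
      have e : |x - y| = t * |(x - y) / t| := by
        rw [abs_div, abs_of_pos ht]; field_simp
      rw [e, ← sq_abs ((x - y) / t)]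
      gcongr
      nlinarith [sq_nonneg (|(x - y) / t| - 1), abs_nonneg ((x - y) / t)]
    have h3 : 0 ≤ |y| * ((x - y) / t) ^ 2 := by positivity
    nlinarith
  refine ((integrable_wt y ht).const_mul (t⁻¹ * C * (|y| + t) ^ n * (t'⁻¹ * C'))).mono' ?_ ?_
  · have := continuous_pkt φ t ν y
    have := continuous_pkt φ t' ν' y'
    have := Complex.continuous_conj
    refine Continuous.aestronglyMeasurable ?_
    fun_prop
  · refine ae_of_all _ fun x => ?_
    rw [norm_smul, norm_mul, RCLike.norm_conj, norm_pow, Real.norm_eq_abs]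
    have b1 := norm_pkt_le h ht ν y x
    have b2 := norm_pkt_le h' ht' ν' y' x
    rw [pow_zero, mul_one] at b2
    have hw := wt_pos y t x
    calc |x| ^ n * (‖pkt φ t ν y x‖ * ‖pkt φ t' ν' y' x‖)
        ≤ |x| ^ n * ((t⁻¹ * (C * wt y t x ^ (n + 1))) * (t'⁻¹ * C')) := by gcongr
      _ = t⁻¹ * C * (|x| * wt y t x) ^ n * (t'⁻¹ * C') * wt y t x := by rw [mul_pow]; ring
      _ ≤ t⁻¹ * C * (|y| + t) ^ n * (t'⁻¹ * C') * wt y t x := by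
        gcongr
        exact hx x

lemma integral_pow_pkt_eq_zero (φ : SchwartzMap ℝ ℂ) (hφ : ∀ ξ, 1 ≤ |ξ| → 𝓕 (φ : ℝ → ℂ) ξ = 0)
    {t t' : ℝ} (ht : 0 < t) (ht' : 0 < t') {ν ν' : ℝ} (y y' : ℝ)
    (h : t⁻¹ + t'⁻¹ < |ν - ν'|) (n : ℕ) :
    ∫ x : ℝ, x ^ n • (pkt φ t ν y x * conj (pkt φ t' ν' y' x)) = 0 := by
  set f : ℝ → ℂ := fun x => pkt φ t ν y x * conj (pkt φ t' ν' y' x) with hf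
  have hz : 𝓕 f =ᶠ[nhds 0] fun _ => (0 : ℂ) := by
    have hpos : 0 < |ν - ν'| - (t⁻¹ + t'⁻¹) := by linarith
    filter_upwards [Metric.ball_mem_nhds (0 : ℝ) hpos] with s hs
    rw [Metric.mem_ball, dist_zero_right, Real.norm_eq_abs] at hs
    rw [fourier_eq_ee]
    have := integral_pkt_mul_conj_eq_zero φ hφ ht ht' (ν := ν) (ν' := ν') (s := -s) y y'
      (by rw [abs_neg]; linarith)
    rw [← this]
    congr 1; ext x
    rw [hf]; simp only [smul_eq_mul]
    rw [show -(x * s) = -s * x by ring]; ring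
  have h1 := Real.iteratedDeriv_fourier (f := f) (N := ⊤) (n := n)
    (fun n _ => integrable_pow_mul_pkt φ ht ht' ν ν' y y' n) (by simp)
  have h2 : iteratedDeriv n (𝓕 f) 0 = 0 := by
    rw [hz.iteratedDeriv_eq n]
    simp
  rw [h1, fourier_eq_ee] at h2
  simp only [mul_zero, neg_zero, ee_zero, one_mul, smul_eq_mul] at h2
  have h3 : ∀ x : ℝ, (-2 * π * Complex.I * x : ℂ) ^ n * f x =
      (-2 * π * Complex.I) ^ n * (x ^ n • f x) := by
    intro x
    rw [mul_pow, Complex.real_smul]; push_cast; ring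
  simp_rw [h3] at h2
  rw [integral_const_mul] at h2
  have hne : (-2 * π * Complex.I : ℂ) ^ n ≠ 0 := by
    apply pow_ne_zero; simp [pi_ne_zero]
  exact (mul_eq_zero.1 h2).resolve_left hne

lemma integral_polynomial_pkt_eq_zero (φ : SchwartzMap ℝ ℂ)
    (hφ : ∀ ξ, 1 ≤ |ξ| → 𝓕 (φ : ℝ → ℂ) ξ = 0)
    {t t' : ℝ} (ht : 0 < t) (ht' : 0 < t') {ν ν' : ℝ} (y y' : ℝ)
    (h : t⁻¹ + t'⁻¹ < |ν - ν'|) (p : Polynomial ℝ) :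
    ∫ x : ℝ, p.eval x • (pkt φ t ν y x * conj (pkt φ t' ν' y' x)) = 0 := by
  simp_rw [Polynomial.eval_eq_sum_range, Finset.sum_smul, mul_smul]
  rw [integral_finsetSum (f := fun n (x : ℝ) => p.coeff n • x ^ n •
    (pkt φ t ν y x * conj (pkt φ t' ν' y' x))) _ fun n _ =>
    (integrable_pow_mul_pkt φ ht ht' ν ν' y y' n).smul (p.coeff n)]
  refine Finset.sum_eq_zero fun n _ => ?_
  rw [integral_smul, integral_pow_pkt_eq_zero φ hφ ht ht' y y' h, smul_zero]

/-- Tiles: a dyadic interval together with a frequency index. -/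
abbrev Tl := (ℤ × ℤ) × ℤ

/-- The properties satisfied by a family of wave packets adapted to tiles. -/
structure WP (κ B : ℝ) (Cd : ℕ → ℝ) (Cl : ℝ) (ph : Tl → ℝ → ℂ) (ν : Tl → ℝ) : Prop where
  cont : ∀ P, Continuous (ph P)
  decay : ∀ N P x, ‖ph P x‖ ≤ Cd N * (dlen P.1)⁻¹ * dw P.1 x ^ N
  lip : ∀ P ζ x x', |ν P - ζ| * dlen P.1 ≤ 113 → |x - x'| ≤ (dlen P.1 + |x - dcen P.1|) / 8 →
    ‖ee (ζ * x) * ph P x - ee (ζ * x') * ph P x'‖ ≤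
      Cl * (dlen P.1 ^ 2)⁻¹ * dw P.1 x ^ 3 * |x - x'|
  orth : ∀ P P' a b, 2 * ((dlen P.1)⁻¹ + (dlen P'.1)⁻¹) ≤ |ν P - ν P'| →
    ∫ x : ℝ, (1 + ((x - a) / b) ^ 2) ^ 2 • (ph P x * conj (ph P' x)) = 0
  freq : ∀ P, |ν P * dlen P.1 - κ * P.2| ≤ B
  Cd_pos : ∀ N, 0 < Cd N
  Cl_pos : 0 < Cl
  one_le_kappa : 1 ≤ |κ|
  freq_upper : B + 40 * |κ| ≤ 113
  freq_lower : B + 4 ≤ 40 * |κ|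
  freq_sep : 62 + 2 * B ≤ 128 * |κ|

lemma wt_le_dw {I : ℤ × ℤ} {y t : ℝ} (h1 : dlen I ≤ t) (h2 : t ≤ 2 * dlen I)
    (hy : |y - dcen I| ≤ dlen I) (x : ℝ) : wt y t x ≤ 12 * dw I x := by
  have hl := dlen_pos I
  have ht : 0 < t := hl.trans_le h1
  unfold dw wt
  rw [← div_eq_mul_inv, inv_eq_one_div, div_le_div_iff₀ (by positivity) (by positivity)]
  have e1 : |(x - dcen I) / dlen I| ≤ 2 * |(x - y) / t| + 1 := by
    rw [abs_div, abs_div, abs_of_pos ht, abs_of_pos hl, div_le_iff₀ hl]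
    have h3 : |x - dcen I| ≤ |x - y| + |y - dcen I| := abs_sub_le _ _ _
    have h4 : |x - y| ≤ 2 * (|x - y| / t) * dlen I := by
      have : |x - y| = |x - y| / t * t := by field_simp
      have h5 : |x - y| / t * t ≤ |x - y| / t * (2 * dlen I) := by gcongr
      linarith
    linarith
  have e2 : ((x - dcen I) / dlen I) ^ 2 ≤ (2 * |(x - y) / t| + 1) ^ 2 := by
    rw [← sq_abs]; gcongr
  have h5 := sq_abs ((x - y) / t)
  nlinarith [sq_nonneg (|(x - y) / t| - 1)]

lemma dw_le_dw_of_near {I : ℤ × ℤ} {x z : ℝ} (h : |x - z| ≤ (dlen I + |x - dcen I|) / 8) :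
    dw I z ≤ 3 * dw I x := by
  have hl := dlen_pos I
  unfold dw wt
  rw [← div_eq_mul_inv, inv_eq_one_div, div_le_div_iff₀ (by positivity) (by positivity)]
  have e1 : |(x - dcen I) / dlen I| ≤ 8 / 7 * |(z - dcen I) / dlen I| + 1 / 7 := by
    rw [abs_div, abs_div, abs_of_pos hl, div_le_iff₀ hl]
    have h3 : |x - dcen I| ≤ |x - z| + |z - dcen I| := abs_sub_le _ _ _
    have h4 : |z - dcen I| / dlen I * dlen I = |z - dcen I| := by field_simp
    nlinarith
  have e2 : ((x - dcen I) / dlen I) ^ 2 ≤ (8 / 7 * |(z - dcen I) / dlen I| + 1 / 7) ^ 2 := by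
    rw [← sq_abs]; gcongr
  have h5 := sq_abs ((z - dcen I) / dlen I)
  nlinarith [sq_nonneg (|(z - dcen I) / dlen I| - 1)]

theorem exists_WP (φ : SchwartzMap ℝ ℂ) (hφ : ∀ ξ, 1 ≤ |ξ| → 𝓕 (φ : ℝ → ℂ) ξ = 0) (κ B : ℝ)
    (h1 : 1 ≤ |κ|) (h2 : B + 40 * |κ| ≤ 113) (h3 : B + 4 ≤ 40 * |κ|) (h4 : 62 + 2 * B ≤ 128 * |κ|) :
    ∃ (Cd : ℕ → ℝ) (Cl : ℝ), ∀ t ν y : Tl → ℝ,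
      (∀ P, dlen P.1 ≤ t P ∧ t P ≤ 2 * dlen P.1) → (∀ P, |y P - dcen P.1| ≤ dlen P.1) →
      (∀ P, |ν P * dlen P.1 - κ * P.2| ≤ B) →
      WP κ B Cd Cl (fun P => pkt φ (t P) (ν P) (y P)) ν := by
  choose Cd hCd hdec using schwartz_decay φ
  obtain ⟨C, hC, hder⟩ := exists_deriv_pkt_bound φ
  refine ⟨fun N => Cd N * 12 ^ N, C * (1 + 226) * 36 ^ 3, fun t ν y ht hy hν => ?_⟩
  have htp : ∀ P, 0 < t P := fun P => (dlen_pos P.1).trans_le (ht P).1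
  refine ⟨fun P => continuous_pkt φ _ _ _, fun N P x => ?_, fun P ζ x x' hζ hx => ?_,
    fun P P' a b hPP => ?_, hν, fun N => mul_pos (hCd N) (by positivity), by positivity, h1, h2, h3, h4⟩
  · refine (norm_pkt_le (hdec N) (htp P) _ _ _).trans ?_
    have e1 := wt_le_dw (ht P).1 (ht P).2 (hy P) x
    have e2 : (t P)⁻¹ ≤ (dlen P.1)⁻¹ := inv_anti₀ (dlen_pos _) (ht P).1
    have e3 := wt_pos (y P) (t P) x
    have := dlen_pos P.1
    have := hCd N
    calc (t P)⁻¹ * (Cd N * wt (y P) (t P) x ^ N)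
        ≤ (dlen P.1)⁻¹ * (Cd N * (12 * dw P.1 x) ^ N) := by gcongr
      _ = _ := by rw [mul_pow]; ring
  · have hD : |ν P - ζ| * t P ≤ 226 := by
      have : |ν P - ζ| * t P ≤ |ν P - ζ| * (2 * dlen P.1) := by gcongr; exact (ht P).2
      linarith
    choose d hd1 hd2 using fun z => hder (t P) (ν P) (y P) ζ z 226 (htp P) hD
    have key := Convex.norm_image_sub_le_of_norm_hasDerivWithin_le (𝕜 := ℝ)
      (f := fun x => ee (ζ * x) * pkt φ (t P) (ν P) (y P) x) (f' := d) (s := uIcc x' x) (x := x') (y := x)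
      (C := C * (1 + 226) * 36 ^ 3 * (dlen P.1 ^ 2)⁻¹ * dw P.1 x ^ 3)
      (fun z _ => (hd1 z).hasDerivWithinAt) (fun z hz => ?_) (convex_uIcc _ _) left_mem_uIcc right_mem_uIcc
    · exact key
    · refine (hd2 z).trans ?_
      have hz' : |x - z| ≤ (dlen P.1 + |x - dcen P.1|) / 8 := by
        refine le_trans ?_ hx
        rw [uIcc_comm] at hz
        have := abs_sub_left_of_mem_uIcc hz
        rwa [abs_sub_comm z x, abs_sub_comm x' x] at this
      have e1 := wt_le_dw (ht P).1 (ht P).2 (hy P) z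
      have e2 : wt (y P) (t P) z ≤ 36 * dw P.1 x := by linarith [dw_le_dw_of_near hz']
      have e3 : (t P ^ 2)⁻¹ ≤ (dlen P.1 ^ 2)⁻¹ := by
        have := dlen_pos P.1
        have := (ht P).1
        gcongr
      have e4 := wt_pos (y P) (t P) z
      calc C * (1 + 226) * (t P ^ 2)⁻¹ * wt (y P) (t P) z ^ 3
          ≤ C * (1 + 226) * (dlen P.1 ^ 2)⁻¹ * (36 * dw P.1 x) ^ 3 := by gcongr
        _ = _ := by rw [mul_pow]; ring
  · have hlt : (t P)⁻¹ + (t P')⁻¹ < |ν P - ν P'| := by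
      have e1 : (t P)⁻¹ ≤ (dlen P.1)⁻¹ := inv_anti₀ (dlen_pos _) (ht P).1
      have e2 : (t P')⁻¹ ≤ (dlen P'.1)⁻¹ := inv_anti₀ (dlen_pos _) (ht P').1
      have e3 := inv_pos.2 (dlen_pos P.1)
      have e4 := inv_pos.2 (dlen_pos P'.1)
      linarith
    have := integral_polynomial_pkt_eq_zero φ hφ (htp P) (htp P') (y P) (y P') hlt
      ((1 + (Polynomial.C b⁻¹ * (Polynomial.X - Polynomial.C a)) ^ 2) ^ 2)
    convert this using 4
    simp [div_eq_inv_mul]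

section Gram
variable {κ B : ℝ} {Cd : ℕ → ℝ} {Cl : ℝ} {ph : Tl → ℝ → ℂ} {ν : Tl → ℝ}

/-- The quartic weight associated with the dyadic interval `J`. -/
noncomputable def om (J : ℤ × ℤ) (x : ℝ) : ℝ := (1 + ((x - dcen J) / dlen J) ^ 2) ^ 2

lemma om_eq (J : ℤ × ℤ) (x : ℝ) : om J x = (dw J x ^ 2)⁻¹ := by
  unfold om dw wt; rw [inv_pow, inv_inv]

lemma om_pos (J : ℤ × ℤ) (x : ℝ) : 0 < om J x := by unfold om; positivity

lemma continuous_om (J : ℤ × ℤ) : Continuous (om J) := by unfold om; fun_prop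

lemma continuous_dw (J : ℤ × ℤ) : Continuous (dw J) := continuous_wt _ _

lemma integrable_dw (J : ℤ × ℤ) : Integrable (dw J) := integrable_wt _ (dlen_pos J)

lemma integral_dw (J : ℤ × ℤ) : ∫ x, dw J x = π * dlen J := integral_wt _ (dlen_pos J)

lemma om_mul_le {I I' J : ℤ × ℤ} (h : dint I ⊆ dint J) (h' : dint I' ⊆ dint J) (x : ℝ) :
    om J x * (dw I x ^ 4 * dw I' x ^ 4) ≤ 9 * (dw I x ^ 3 * dw I' x ^ 3) := by
  have h1 := dw_le_of_sub h x
  have h2 := dw_le_of_sub h' x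
  have p1 := dw_pos I x
  have p2 := dw_pos I' x
  have p3 := dw_pos J x
  rw [om_eq, inv_mul_le_iff₀ (by positivity)]
  calc dw I x ^ 4 * dw I' x ^ 4 = (dw I x * dw I' x) * (dw I x ^ 3 * dw I' x ^ 3) := by ring
    _ ≤ ((3 * dw J x) * (3 * dw J x)) * (dw I x ^ 3 * dw I' x ^ 3) := by gcongr
    _ = _ := by ring

lemma dw_mul_dw_le {I I' : ℤ × ℤ} (hl : dlen I' ≤ dlen I) {y : ℝ} (hy : y ∈ dint I') (x : ℝ) :
    dw I x * dw I' x ≤ 4 * dw I y := by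
  have l1 := dlen_pos I
  have l2 := dlen_pos I'
  unfold dw wt
  rw [← mul_inv, ← div_eq_mul_inv, inv_eq_one_div, div_le_div_iff₀ (by positivity) (by positivity)]
  have e1 : |(y - dcen I) / dlen I| ≤ |(x - dcen I) / dlen I| + |(x - dcen I') / dlen I'| + 1 / 2 := by
    rw [abs_div, abs_div, abs_div, abs_of_pos l1, abs_of_pos l2, div_le_iff₀ l1]
    have a1 := abs_sub_dcen hy
    have a2 : |y - dcen I| ≤ |y - dcen I'| + |x - dcen I'| + |x - dcen I| := by
      have b1 := abs_sub_le y (dcen I') (dcen I)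
      have b2 := abs_sub_le (dcen I') x (dcen I)
      rw [abs_sub_comm (dcen I') x] at b2
      linarith
    have a3 : |x - dcen I'| ≤ |x - dcen I'| / dlen I' * dlen I := by
      rw [div_mul_eq_mul_div, le_div_iff₀ l2]
      gcongr
    have a4 : |x - dcen I| = |x - dcen I| / dlen I * dlen I := by field_simp
    nlinarith
  have e2 : ((y - dcen I) / dlen I) ^ 2 ≤
      (|(x - dcen I) / dlen I| + |(x - dcen I') / dlen I'| + 1 / 2) ^ 2 := by
    rw [← sq_abs]; gcongr
  have h5 := sq_abs ((x - dcen I) / dlen I)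
  have h6 := sq_abs ((x - dcen I') / dlen I')
  generalize |(x - dcen I) / dlen I| = u at *
  generalize |(x - dcen I') / dlen I'| = w at *
  rw [← h5, ← h6]
  nlinarith [sq_nonneg (u - w), sq_nonneg (u - 1 / 2), sq_nonneg (w - 1 / 2), mul_nonneg (sq_nonneg u) (sq_nonneg w)]

/-- The weighted Gram matrix of the packets. -/
noncomputable def gr (ph : Tl → ℝ → ℂ) (J : ℤ × ℤ) (P P' : Tl) : ℂ :=
  ∫ x : ℝ, om J x • (ph P x * conj (ph P' x))

lemma WP.norm_om_mul_le (hW : WP κ B Cd Cl ph ν) {J : ℤ × ℤ} {P P' : Tl} (h : dint P.1 ⊆ dint J) (h' : dint P'.1 ⊆ dint J)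
    (x : ℝ) : ‖om J x • (ph P x * conj (ph P' x))‖ ≤
      9 * Cd 4 ^ 2 * ((dlen P.1)⁻¹ * (dlen P'.1)⁻¹) * (dw P.1 x ^ 3 * dw P'.1 x ^ 3) := by
  rw [norm_smul, norm_mul, RCLike.norm_conj, norm_of_nonneg (om_pos J x).le]
  have b1 := hW.decay 4 P x
  have b2 := hW.decay 4 P' x
  have b3 := om_mul_le h h' x
  have := om_pos J x
  have := dlen_pos P.1
  have := dlen_pos P'.1
  have := hW.Cd_pos 4
  have := dw_pos P.1 x
  have := dw_pos P'.1 x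
  calc om J x * (‖ph P x‖ * ‖ph P' x‖)
      ≤ om J x * ((Cd 4 * (dlen P.1)⁻¹ * dw P.1 x ^ 4) * (Cd 4 * (dlen P'.1)⁻¹ * dw P'.1 x ^ 4)) := by
        gcongr
    _ = Cd 4 ^ 2 * ((dlen P.1)⁻¹ * (dlen P'.1)⁻¹) * (om J x * (dw P.1 x ^ 4 * dw P'.1 x ^ 4)) := by ring
    _ ≤ Cd 4 ^ 2 * ((dlen P.1)⁻¹ * (dlen P'.1)⁻¹) * (9 * (dw P.1 x ^ 3 * dw P'.1 x ^ 3)) := by gcongr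
    _ = _ := by ring

lemma integrable_dw_mul (I I' : ℤ × ℤ) : Integrable fun x => dw I x ^ 3 * dw I' x ^ 3 := by
  refine (integrable_dw I).mono' (by
    have := continuous_dw I; have := continuous_dw I'
    exact Continuous.aestronglyMeasurable (by fun_prop)) (ae_of_all _ fun x => ?_)
  have h1 := dw_pos I x
  have h2 := dw_pos I' x
  rw [norm_of_nonneg (by positivity)]
  have h3 : dw I x ^ 3 ≤ dw I x := by
    unfold dw
    simpa using wt_pow_le (c := dcen I) (t := dlen I) (x := x) (show 1 ≤ 3 by norm_num)
  have h4 : dw I' x ^ 3 ≤ 1 := pow_le_one₀ h2.le (dw_le_one _ _)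
  nlinarith [pow_pos h2 3]

lemma WP.integrable_om_mul (hW : WP κ B Cd Cl ph ν) {J : ℤ × ℤ} {P P' : Tl} (h : dint P.1 ⊆ dint J) (h' : dint P'.1 ⊆ dint J) :
    Integrable fun x : ℝ => om J x • (ph P x * conj (ph P' x)) := by
  refine ((integrable_dw_mul P.1 P'.1).const_mul
    (9 * Cd 4 ^ 2 * ((dlen P.1)⁻¹ * (dlen P'.1)⁻¹))).mono' ?_ (ae_of_all _ (hW.norm_om_mul_le h h'))
  have := hW.cont P
  have := hW.cont P'
  have := continuous_om J
  have := Complex.continuous_conj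
  exact Continuous.aestronglyMeasurable (by fun_prop)

lemma WP.gr_le (hW : WP κ B Cd Cl ph ν) {J : ℤ × ℤ} {P P' : Tl} (h : dint P.1 ⊆ dint J) (h' : dint P'.1 ⊆ dint J)
    (hl : dlen P'.1 ≤ dlen P.1) : dlen P'.1 * ‖gr ph J P P'‖ ≤
      (144 * π * Cd 4 ^ 2) * (dlen P.1)⁻¹ * ∫ y in dint P'.1, dw P.1 y ^ 2 := by
  have l1 := dlen_pos P.1
  have l2 := dlen_pos P'.1
  have hC := hW.Cd_pos 4
  have key : ∀ y ∈ dint P'.1, ‖gr ph J P P'‖ ≤ (144 * π * Cd 4 ^ 2) * (dlen P.1)⁻¹ * dw P.1 y ^ 2 := by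
    intro y hy
    have h1 : ‖gr ph J P P'‖ ≤ ∫ x, 9 * Cd 4 ^ 2 * ((dlen P.1)⁻¹ * (dlen P'.1)⁻¹) *
        (16 * dw P.1 y ^ 2 * dw P'.1 x) := by
      refine norm_integral_le_of_norm_le (((integrable_dw P'.1).const_mul _).const_mul _)
        (ae_of_all _ fun x => (hW.norm_om_mul_le h h' x).trans ?_)
      have e1 := dw_mul_dw_le hl hy x
      have p1 := dw_pos P.1 x
      have p2 := dw_pos P'.1 x
      have p3 := dw_pos P.1 y
      have e2 : dw P.1 x ^ 3 * dw P'.1 x ^ 3 ≤ 16 * dw P.1 y ^ 2 * dw P'.1 x := by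
        calc dw P.1 x ^ 3 * dw P'.1 x ^ 3 = (dw P.1 x * dw P'.1 x) ^ 2 * (dw P.1 x * dw P'.1 x) := by ring
          _ ≤ (4 * dw P.1 y) ^ 2 * (1 * dw P'.1 x) := by
            gcongr
            exact dw_le_one _ _
          _ = _ := by ring
      exact mul_le_mul_of_nonneg_left e2 (by positivity)
    rw [integral_const_mul, integral_const_mul, integral_dw] at h1
    refine h1.trans (le_of_eq ?_)
    field_simp; ring
  have h2 : ∫ _y in dint P'.1, ‖gr ph J P P'‖ ≤
      ∫ y in dint P'.1, (144 * π * Cd 4 ^ 2) * (dlen P.1)⁻¹ * dw P.1 y ^ 2 := by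
    refine setIntegral_mono_on (by simp [volume_dint]) ?_ (measurableSet_dint _) key
    exact ((integrable_wt_pow _ l1 (by norm_num)).const_mul _).integrableOn
  rw [integral_const_mul] at h2
  simpa [volume_real_dint] using h2

/-- Two tiles whose packets may fail to be orthogonal. -/
def near (ν : Tl → ℝ) (P P' : Tl) : Prop :=
  |ν P - ν P'| < 2 * ((dlen P.1)⁻¹ + (dlen P'.1)⁻¹)

lemma WP.gr_eq_zero (hW : WP κ B Cd Cl ph ν) (J : ℤ × ℤ) {P P' : Tl} (h : ¬ near ν P P') : gr ph J P P' = 0 :=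
  hW.orth P P' _ _ (not_lt.1 h)

lemma norm_gr_comm (J : ℤ × ℤ) (P P' : Tl) : ‖gr ph J P P'‖ = ‖gr ph J P' P‖ := by
  have : gr ph J P P' = conj (gr ph J P' P) := by
    unfold gr
    rw [← integral_conj]
    congr 1; ext x
    simp [mul_comm]
  rw [this, RCLike.norm_conj]

/-- Scale and frequency separation of a collection of tiles. -/
def Sparse (s : Finset Tl) : Prop :=
  ∀ P ∈ s, ∀ P' ∈ s, (P.1.1 ≠ P'.1.1 → 7 ≤ |P.1.1 - P'.1.1|) ∧ (P.2 ≠ P'.2 → 128 ≤ |P.2 - P'.2|)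

lemma WP.eq_of_near_of_le (hW : WP κ B Cd Cl ph ν) {s : Finset Tl} (hs : Sparse s) {P P' : Tl} (hP : P ∈ s) (hP' : P' ∈ s)
    (hk : P.1.1 = P'.1.1) (h : |ν P - ν P'| * dlen P.1 < 62) : P.2 = P'.2 := by
  by_contra hne
  have h1 := (hs P hP P' hP').2 hne
  have h2 := hW.freq P
  have h3 := hW.freq P'
  have hl : dlen P'.1 = dlen P.1 := by unfold dlen; rw [hk]
  rw [hl] at h3
  have h4 : |κ * P.2 - κ * P'.2| ≤ 2 * B + |ν P - ν P'| * dlen P.1 := by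
    have e : |ν P - ν P'| * dlen P.1 = |(ν P - ν P') * dlen P.1| := by
      rw [abs_mul, abs_of_pos (dlen_pos P.1)]
    rw [e]
    rw [abs_le] at h2 h3 ⊢
    have := abs_le.1 (le_refl |(ν P - ν P') * dlen P.1|)
    constructor <;> nlinarith
  rw [← mul_sub, abs_mul] at h4
  have h5 : (128 : ℝ) ≤ |(P.2 : ℝ) - P'.2| := by exact_mod_cast h1
  have := hW.freq_sep
  have := hW.one_le_kappa
  nlinarith

lemma WP.eq_of_near (hW : WP κ B Cd Cl ph ν) {s : Finset Tl} (hs : Sparse s) {P P' : Tl} (hP : P ∈ s) (hP' : P' ∈ s)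
    (hk : P.1.1 = P'.1.1) (h : near ν P P') : P.2 = P'.2 := by
  refine hW.eq_of_near_of_le hs hP hP' hk ?_
  have hl : dlen P'.1 = dlen P.1 := by unfold dlen; rw [hk]
  unfold near at h
  rw [hl] at h
  have := dlen_pos P.1
  calc |ν P - ν P'| * dlen P.1 < 2 * ((dlen P.1)⁻¹ + (dlen P.1)⁻¹) * dlen P.1 := by gcongr
    _ = 4 := by field_simp; norm_num
    _ < 62 := by norm_num

open Classical in
lemma WP.sum_same_scale (hW : WP κ B Cd Cl ph ν) {s : Finset Tl} (hs : Sparse s) {J : ℤ × ℤ}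
    (hJ : ∀ P ∈ s, dint P.1 ⊆ dint J) {P : Tl} (hP : P ∈ s) :
    ∑ P' ∈ s with P'.1.1 = P.1.1 ∧ near ν P P', dlen P'.1 * ‖gr ph J P P'‖ ≤ 144 * π ^ 2 * Cd 4 ^ 2 := by
  have l1 := dlen_pos P.1
  have hC := hW.Cd_pos 4
  have h1 := Finset.sum_le_sum (s := s.filter fun P' => P'.1.1 = P.1.1 ∧ near ν P P') fun P' hP' =>
    hW.gr_le (hJ P hP) (hJ P' (Finset.mem_filter.1 hP').1)
      (dlen_le (Finset.mem_filter.1 hP').2.1.le)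
  refine h1.trans ?_
  rw [← Finset.mul_sum]
  have h2 := sum_setIntegral_le (s.filter fun P' => P'.1.1 = P.1.1 ∧ near ν P P') (fun P' => P'.1)
    (fun y => dw P.1 y ^ 2) (integrable_wt_pow _ l1 (by norm_num))
    (fun x => pow_nonneg (dw_pos _ _).le 2) univ MeasurableSet.univ (fun _ _ => subset_univ _) (by
      intro i hi j hj hij
      rw [Finset.mem_filter] at hi hj
      refine disjoint_of_same_scale (hi.2.1.trans hj.2.1.symm) fun h => hij ?_
      exact Prod.ext h (((hW.eq_of_near hs hP hi.1 hi.2.1.symm hi.2.2).symm).trans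
        (hW.eq_of_near hs hP hj.1 hj.2.1.symm hj.2.2)))
  rw [setIntegral_univ] at h2
  have h3 := integral_wt_pow_le (dcen P.1) l1 (show 1 ≤ 2 by norm_num)
  calc _ ≤ 144 * π * Cd 4 ^ 2 * (dlen P.1)⁻¹ * (π * dlen P.1) := by
        gcongr
        exact h2.trans h3
    _ = _ := by field_simp

end Gram

section GramForm
variable {V : Type*} [NormedAddCommGroup V] [InnerProductSpace ℂ V]
variable {κ B : ℝ} {Cd : ℕ → ℝ} {Cl : ℝ} {ph : Tl → ℝ → ℂ} {ν : Tl → ℝ}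

/-- The coefficient of `f` against the packet of the tile `P`. -/
noncomputable def cf (ph : Tl → ℝ → ℂ) (f : ℝ → V) (P : Tl) : V := ∫ x, ph P x • f x

/-- Synthesis of a function from coefficients. -/
noncomputable def syn (ph : Tl → ℝ → ℂ) (s : Finset Tl) (v : Tl → V) (x : ℝ) : V :=
  ∑ P ∈ s, (((dlen P.1 : ℝ) : ℂ) * conj (ph P x)) • v P

lemma WP.bounded (hW : WP κ B Cd Cl ph ν) (P : Tl) : ∃ C, ∀ x, ‖ph P x‖ ≤ C :=
  ⟨Cd 0 * (dlen P.1)⁻¹, fun x => by simpa using hW.decay 0 P x⟩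

lemma WP.integrable_smul (hW : WP κ B Cd Cl ph ν) {f : ℝ → V} (hf : Integrable f) (P : Tl) :
    Integrable fun x => ph P x • f x := by
  obtain ⟨C, hC⟩ := hW.bounded P
  exact hf.bdd_smul C (hW.cont P).aestronglyMeasurable (ae_of_all _ hC)

lemma WP.continuous_syn (hW : WP κ B Cd Cl ph ν) (s : Finset Tl) (v : Tl → V) : Continuous (syn ph s v) := by
  unfold syn
  refine continuous_finsetSum _ fun P _ => ?_
  have := hW.cont P
  have := Complex.continuous_conj
  fun_prop

lemma WP.syn_bounded (hW : WP κ B Cd Cl ph ν) (s : Finset Tl) (v : Tl → V) : ∃ C, ∀ x, ‖syn ph s v x‖ ≤ C := by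
  choose C hC using hW.bounded
  refine ⟨∑ P ∈ s, dlen P.1 * C P * ‖v P‖, fun x => (norm_sum_le _ _).trans
    (Finset.sum_le_sum fun P _ => ?_)⟩
  rw [norm_smul, norm_mul, RCLike.norm_conj, Complex.norm_real, norm_of_nonneg (dlen_pos _).le]
  have := dlen_pos P.1
  have := hC P x
  gcongr

lemma WP.sum_sq_le (hW : WP κ B Cd Cl ph ν) [CompleteSpace V] {f : ℝ → V} (hf : Integrable f) (s : Finset Tl) :
    ∑ P ∈ s, dlen P.1 * ‖cf ph f P‖ ^ 2 ≤ ∫ x, ‖syn ph s (cf ph f) x‖ * ‖f x‖ := by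
  have e : ((∑ P ∈ s, dlen P.1 * ‖cf ph f P‖ ^ 2 : ℝ) : ℂ) =
      ∫ x, ⟪syn ph s (cf ph f) x, f x⟫_ℂ := by
    have h1 : ∀ P ∈ s, (((dlen P.1 * ‖cf ph f P‖ ^ 2 : ℝ)) : ℂ) =
        ∫ x, ((dlen P.1 : ℝ) : ℂ) * ⟪cf ph f P, ph P x • f x⟫_ℂ := by
      intro P _
      rw [integral_const_mul, integral_inner (hW.integrable_smul hf P)]
      rw [show (∫ x, ph P x • f x) = cf ph f P from rfl, inner_self_eq_norm_sq_to_K]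
      push_cast; rfl
    rw [Complex.ofReal_sum, Finset.sum_congr rfl h1, ← integral_finsetSum]
    · congr 1; ext x
      unfold syn
      rw [sum_inner]
      refine Finset.sum_congr rfl fun P _ => ?_
      rw [inner_smul_left, inner_smul_right]
      simp; ring
    · exact fun P _ => ((hW.integrable_smul hf P).const_inner _).const_mul _
  have h2 : (∑ P ∈ s, dlen P.1 * ‖cf ph f P‖ ^ 2 : ℝ) ≤
      ‖((∑ P ∈ s, dlen P.1 * ‖cf ph f P‖ ^ 2 : ℝ) : ℂ)‖ := by
    rw [Complex.norm_real]; exact le_abs_self _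
  refine h2.trans ?_
  rw [e]
  refine norm_integral_le_of_norm_le ?_ (ae_of_all _ fun x => norm_inner_le_norm _ _)
  obtain ⟨C, hC⟩ := hW.syn_bounded s (cf ph f)
  exact hf.norm.bdd_mul (c := C) (hW.continuous_syn _ _).norm.aestronglyMeasurable
    (ae_of_all _ fun x => by simpa using hC x)

lemma WP.integral_syn_sq_le (hW : WP κ B Cd Cl ph ν) {s : Finset Tl} {J : ℤ × ℤ}
    (hJ : ∀ P ∈ s, dint P.1 ⊆ dint J) (v : Tl → V) :
    (Integrable fun x => om J x * ‖syn ph s v x‖ ^ 2) ∧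
    ∫ x, om J x * ‖syn ph s v x‖ ^ 2 ≤
      ∑ P ∈ s, ∑ P' ∈ s, dlen P.1 * dlen P'.1 * ‖gr ph J P P'‖ * (‖v P‖ * ‖v P'‖) := by
  have e : ∀ x, ((om J x * ‖syn ph s v x‖ ^ 2 : ℝ) : ℂ) = ∑ P ∈ s, ∑ P' ∈ s,
      ((dlen P.1 * dlen P'.1 : ℝ) : ℂ) * ⟪v P, v P'⟫_ℂ * (om J x • (ph P x * conj (ph P' x))) := by
    intro x
    have : ((‖syn ph s v x‖ ^ 2 : ℝ) : ℂ) = ⟪syn ph s v x, syn ph s v x⟫_ℂ := by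
      rw [inner_self_eq_norm_sq_to_K]; push_cast; rfl
    rw [Complex.ofReal_mul, this]
    unfold syn
    rw [sum_inner, Finset.mul_sum]
    refine Finset.sum_congr rfl fun P _ => ?_
    rw [inner_sum, Finset.mul_sum]
    refine Finset.sum_congr rfl fun P' _ => ?_
    rw [inner_smul_left, inner_smul_right]
    simp; ring
  have hi : ∀ P ∈ s, ∀ P' ∈ s, Integrable fun x =>
      ((dlen P.1 * dlen P'.1 : ℝ) : ℂ) * ⟪v P, v P'⟫_ℂ * (om J x • (ph P x * conj (ph P' x))) :=
    fun P hP P' hP' => (hW.integrable_om_mul (hJ P hP) (hJ P' hP')).const_mul _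
  have hI : Integrable fun x => ((om J x * ‖syn ph s v x‖ ^ 2 : ℝ) : ℂ) := by
    simp_rw [e]
    exact integrable_finsetSum _ fun P hP => integrable_finsetSum _ fun P' hP' => hi P hP P' hP'
  refine ⟨hI.re.congr (ae_of_all _ fun x => Complex.ofReal_re _), ?_⟩
  have h1 : ((∫ x, om J x * ‖syn ph s v x‖ ^ 2 : ℝ) : ℂ) = ∑ P ∈ s, ∑ P' ∈ s,
      ((dlen P.1 * dlen P'.1 : ℝ) : ℂ) * ⟪v P, v P'⟫_ℂ * gr ph J P P' := by
    rw [← integral_complex_ofReal]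
    simp_rw [e]
    rw [integral_finsetSum _ fun P hP => integrable_finsetSum _ fun P' hP' => hi P hP P' hP']
    refine Finset.sum_congr rfl fun P hP => ?_
    rw [integral_finsetSum _ fun P' hP' => hi P hP P' hP']
    refine Finset.sum_congr rfl fun P' hP' => ?_
    rw [integral_const_mul]; rfl
  have h2 : (∫ x, om J x * ‖syn ph s v x‖ ^ 2 : ℝ) ≤
      ‖((∫ x, om J x * ‖syn ph s v x‖ ^ 2 : ℝ) : ℂ)‖ := by
    rw [Complex.norm_real]; exact le_abs_self _
  refine h2.trans ?_
  rw [h1]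
  refine (norm_sum_le _ _).trans (Finset.sum_le_sum fun P _ => (norm_sum_le _ _).trans
    (Finset.sum_le_sum fun P' _ => ?_))
  have l1 := dlen_pos P.1
  have l2 := dlen_pos P'.1
  rw [norm_mul, norm_mul, Complex.norm_real, norm_of_nonneg (by positivity)]
  have := norm_inner_le_norm (𝕜 := ℂ) (v P) (v P')
  calc _ ≤ dlen P.1 * dlen P'.1 * (‖v P‖ * ‖v P'‖) * ‖gr ph J P P'‖ := by gcongr
    _ = _ := by ring

open Classical in
omit [InnerProductSpace ℂ V] in
lemma WP.gram_le (hW : WP κ B Cd Cl ph ν) {s : Finset Tl} (hs : Sparse s) {J : ℤ × ℤ}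
    (hJ : ∀ P ∈ s, dint P.1 ⊆ dint J) (v : Tl → V) :
    ∑ P ∈ s, ∑ P' ∈ s, dlen P.1 * dlen P'.1 * ‖gr ph J P P'‖ * (‖v P‖ * ‖v P'‖) ≤
      144 * π ^ 2 * Cd 4 ^ 2 * ∑ P ∈ s, dlen P.1 * ‖v P‖ ^ 2 +
      2 * ∑ P ∈ s, ∑ P' ∈ s with P'.1.1 < P.1.1 ∧ near ν P P',
        dlen P.1 * dlen P'.1 * ‖gr ph J P P'‖ * (‖v P‖ * ‖v P'‖) := by
  set t : Tl → Tl → ℝ := fun P P' => dlen P.1 * dlen P'.1 * ‖gr ph J P P'‖ * (‖v P‖ * ‖v P'‖) with ht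
  have tsymm : ∀ P P', t P P' = t P' P := fun P P' => by
    simp only [ht]; rw [norm_gr_comm]; ring
  have nsymm : ∀ P P', near ν P P' ↔ near ν P' P := fun P P' => by
    unfold near; rw [abs_sub_comm, add_comm]
  set a : Tl → Tl → ℝ := fun P P' => if P'.1.1 < P.1.1 ∧ near ν P P' then t P P' else 0 with ha
  set b : Tl → Tl → ℝ := fun P P' => if P'.1.1 = P.1.1 ∧ near ν P P' then t P P' else 0 with hb
  have dec : ∀ P P', t P P' = b P P' + (a P P' + a P' P) := by
    intro P P'
    simp only [ha, hb]
    by_cases hn : near ν P P'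
    · have hn' := (nsymm _ _).1 hn
      rcases lt_trichotomy P.1.1 P'.1.1 with h | h | h
      · simp [h, hn, hn', h.ne', h.not_gt, tsymm P P']
      · simp [h, hn, hn']
      · simp [h, hn, hn', h.ne, h.not_gt]
    · have hn' : ¬ near ν P' P := fun h => hn ((nsymm _ _).2 h)
      simp [hn, hn', ht, hW.gr_eq_zero J hn]
  have e1 : ∑ P ∈ s, ∑ P' ∈ s, t P P' = ∑ P ∈ s, ∑ P' ∈ s, b P P' + 2 * ∑ P ∈ s, ∑ P' ∈ s, a P P' := by
    simp_rw [dec, Finset.sum_add_distrib]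
    rw [Finset.sum_comm (f := fun x y => a y x)]
    ring
  have e2 : ∑ P ∈ s, ∑ P' ∈ s with P'.1.1 < P.1.1 ∧ near ν P P', t P P' = ∑ P ∈ s, ∑ P' ∈ s, a P P' :=
    Finset.sum_congr rfl fun P _ => Finset.sum_filter _ _
  change ∑ P ∈ s, ∑ P' ∈ s, t P P' ≤ _ + 2 * ∑ P ∈ s, ∑ P' ∈ s with P'.1.1 < P.1.1 ∧ near ν P P', t P P'
  rw [e1, e2]
  gcongr
  set g : Tl → Tl → ℝ := fun P P' => if P'.1.1 = P.1.1 ∧ near ν P P' then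
    dlen P.1 * dlen P'.1 * ‖gr ph J P P'‖ else 0 with hg
  have gsymm : ∀ P P', g P P' = g P' P := fun P P' => by
    simp only [hg]
    rw [norm_gr_comm, mul_comm (dlen P.1)]
    congr 1
    exact propext ⟨fun h => ⟨h.1.symm, (nsymm _ _).1 h.2⟩, fun h => ⟨h.1.symm, (nsymm _ _).1 h.2⟩⟩
  have gnn : ∀ P P', 0 ≤ g P P' := fun P P' => by
    simp only [hg]
    have := dlen_pos P.1
    have := dlen_pos P'.1
    split_ifs <;> positivity
  have hbg : ∀ P P', b P P' ≤ (g P P' * ‖v P‖ ^ 2 + g P' P * ‖v P'‖ ^ 2) / 2 := by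
    intro P P'
    rw [gsymm P' P]
    have : b P P' = g P P' * (‖v P‖ * ‖v P'‖) := by
      simp only [hb, hg, ht]; split_ifs <;> simp
    rw [this]
    nlinarith [mul_nonneg (gnn P P') (sq_nonneg (‖v P‖ - ‖v P'‖))]
  calc ∑ P ∈ s, ∑ P' ∈ s, b P P'
      ≤ ∑ P ∈ s, ∑ P' ∈ s, (g P P' * ‖v P‖ ^ 2 + g P' P * ‖v P'‖ ^ 2) / 2 :=
        Finset.sum_le_sum fun P _ => Finset.sum_le_sum fun P' _ => hbg P P'
    _ = ∑ P ∈ s, ∑ P' ∈ s, g P P' * ‖v P‖ ^ 2 := by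
        simp_rw [← Finset.sum_div, Finset.sum_add_distrib]
        rw [Finset.sum_comm (f := fun x y => g y x * ‖v y‖ ^ 2)]
        ring
    _ ≤ ∑ P ∈ s, dlen P.1 * (144 * π ^ 2 * Cd 4 ^ 2) * ‖v P‖ ^ 2 := by
        refine Finset.sum_le_sum fun P hP => ?_
        rw [← Finset.sum_mul]
        have h := hW.sum_same_scale hs hJ hP
        rw [Finset.sum_filter] at h
        have l1 := dlen_pos P.1
        have : ∑ P' ∈ s, g P P' = dlen P.1 * ∑ P' ∈ s, if P'.1.1 = P.1.1 ∧ near ν P P' then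
            dlen P'.1 * ‖gr ph J P P'‖ else 0 := by
          rw [Finset.mul_sum]
          refine Finset.sum_congr rfl fun P' _ => ?_
          simp only [hg]; split_ifs <;> simp [mul_assoc]
        rw [this]
        gcongr
    _ = _ := by
        rw [Finset.mul_sum]
        exact Finset.sum_congr rfl fun P _ => by ring

end GramForm

section Trees
variable {κ B : ℝ} {Cd : ℕ → ℝ} {Cl : ℝ} {ph : Tl → ℝ → ℂ} {ν : Tl → ℝ}

/-- The tile is close to the frequency `ξ`. -/
def Full (ξ : ℝ) (P : Tl) : Prop := |dlen P.1 * ξ - P.2| ≤ 40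

/-- The tile is close to `ξ`, and its packet is lacunary about `κ ξ`, on the side `σ`. -/
def Lac (κ : ℝ) (ν : Tl → ℝ) (σ ξ : ℝ) (P : Tl) : Prop :=
  Full ξ P ∧ 4 * (dlen P.1)⁻¹ ≤ σ * (ν P - κ * ξ)

lemma WP.full_freq (hW : WP κ B Cd Cl ph ν) {ξ : ℝ} {P : Tl} (h : Full ξ P) : |ν P - κ * ξ| * dlen P.1 ≤ 113 := by
  have l := dlen_pos P.1
  have e : |ν P - κ * ξ| * dlen P.1 = |(ν P - κ * ξ) * dlen P.1| := by rw [abs_mul, abs_of_pos l]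
  rw [e]
  have h1 := hW.freq P
  have h2 : |κ * (dlen P.1 * ξ - P.2)| ≤ |κ| * 40 := by
    rw [abs_mul]; gcongr; exact h
  have h3 := hW.freq_upper
  calc |(ν P - κ * ξ) * dlen P.1| = |(ν P * dlen P.1 - κ * P.2) - κ * (dlen P.1 * ξ - P.2)| := by
        congr 1; ring
    _ ≤ |ν P * dlen P.1 - κ * P.2| + |κ * (dlen P.1 * ξ - P.2)| := abs_sub _ _
    _ ≤ 113 := by linarith

lemma dlen_ge_of_sparse {s : Finset Tl} (hs : Sparse s) {P P' : Tl} (hP : P ∈ s) (hP' : P' ∈ s)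
    (h : P'.1.1 < P.1.1) : 128 * dlen P'.1 ≤ dlen P.1 := by
  have h1 := (hs P hP P' hP').1 h.ne'
  rw [abs_of_pos (by linarith)] at h1
  have : (128 : ℝ) * dlen P'.1 = 2 ^ (7 + P'.1.1) := by
    rw [zpow_add₀ (by norm_num)]; unfold dlen; norm_num
  rw [this]
  exact zpow_le_zpow_right₀ (by norm_num) (by linarith)

lemma WP.not_near_of_lac (hW : WP κ B Cd Cl ph ν) {s : Finset Tl} (hs : Sparse s) {σ ξ : ℝ} (hσ : |σ| = 1) {P P' : Tl}
    (hP : P ∈ s) (hP' : P' ∈ s) (hl : Full ξ P) (hl' : Lac κ ν σ ξ P') (h : P'.1.1 < P.1.1) :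
    ¬ near ν P P' := by
  have h1 := dlen_ge_of_sparse hs hP hP' h
  have h2 := hW.full_freq hl
  have h3 := hl'.2
  have l1 := dlen_pos P.1
  have l2 := dlen_pos P'.1
  unfold near
  rw [not_lt]
  have h4 : |ν P - κ * ξ| ≤ 113 * (dlen P.1)⁻¹ := by
    rwa [← div_eq_mul_inv, le_div_iff₀ l1]
  have h5 : 128 * (dlen P.1)⁻¹ ≤ (dlen P'.1)⁻¹ := by
    rw [← div_eq_mul_inv, div_le_iff₀ l1, inv_mul_eq_div, le_div_iff₀ l2]; exact h1
  have h6 : σ * (ν P - κ * ξ) ≤ |ν P - κ * ξ| := by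
    have := le_abs_self (σ * (ν P - κ * ξ))
    rwa [abs_mul, hσ, one_mul] at this
  have h7 : σ * (ν P' - ν P) ≤ |ν P - ν P'| := by
    have := le_abs_self (σ * (ν P' - ν P))
    rwa [abs_mul, hσ, one_mul, abs_sub_comm] at this
  have h8 : 0 < (dlen P.1)⁻¹ := by positivity
  nlinarith

open Classical in
/-- Bessel inequality in a lacunary tree. -/
lemma WP.tree_bessel (hW : WP κ B Cd Cl ph ν) {V : Type*} [NormedAddCommGroup V] [InnerProductSpace ℂ V]
    {s : Finset Tl} (hs : Sparse s) {J : ℤ × ℤ}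
    (hJ : ∀ P ∈ s, dint P.1 ⊆ dint J) {σ ξ : ℝ} (hσ : |σ| = 1) (hl : ∀ P ∈ s, Lac κ ν σ ξ P)
    (v : Tl → V) : ∫ x, om J x * ‖syn ph s v x‖ ^ 2 ≤
      144 * π ^ 2 * Cd 4 ^ 2 * ∑ P ∈ s, dlen P.1 * ‖v P‖ ^ 2 := by
  refine (hW.integral_syn_sq_le hJ v).2.trans ((hW.gram_le hs hJ v).trans ?_)
  rw [Finset.sum_eq_zero (s := s) (f := fun P => ∑ P' ∈ s with P'.1.1 < P.1.1 ∧ near ν P P', _)]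
  · simp
  · intro P hP
    rw [Finset.filter_false_of_mem, Finset.sum_empty]
    intro P' hP' h
    exact hW.not_near_of_lac hs hσ hP hP' (hl P hP).1 (hl P' hP') h.1 h.2

end Trees

section Averaging

/-- Averaging against a kernel of variable width. -/
lemma lintegral_mul_le_of_local {u F G δ : ℝ → ℝ} {M : ℝ}
    (hu : Integrable u) (hu0 : ∀ x, 0 ≤ u x)
    (hG : Continuous G) (hδ : Continuous δ) (hδ0 : ∀ x, 0 < δ x)
    (hlip : ∀ x y, δ x ≤ δ y + |x - y|)
    (hFG : ∀ x y, |x - y| ≤ δ y / 8 → F x ≤ G y)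
    (hloc : ∀ y, ∫ x in {x | |x - y| ≤ δ y / 8}, u x ≤ M * δ y) :
    ∫⁻ x, ENNReal.ofReal (u x * F x) ≤ ENNReal.ofReal (5 * M) * ∫⁻ y, ENNReal.ofReal (G y) := by
  set k : ℝ → ℝ → ℝ≥0∞ := fun x y =>
    ({z : ℝ × ℝ | |z.1 - z.2| ≤ δ z.2 / 8}.indicator 1 (x, y)) * ENNReal.ofReal (5 / δ y) with hk
  have hS : MeasurableSet {z : ℝ × ℝ | |z.1 - z.2| ≤ δ z.2 / 8} :=
    (isClosed_le (by fun_prop) (by fun_prop)).measurableSet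
  have hkm : Measurable (Function.uncurry k) := by
    have h1 : Measurable fun z : ℝ × ℝ => ENNReal.ofReal (5 / δ z.2) := by
      have := hδ.measurable
      fun_prop
    exact (measurable_one.indicator hS).mul h1
  have hlow : ∀ x, 1 ≤ ∫⁻ y, k x y := by
    intro x
    have hx := hδ0 x
    have h1 : ∀ y ∈ Metric.closedBall x (δ x / 9), ENNReal.ofReal (9 / (2 * δ x)) ≤ k x y := by
      intro y hy
      rw [Metric.mem_closedBall, Real.dist_eq] at hy
      have a1 := hlip x y
      have a2 := hlip y x
      rw [abs_sub_comm] at a1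
      have hmem : (x, y) ∈ {z : ℝ × ℝ | |z.1 - z.2| ≤ δ z.2 / 8} := by
        simp only [mem_ofPred_eq]; rw [abs_sub_comm]; linarith
      simp only [hk]
      rw [indicator_of_mem hmem, Pi.one_apply, one_mul]
      refine ENNReal.ofReal_le_ofReal ?_
      rw [div_le_div_iff₀ (by positivity) (hδ0 y)]
      linarith
    calc (1 : ℝ≥0∞) = ENNReal.ofReal (9 / (2 * δ x)) * volume (Metric.closedBall x (δ x / 9)) := by
          rw [Real.volume_closedBall, ← ENNReal.ofReal_mul (by positivity), eq_comm,
            ENNReal.ofReal_eq_one]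
          field_simp
      _ = ∫⁻ y in Metric.closedBall x (δ x / 9), ENNReal.ofReal (9 / (2 * δ x)) := by
          rw [setLIntegral_const]
      _ ≤ ∫⁻ y in Metric.closedBall x (δ x / 9), k x y :=
          setLIntegral_mono' Metric.isClosed_closedBall.measurableSet h1
      _ ≤ _ := setLIntegral_le_lintegral _ _
  calc ∫⁻ x, ENNReal.ofReal (u x * F x)
      ≤ ∫⁻ x, ∫⁻ y, ENNReal.ofReal (u x) * k x y * ENNReal.ofReal (G y) := by
        refine lintegral_mono fun x => ?_
        calc ENNReal.ofReal (u x * F x) = ENNReal.ofReal (u x) * ENNReal.ofReal (F x) * 1 := by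
              rw [ENNReal.ofReal_mul (hu0 x), mul_one]
          _ ≤ ENNReal.ofReal (u x) * ENNReal.ofReal (F x) * ∫⁻ y, k x y := by gcongr; exact hlow x
          _ = ∫⁻ y, ENNReal.ofReal (u x) * ENNReal.ofReal (F x) * k x y := by
              rw [lintegral_const_mul]
              exact hkm.comp measurable_prodMk_left
          _ ≤ _ := by
              refine lintegral_mono fun y => ?_
              by_cases hmem : (x, y) ∈ {z : ℝ × ℝ | |z.1 - z.2| ≤ δ z.2 / 8}
              · have := hFG x y hmem
                calc _ ≤ ENNReal.ofReal (u x) * ENNReal.ofReal (G y) * k x y := by gcongr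
                  _ = _ := by ring
              · simp only [hk]; rw [indicator_of_notMem hmem]; simp
    _ = ∫⁻ y, ∫⁻ x, ENNReal.ofReal (u x) * k x y * ENNReal.ofReal (G y) := by
        refine lintegral_lintegral_swap ?_
        have h1 : AEMeasurable (fun z : ℝ × ℝ => ENNReal.ofReal (u z.1)) (volume.prod volume) :=
          hu.aemeasurable.ennreal_ofReal.comp_fst
        have h2 : Measurable fun z : ℝ × ℝ => ENNReal.ofReal (G z.2) := by
          have := hG.measurable
          fun_prop
        exact (h1.mul hkm.aemeasurable).mul h2.aemeasurable
    _ ≤ ∫⁻ y, ENNReal.ofReal (5 * M) * ENNReal.ofReal (G y) := by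
        refine lintegral_mono fun y => ?_
        have hy := hδ0 y
        have hm : MeasurableSet {x : ℝ | |x - y| ≤ δ y / 8} :=
          (isClosed_le (by fun_prop) (by fun_prop)).measurableSet
        have h1 : ∀ x, ENNReal.ofReal (u x) * k x y * ENNReal.ofReal (G y) =
            (ENNReal.ofReal (5 / δ y) * ENNReal.ofReal (G y)) *
              {x : ℝ | |x - y| ≤ δ y / 8}.indicator (fun x => ENNReal.ofReal (u x)) x := by
          intro x
          simp only [hk, indicator_apply, mem_ofPred_eq]
          split_ifs <;> simp [mul_comm, mul_left_comm]
        simp_rw [h1]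
        rw [lintegral_const_mul' _ _ (ENNReal.mul_ne_top ENNReal.ofReal_ne_top ENNReal.ofReal_ne_top),
          lintegral_indicator hm, ← ofReal_integral_eq_lintegral_ofReal hu.integrableOn (ae_of_all _ hu0)]
        calc _ ≤ ENNReal.ofReal (5 / δ y) * ENNReal.ofReal (G y) * ENNReal.ofReal (M * δ y) := by
              gcongr; exact hloc y
          _ = ENNReal.ofReal (5 / δ y) * ENNReal.ofReal (M * δ y) * ENNReal.ofReal (G y) := by ring
          _ = _ := by
              rw [← ENNReal.ofReal_mul (by positivity)]
              congr 2
              field_simp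
    _ = _ := by rw [lintegral_const_mul' _ _ ENNReal.ofReal_ne_top]

end Averaging

section TreeScale

/-- Distance to a finite collection of tiles, regularised by their lengths. -/
noncomputable def tdist (T : Finset Tl) (hT : T.Nonempty) (x : ℝ) : ℝ :=
  T.inf' hT fun P => dlen P.1 + |x - dcen P.1|

variable {T : Finset Tl} (hT : T.Nonempty)

lemma tdist_le {P : Tl} (hP : P ∈ T) (x : ℝ) : tdist T hT x ≤ dlen P.1 + |x - dcen P.1| :=
  Finset.inf'_le _ hP

lemma exists_tdist_eq (x : ℝ) : ∃ P ∈ T, tdist T hT x = dlen P.1 + |x - dcen P.1| :=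
  Finset.exists_mem_eq_inf' hT _

lemma tdist_pos (x : ℝ) : 0 < tdist T hT x := by
  obtain ⟨P, _, h⟩ := exists_tdist_eq hT x
  rw [h]; have := dlen_pos P.1; positivity

lemma continuous_tdist : Continuous (tdist T hT) := by
  unfold tdist
  have : (fun x => T.inf' hT fun P => dlen P.1 + |x - dcen P.1|) =
      T.inf' hT fun P x => dlen P.1 + |x - dcen P.1| := by
    ext x; simp
  rw [this]
  exact Continuous.finset_inf' hT fun P _ => by fun_prop

lemma tdist_lip (x y : ℝ) : tdist T hT x ≤ tdist T hT y + |x - y| := by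
  obtain ⟨P, hP, h⟩ := exists_tdist_eq hT y
  rw [h]
  refine (tdist_le hT hP x).trans ?_
  have := abs_sub_le x y (dcen P.1)
  linarith

lemma tdist_local {u : ℝ → ℝ} (hu : Integrable u) (hu0 : ∀ x, 0 ≤ u x) {lam : ℝ}
    (hA : ∀ I : ℤ × ℤ, (∃ P ∈ T, dint P.1 ⊆ dint I) → ∫ x, u x * dw I x ≤ lam * dlen I) (y : ℝ) :
    ∫ x in {x | |x - y| ≤ tdist T hT y / 8}, u x ≤ (10 * lam) * tdist T hT y := by
  obtain ⟨P, hP, h⟩ := exists_tdist_eq hT y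
  have hd := tdist_pos hT y
  obtain ⟨n, hn1, hn2⟩ := exists_mem_Ioc_zpow (x := tdist T hT y) (y := 2) hd one_lt_two
  set I := dat (n + 1) (dcen P.1) with hI
  have hlI : dlen I = 2 ^ (n + 1) := rfl
  have hlI2 : dlen I = 2 * 2 ^ n := by rw [hlI, zpow_add_one₀ two_ne_zero, mul_comm]
  have hlow : tdist T hT y ≤ dlen I := by rw [hlI]; exact hn2
  have hsc : P.1.1 ≤ I.1 := by
    have : dlen P.1 ≤ dlen I := by
      have := abs_nonneg (y - dcen P.1)
      linarith
    exact (zpow_le_zpow_iff_right₀ one_lt_two).1 this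
  have hsub : dint P.1 ⊆ dint I := dint_subset_of_le hsc (dcen_mem P.1) (mem_dat _ _)
  have h1 := hA I ⟨P, hP, hsub⟩
  have hlam : 0 ≤ lam * dlen I :=
    (integral_nonneg fun x => mul_nonneg (hu0 x) (dw_pos I x).le).trans h1
  have hlam' : 0 ≤ lam := nonneg_of_mul_nonneg_left hlam (dlen_pos I)
  have hint : Integrable fun x => u x * dw I x :=
    hu.mul_bdd (c := 1) (continuous_dw I).aestronglyMeasurable
      (ae_of_all _ fun x => by rw [norm_of_nonneg (dw_pos I x).le]; exact dw_le_one I x)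
  have hm : MeasurableSet {x : ℝ | |x - y| ≤ tdist T hT y / 8} :=
    (isClosed_le (by fun_prop) (by fun_prop)).measurableSet
  calc ∫ x in {x | |x - y| ≤ tdist T hT y / 8}, u x
      ≤ ∫ x in {x | |x - y| ≤ tdist T hT y / 8}, 5 * (u x * dw I x) := by
        refine setIntegral_mono_on hu.integrableOn (hint.const_mul 5).integrableOn hm fun x hx => ?_
        have hx' : |x - y| ≤ tdist T hT y / 8 := hx
        have a1 : |x - dcen I| ≤ 2 * dlen I := by
          have b1 := abs_sub_le x y (dcen I)
          have b2 := abs_sub_le y (dcen P.1) (dcen I)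
          have b3 := dint_sub_dcen hsub
          have := dlen_pos P.1
          linarith
        have a2 : 1 ≤ 5 * dw I x := by
          unfold dw wt
          have : ((x - dcen I) / dlen I) ^ 2 ≤ 2 ^ 2 := by
            rw [← sq_abs, abs_div, abs_of_pos (dlen_pos I)]
            have := dlen_pos I
            gcongr
            rwa [div_le_iff₀ this]
          rw [← div_eq_mul_inv, le_div_iff₀ (by positivity)]
          linarith
        nlinarith [hu0 x]
    _ ≤ ∫ x, 5 * (u x * dw I x) :=
        setIntegral_le_integral (hint.const_mul 5) (ae_of_all _ fun x => by
          have := hu0 x; have := dw_pos I x; positivity)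
    _ ≤ 5 * (lam * dlen I) := by rw [integral_const_mul]; linarith
    _ ≤ _ := by nlinarith

end TreeScale

section TreeSum

lemma full_scale_unique {T : Finset Tl} (hs : Sparse T) {ξ : ℝ} {P P' : Tl} (hP : P ∈ T) (hP' : P' ∈ T)
    (h : Full ξ P) (h' : Full ξ P') (hk : P.1.1 = P'.1.1) : P.2 = P'.2 := by
  by_contra hne
  have h1 := (hs P hP P' hP').2 hne
  have h5 : (128 : ℝ) ≤ |(P.2 : ℝ) - P'.2| := by exact_mod_cast h1
  have hl : dlen P'.1 = dlen P.1 := by unfold dlen; rw [hk]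
  unfold Full at h h'
  rw [hl] at h'
  have := abs_sub_le (P.2 : ℝ) (dlen P.1 * ξ) P'.2
  rw [abs_sub_comm (P.2 : ℝ) (dlen P.1 * ξ)] at this
  linarith

lemma dlen_ratio_mul_dw_le {I : ℤ × ℤ} {δ y : ℝ} (hδ : 0 < δ) (h : δ ≤ dlen I + |y - dcen I|) :
    (δ / dlen I) * dw I y ≤ 2 * min (δ / dlen I) (dlen I / δ) := by
  have l := dlen_pos I
  have hd := dw_pos I y
  rcases min_cases (δ / dlen I) (dlen I / δ) with ⟨h1, _⟩ | ⟨h1, _⟩ <;> rw [h1]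
  · have : δ / dlen I * dw I y ≤ δ / dlen I * 1 := by gcongr; exact dw_le_one _ _
    have : 0 ≤ δ / dlen I := by positivity
    linarith
  · have h3 : (δ / dlen I) ^ 2 * dw I y ≤ 2 := by
      unfold dw wt
      rw [← div_eq_mul_inv, div_le_iff₀ (by positivity)]
      have h4 : δ / dlen I ≤ 1 + |(y - dcen I) / dlen I| := by
        rw [abs_div, abs_of_pos l, div_le_iff₀ l, add_mul, div_mul_cancel₀ _ l.ne']; linarith
      rw [← sq_abs ((y - dcen I) / dlen I)]
      have : (δ / dlen I) ^ 2 ≤ (1 + |(y - dcen I) / dlen I|) ^ 2 := by gcongr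
      nlinarith [sq_nonneg (|(y - dcen I) / dlen I| - 1)]
    have h5 : δ / dlen I * dw I y = (δ / dlen I) ^ 2 * dw I y * (dlen I / δ) := by field_simp
    rw [h5]
    have : 0 < dlen I / δ := by positivity
    gcongr

lemma exists_tree_sum_le : ∃ C : ℝ, 0 < C ∧ ∀ (T : Finset Tl) (hT : T.Nonempty) (ξ : ℝ), Sparse T →
    (∀ P ∈ T, Full ξ P) → ∀ I0 : ℤ × ℤ, (∀ P ∈ T, dint P.1 ⊆ dint I0) → ∀ y,
    ∑ P ∈ T, tdist T hT y / dlen P.1 * dw P.1 y ^ 3 ≤ C * dw I0 y := by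
  classical
  obtain ⟨C, hC, h⟩ := exists_sum_min_rpow_le one_pos
  refine ⟨18 * π * C, by positivity, fun T hT ξ hs hf I0 hI y => ?_⟩
  set δ := tdist T hT y with hδ
  have hδ0 : 0 < δ := tdist_pos hT y
  have p0 := dw_pos I0 y
  have e1 : ∀ P ∈ T, δ / dlen P.1 * dw P.1 y ^ 3 ≤
      6 * dw I0 y * (min (((2 : ℝ) ^ P.1.1 * δ⁻¹) ^ (1 : ℝ)) (((2 : ℝ) ^ P.1.1 * δ⁻¹) ^ (-1 : ℝ)) * dw P.1 y) := by
    intro P hP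
    have a1 := dlen_ratio_mul_dw_le hδ0 (tdist_le hT hP y)
    have a2 := dw_le_of_sub (hI P hP) y
    have l := dlen_pos P.1
    have p1 := dw_pos P.1 y
    have e : min (((2 : ℝ) ^ P.1.1 * δ⁻¹) ^ (1 : ℝ)) (((2 : ℝ) ^ P.1.1 * δ⁻¹) ^ (-1 : ℝ)) =
        min (δ / dlen P.1) (dlen P.1 / δ) := by
      rw [min_comm, Real.rpow_one, Real.rpow_neg_one]
      unfold dlen
      congr 1
      rw [mul_inv, inv_inv, div_eq_mul_inv, mul_comm]
    rw [e]
    have : 0 ≤ min (δ / dlen P.1) (dlen P.1 / δ) := by positivity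
    calc δ / dlen P.1 * dw P.1 y ^ 3 = (δ / dlen P.1 * dw P.1 y) * dw P.1 y * dw P.1 y := by ring
      _ ≤ (2 * min (δ / dlen P.1) (dlen P.1 / δ)) * (3 * dw I0 y) * dw P.1 y := by gcongr
      _ = _ := by ring
  refine (Finset.sum_le_sum e1).trans ?_
  rw [← Finset.mul_sum]
  have e2 : ∑ P ∈ T, min (((2 : ℝ) ^ P.1.1 * δ⁻¹) ^ (1 : ℝ)) (((2 : ℝ) ^ P.1.1 * δ⁻¹) ^ (-1 : ℝ)) * dw P.1 y =
      ∑ k ∈ T.image fun P => P.1.1, min (((2 : ℝ) ^ k * δ⁻¹) ^ (1 : ℝ)) (((2 : ℝ) ^ k * δ⁻¹) ^ (-1 : ℝ)) *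
        ∑ P ∈ T with P.1.1 = k, dw P.1 y := by
    rw [← Finset.sum_fiberwise_of_maps_to (s := T) (t := T.image fun P => P.1.1) (g := fun P => P.1.1)
      (fun P hP => Finset.mem_image_of_mem _ hP)]
    refine Finset.sum_congr rfl fun k _ => ?_
    rw [Finset.mul_sum]
    refine Finset.sum_congr rfl fun P hP => ?_
    rw [(Finset.mem_filter.1 hP).2]
  have e3 : ∀ k, ∑ P ∈ T with P.1.1 = k, dw P.1 y ≤ 3 * π := by
    intro k
    rw [← Finset.sum_image (s := T.filter fun P => P.1.1 = k) (g := fun P : Tl => P.1) (f := fun I => dw I y)]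
    · refine sum_dw_le k _ (fun I hI => ?_) y
      obtain ⟨P, hP, rfl⟩ := Finset.mem_image.1 hI
      exact (Finset.mem_filter.1 hP).2
    · intro P hP P' hP' he
      have hP := Finset.mem_filter.1 hP
      have hP' := Finset.mem_filter.1 hP'
      exact Prod.ext he (full_scale_unique hs hP.1 hP'.1 (hf P hP.1) (hf P' hP'.1) (hP.2.trans hP'.2.symm))
  rw [e2]
  calc _ ≤ 6 * dw I0 y * ∑ k ∈ T.image fun P => P.1.1,
        min (((2 : ℝ) ^ k * δ⁻¹) ^ (1 : ℝ)) (((2 : ℝ) ^ k * δ⁻¹) ^ (-1 : ℝ)) * (3 * π) := by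
        gcongr with k _
        exact e3 k
    _ = 18 * π * dw I0 y * ∑ k ∈ T.image fun P => P.1.1,
        min (((2 : ℝ) ^ k * δ⁻¹) ^ (1 : ℝ)) (((2 : ℝ) ^ k * δ⁻¹) ^ (-1 : ℝ)) := by
        rw [← Finset.sum_mul]; ring
    _ ≤ 18 * π * dw I0 y * C := by
        gcongr
        exact h _ (by positivity) _
    _ = _ := by ring

end TreeSum

section SizeLemma
variable {V : Type*} [NormedAddCommGroup V] [InnerProductSpace ℂ V]
variable {κ B : ℝ} {Cd : ℕ → ℝ} {Cl : ℝ} {ph : Tl → ℝ → ℂ} {ν : Tl → ℝ}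

lemma integrable_mul_dw_of {u : ℝ → ℝ} (hu : Integrable u) (I : ℤ × ℤ) :
    Integrable fun x => u x * dw I x :=
  hu.mul_bdd (c := 1) (continuous_dw I).aestronglyMeasurable
    (ae_of_all _ fun x => by rw [norm_of_nonneg (dw_pos I x).le]; exact dw_le_one I x)

lemma WP.norm_cf_le (hW : WP κ B Cd Cl ph ν) {f : ℝ → V} (hf : Integrable f) (P : Tl) :
    ‖cf ph f P‖ ≤ Cd 1 * (dlen P.1)⁻¹ * ∫ x, ‖f x‖ * dw P.1 x := by
  rw [← integral_const_mul]
  refine norm_integral_le_of_norm_le ((integrable_mul_dw_of hf.norm P.1).const_mul _)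
    (ae_of_all _ fun x => ?_)
  rw [norm_smul]
  have := hW.decay 1 P x
  rw [pow_one] at this
  calc ‖ph P x‖ * ‖f x‖ ≤ Cd 1 * (dlen P.1)⁻¹ * dw P.1 x * ‖f x‖ := by gcongr
    _ = _ := by ring

lemma WP.syn_le (hW : WP κ B Cd Cl ph ν) {T : Finset Tl} (hT : T.Nonempty) {ξ : ℝ} (hfull : ∀ P ∈ T, Full ξ P) (v : Tl → V)
    {x y : ℝ} (hxy : |x - y| ≤ tdist T hT y / 8) :
    ‖syn ph T v x‖ ≤ ‖syn ph T v y‖ +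
      Cl * ∑ P ∈ T, ‖v P‖ * (tdist T hT y / dlen P.1 * dw P.1 y ^ 3) := by
  have hCl := hW.Cl_pos
  have e : ∀ z, ‖syn ph T v z‖ = ‖conj (ee (κ * ξ * z)) • syn ph T v z‖ := fun z => by
    rw [norm_smul, RCLike.norm_conj, norm_ee, one_mul]
  rw [e x, e y, ← sub_le_iff_le_add']
  refine (norm_sub_norm_le _ _).trans ?_
  unfold syn
  rw [Finset.smul_sum, Finset.smul_sum, ← Finset.sum_sub_distrib, Finset.mul_sum]
  refine (norm_sum_le _ _).trans (Finset.sum_le_sum fun P hP => ?_)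
  have l := dlen_pos P.1
  have hd := tdist_le hT hP y
  have h1 := hW.lip P (κ * ξ) y x (hW.full_freq (hfull P hP)) (by rw [abs_sub_comm]; linarith)
  have e2 : conj (ee (κ * ξ * x)) • (((dlen P.1 : ℝ) : ℂ) * conj (ph P x)) • v P -
      conj (ee (κ * ξ * y)) • (((dlen P.1 : ℝ) : ℂ) * conj (ph P y)) • v P =
      (((dlen P.1 : ℝ) : ℂ) * conj (ee (κ * ξ * x) * ph P x - ee (κ * ξ * y) * ph P y)) • v P := by
    rw [smul_smul, smul_smul, ← sub_smul]
    congr 1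
    simp only [map_sub, map_mul]
    ring
  rw [e2, norm_smul, norm_mul, Complex.norm_real, norm_of_nonneg l.le, RCLike.norm_conj, norm_sub_rev]
  have p := dw_pos P.1 y
  have hδ := tdist_pos hT y
  calc dlen P.1 * ‖ee (κ * ξ * y) * ph P y - ee (κ * ξ * x) * ph P x‖ * ‖v P‖
      ≤ dlen P.1 * (Cl * (dlen P.1 ^ 2)⁻¹ * dw P.1 y ^ 3 * tdist T hT y) * ‖v P‖ := by
        gcongr
        refine h1.trans ?_
        gcongr
        rw [abs_sub_comm]
        linarith
    _ = _ := by field_simp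

end SizeLemma

/-- Tree estimate: averages control the square function over a lacunary tree. -/
lemma exists_size_le {κ B : ℝ} {Cd : ℕ → ℝ} {Cl : ℝ} (hC4 : 0 < Cd 4) (hC1 : 0 < Cd 1) (hCl : 0 < Cl) :
    ∃ C : ℝ, 0 < C ∧ ∀ (V : Type) [NormedAddCommGroup V] [InnerProductSpace ℂ V] [CompleteSpace V]
      (ph : Tl → ℝ → ℂ) (ν : Tl → ℝ), WP κ B Cd Cl ph ν → ∀ (f : ℝ → V), Integrable f →
      ∀ (T : Finset Tl), Sparse T → ∀ (I0 : ℤ × ℤ), (∀ P ∈ T, dint P.1 ⊆ dint I0) →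
      ∀ σ ξ : ℝ, |σ| = 1 → (∀ P ∈ T, Lac κ ν σ ξ P) →
      ∀ lam : ℝ, 0 < lam → (∀ I : ℤ × ℤ, (∃ P ∈ T, dint P.1 ⊆ dint I) →
        ∫ x, ‖f x‖ * dw I x ≤ lam * dlen I) →
      ∑ P ∈ T, dlen P.1 * ‖cf ph f P‖ ^ 2 ≤ C * lam ^ 2 * dlen I0 := by
  obtain ⟨C0, hC0, hsum⟩ := exists_tree_sum_le
  set K := 144 * π ^ 2 * Cd 4 ^ 2 with hK
  have hKp : 0 < K := by positivity
  refine ⟨2500 * K * π + 100 * Cl * Cd 1 * C0 * π, by positivity, ?_⟩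
  intro V _ _ _ ph ν hW f hf T hs I0 hI0 σ ξ hσ hl lam hlam hA
  have l0 := dlen_pos I0
  rcases T.eq_empty_or_nonempty with rfl | hT
  · simp only [Finset.sum_empty]; positivity
  set v := cf ph f with hv
  set X := ∑ P ∈ T, dlen P.1 * ‖v P‖ ^ 2 with hX
  set F := syn ph T v with hF
  set δ := tdist T hT with hδ
  have hvP : ∀ P ∈ T, ‖v P‖ ≤ Cd 1 * lam := by
    intro P hP
    refine (hW.norm_cf_le hf P).trans ?_
    have h1 := hA P.1 ⟨P, hP, Subset.rfl⟩
    have l := dlen_pos P.1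
    calc _ ≤ Cd 1 * (dlen P.1)⁻¹ * (lam * dlen P.1) := by gcongr
      _ = _ := by field_simp
  have hFc : Continuous F := hW.continuous_syn T v
  set G : ℝ → ℝ := fun y => ‖F y‖ + Cl * (Cd 1 * lam * (C0 * dw I0 y)) with hG
  have hGc : Continuous G := by
    have := continuous_dw I0
    fun_prop
  have hFG : ∀ x y, |x - y| ≤ δ y / 8 → ‖F x‖ ≤ G y := by
    intro x y hxy
    refine (hW.syn_le hT (fun P hP => (hl P hP).1) v hxy).trans ?_
    simp only [hG, hF]
    gcongr
    have h1 := hsum T hT ξ hs (fun P hP => (hl P hP).1) I0 hI0 y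
    calc ∑ P ∈ T, ‖v P‖ * (tdist T hT y / dlen P.1 * dw P.1 y ^ 3)
        ≤ ∑ P ∈ T, Cd 1 * lam * (tdist T hT y / dlen P.1 * dw P.1 y ^ 3) := by
          refine Finset.sum_le_sum fun P hP => ?_
          have := hvP P hP
          have := dlen_pos P.1
          have := dw_pos P.1 y
          have := tdist_pos hT y
          gcongr
      _ ≤ _ := by rw [← Finset.mul_sum]; gcongr
  have hloc := tdist_local hT hf.norm (fun x => norm_nonneg _) hA
  have havg := lintegral_mul_le_of_local hf.norm (fun x => norm_nonneg _) hGc (continuous_tdist hT)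
    (tdist_pos hT) (tdist_lip hT) hFG hloc
  obtain ⟨hom, homle⟩ := hW.integral_syn_sq_le hI0 v
  have hbes := hW.tree_bessel hs hI0 hσ hl v
  change Integrable fun x => om I0 x * ‖F x‖ ^ 2 at hom
  change ∫ x, om I0 x * ‖F x‖ ^ 2 ≤ K * X at hbes
  have hFle : ∀ a : ℝ, 0 < a → ∀ x, ‖F x‖ ≤ a / 2 * (om I0 x * ‖F x‖ ^ 2) + 1 / (2 * a) * dw I0 x := by
    intro a ha x
    have hd := dw_pos I0 x
    have hd1 := dw_le_one I0 x
    rw [om_eq]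
    have h1 : ‖F x‖ ≤ a / 2 * ((dw I0 x ^ 2)⁻¹ * ‖F x‖ ^ 2) + 1 / (2 * a) * dw I0 x ^ 2 := by
      have h0 := sq_nonneg (a * (dw I0 x)⁻¹ * ‖F x‖ - dw I0 x)
      have e : a / 2 * ((dw I0 x ^ 2)⁻¹ * ‖F x‖ ^ 2) + 1 / (2 * a) * dw I0 x ^ 2 - ‖F x‖ =
        (a * (dw I0 x)⁻¹ * ‖F x‖ - dw I0 x) ^ 2 / (2 * a) := by field_simp; ring
      have : 0 ≤ (a * (dw I0 x)⁻¹ * ‖F x‖ - dw I0 x) ^ 2 / (2 * a) := by positivity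
      linarith
    have h2 : 1 / (2 * a) * dw I0 x ^ 2 ≤ 1 / (2 * a) * dw I0 x := by gcongr; nlinarith
    linarith
  have hFint : Integrable fun x => ‖F x‖ := by
    refine ((hom.const_mul (1 / 2)).add ((integrable_dw I0).const_mul (1 / (2 * 1)))).mono'
      hFc.norm.aestronglyMeasurable (ae_of_all _ fun x => ?_)
    rw [norm_norm]
    exact hFle 1 one_pos x
  have hG0 : ∀ y, 0 ≤ G y := fun y => by
    have := dw_pos I0 y
    positivity
  have hGint : Integrable G :=
    hFint.add ((((integrable_dw I0).const_mul C0).const_mul (Cd 1 * lam)).const_mul Cl)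
  have hGval : ∫ y, G y = (∫ y, ‖F y‖) + Cl * (Cd 1 * lam * (C0 * (π * dlen I0))) := by
    rw [integral_add hFint ((((integrable_dw I0).const_mul C0).const_mul (Cd 1 * lam)).const_mul Cl),
      integral_const_mul, integral_const_mul, integral_const_mul, integral_dw]
  have hmain : X ≤ 50 * lam * ∫ y, G y := by
    refine (hW.sum_sq_le hf T).trans ?_
    rw [← ofReal_integral_eq_lintegral_ofReal hGint (ae_of_all _ hG0),
      ← ENNReal.ofReal_mul (by positivity)] at havg
    rw [integral_eq_lintegral_of_nonneg_ae (ae_of_all _ fun x => by positivity)]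
    · refine ENNReal.toReal_le_of_le_ofReal ?_ ?_
      · have : 0 ≤ ∫ y, G y := integral_nonneg fun y => hG0 y
        positivity
      · refine le_trans (le_of_eq ?_) (havg.trans (le_of_eq ?_))
        · simp_rw [mul_comm ‖f _‖]; rfl
        · congr 1; ring
    · exact hFc.norm.aestronglyMeasurable.mul hf.norm.aestronglyMeasurable
  have hX0 : 0 ≤ X := Finset.sum_nonneg fun P _ => by have := dlen_pos P.1; positivity
  have hFI : ∫ y, ‖F y‖ ≤ (1 / (50 * lam * K)) / 2 * (K * X) + (50 * lam * K) / 2 * (π * dlen I0) := by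
    calc ∫ y, ‖F y‖ ≤ ∫ x, (1 / (50 * lam * K)) / 2 * (om I0 x * ‖F x‖ ^ 2) +
          1 / (2 * (1 / (50 * lam * K))) * dw I0 x :=
          integral_mono hFint ((hom.const_mul _).add ((integrable_dw I0).const_mul _))
            (hFle _ (by positivity))
      _ = (1 / (50 * lam * K)) / 2 * (∫ x, om I0 x * ‖F x‖ ^ 2) +
          1 / (2 * (1 / (50 * lam * K))) * (π * dlen I0) := by
          rw [integral_add (hom.const_mul _) ((integrable_dw I0).const_mul _), integral_const_mul,
            integral_const_mul, integral_dw]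
      _ ≤ _ := by
          have : 1 / (2 * (1 / (50 * lam * K))) = (50 * lam * K) / 2 := by field_simp
          rw [this]
          gcongr
  rw [hGval] at hmain
  have h5 : 50 * lam * ((1 / (50 * lam * K)) / 2 * (K * X)) = X / 2 := by field_simp
  have h6 : 50 * lam * ∫ y, ‖F y‖ ≤ X / 2 + 50 * lam * ((50 * lam * K) / 2 * (π * dlen I0)) := by
    rw [← h5, ← mul_add]; gcongr
  nlinarith

/-- Coefficients `a` have size at most `S` over the collection `Q` (on the side `σ`). -/
def SizeLe (κ : ℝ) (ν : Tl → ℝ) (σ : ℝ) (a : Tl → ℝ) (Q : Finset Tl) (S : ℝ) : Prop :=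
  ∀ P0 ∈ Q, ∀ ξ : ℝ, ∀ T ⊆ Q, (∀ P ∈ T, dint P.1 ⊆ dint P0.1 ∧ Lac κ ν σ ξ P) →
    ∑ P ∈ T, dlen P.1 * a P ^ 2 ≤ S ^ 2 * dlen P0.1

lemma SizeLe.mono {κ : ℝ} {ν : Tl → ℝ} {σ : ℝ} {a : Tl → ℝ} {Q Q' : Finset Tl} {S : ℝ}
    (h : SizeLe κ ν σ a Q S) (hQ : Q' ⊆ Q) : SizeLe κ ν σ a Q' S :=
  fun P0 h0 ξ T hT hl => h P0 (hQ h0) ξ T (hT.trans hQ) hl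

lemma sum_two_zpow_le (F : Finset ℤ) (k0 : ℤ) (h : ∀ k ∈ F, k ≤ k0) :
    ∑ k ∈ F, (2 : ℝ) ^ k ≤ 2 * 2 ^ k0 := by
  have e : ∀ k ∈ F, (2 : ℝ) ^ k = 2 ^ k0 * (1 / 2) ^ (k0 - k).toNat := by
    intro k hk
    have := h k hk
    obtain ⟨n, hn⟩ := Int.eq_ofNat_of_zero_le (sub_nonneg.2 this)
    have : k = k0 - n := by omega
    rw [hn, this, zpow_sub₀ two_ne_zero]
    simp [div_eq_mul_inv]
  rw [Finset.sum_congr rfl e, ← Finset.mul_sum, mul_comm (2 : ℝ)]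
  gcongr
  rw [← Finset.sum_image (s := F) (g := fun k => (k0 - k).toNat) (f := fun n => (1 / 2 : ℝ) ^ n)]
  · have := (summable_geometric_two).sum_le_tsum (F.image fun k => (k0 - k).toNat) (fun n _ => by positivity)
    rwa [tsum_geometric_two] at this
  · intro k hk k' hk' he
    have := h k hk
    have := h k' hk'
    simp only at he
    omega

lemma sum_integral_compl_le {T : Finset Tl} (hs : Sparse T) {ξ : ℝ} (hf : ∀ P ∈ T, Full ξ P)
    {I0 : ℤ × ℤ} (hI : ∀ P ∈ T, dint P.1 ⊆ dint I0) :
    ∑ P ∈ T, ∫ y in (dint I0)ᶜ, dw P.1 y ^ 2 ≤ 12 * π ^ 2 * dlen I0 := by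
  classical
  set a := dcen I0 - dlen I0 / 2 with ha
  set b := dcen I0 + dlen I0 / 2 with hb
  have l0 := dlen_pos I0
  have e1 : ∀ P ∈ T, ∫ y in (dint I0)ᶜ, dw P.1 y ^ 2 ≤ π * ((2 : ℝ) ^ P.1.1 * (dw P.1 a + dw P.1 b)) := by
    intro P hP
    have l := dlen_pos P.1
    have hc : dcen P.1 ∈ dint I0 := hI P hP (dcen_mem _)
    rw [dint_eq] at hc
    have mono : ∀ u v : ℝ, |u - dcen P.1| ≤ |v - dcen P.1| → dw P.1 v ≤ dw P.1 u := by
      intro u v h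
      unfold dw wt
      refine inv_anti₀ (by positivity) ?_
      have : ((u - dcen P.1) / dlen P.1) ^ 2 ≤ ((v - dcen P.1) / dlen P.1) ^ 2 := by
        rw [sq_le_sq, abs_div, abs_div]; gcongr
      linarith
    have mono' : ∀ u v : ℝ, |u - v| ≤ |v - dcen P.1| → dw P.1 v ≤ wt u (dlen P.1) v := by
      intro u v h
      rw [abs_sub_comm] at h
      unfold dw wt
      refine inv_anti₀ (by positivity) ?_
      have : ((v - u) / dlen P.1) ^ 2 ≤ ((v - dcen P.1) / dlen P.1) ^ 2 := by
        rw [sq_le_sq, abs_div, abs_div]; gcongr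
      linarith
    have key : ∀ y ∈ (dint I0)ᶜ, dw P.1 y ^ 2 ≤ wt a (dlen P.1) y * dw P.1 a + wt b (dlen P.1) y * dw P.1 b := by
      intro y hy
      have p := dw_pos P.1 y
      have pa := dw_pos P.1 a
      have pb := dw_pos P.1 b
      have qa := wt_pos a (dlen P.1) y
      have qb := wt_pos b (dlen P.1) y
      rw [dint_eq, mem_compl_iff, mem_Ico, not_and_or, not_le, not_lt] at hy
      rw [mem_Ico] at hc
      rcases hy with hy | hy
      · have h1 := mono a y (by rw [abs_of_nonpos (by linarith), abs_of_nonpos (by linarith)]; linarith)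
        have h2 := mono' a y (by rw [abs_of_nonneg (by linarith), abs_of_nonpos (by linarith)]; linarith)
        have := mul_le_mul h2 h1 p.le qa.le
        nlinarith [mul_pos qb pb]
      · have h1 := mono b y (by rw [abs_of_nonneg (by linarith), abs_of_nonneg (by linarith)]; linarith)
        have h2 := mono' b y (by rw [abs_of_nonpos (by linarith), abs_of_nonneg (by linarith)]; linarith)
        have := mul_le_mul h2 h1 p.le qb.le
        nlinarith [mul_pos qa pa]
    have hi : Integrable fun y => wt a (dlen P.1) y * dw P.1 a + wt b (dlen P.1) y * dw P.1 b :=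
      ((integrable_wt a l).mul_const _).add ((integrable_wt b l).mul_const _)
    calc ∫ y in (dint I0)ᶜ, dw P.1 y ^ 2
        ≤ ∫ y in (dint I0)ᶜ, (wt a (dlen P.1) y * dw P.1 a + wt b (dlen P.1) y * dw P.1 b) :=
          setIntegral_mono_on (integrable_wt_pow _ l (by norm_num)).integrableOn hi.integrableOn
            (measurableSet_dint I0).compl key
      _ ≤ ∫ y, (wt a (dlen P.1) y * dw P.1 a + wt b (dlen P.1) y * dw P.1 b) :=
          setIntegral_le_integral hi (ae_of_all _ fun y => by
            have := wt_pos a (dlen P.1) y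
            have := wt_pos b (dlen P.1) y
            have := dw_pos P.1 a
            have := dw_pos P.1 b
            positivity)
      _ = _ := by
          rw [integral_add ((integrable_wt a l).mul_const _) ((integrable_wt b l).mul_const _),
            integral_mul_const, integral_mul_const, integral_wt _ l, integral_wt _ l]
          unfold dlen; ring
  refine (Finset.sum_le_sum e1).trans ?_
  rw [← Finset.mul_sum]
  have e2 : ∑ P ∈ T, (2 : ℝ) ^ P.1.1 * (dw P.1 a + dw P.1 b) =
      ∑ k ∈ T.image fun P => P.1.1, (2 : ℝ) ^ k * ∑ P ∈ T with P.1.1 = k, (dw P.1 a + dw P.1 b) := by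
    rw [← Finset.sum_fiberwise_of_maps_to (s := T) (t := T.image fun P => P.1.1) (g := fun P => P.1.1)
      (fun P hP => Finset.mem_image_of_mem _ hP)]
    refine Finset.sum_congr rfl fun k _ => ?_
    rw [Finset.mul_sum]
    refine Finset.sum_congr rfl fun P hP => ?_
    rw [(Finset.mem_filter.1 hP).2]
  have e3 : ∀ k y, ∑ P ∈ T with P.1.1 = k, dw P.1 y ≤ 3 * π := by
    intro k y
    rw [← Finset.sum_image (s := T.filter fun P => P.1.1 = k) (g := fun P : Tl => P.1) (f := fun I => dw I y)]
    · refine sum_dw_le k _ (fun I hI => ?_) y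
      obtain ⟨P, hP, rfl⟩ := Finset.mem_image.1 hI
      exact (Finset.mem_filter.1 hP).2
    · intro P hP P' hP' he
      have hP := Finset.mem_filter.1 hP
      have hP' := Finset.mem_filter.1 hP'
      exact Prod.ext he (full_scale_unique hs hP.1 hP'.1 (hf P hP.1) (hf P' hP'.1) (hP.2.trans hP'.2.symm))
  have e4 := sum_two_zpow_le (T.image fun P => P.1.1) I0.1 (by
    intro k hk
    obtain ⟨P, hP, rfl⟩ := Finset.mem_image.1 hk
    exact dint_sub_scale (hI P hP))
  rw [e2]
  calc _ ≤ π * ∑ k ∈ T.image fun P => P.1.1, (2 : ℝ) ^ k * (6 * π) := by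
        gcongr with k _
        rw [Finset.sum_add_distrib]
        linarith [e3 k a, e3 k b]
    _ = 6 * π ^ 2 * ∑ k ∈ T.image fun P => P.1.1, (2 : ℝ) ^ k := by rw [← Finset.sum_mul]; ring
    _ ≤ 6 * π ^ 2 * (2 * dlen I0) := by gcongr; exact e4
    _ = _ := by ring

section Select
variable {κ B : ℝ} {Cd : ℕ → ℝ} {Cl : ℝ} {ph : Tl → ℝ → ℂ} {ν : Tl → ℝ}

/-- A selected tree: its top tile, its frequency, its tiles. -/
structure TreeData (κ : ℝ) (ν : Tl → ℝ) (σ : ℝ) (a : Tl → ℝ) (Q : Finset Tl) (lam : ℝ)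
    (e : Tl × ℝ × Finset Tl) : Prop where
  top_mem : e.1 ∈ Q
  sub : e.2.2 ⊆ Q
  tree : ∀ P ∈ e.2.2, dint P.1 ⊆ dint e.1.1 ∧ Lac κ ν σ e.2.1 P
  big : lam ^ 2 * dlen e.1.1 < ∑ P ∈ e.2.2, dlen P.1 * a P ^ 2

/-- The order relation between successively selected trees. -/
def TreeRel (κ σ : ℝ) (e e' : Tl × ℝ × Finset Tl) : Prop :=
  σ * κ * e'.2.1 ≤ σ * κ * e.2.1 ∧ ∀ P ∈ e'.2.2, ¬ (dint P.1 ⊆ dint e.1.1 ∧ Full e.2.1 P)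

lemma TreeData.nonempty {σ : ℝ} {a : Tl → ℝ} {Q : Finset Tl} {lam : ℝ} {e : Tl × ℝ × Finset Tl}
    (h : TreeData κ ν σ a Q lam e) : e.2.2.Nonempty := by
  rw [Finset.nonempty_iff_ne_empty]
  intro he
  have h1 := h.big
  rw [he, Finset.sum_empty] at h1
  have := dlen_pos e.1.1
  nlinarith [mul_nonneg (sq_nonneg lam) this.le]

lemma exists_max_tree {σ : ℝ} (a : Tl → ℝ) (Q : Finset Tl) (lam : ℝ)
    (h : ¬ SizeLe κ ν σ a Q lam) : ∃ e, TreeData κ ν σ a Q lam e ∧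
      ∀ e', TreeData κ ν σ a Q lam e' → σ * κ * e'.2.1 ≤ σ * κ * e.2.1 := by
  classical
  set I : Finset (Tl × Finset Tl) := (Q ×ˢ Q.powerset).filter fun p =>
    (∀ P ∈ p.2, dint P.1 ⊆ dint p.1.1) ∧ lam ^ 2 * dlen p.1.1 < ∑ P ∈ p.2, dlen P.1 * a P ^ 2 with hI
  set S : Tl × Finset Tl → Set ℝ := fun p => {ξ | ∀ P ∈ p.2, Lac κ ν σ ξ P} with hS
  have hmem : ∀ p ξ, (p ∈ I ∧ ξ ∈ S p) ↔ TreeData κ ν σ a Q lam (p.1, ξ, p.2) := by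
    intro p ξ
    constructor
    · rintro ⟨h1, h2⟩
      rw [hI, Finset.mem_filter, Finset.mem_product, Finset.mem_powerset] at h1
      exact ⟨h1.1.1, h1.1.2, fun P hP => ⟨h1.2.1 P hP, h2 P hP⟩, h1.2.2⟩
    · rintro ⟨h1, h2, h3, h4⟩
      refine ⟨?_, fun P hP => (h3 P hP).2⟩
      rw [hI, Finset.mem_filter, Finset.mem_product, Finset.mem_powerset]
      exact ⟨⟨h1, h2⟩, fun P hP => (h3 P hP).1, h4⟩
  have hcomp : IsCompact (⋃ p ∈ I, S p) := by
    refine I.isCompact_biUnion fun p hp => ?_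
    have hne : p.2.Nonempty := by
      rw [Finset.nonempty_iff_ne_empty]
      intro he
      have h1 := (Finset.mem_filter.1 hp).2.2
      rw [he, Finset.sum_empty] at h1
      have := dlen_pos p.1.1
      nlinarith [mul_nonneg (sq_nonneg lam) this.le]
    obtain ⟨P, hP⟩ := hne
    refine Metric.isCompact_of_isClosed_isBounded ?_ ?_
    · simp only [hS, Lac, Full]
      have : {ξ : ℝ | ∀ P ∈ p.2, |dlen P.1 * ξ - P.2| ≤ 40 ∧ 4 * (dlen P.1)⁻¹ ≤ σ * (ν P - κ * ξ)} =
          ⋂ P ∈ p.2, {ξ : ℝ | |dlen P.1 * ξ - P.2| ≤ 40} ∩ {ξ | 4 * (dlen P.1)⁻¹ ≤ σ * (ν P - κ * ξ)} := by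
        ext ξ; simp
      rw [this]
      exact isClosed_biInter fun P _ => (isClosed_le (by fun_prop) (by fun_prop)).inter
        (isClosed_le (by fun_prop) (by fun_prop))
    · refine Metric.isBounded_closedBall (x := (P.2 : ℝ) / dlen P.1) (r := 40 / dlen P.1) |>.subset ?_
      intro ξ hξ
      have h1 : |dlen P.1 * ξ - P.2| ≤ 40 := (hξ P hP).1
      have l := dlen_pos P.1
      rw [Metric.mem_closedBall, Real.dist_eq, le_div_iff₀ l]
      calc |ξ - P.2 / dlen P.1| * dlen P.1 = |(ξ - P.2 / dlen P.1) * dlen P.1| := by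
            rw [abs_mul, abs_of_pos l]
        _ = |dlen P.1 * ξ - P.2| := by congr 1; field_simp
        _ ≤ 40 := h1
  have hne : (⋃ p ∈ I, S p).Nonempty := by
    unfold SizeLe at h
    push Not at h
    obtain ⟨P0, h0, ξ, T, hT, hl, hb⟩ := h
    have := (hmem (P0, T) ξ).2 ⟨h0, hT, hl, hb⟩
    exact ⟨ξ, mem_iUnion₂.2 ⟨_, this.1, this.2⟩⟩
  obtain ⟨ξ, hξ, hmax⟩ := hcomp.exists_isMaxOn hne (f := fun ξ => σ * κ * ξ) (by fun_prop)
  obtain ⟨p, hp, hpS⟩ := mem_iUnion₂.1 hξ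
  refine ⟨(p.1, ξ, p.2), (hmem p ξ).1 ⟨hp, hpS⟩, fun e' he' => ?_⟩
  have := (hmem (e'.1, e'.2.2) e'.2.1).2 he'
  exact hmax (mem_iUnion₂.2 ⟨_, this.1, this.2⟩)

/-- Greedy selection of trees. -/
lemma exists_greedy (σ : ℝ) (a : Tl → ℝ) (lam : ℝ) : ∀ Q : Finset Tl,
    ∃ L : List (Tl × ℝ × Finset Tl), ∃ Q' ⊆ Q, SizeLe κ ν σ a Q' lam ∧
      (∀ P ∈ Q, P ∉ Q' → ∃ e ∈ L, dint P.1 ⊆ dint e.1.1 ∧ Full e.2.1 P) ∧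
      (∀ e ∈ L, TreeData κ ν σ a Q lam e) ∧ L.Pairwise (TreeRel κ σ) := by
  classical
  intro Q
  induction Q using Finset.strongInduction with
  | H Q ih =>
    by_cases h : SizeLe κ ν σ a Q lam
    · exact ⟨[], Q, Subset.rfl, h, fun P hP hn => (hn hP).elim, by simp, by simp⟩
    · obtain ⟨e, he, hmax⟩ := exists_max_tree a Q lam h
      set R := Q.filter fun P => dint P.1 ⊆ dint e.1.1 ∧ Full e.2.1 P with hR
      have hss : Q \ R ⊂ Q := by
        obtain ⟨P, hP⟩ := he.nonempty
        have h1 := he.tree P hP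
        refine Finset.sdiff_ssubset (Finset.filter_subset _ _) ⟨P, ?_⟩
        rw [hR, Finset.mem_filter]
        exact ⟨he.sub hP, h1.1, h1.2.1⟩
      obtain ⟨L, Q', hQ', hsz, hcov, hdat, hpw⟩ := ih _ hss
      have hdat' : ∀ e' ∈ L, TreeData κ ν σ a Q lam e' := fun e' he' =>
        ⟨Finset.sdiff_subset (hdat e' he').top_mem, (hdat e' he').sub.trans Finset.sdiff_subset,
          (hdat e' he').tree, (hdat e' he').big⟩
      refine ⟨e :: L, Q', hQ'.trans Finset.sdiff_subset, hsz, fun P hP hn => ?_, ?_, ?_⟩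
      · by_cases hPR : P ∈ R
        · exact ⟨e, List.mem_cons_self, (Finset.mem_filter.1 hPR).2⟩
        · obtain ⟨e', he', h'⟩ := hcov P (Finset.mem_sdiff.2 ⟨hP, hPR⟩) hn
          exact ⟨e', List.mem_cons_of_mem _ he', h'⟩
      · intro e' he'
        rcases List.mem_cons.1 he' with rfl | he'
        · exact he
        · exact hdat' e' he'
      · rw [List.pairwise_cons]
        refine ⟨fun e' he' => ⟨hmax e' (hdat' e' he'), fun P hP hc => ?_⟩, hpw⟩
        have h1 := Finset.mem_sdiff.1 ((hdat e' he').sub hP)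
        exact h1.2 (Finset.mem_filter.2 ⟨h1.1, hc⟩)

end Select

section Forest
variable {κ B : ℝ} {Cd : ℕ → ℝ} {Cl : ℝ} {ph : Tl → ℝ → ℂ} {ν : Tl → ℝ}

/-- Two trees are comparable when they coincide or one was selected before the other. -/
def TreeCmp (κ σ : ℝ) (e e' : Tl × ℝ × Finset Tl) : Prop :=
  e = e' ∨ TreeRel κ σ e e' ∨ TreeRel κ σ e' e

lemma WP.disjoint_top (hW : WP κ B Cd Cl ph ν) {σ : ℝ} (hσ : |σ| = 1) {e e' : Tl × ℝ × Finset Tl} (h : TreeCmp κ σ e e')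
    {P P' : Tl} (hP : dint P.1 ⊆ dint e.1.1 ∧ Lac κ ν σ e.2.1 P) (hPe' : P' ∈ e'.2.2)
    (hP' : Lac κ ν σ e'.2.1 P')
    (hl : 128 * dlen P'.1 ≤ dlen P.1) (hn : |ν P - ν P'| ≤ 3 * ((dlen P.1)⁻¹ + (dlen P'.1)⁻¹)) :
    Disjoint (dint P'.1) (dint e.1.1) := by
  have l1 := dlen_pos P.1
  have l2 := dlen_pos P'.1
  have h2 := hW.full_freq hP.2.1
  have h3 := hP'.2
  have h4 : |ν P - κ * e.2.1| ≤ 113 * (dlen P.1)⁻¹ := by rwa [← div_eq_mul_inv, le_div_iff₀ l1]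
  have h5 : 128 * (dlen P.1)⁻¹ ≤ (dlen P'.1)⁻¹ := by
    rw [← div_eq_mul_inv, div_le_iff₀ l1, inv_mul_eq_div, le_div_iff₀ l2]; exact hl
  have h6 : σ * (ν P - κ * e.2.1) ≤ |ν P - κ * e.2.1| := by
    have := le_abs_self (σ * (ν P - κ * e.2.1))
    rwa [abs_mul, hσ, one_mul] at this
  have h7 : σ * (ν P' - ν P) ≤ |ν P - ν P'| := by
    have := le_abs_self (σ * (ν P' - ν P))
    rwa [abs_mul, hσ, one_mul, abs_sub_comm] at this
  have h8 : 0 < (dlen P.1)⁻¹ := by positivity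
  have hlt : σ * κ * e'.2.1 < σ * κ * e.2.1 := by nlinarith
  have hfull : Full e.2.1 P' := by
    unfold Full
    have hk := hW.one_le_kappa
    have a1 := hW.freq P'
    have a2 := hW.freq_lower
    have a3 : |κ * e.2.1 - ν P| ≤ 113 * (dlen P.1)⁻¹ := by rwa [abs_sub_comm]
    have a4 : |κ * e.2.1 - ν P'| ≤ 116 * (dlen P.1)⁻¹ + 3 * (dlen P'.1)⁻¹ := by
      have := abs_sub_le (κ * e.2.1) (ν P) (ν P')
      linarith
    have a5 : |(κ * e.2.1 - ν P') * dlen P'.1| ≤ 4 := by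
      rw [abs_mul, abs_of_pos l2]
      calc _ ≤ (116 * (dlen P.1)⁻¹ + 3 * (dlen P'.1)⁻¹) * dlen P'.1 := by gcongr
        _ ≤ (116 / 128 * (dlen P'.1)⁻¹ + 3 * (dlen P'.1)⁻¹) * dlen P'.1 := by
            gcongr ?_ * _
            linarith
        _ ≤ 4 := by
            rw [← add_mul, mul_assoc, inv_mul_cancel₀ l2.ne']
            norm_num
    have a6 : |κ| * |dlen P'.1 * e.2.1 - P'.2| ≤ B + 4 := by
      rw [← abs_mul]
      calc _ = |(ν P' * dlen P'.1 - κ * P'.2) + (κ * e.2.1 - ν P') * dlen P'.1| := by congr 1; ring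
        _ ≤ _ := abs_add_le _ _
        _ ≤ _ := by linarith
    have : |κ| * |dlen P'.1 * e.2.1 - P'.2| ≤ |κ| * 40 := by linarith
    exact le_of_mul_le_mul_left this (by linarith)
  have hk' : P'.1.1 ≤ e.1.1.1 := by
    have hle := dint_sub_dlen hP.1
    exact (zpow_le_zpow_iff_right₀ one_lt_two).1 (show dlen P'.1 ≤ dlen e.1.1 by linarith)
  rcases h with h | h | h
  · rw [h] at hlt; exact (lt_irrefl _ hlt).elim
  · rcases dint_sub_or_disjoint hk' with hs | hd
    · exact (h.2 P' hPe' ⟨hs, hfull⟩).elim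
    · exact hd
  · exact absurd h.1 (not_le.2 hlt)

lemma WP.single_le (hW : WP κ B Cd Cl ph ν) {σ : ℝ} (hσ : |σ| = 1) {a : Tl → ℝ} {Q : Finset Tl} {S : ℝ} (hS : 0 ≤ S)
    (h : SizeLe κ ν σ a Q S) {P : Tl} (hP : P ∈ Q) : a P ≤ S := by
  have l := dlen_pos P.1
  have hk := hW.one_le_kappa
  have hk0 : κ ≠ 0 := by
    intro h0; rw [h0, abs_zero] at hk; linarith
  have hs2 : σ * σ = 1 := by rw [← abs_mul_abs_self, hσ, one_mul]
  have h1 := h P hP ((ν P - 4 * σ * (dlen P.1)⁻¹) / κ) {P} (by simpa using hP) (by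
    intro P' hP'
    rw [Finset.mem_singleton] at hP'
    subst hP'
    refine ⟨Subset.rfl, ?_, ?_⟩
    · unfold Full
      have a1 := hW.freq P'
      have a2 := hW.freq_lower
      have : |κ| * |dlen P'.1 * ((ν P' - 4 * σ * (dlen P'.1)⁻¹) / κ) - P'.2| ≤ |κ| * 40 := by
        rw [← abs_mul]
        calc _ = |(ν P' * dlen P'.1 - κ * P'.2) - 4 * σ| := by congr 1; field_simp; ring
          _ ≤ |ν P' * dlen P'.1 - κ * P'.2| + |4 * σ| := abs_sub _ _
          _ ≤ B + 4 := by rw [abs_mul, hσ]; norm_num; linarith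
          _ ≤ _ := by linarith
      exact le_of_mul_le_mul_left this (by linarith)
    · rw [mul_div_cancel₀ _ hk0]
      have : σ * (ν P' - (ν P' - 4 * σ * (dlen P'.1)⁻¹)) = (σ * σ) * (4 * (dlen P'.1)⁻¹) := by ring
      rw [this, hs2, one_mul])
  rw [Finset.sum_singleton, mul_comm] at h1
  exact le_of_sq_le_sq hS (le_of_mul_le_mul_right h1 l)
where
  le_of_sq_le_sq {x y : ℝ} (hy : 0 ≤ y) (h : x ^ 2 ≤ y ^ 2) : x ≤ y := abs_le_of_sq_le_sq' h hy |>.2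

open Classical in
lemma WP.forest_off_diag (hW : WP κ B Cd Cl ph ν) {σ : ℝ} (hσ : |σ| = 1) {Q : Finset Tl} (hQ : Sparse Q) {a : Tl → ℝ} {lam : ℝ}
    {L : Finset (Tl × ℝ × Finset Tl)} (hdat : ∀ e ∈ L, TreeData κ ν σ a Q lam e)
    (hcmp : ∀ e ∈ L, ∀ e' ∈ L, TreeCmp κ σ e e') {J : ℤ × ℤ} (hJ : ∀ P ∈ Q, dint P.1 ⊆ dint J)
    {e : Tl × ℝ × Finset Tl} (he : e ∈ L) {P : Tl} (hP : P ∈ e.2.2) :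
    ∑ P' ∈ L.biUnion (fun e => e.2.2) with P'.1.1 < P.1.1 ∧ near ν P P',
      dlen P.1 * (dlen P'.1 * ‖gr ph J P P'‖) ≤
      144 * π * Cd 4 ^ 2 * ∫ y in (dint e.1.1)ᶜ, dw P.1 y ^ 2 := by
  have l1 := dlen_pos P.1
  have hC := hW.Cd_pos 4
  have hPQ : P ∈ Q := (hdat e he).sub hP
  have info : ∀ P' ∈ (L.biUnion (fun e => e.2.2)).filter fun P' => P'.1.1 < P.1.1 ∧ near ν P P',
      ∃ e' ∈ L, P' ∈ e'.2.2 ∧ P' ∈ Q ∧ 128 * dlen P'.1 ≤ dlen P.1 ∧ near ν P P' := by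
    intro P' h
    obtain ⟨h1, h2, h3⟩ := Finset.mem_filter.1 h
    obtain ⟨e', he', hPe'⟩ := Finset.mem_biUnion.1 h1
    have hPQ' := (hdat e' he').sub hPe'
    exact ⟨e', he', hPe', hPQ', dlen_ge_of_sparse hQ hPQ hPQ' h2, h3⟩
  have h1 := sum_setIntegral_le ((L.biUnion (fun e => e.2.2)).filter fun P' => P'.1.1 < P.1.1 ∧ near ν P P')
    (fun P' => P'.1) (fun y => dw P.1 y ^ 2) (integrable_wt_pow _ l1 (by norm_num))
    (fun x => pow_nonneg (dw_pos _ _).le 2) (dint e.1.1)ᶜ (measurableSet_dint _).compl (by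
      intro P' h
      obtain ⟨e', he', hPe', hPQ', hl, hn⟩ := info P' h
      unfold near at hn
      have := dlen_pos P'.1
      have : 0 < (dlen P.1)⁻¹ := by positivity
      have : 0 < (dlen P'.1)⁻¹ := by positivity
      exact (hW.disjoint_top hσ (hcmp e he e' he') ((hdat e he).tree P hP) hPe'
        ((hdat e' he').tree P' hPe').2 hl (by linarith)).subset_compl_right) (by
      have key : ∀ P' ∈ (L.biUnion (fun e => e.2.2)).filter fun P' => P'.1.1 < P.1.1 ∧ near ν P P',
          ∀ P'' ∈ (L.biUnion (fun e => e.2.2)).filter fun P' => P'.1.1 < P.1.1 ∧ near ν P P',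
          P''.1.1 < P'.1.1 → Disjoint (dint P'.1) (dint P''.1) := by
        intro P' h' P'' h'' hlt
        obtain ⟨e', he', hPe', hPQ', hl', hn'⟩ := info P' h'
        obtain ⟨e'', he'', hPe'', hPQ'', hl'', hn''⟩ := info P'' h''
        have hl := dlen_ge_of_sparse hQ hPQ' hPQ'' hlt
        have l' := dlen_pos P'.1
        have l'' := dlen_pos P''.1
        have h5 : 128 * (dlen P.1)⁻¹ ≤ (dlen P'.1)⁻¹ := by
          rw [← div_eq_mul_inv, div_le_iff₀ l1, inv_mul_eq_div, le_div_iff₀ l']; exact hl'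
        have h6 : 0 < (dlen P.1)⁻¹ := by positivity
        have h7 : 0 < (dlen P''.1)⁻¹ := by positivity
        unfold near at hn' hn''
        have h8 := abs_sub_le (ν P') (ν P) (ν P'')
        rw [abs_sub_comm (ν P') (ν P)] at h8
        exact ((hW.disjoint_top hσ (hcmp e' he' e'' he'') ((hdat e' he').tree P' hPe') hPe''
          ((hdat e'' he'').tree P'' hPe'').2 hl (by linarith)).mono_right
          ((hdat e' he').tree P' hPe').1).symm
      intro P' h' P'' h'' hne
      rcases lt_trichotomy P'.1.1 P''.1.1 with hlt | heq | hlt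
      · exact (key P'' h'' P' h' hlt).symm
      · refine disjoint_of_same_scale heq fun h => hne (Prod.ext h ?_)
        obtain ⟨e', he', hPe', hPQ', hl', hn'⟩ := info P' h'
        obtain ⟨e'', he'', hPe'', hPQ'', hl'', hn''⟩ := info P'' h''
        refine hW.eq_of_near_of_le hQ hPQ' hPQ'' heq ?_
        have l' := dlen_pos P'.1
        have hll : dlen P''.1 = dlen P'.1 := by rw [h]
        have h5 : 128 * (dlen P.1)⁻¹ ≤ (dlen P'.1)⁻¹ := by
          rw [← div_eq_mul_inv, div_le_iff₀ l1, inv_mul_eq_div, le_div_iff₀ l']; exact hl'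
        unfold near at hn' hn''
        rw [hll] at hn''
        have h6 : 0 < (dlen P'.1)⁻¹ := by positivity
        have h8 := abs_sub_le (ν P') (ν P) (ν P'')
        rw [abs_sub_comm (ν P') (ν P)] at h8
        calc |ν P' - ν P''| * dlen P'.1 ≤ (5 * (dlen P'.1)⁻¹) * dlen P'.1 := by
              gcongr; linarith
          _ = 5 := by field_simp
          _ < 62 := by norm_num
      · exact key P' h' P'' h'' hlt)
  calc _ ≤ ∑ P' ∈ L.biUnion (fun e => e.2.2) with P'.1.1 < P.1.1 ∧ near ν P P',
        144 * π * Cd 4 ^ 2 * ∫ y in dint P'.1, dw P.1 y ^ 2 := by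
        refine Finset.sum_le_sum fun P' h => ?_
        obtain ⟨e', he', hPe', hPQ', hl', hn'⟩ := info P' h
        have := dlen_pos P'.1
        have h2 := hW.gr_le (hJ P hPQ) (hJ P' hPQ') (by linarith : dlen P'.1 ≤ dlen P.1)
        calc _ ≤ dlen P.1 * ((144 * π * Cd 4 ^ 2) * (dlen P.1)⁻¹ * ∫ y in dint P'.1, dw P.1 y ^ 2) := by
              gcongr
          _ = _ := by field_simp
    _ ≤ _ := by
        rw [← Finset.mul_sum]
        gcongr

end Forest

lemma sum_biUnion_le_sum {α β : Type*} [DecidableEq α] (L : Finset β) (T : β → Finset α) {b : α → ℝ}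
    (hb : ∀ P, 0 ≤ b P) : ∑ P ∈ L.biUnion T, b P ≤ ∑ e ∈ L, ∑ P ∈ T e, b P := by
  classical
  induction L using Finset.induction_on with
  | empty => simp
  | insert e L he ih =>
    rw [Finset.biUnion_insert, Finset.sum_insert he]
    have := Finset.sum_union_inter (s₁ := T e) (s₂ := L.biUnion T) (f := b)
    have h0 : 0 ≤ ∑ P ∈ T e ∩ L.biUnion T, b P := Finset.sum_nonneg fun P _ => hb P
    linarith

section Selection
variable {V : Type*} [NormedAddCommGroup V] [InnerProductSpace ℂ V]
variable {κ B : ℝ} {Cd : ℕ → ℝ} {Cl : ℝ} {ph : Tl → ℝ → ℂ} {ν : Tl → ℝ}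

lemma TreeCmp.symm {σ : ℝ} {e e' : Tl × ℝ × Finset Tl} (h : TreeCmp κ σ e e') : TreeCmp κ σ e' e := by
  rcases h with h | h | h
  · exact Or.inl h.symm
  · exact Or.inr (Or.inr h)
  · exact Or.inr (Or.inl h)

lemma TreeCmp.disjoint {σ a lam : _} {Q : Finset Tl} {e e' : Tl × ℝ × Finset Tl} (h : TreeCmp κ σ e e')
    (he : TreeData κ ν σ a Q lam e) (he' : TreeData κ ν σ a Q lam e') (hne : e ≠ e') :
    Disjoint e.2.2 e'.2.2 := by
  rw [Finset.disjoint_left]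
  intro P hP hP'
  rcases h with h | h | h
  · exact hne h
  · exact h.2 P hP' ⟨(he.tree P hP).1, (he.tree P hP).2.1⟩
  · exact h.2 P hP ⟨(he'.tree P hP').1, (he'.tree P hP').2.1⟩

omit [InnerProductSpace ℂ V] in
lemma integrable_mul_dw {f : ℝ → V} (hf : Integrable f)
    (J : ℤ × ℤ) : Integrable fun x => ‖f x‖ * dw J x := by
  refine (hf.norm.bdd_mul (c := 1) (continuous_dw J).aestronglyMeasurable (ae_of_all _ fun x => ?_)).congr
    (ae_of_all _ fun x => mul_comm _ _)
  rw [norm_of_nonneg (dw_pos J x).le]; exact dw_le_one J x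

open Classical in
/-- The forest inequality. -/
lemma WP.forest_le [CompleteSpace V] (hW : WP κ B Cd Cl ph ν) {σ : ℝ} (hσ : |σ| = 1) {Q : Finset Tl}
    (hQ : Sparse Q) {f : ℝ → V} (hf : Integrable f) (hf1 : ∀ x, ‖f x‖ ≤ 1) {lam : ℝ} (hlam : 0 < lam)
    {J : ℤ × ℤ} (hJ : ∀ P ∈ Q, dint P.1 ⊆ dint J)
    (hS : SizeLe κ ν σ (fun P => ‖cf ph f P‖) Q (2 * lam))
    {L : Finset (Tl × ℝ × Finset Tl)} (hdat : ∀ e ∈ L, TreeData κ ν σ (fun P => ‖cf ph f P‖) Q lam e)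
    (hcmp : ∀ e ∈ L, ∀ e' ∈ L, TreeCmp κ σ e e') :
    lam ^ 2 * ∑ e ∈ L, dlen e.1.1 ≤
      (144 * π ^ 2 * Cd 4 ^ 2 + 96 * π ^ 2 * (144 * π * Cd 4 ^ 2)) * ∫ x, ‖f x‖ * dw J x := by
  set s := L.biUnion fun e => e.2.2 with hs
  have hsQ : s ⊆ Q := Finset.biUnion_subset.2 fun e he => (hdat e he).sub
  set b : Tl → ℝ := fun P => ‖cf ph f P‖ with hb
  set X := ∑ P ∈ s, dlen P.1 * b P ^ 2 with hX
  have hdisj : (L : Set (Tl × ℝ × Finset Tl)).PairwiseDisjoint fun e => e.2.2 :=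
    fun e he e' he' hne => (hcmp e he e' he').disjoint (hdat e he) (hdat e' he') hne
  have hsum : ∀ F : Tl → ℝ, ∑ P ∈ s, F P = ∑ e ∈ L, ∑ P ∈ e.2.2, F P := fun F =>
    Finset.sum_biUnion hdisj
  have h1 : lam ^ 2 * ∑ e ∈ L, dlen e.1.1 ≤ X := by
    rw [hX, hsum, Finset.mul_sum]
    exact Finset.sum_le_sum fun e he => (hdat e he).big.le
  have hC := hW.Cd_pos 4
  have hb2 : ∀ P ∈ s, b P ≤ 2 * lam := fun P hP => hW.single_le hσ (by positivity) hS (hsQ hP)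
  have hb0 : ∀ P, 0 ≤ b P := fun P => norm_nonneg _
  set S2 := ∑ P ∈ s, ∑ P' ∈ s with P'.1.1 < P.1.1 ∧ near ν P P',
        dlen P.1 * dlen P'.1 * ‖gr ph J P P'‖ * (b P * b P') with hS2
  have h2 : S2 ≤ 48 * π ^ 2 * (144 * π * Cd 4 ^ 2) * X := by
    calc S2 ≤ ∑ P ∈ s, 4 * lam ^ 2 * ∑ P' ∈ s with P'.1.1 < P.1.1 ∧ near ν P P',
          dlen P.1 * (dlen P'.1 * ‖gr ph J P P'‖) := by
          refine Finset.sum_le_sum fun P hP => ?_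
          rw [Finset.mul_sum]
          refine Finset.sum_le_sum fun P' hP' => ?_
          have := dlen_pos P.1
          have := dlen_pos P'.1
          have e1 : b P * b P' ≤ (2 * lam) * (2 * lam) :=
            mul_le_mul (hb2 P hP) (hb2 P' (Finset.mem_filter.1 hP').1) (hb0 _) (by positivity)
          calc _ ≤ dlen P.1 * dlen P'.1 * ‖gr ph J P P'‖ * ((2 * lam) * (2 * lam)) := by gcongr
            _ = _ := by ring
      _ = ∑ e ∈ L, ∑ P ∈ e.2.2, 4 * lam ^ 2 * ∑ P' ∈ s with P'.1.1 < P.1.1 ∧ near ν P P',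
          dlen P.1 * (dlen P'.1 * ‖gr ph J P P'‖) := hsum _
      _ ≤ ∑ e ∈ L, ∑ P ∈ e.2.2, 4 * lam ^ 2 * (144 * π * Cd 4 ^ 2 * ∫ y in (dint e.1.1)ᶜ, dw P.1 y ^ 2) := by
          refine Finset.sum_le_sum fun e he => Finset.sum_le_sum fun P hP => ?_
          gcongr
          exact hW.forest_off_diag hσ hQ hdat hcmp hJ he hP
      _ ≤ ∑ e ∈ L, 4 * lam ^ 2 * (144 * π * Cd 4 ^ 2 * (12 * π ^ 2 * dlen e.1.1)) := by
          refine Finset.sum_le_sum fun e he => ?_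
          rw [← Finset.mul_sum, ← Finset.mul_sum]
          gcongr
          exact sum_integral_compl_le (fun P hP P' hP' => hQ P ((hdat e he).sub hP) P' ((hdat e he).sub hP')) (fun P hP => ((hdat e he).tree P hP).2.1)
            (fun P hP => ((hdat e he).tree P hP).1)
      _ = 48 * π ^ 2 * (144 * π * Cd 4 ^ 2) * (lam ^ 2 * ∑ e ∈ L, dlen e.1.1) := by
          simp only [Finset.mul_sum]
          exact Finset.sum_congr rfl fun e _ => by ring
      _ ≤ _ := by gcongr
  set K0 := 144 * π ^ 2 * Cd 4 ^ 2 + 96 * π ^ 2 * (144 * π * Cd 4 ^ 2) with hK0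
  have hK : 0 < K0 := by positivity
  set F := syn ph s (cf ph f) with hF
  have hJs : ∀ P ∈ s, dint P.1 ⊆ dint J := fun P hP => hJ P (hsQ hP)
  obtain ⟨hi, h3⟩ := hW.integral_syn_sq_le hJs (cf ph f)
  have h4 : ∫ x, om J x * ‖F x‖ ^ 2 ≤ K0 * X := by
    refine h3.trans ((hW.gram_le (fun P hP P' hP' => hQ P (hsQ hP) P' (hsQ hP')) hJs _).trans ?_)
    have : 144 * π ^ 2 * Cd 4 ^ 2 * X + 2 * S2 ≤ K0 * X := by rw [hK0]; linarith
    convert this using 2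
  have hi2 := integrable_mul_dw hf J
  have h5 : X ≤ ∫ x, ((2 * K0)⁻¹ * (om J x * ‖F x‖ ^ 2) + K0 / 2 * (‖f x‖ * dw J x)) := by
    refine (hW.sum_sq_le hf s).trans ?_
    refine integral_mono_of_nonneg (ae_of_all _ fun x => by positivity)
      ((hi.const_mul _).add (hi2.const_mul _)) (ae_of_all _ fun x => ?_)
    show ‖F x‖ * ‖f x‖ ≤ _
    have p := dw_pos J x
    have p1 := dw_le_one J x
    have e1 : ‖f x‖ ^ 2 * dw J x ^ 2 ≤ ‖f x‖ * dw J x := by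
      have : ‖f x‖ * dw J x ≤ 1 := mul_le_one₀ (hf1 x) p.le p1
      have h0 : 0 ≤ ‖f x‖ * dw J x := by positivity
      nlinarith
    have e2 : om J x * ‖F x‖ ^ 2 = (‖F x‖ / dw J x) ^ 2 := by rw [om_eq]; field_simp
    show _ ≤ (2 * K0)⁻¹ * (om J x * ‖F x‖ ^ 2) + K0 / 2 * (‖f x‖ * dw J x)
    rw [e2]
    set u := ‖F x‖ / dw J x with hu
    have e3 : ‖F x‖ * ‖f x‖ = u * (‖f x‖ * dw J x) := by rw [hu]; field_simp
    rw [e3]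
    set w := ‖f x‖ * dw J x with hw
    have e4 : w ^ 2 ≤ w := by rw [hw, mul_pow]; exact e1
    have e5 : (2 * K0)⁻¹ * u ^ 2 + K0 / 2 * w ^ 2 - u * w = (2 * K0)⁻¹ * (u - K0 * w) ^ 2 := by
      field_simp; ring
    have e6 : 0 ≤ (2 * K0)⁻¹ * (u - K0 * w) ^ 2 := by positivity
    have e7 : K0 / 2 * w ^ 2 ≤ K0 / 2 * w := by gcongr
    linarith
  rw [integral_add (hi.const_mul _) (hi2.const_mul _), integral_const_mul, integral_const_mul] at h5
  have h6 : (2 * K0)⁻¹ * ∫ x, om J x * ‖F x‖ ^ 2 ≤ X / 2 := by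
    calc _ ≤ (2 * K0)⁻¹ * (K0 * X) := by gcongr
      _ = _ := by field_simp
  linarith

/-- Selection of a collection of smaller size. -/
lemma WP.exists_select [CompleteSpace V] (hW : WP κ B Cd Cl ph ν) {σ : ℝ} (hσ : |σ| = 1) {Q : Finset Tl}
    (hQ : Sparse Q) {f : ℝ → V} (hf : Integrable f) (hf1 : ∀ x, ‖f x‖ ≤ 1) {lam : ℝ} (hlam : 0 < lam)
    {J : ℤ × ℤ} (hJ : ∀ P ∈ Q, dint P.1 ⊆ dint J)
    (hS : SizeLe κ ν σ (fun P => ‖cf ph f P‖) Q (2 * lam)) :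
    ∃ Q' ⊆ Q, SizeLe κ ν σ (fun P => ‖cf ph f P‖) Q' lam ∧
      ∀ (b : Tl → ℝ) (Y : ℝ), (∀ P, 0 ≤ b P) → 0 ≤ Y →
        (∀ P0 ∈ Q, ∀ ξ, ∀ T ⊆ Q, (∀ P ∈ T, dint P.1 ⊆ dint P0.1 ∧ Full ξ P) →
          ∑ P ∈ T, b P ≤ Y * dlen P0.1) →
        ∑ P ∈ Q \ Q', b P ≤ Y * ((144 * π ^ 2 * Cd 4 ^ 2 + 96 * π ^ 2 * (144 * π * Cd 4 ^ 2)) *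
          (lam ^ 2)⁻¹ * ∫ x, ‖f x‖ * dw J x) := by
  classical
  obtain ⟨L, Q', hQ', hsz, hcov, hdat, hpw⟩ := exists_greedy (κ := κ) (ν := ν) σ (fun P => ‖cf ph f P‖) lam Q
  refine ⟨Q', hQ', hsz, fun b Y hb hY h => ?_⟩
  have hcmp : ∀ e ∈ L, ∀ e' ∈ L, TreeCmp κ σ e e' := by
    have hp : L.Pairwise (TreeCmp κ σ) := hpw.imp fun h => Or.inr (Or.inl h)
    have : Std.Symm (TreeCmp κ σ) := ⟨fun _ _ h => h.symm⟩
    have h0 : ∀ e ∈ L, TreeCmp κ σ e e := fun _ _ => Or.inl rfl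
    exact fun e he e' he' => List.Pairwise.forall_of_forall h0 hp he he'
  have key := hW.forest_le hσ hQ hf hf1 hlam hJ hS (L := L.toFinset)
    (fun e he => hdat e (List.mem_toFinset.1 he))
    (fun e he e' he' => hcmp e (List.mem_toFinset.1 he) e' (List.mem_toFinset.1 he'))
  have hsub : Q \ Q' ⊆ L.toFinset.biUnion fun e => Q.filter fun P => dint P.1 ⊆ dint e.1.1 ∧ Full e.2.1 P := by
    intro P hP
    obtain ⟨h1, h2⟩ := Finset.mem_sdiff.1 hP
    obtain ⟨e, he, h3⟩ := hcov P h1 h2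
    exact Finset.mem_biUnion.2 ⟨e, List.mem_toFinset.2 he, Finset.mem_filter.2 ⟨h1, h3⟩⟩
  calc ∑ P ∈ Q \ Q', b P
      ≤ ∑ P ∈ L.toFinset.biUnion fun e => Q.filter fun P => dint P.1 ⊆ dint e.1.1 ∧ Full e.2.1 P, b P :=
        Finset.sum_le_sum_of_subset_of_nonneg hsub fun P _ _ => hb P
    _ ≤ ∑ e ∈ L.toFinset, ∑ P ∈ Q.filter fun P => dint P.1 ⊆ dint e.1.1 ∧ Full e.2.1 P, b P :=
        sum_biUnion_le_sum _ _ hb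
    _ ≤ ∑ e ∈ L.toFinset, Y * dlen e.1.1 := by
        refine Finset.sum_le_sum fun e he => ?_
        exact h e.1 (hdat e (List.mem_toFinset.1 he)).top_mem e.2.1 _ (Finset.filter_subset _ _)
          fun P hP => (Finset.mem_filter.1 hP).2
    _ ≤ _ := by
        rw [← Finset.mul_sum]
        gcongr
        have : 0 < lam ^ 2 := by positivity
        rw [mul_assoc, mul_comm (lam ^ 2)⁻¹, ← mul_assoc, ← div_eq_mul_inv, le_div_iff₀ this, mul_comm]
        exact key

end Selection

/-- The sum of `b` over the frequency-localised trees of `Q` is at most `Y` times the length of the top. -/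
def TreeSumLe (b : Tl → ℝ) (Q : Finset Tl) (Y : ℝ) : Prop :=
  ∀ P0 ∈ Q, ∀ ξ : ℝ, ∀ T ⊆ Q, (∀ P ∈ T, dint P.1 ⊆ dint P0.1 ∧ Full ξ P) → ∑ P ∈ T, b P ≤ Y * dlen P0.1

lemma TreeSumLe.mono {b : Tl → ℝ} {Q Q' : Finset Tl} {Y : ℝ} (h : TreeSumLe b Q Y) (hQ : Q' ⊆ Q) :
    TreeSumLe b Q' Y := fun P0 h0 ξ T hT hl => h P0 (hQ h0) ξ T (hT.trans hQ) hl

/-- The outcome of the selection algorithm, with total mass `M`. -/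
def Selectable (κ : ℝ) (ν : Tl → ℝ) (a : Tl → ℝ) (U : Finset Tl) (M : ℝ) : Prop :=
  ∀ σ : ℝ, |σ| = 1 → ∀ Q ⊆ U, ∀ lam : ℝ, 0 < lam → SizeLe κ ν σ a Q (2 * lam) →
    ∃ Q' ⊆ Q, SizeLe κ ν σ a Q' lam ∧ ∀ (b : Tl → ℝ) (Y : ℝ), (∀ P, 0 ≤ b P) → 0 ≤ Y →
      TreeSumLe b Q Y → ∑ P ∈ Q \ Q', b P ≤ Y * (M * (lam ^ 2)⁻¹)

/-- A sign. -/
def sg (b : Bool) : ℝ := if b then 1 else -1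

lemma abs_sg (b : Bool) : |sg b| = 1 := by cases b <;> simp [sg]

lemma sum_three_le {T : Finset Tl} {x y z : Tl → ℝ} {s u v L : ℝ} (hs : 0 ≤ s) (hu : 0 < u) (hv : 0 < v)
    (hx : ∀ P ∈ T, x P ≤ s) (hyp : ∀ P, 0 ≤ y P) (hzp : ∀ P, 0 ≤ z P)
    (hy : ∑ P ∈ T, dlen P.1 * y P ^ 2 ≤ u ^ 2 * L) (hz : ∑ P ∈ T, dlen P.1 * z P ^ 2 ≤ v ^ 2 * L) :
    ∑ P ∈ T, dlen P.1 * (x P * (y P * z P)) ≤ s * (u * v) * L := by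
  calc _ ≤ ∑ P ∈ T, (s * (v / u) / 2 * (dlen P.1 * y P ^ 2) + s * (u / v) / 2 * (dlen P.1 * z P ^ 2)) := by
        refine Finset.sum_le_sum fun P hP => ?_
        have l := dlen_pos P.1
        have e1 : y P * z P ≤ v / u / 2 * y P ^ 2 + u / v / 2 * z P ^ 2 := by
          have : v / u / 2 * y P ^ 2 + u / v / 2 * z P ^ 2 - y P * z P = (v * y P - u * z P) ^ 2 / (2 * u * v) := by
            field_simp; ring
          have : 0 ≤ (v * y P - u * z P) ^ 2 / (2 * u * v) := by positivity
          linarith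
        have e2 : x P * (y P * z P) ≤ s * (y P * z P) :=
          mul_le_mul_of_nonneg_right (hx P hP) (mul_nonneg (hyp P) (hzp P))
        calc _ ≤ dlen P.1 * (s * (v / u / 2 * y P ^ 2 + u / v / 2 * z P ^ 2)) := by
              exact mul_le_mul_of_nonneg_left (e2.trans (mul_le_mul_of_nonneg_left e1 hs)) l.le
          _ = _ := by ring
    _ = s * (v / u) / 2 * (∑ P ∈ T, dlen P.1 * y P ^ 2) + s * (u / v) / 2 * ∑ P ∈ T, dlen P.1 * z P ^ 2 := by
        rw [Finset.sum_add_distrib, Finset.mul_sum, Finset.mul_sum]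
    _ ≤ s * (v / u) / 2 * (u ^ 2 * L) + s * (u / v) / 2 * (v ^ 2 * L) := by gcongr
    _ = _ := by field_simp; ring

section Local
variable {κ : Fin 3 → ℝ} {ν : Fin 3 → Tl → ℝ} {a : Fin 3 → Tl → ℝ}

lemma treeSumLe_of_size (ha : ∀ j P, 0 ≤ a j P) {Q : Finset Tl} {s : Fin 3 → ℝ} (hs : ∀ j, 0 < s j)
    (hS : ∀ j b, SizeLe (κ j) (ν j) (sg b) (a j) Q (s j))
    (hsingle : ∀ j, ∀ P ∈ Q, a j P ≤ s j)
    (hlac : ∀ P ∈ Q, ∀ ξ, Full ξ P → ∃ i, ∀ j, j ≠ i → ∃ b, Lac (κ j) (ν j) (sg b) ξ P) :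
    TreeSumLe (fun P => dlen P.1 * (a 0 P * a 1 P * a 2 P)) Q (24 * (s 0 * s 1 * s 2)) := by
  classical
  intro P0 h0 ξ T hT hl
  set W : Fin 3 × (Fin 3 → Bool) → Finset Tl := fun p =>
    T.filter fun P => ∀ j, j ≠ p.1 → Lac (κ j) (ν j) (sg (p.2 j)) ξ P with hW
  have hsub : T ⊆ Finset.univ.biUnion W := by
    intro P hP
    obtain ⟨i, hi⟩ := hlac P (hT hP) ξ (hl P hP).2
    have : ∀ j, ∃ b, j ≠ i → Lac (κ j) (ν j) (sg b) ξ P := fun j => by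
      by_cases hj : j = i
      · exact ⟨true, fun h => (h hj).elim⟩
      · obtain ⟨b, hb⟩ := hi j hj
        exact ⟨b, fun _ => hb⟩
    choose b hb using this
    exact Finset.mem_biUnion.2 ⟨(i, b), Finset.mem_univ _, Finset.mem_filter.2 ⟨hP, hb⟩⟩
  have hb0 : ∀ P : Tl, 0 ≤ dlen P.1 * (a 0 P * a 1 P * a 2 P) := fun P => by
    have := dlen_pos P.1
    have := ha 0 P
    have := ha 1 P
    have := ha 2 P
    positivity
  have l0 := dlen_pos P0.1
  have hs0 := hs 0
  have hs1 := hs 1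
  have hs2 := hs 2
  have key : ∀ p, ∑ P ∈ W p, dlen P.1 * (a 0 P * a 1 P * a 2 P) ≤ (s 0 * s 1 * s 2) * dlen P0.1 := by
    rintro ⟨i, b⟩
    have hWT : W (i, b) ⊆ T := Finset.filter_subset _ _
    have hsz : ∀ j, j ≠ i → ∑ P ∈ W (i, b), dlen P.1 * a j P ^ 2 ≤ s j ^ 2 * dlen P0.1 := fun j hj =>
      hS j (b j) P0 h0 ξ _ (hWT.trans hT) fun P hP =>
        ⟨(hl P (hWT hP)).1, (Finset.mem_filter.1 hP).2 j hj⟩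
    have hx : ∀ j, ∀ P ∈ W (i, b), a j P ≤ s j := fun j P hP => hsingle j P (hT (hWT hP))
    fin_cases i
    · calc _ = ∑ P ∈ W (0, b), dlen P.1 * (a 0 P * (a 1 P * a 2 P)) :=
            Finset.sum_congr rfl fun P _ => by ring
        _ ≤ _ := sum_three_le (hs 0).le (hs 1) (hs 2) (hx 0) (ha 1) (ha 2) (hsz 1 (by decide)) (hsz 2 (by decide))
        _ = _ := by ring
    · calc _ = ∑ P ∈ W (1, b), dlen P.1 * (a 1 P * (a 0 P * a 2 P)) :=
            Finset.sum_congr rfl fun P _ => by ring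
        _ ≤ _ := sum_three_le (hs 1).le (hs 0) (hs 2) (hx 1) (ha 0) (ha 2) (hsz 0 (by decide)) (hsz 2 (by decide))
        _ = _ := by ring
    · calc _ = ∑ P ∈ W (2, b), dlen P.1 * (a 2 P * (a 0 P * a 1 P)) :=
            Finset.sum_congr rfl fun P _ => by ring
        _ ≤ _ := sum_three_le (hs 2).le (hs 0) (hs 1) (hx 2) (ha 0) (ha 1) (hsz 0 (by decide)) (hsz 1 (by decide))
        _ = _ := by ring
  calc _ ≤ ∑ P ∈ Finset.univ.biUnion W, dlen P.1 * (a 0 P * a 1 P * a 2 P) :=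
        Finset.sum_le_sum_of_subset_of_nonneg hsub fun P _ _ => hb0 P
    _ ≤ ∑ p, ∑ P ∈ W p, dlen P.1 * (a 0 P * a 1 P * a 2 P) := sum_biUnion_le_sum _ _ hb0
    _ ≤ ∑ p : Fin 3 × (Fin 3 → Bool), (s 0 * s 1 * s 2) * dlen P0.1 := Finset.sum_le_sum fun p _ => key p
    _ = _ := by
        rw [Finset.sum_const, Finset.card_univ]
        simp
        ring

lemma exists_one_level {U : Finset Tl} {M : Fin 3 → ℝ} (hsel : ∀ j, Selectable (κ j) (ν j) (a j) U (M j))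
    {b : Tl → ℝ} (hb : ∀ P, 0 ≤ b P) {Y m : ℝ} (hY : 0 ≤ Y) {lam : Fin 3 → ℝ} (hlam : ∀ j, 0 < lam j)
    (hm : ∀ j, M j * (lam j ^ 2)⁻¹ = m) {Q : Finset Tl} (hQ : Q ⊆ U)
    (hS : ∀ j e, SizeLe (κ j) (ν j) (sg e) (a j) Q (2 * lam j)) (hT : TreeSumLe b Q Y)
    (F : Finset (Fin 3 × Bool)) :
    ∃ Q' ⊆ Q, (∀ p ∈ F, SizeLe (κ p.1) (ν p.1) (sg p.2) (a p.1) Q' (lam p.1)) ∧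
      ∑ P ∈ Q, b P ≤ F.card * (Y * m) + ∑ P ∈ Q', b P := by
  classical
  induction F using Finset.induction_on with
  | empty => exact ⟨Q, Subset.rfl, by simp, by simp⟩
  | insert p F hp ih =>
    obtain ⟨Q1, hQ1, hz1, hs1⟩ := ih
    obtain ⟨Q2, hQ2, hz2, hs2⟩ := hsel p.1 (sg p.2) (abs_sg _) Q1 (hQ1.trans hQ) (lam p.1) (hlam _)
      ((hS p.1 p.2).mono hQ1)
    refine ⟨Q2, hQ2.trans hQ1, fun p' hp' => ?_, ?_⟩
    · rcases Finset.mem_insert.1 hp' with rfl | h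
      · exact hz2
      · exact (hz1 p' h).mono hQ2
    · have h1 := hs2 b Y hb hY (hT.mono hQ1)
      rw [hm] at h1
      have h2 := Finset.sum_sdiff hQ2 (f := b)
      rw [Finset.card_insert_of_notMem hp]
      push_cast
      linarith

lemma min_le_mul_rpow {u v α : ℝ} (hu : 0 < u) (hv : 0 < v) (h0 : 0 ≤ α) (h1 : α ≤ 1) :
    min u v ≤ u * (v / u) ^ α := by
  rcases le_total v u with h | h
  · refine (min_le_right _ _).trans ?_
    have hr : v / u ≤ 1 := (div_le_one hu).2 h
    calc v = u * (v / u) ^ (1 : ℝ) := by rw [rpow_one]; field_simp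
      _ ≤ _ := by
          gcongr u * ?_
          exact rpow_le_rpow_of_exponent_ge (by positivity) hr h1
  · refine (min_le_left _ _).trans ?_
    have hr : 1 ≤ v / u := (one_le_div hu).2 h
    calc u = u * 1 := (mul_one _).symm
      _ ≤ _ := by
          gcongr u * ?_
          exact one_le_rpow hr h0

lemma sq_mul_prod_min_le {θ S e : Fin 3 → ℝ} (hθ : ∀ j, 0 < θ j) (hsum : θ 0 + θ 1 + θ 2 = 1)
    (hS : ∀ j, 0 < S j) (he : ∀ j, 0 < e j) {x τ : ℝ} (hx : 0 < x) (hτ : 0 ≤ τ) (hτ1 : ∀ j, τ * θ j ≤ 1) :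
    x ^ 2 * (min (x⁻¹ * e 0) (S 0) * min (x⁻¹ * e 1) (S 1) * min (x⁻¹ * e 2) (S 2)) ≤
      e 0 * e 1 * e 2 * ((S 0 / e 0) ^ θ 0 * (S 1 / e 1) ^ θ 1 * (S 2 / e 2) ^ θ 2) *
        (x * ((S 0 / e 0) ^ θ 0 * (S 1 / e 1) ^ θ 1 * (S 2 / e 2) ^ θ 2)) ^ (τ - 1) := by
  have h : ∀ j, min (x⁻¹ * e j) (S j) ≤ x⁻¹ * e j * (x ^ θ j * (S j / e j) ^ θ j) ^ τ := by
    intro j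
    have hej := he j
    have hSj := hS j
    have := min_le_mul_rpow (u := x⁻¹ * e j) (v := S j) (by positivity) (hS j)
      (mul_nonneg hτ (hθ j).le) (hτ1 j)
    rwa [show S j / (x⁻¹ * e j) = x * (S j / e j) by field_simp, mul_comm τ, rpow_mul (by positivity),
      mul_rpow hx.le (by positivity)] at this
  have hp : ∀ j, 0 < (S j / e j) ^ θ j := fun j => rpow_pos_of_pos (div_pos (hS j) (he j)) _
  have hx' : ∀ j, 0 < x ^ θ j := fun j => rpow_pos_of_pos hx _
  have hm : ∀ j, 0 ≤ min (x⁻¹ * e j) (S j) := fun j => le_min (by have := he j; positivity) (hS j).le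
  have hxx : x = x ^ θ 0 * x ^ θ 1 * x ^ θ 2 := by
    rw [← rpow_add hx, ← rpow_add hx, hsum, rpow_one]
  have p0 := hp 0
  have p1 := hp 1
  have p2 := hp 2
  have q0 := hx' 0
  have q1 := hx' 1
  have q2 := hx' 2
  have e0 := he 0
  have e1 := he 1
  have e2 := he 2
  set r0 := (S 0 / e 0) ^ θ 0
  set r1 := (S 1 / e 1) ^ θ 1
  set r2 := (S 2 / e 2) ^ θ 2
  rw [rpow_sub (by positivity), rpow_one]
  calc _ ≤ x ^ 2 * ((x⁻¹ * e 0 * (x ^ θ 0 * r0) ^ τ) * (x⁻¹ * e 1 * (x ^ θ 1 * r1) ^ τ) *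
        (x⁻¹ * e 2 * (x ^ θ 2 * r2) ^ τ)) := by
        gcongr
        · exact hm 2
        · exact hm 1
        · exact h 0
        · exact h 1
        · exact h 2
    _ = x⁻¹ * (e 0 * e 1 * e 2) * ((x ^ θ 0 * r0) ^ τ * (x ^ θ 1 * r1) ^ τ * (x ^ θ 2 * r2) ^ τ) := by
        field_simp
    _ = x⁻¹ * (e 0 * e 1 * e 2) * (x * (r0 * r1 * r2)) ^ τ := by
        rw [← mul_rpow (by positivity) (by positivity), ← mul_rpow (by positivity) (by positivity)]
        congr 2
        nth_rewrite 4 [hxx]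
        ring
    _ = _ := by field_simp

end Local

section Local
variable {κ : Fin 3 → ℝ} {ν : Fin 3 → Tl → ℝ} {a : Fin 3 → Tl → ℝ}

/-- Hypotheses of the local estimate: sizes at most `S j`, masses at most `e j ^ 2`. -/
structure LocalData (κ : Fin 3 → ℝ) (ν a : Fin 3 → Tl → ℝ) (U : Finset Tl) (S e : Fin 3 → ℝ) : Prop where
  nonneg : ∀ j P, 0 ≤ a j P
  S_pos : ∀ j, 0 < S j
  e_pos : ∀ j, 0 < e j
  single : ∀ j, ∀ s, 0 ≤ s → ∀ Q ⊆ U, SizeLe (κ j) (ν j) 1 (a j) Q s → ∀ P ∈ Q, a j P ≤ s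
  sel : ∀ j, Selectable (κ j) (ν j) (a j) U (e j ^ 2)
  size : ∀ j b, SizeLe (κ j) (ν j) (sg b) (a j) U (S j)
  lac : ∀ P ∈ U, ∀ ξ, Full ξ P → ∃ i, ∀ j, j ≠ i → ∃ b, Lac (κ j) (ν j) (sg b) ξ P

lemma LocalData.next {U : Finset Tl} {S e : Fin 3 → ℝ} (h : LocalData κ ν a U S e) {x : ℝ} (hx : 0 < x)
    {Q : Finset Tl} (hQ : Q ⊆ U) (hS : ∀ j b, SizeLe (κ j) (ν j) (sg b) (a j) Q (x⁻¹ * e j)) :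
    ∃ Q' ⊆ Q, (∀ j b, SizeLe (κ j) (ν j) (sg b) (a j) Q' ((x * 2)⁻¹ * e j)) ∧
      ∑ P ∈ Q, dlen P.1 * (a 0 P * a 1 P * a 2 P) ≤
        576 * (x ^ 2 * (min (x⁻¹ * e 0) (S 0) * min (x⁻¹ * e 1) (S 1) * min (x⁻¹ * e 2) (S 2))) +
        ∑ P ∈ Q', dlen P.1 * (a 0 P * a 1 P * a 2 P) := by
  set s : Fin 3 → ℝ := fun j => min (x⁻¹ * e j) (S j) with hs
  have hsp : ∀ j, 0 < s j := fun j => lt_min (by have := h.e_pos j; positivity) (h.S_pos j)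
  have hz : ∀ j b, SizeLe (κ j) (ν j) (sg b) (a j) Q (s j) := by
    intro j b
    rcases min_choice (x⁻¹ * e j) (S j) with h1 | h1
    · simp only [hs]; rw [h1]; exact hS j b
    · simp only [hs]; rw [h1]; exact (h.size j b).mono hQ
  have hT := treeSumLe_of_size h.nonneg hsp hz
    (fun j => h.single j (s j) (hsp j).le Q hQ (hz j true)) (fun P hP => h.lac P (hQ hP))
  have hb0 : ∀ P : Tl, 0 ≤ dlen P.1 * (a 0 P * a 1 P * a 2 P) := fun P => by
    have := dlen_pos P.1
    have := h.nonneg 0 P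
    have := h.nonneg 1 P
    have := h.nonneg 2 P
    positivity
  obtain ⟨Q', hQ', hz', hs'⟩ := exists_one_level h.sel hb0
    (Y := 24 * (s 0 * s 1 * s 2)) (m := 4 * x ^ 2) (lam := fun j => (x * 2)⁻¹ * e j)
    (by have := hsp 0; have := hsp 1; have := hsp 2; positivity)
    (fun j => by have := h.e_pos j; positivity)
    (fun j => by have := h.e_pos j; field_simp; norm_num) hQ
    (fun j b => by
      have : 2 * ((x * 2)⁻¹ * e j) = x⁻¹ * e j := by field_simp
      rw [this]; exact hS j b) hT Finset.univ
  refine ⟨Q', hQ', fun j b => hz' (j, b) (Finset.mem_univ _), hs'.trans (le_of_eq ?_)⟩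
  rw [Finset.card_univ]
  simp only [Fintype.card_prod, Fintype.card_fin, Fintype.card_bool]
  push_cast
  ring

lemma LocalData.iterate {U : Finset Tl} {S e : Fin 3 → ℝ} (h : LocalData κ ν a U S e) (n0 : ℤ)
    (hn : ∀ j, S j ≤ ((2 : ℝ) ^ n0)⁻¹ * e j) (N : ℕ) :
    ∃ Q ⊆ U, (∀ j b, SizeLe (κ j) (ν j) (sg b) (a j) Q (((2 : ℝ) ^ (n0 + N))⁻¹ * e j)) ∧
      ∑ P ∈ U, dlen P.1 * (a 0 P * a 1 P * a 2 P) ≤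
        576 * (∑ n ∈ Finset.Ico n0 (n0 + N), ((2 : ℝ) ^ n) ^ 2 * (min (((2 : ℝ) ^ n)⁻¹ * e 0) (S 0) *
          min (((2 : ℝ) ^ n)⁻¹ * e 1) (S 1) * min (((2 : ℝ) ^ n)⁻¹ * e 2) (S 2))) +
        ∑ P ∈ Q, dlen P.1 * (a 0 P * a 1 P * a 2 P) := by
  induction N with
  | zero =>
    refine ⟨U, Subset.rfl, fun j b P0 h0 ξ T hT hl => ?_, by simp⟩
    refine (h.size j b P0 h0 ξ T hT hl).trans ?_
    have := dlen_pos P0.1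
    have := (h.S_pos j).le
    have := hn j
    rw [Nat.cast_zero, add_zero]
    gcongr
  | succ N ih =>
    obtain ⟨Q, hQ, hz, hs⟩ := ih
    obtain ⟨Q', hQ', hz', hs'⟩ := h.next (x := (2 : ℝ) ^ (n0 + N)) (by positivity) hQ hz
    have e1 : (2 : ℝ) ^ (n0 + (N + 1 : ℕ)) = (2 : ℝ) ^ (n0 + N) * 2 := by
      rw [← zpow_add_one₀ two_ne_zero]; push_cast; ring_nf
    refine ⟨Q', hQ'.trans hQ, by rw [e1]; exact hz', ?_⟩
    have e2 : Finset.Ico n0 (n0 + (N + 1 : ℕ)) = insert (n0 + N) (Finset.Ico n0 (n0 + N)) := by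
      ext k; simp only [Finset.mem_Ico, Finset.mem_insert]; push_cast; omega
    rw [e2, Finset.sum_insert (by simp), mul_add]
    linarith

end Local

/-- The local estimate for the trilinear model form. -/
theorem exists_local_form_le {θ : Fin 3 → ℝ} (hθ : ∀ j, 0 < θ j) (hsum : θ 0 + θ 1 + θ 2 = 1) :
    ∃ C : ℝ, 0 < C ∧ ∀ (κ : Fin 3 → ℝ) (ν a : Fin 3 → Tl → ℝ) (U : Finset Tl) (S e : Fin 3 → ℝ),
      LocalData κ ν a U S e → ∑ P ∈ U, dlen P.1 * (a 0 P * a 1 P * a 2 P) ≤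
        C * (e 0 * e 1 * e 2 * ((S 0 / e 0) ^ θ 0 * (S 1 / e 1) ^ θ 1 * (S 2 / e 2) ^ θ 2)) := by
  have hθ1 : ∀ j, θ j < 1 := by
    have h0 := hθ 0
    have h1 := hθ 1
    have h2 := hθ 2
    intro j; fin_cases j <;> simp <;> linarith
  obtain ⟨δ, hδ, hδ1, hδθ⟩ : ∃ δ : ℝ, 0 < δ ∧ δ ≤ 1 ∧ ∀ j, (1 + δ) * θ j ≤ 1 := by
    have : ∀ j, ∃ d : ℝ, 0 < d ∧ ∀ δ, δ ≤ d → (1 + δ) * θ j ≤ 1 := fun j => by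
      have h0 := hθ j
      have h1 := hθ1 j
      refine ⟨(1 - θ j) / θ j, div_pos (by linarith) h0, fun δ hd => ?_⟩
      rw [le_div_iff₀ h0] at hd
      linarith
    choose d hd hd' using this
    refine ⟨min 1 (min (d 0) (min (d 1) (d 2))), ?_, min_le_left _ _, fun j => hd' j _ ?_⟩
    · exact lt_min one_pos (lt_min (hd 0) (lt_min (hd 1) (hd 2)))
    · fin_cases j <;> simp
  obtain ⟨C, hC, hgeo⟩ := exists_sum_min_rpow_le hδ
  refine ⟨576 * C + 1, by positivity, fun κ ν a U S e h => ?_⟩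
  set ρ := (S 0 / e 0) ^ θ 0 * (S 1 / e 1) ^ θ 1 * (S 2 / e 2) ^ θ 2 with hρ
  have hρ0 : 0 < ρ := by
    have := fun j => rpow_pos_of_pos (div_pos (h.S_pos j) (h.e_pos j)) (θ j)
    exact mul_pos (mul_pos (this 0) (this 1)) (this 2)
  have hE : 0 < e 0 * e 1 * e 2 := mul_pos (mul_pos (h.e_pos 0) (h.e_pos 1)) (h.e_pos 2)
  obtain ⟨n0, hn0⟩ : ∃ n0 : ℤ, ∀ j, S j ≤ ((2 : ℝ) ^ n0)⁻¹ * e j := by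
    obtain ⟨n, hn⟩ := pow_unbounded_of_one_lt (S 0 / e 0 + S 1 / e 1 + S 2 / e 2) one_lt_two
    have p := fun j => div_pos (h.S_pos j) (h.e_pos j)
    have p0 := p 0
    have p1 := p 1
    have p2 := p 2
    refine ⟨-n, fun j => ?_⟩
    rw [zpow_neg, inv_inv, zpow_natCast, ← div_le_iff₀ (h.e_pos j)]
    fin_cases j <;> simp <;> linarith
  set K := ∑ P ∈ U, dlen P.1 with hK
  have hK0 : 0 ≤ K := Finset.sum_nonneg fun P _ => (dlen_pos _).le
  obtain ⟨N, hN⟩ : ∃ N : ℕ, K * ((2 : ℝ) ^ (n0 + N))⁻¹ ≤ ρ ∧ 1 ≤ (2 : ℝ) ^ (n0 + N) := by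
    obtain ⟨n, hn⟩ := pow_unbounded_of_one_lt (K / ρ / 2 ^ n0 + 1 / 2 ^ n0) (one_lt_two (α := ℝ))
    have p : (0 : ℝ) < 2 ^ n0 := by positivity
    have q : 0 ≤ K / ρ / 2 ^ n0 := by positivity
    have q' : (0 : ℝ) ≤ 1 / 2 ^ n0 := by positivity
    refine ⟨n, ?_, ?_⟩
    · rw [zpow_add₀ two_ne_zero, zpow_natCast, ← div_eq_mul_inv, div_le_iff₀ (by positivity)]
      have : K / ρ / 2 ^ n0 ≤ 2 ^ n := by linarith
      rw [div_le_iff₀ p, div_le_iff₀ hρ0] at this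
      linarith
    · rw [zpow_add₀ two_ne_zero, zpow_natCast]
      have : 1 / (2 : ℝ) ^ n0 ≤ 2 ^ n := by linarith
      rw [div_le_iff₀ p] at this
      linarith
  obtain ⟨Q, hQ, hz, hs⟩ := h.iterate n0 hn0 N
  have h1 : ∀ n : ℤ, ((2 : ℝ) ^ n) ^ 2 * (min (((2 : ℝ) ^ n)⁻¹ * e 0) (S 0) *
          min (((2 : ℝ) ^ n)⁻¹ * e 1) (S 1) * min (((2 : ℝ) ^ n)⁻¹ * e 2) (S 2)) ≤
      e 0 * e 1 * e 2 * ρ * min (((2 : ℝ) ^ n * ρ) ^ δ) (((2 : ℝ) ^ n * ρ) ^ (-δ)) := by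
    intro n
    rw [mul_min_of_nonneg _ _ (show 0 ≤ e 0 * e 1 * e 2 * ρ by positivity)]
    refine le_min ?_ ?_
    · have := sq_mul_prod_min_le hθ hsum h.S_pos h.e_pos (x := (2 : ℝ) ^ n) (τ := 1 + δ)
        (by positivity) (by positivity) hδθ
      rwa [add_sub_cancel_left] at this
    · have := sq_mul_prod_min_le hθ hsum h.S_pos h.e_pos (x := (2 : ℝ) ^ n) (τ := 1 - δ)
        (by positivity) (by linarith) (fun j => by
          have := hδθ j
          have := hθ j
          nlinarith)
      rwa [show 1 - δ - 1 = -δ by ring] at this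
  have h2 : ∑ P ∈ Q, dlen P.1 * (a 0 P * a 1 P * a 2 P) ≤ e 0 * e 1 * e 2 * ρ := by
    set y := ((2 : ℝ) ^ (n0 + N))⁻¹ with hy
    have hy0 : 0 < y := by positivity
    have hy1 : y ≤ 1 := inv_le_one_of_one_le₀ hN.2
    have ha : ∀ j, ∀ P ∈ Q, a j P ≤ y * e j := fun j =>
      h.single j _ (by have := h.e_pos j; positivity) Q hQ (hz j true)
    calc _ ≤ ∑ P ∈ Q, dlen P.1 * (e 0 * e 1 * e 2 * y) := by
          refine Finset.sum_le_sum fun P hP => ?_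
          have l := dlen_pos P.1
          have a0 := h.nonneg 0 P
          have a1 := h.nonneg 1 P
          have a2 := h.nonneg 2 P
          have b0 := ha 0 P hP
          have b1 := ha 1 P hP
          have b2 := ha 2 P hP
          have e0 := h.e_pos 0
          have e1 := h.e_pos 1
          have e2 := h.e_pos 2
          calc _ ≤ dlen P.1 * ((y * e 0) * (y * e 1) * (y * e 2)) := by gcongr
            _ = dlen P.1 * (e 0 * e 1 * e 2 * (y * (y * y))) := by ring
            _ ≤ dlen P.1 * (e 0 * e 1 * e 2 * (y * (1 * 1))) := by gcongr
            _ = _ := by ring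
      _ = (∑ P ∈ Q, dlen P.1) * (e 0 * e 1 * e 2 * y) := by rw [Finset.sum_mul]
      _ ≤ K * (e 0 * e 1 * e 2 * y) := by
          gcongr
          exact Finset.sum_le_sum_of_subset_of_nonneg hQ fun P _ _ => (dlen_pos _).le
      _ = e 0 * e 1 * e 2 * (K * y) := by ring
      _ ≤ _ := by gcongr; exact hN.1
  have h3 : ∑ n ∈ Finset.Ico n0 (n0 + N), ((2 : ℝ) ^ n) ^ 2 * (min (((2 : ℝ) ^ n)⁻¹ * e 0) (S 0) *
          min (((2 : ℝ) ^ n)⁻¹ * e 1) (S 1) * min (((2 : ℝ) ^ n)⁻¹ * e 2) (S 2)) ≤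
      e 0 * e 1 * e 2 * ρ * C := by
    refine (Finset.sum_le_sum fun n _ => h1 n).trans ?_
    rw [← Finset.mul_sum]
    gcongr
    exact hgeo ρ hρ0 _
  linarith

/-- The points lying in a dyadic interval on which the weighted average of `g` exceeds `c`. -/
def dsup (g : ℝ → ℝ≥0∞) (c : ℝ≥0∞) : Set ℝ :=
  {x | ∃ I : ℤ × ℤ, x ∈ dint I ∧ c * ENNReal.ofReal (dlen I) < ∫⁻ y, g y * ENNReal.ofReal (dw I y)}

lemma dw_le_tsum_indicator (I : ℤ × ℤ) (x : ℝ) : ENNReal.ofReal (dw I x) ≤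
    ∑' n : ℕ, (Metric.closedBall (dcen I) (2 ^ n * dlen I)).indicator
      (fun _ => ENNReal.ofReal (4 * (1 / 4) ^ n)) x := by
  have hl := dlen_pos I
  have hex : ∃ n : ℕ, |x - dcen I| ≤ 2 ^ n * dlen I := by
    obtain ⟨n, hn⟩ := pow_unbounded_of_one_lt (|x - dcen I| / dlen I) one_lt_two
    exact ⟨n, by rw [div_lt_iff₀ hl] at hn; exact hn.le⟩
  classical
  set n := Nat.find hex with hn
  have h1 : |x - dcen I| ≤ 2 ^ n * dlen I := Nat.find_spec hex
  have h2 : dw I x ≤ 4 * (1 / 4) ^ n := by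
    rcases Nat.eq_zero_or_pos n with h0 | h0
    · rw [h0]; have := dw_le_one I x; norm_num; linarith
    · have h3 : ¬ |x - dcen I| ≤ 2 ^ (n - 1) * dlen I := Nat.find_min hex (by omega)
      push Not at h3
      obtain ⟨m, hm⟩ : ∃ m, n = m + 1 := ⟨n - 1, by omega⟩
      rw [hm, Nat.add_sub_cancel] at h3
      rw [hm]
      unfold dw wt
      rw [inv_eq_one_div, div_le_iff₀ (by positivity)]
      have h4 : (2 : ℝ) ^ m ≤ |(x - dcen I) / dlen I| := by
        rw [abs_div, abs_of_pos hl, le_div_iff₀ hl]; exact h3.le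
      have h5 : (4 : ℝ) ^ m ≤ ((x - dcen I) / dlen I) ^ 2 := by
        rw [← sq_abs, show (4 : ℝ) = 2 ^ 2 by norm_num, ← pow_mul, mul_comm, pow_mul]
        gcongr
      have h6 : (1 / 4 : ℝ) ^ m * 4 ^ m = 1 := by rw [← mul_pow]; norm_num
      have h7 : (0 : ℝ) < (1 / 4) ^ m := by positivity
      rw [pow_succ]
      nlinarith [mul_le_mul_of_nonneg_left h5 h7.le]
  refine (ENNReal.ofReal_le_ofReal h2).trans (le_trans (le_of_eq ?_) (ENNReal.le_tsum n))
  rw [indicator_of_mem]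
  rw [Metric.mem_closedBall, Real.dist_eq]; exact h1

lemma exists_ball_of_lt {g : ℝ → ℝ≥0∞} (hg : AEMeasurable g) {c : ℝ≥0∞} {I : ℤ × ℤ}
    (h : 8 * c * ENNReal.ofReal (dlen I) < ∫⁻ y, g y * ENNReal.ofReal (dw I y)) :
    ∃ r, dlen I ≤ r ∧ c * ENNReal.ofReal r ≤ ∫⁻ y in Metric.closedBall (dcen I) r, g y := by
  have hl := dlen_pos I
  by_contra! hcon
  refine absurd h (not_lt.2 ?_)
  calc ∫⁻ y, g y * ENNReal.ofReal (dw I y)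
      ≤ ∫⁻ y, ∑' n : ℕ, ENNReal.ofReal (4 * (1 / 4) ^ n) *
          (Metric.closedBall (dcen I) (2 ^ n * dlen I)).indicator g y := by
        refine lintegral_mono fun y => ?_
        refine (mul_le_mul_right (dw_le_tsum_indicator I y) _).trans (le_of_eq ?_)
        rw [← ENNReal.tsum_mul_left]
        refine tsum_congr fun n => ?_
        simp only [indicator]
        split_ifs
        · rw [mul_comm]
        · simp
    _ = ∑' n : ℕ, ENNReal.ofReal (4 * (1 / 4) ^ n) *
          ∫⁻ y in Metric.closedBall (dcen I) (2 ^ n * dlen I), g y := by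
        rw [lintegral_tsum fun n => (hg.indicator Metric.isClosed_closedBall.measurableSet).const_mul _]
        refine tsum_congr fun n => ?_
        rw [lintegral_const_mul'' _ (hg.indicator Metric.isClosed_closedBall.measurableSet),
          lintegral_indicator Metric.isClosed_closedBall.measurableSet]
    _ ≤ ∑' n : ℕ, 4 * c * ENNReal.ofReal (dlen I) * (2⁻¹ : ℝ≥0∞) ^ n := by
        refine ENNReal.tsum_le_tsum fun n => ?_
        have h1 : dlen I ≤ 2 ^ n * dlen I := le_mul_of_one_le_left hl.le (one_le_pow₀ one_le_two)
        refine (mul_le_mul_right (hcon _ h1).le _).trans (le_of_eq ?_)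
        have e : (2⁻¹ : ℝ≥0∞) = ENNReal.ofReal (1 / 2) := by
          rw [one_div, ENNReal.ofReal_inv_of_pos two_pos]; simp
        have e4 : (4 : ℝ≥0∞) = ENNReal.ofReal 4 := by simp
        rw [e, e4, ← ENNReal.ofReal_pow (by norm_num)]
        rw [show ENNReal.ofReal (4 * (1 / 4) ^ n) * (c * ENNReal.ofReal (2 ^ n * dlen I)) =
          c * (ENNReal.ofReal (4 * (1 / 4) ^ n) * ENNReal.ofReal (2 ^ n * dlen I)) by ring,
          show ENNReal.ofReal 4 * c * ENNReal.ofReal (dlen I) * ENNReal.ofReal ((1 / 2) ^ n) =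
          c * (ENNReal.ofReal 4 * ENNReal.ofReal (dlen I) * ENNReal.ofReal ((1 / 2) ^ n)) by ring,
          ← ENNReal.ofReal_mul (by positivity), ← ENNReal.ofReal_mul (by positivity),
          ← ENNReal.ofReal_mul (by positivity)]
        congr 2
        have : (1 / 4 : ℝ) ^ n * 2 ^ n = (1 / 2) ^ n := by rw [← mul_pow]; norm_num
        rw [← this]; ring
    _ = 8 * c * ENNReal.ofReal (dlen I) := by
        rw [ENNReal.tsum_mul_left, ENNReal.tsum_geometric, ENNReal.one_sub_inv_two, inv_inv]
        ring

/-- The weak-type estimate for the dyadic weighted maximal function. -/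
lemma volume_dsup_le {g : ℝ → ℝ≥0∞} (hg : AEMeasurable g) {c : ℝ≥0∞} (hc : c ≠ 0) (hc' : c ≠ ∞)
    (hfin : ∫⁻ y, g y ≠ ∞) : c * volume (dsup g (8 * c)) ≤ 10 * ∫⁻ y, g y := by
  classical
  set t : Set (ℤ × ℤ) :=
    {I | 8 * c * ENNReal.ofReal (dlen I) < ∫⁻ y, g y * ENNReal.ofReal (dw I y)} with ht
  have hex : ∀ I : ℤ × ℤ, ∃ r, I ∈ t → dlen I ≤ r ∧
      c * ENNReal.ofReal r ≤ ∫⁻ y in Metric.closedBall (dcen I) r, g y := by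
    intro I
    by_cases h : I ∈ t
    · obtain ⟨r, hr⟩ := exists_ball_of_lt hg h
      exact ⟨r, fun _ => hr⟩
    · exact ⟨0, fun h' => absurd h' h⟩
  choose r hr using hex
  have hbd : ∀ I ∈ t, r I ≤ ((∫⁻ y, g y) / c).toReal := by
    intro I hI
    have h1 := (hr I hI).2.trans (setLIntegral_le_lintegral _ _)
    rw [mul_comm, ← ENNReal.le_div_iff_mul_le (Or.inl hc) (Or.inl hc')] at h1
    exact (ENNReal.ofReal_le_iff_le_toReal (ENNReal.div_ne_top hfin hc)).1 h1
  obtain ⟨u, hut, hdis, hcov⟩ :=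
    Vitali.exists_disjoint_subfamily_covering_enlargement_closedBall t dcen r _ hbd 5 (by norm_num)
  have hsub : dsup g (8 * c) ⊆ ⋃ I ∈ u, Metric.closedBall (dcen I) (5 * r I) := by
    rintro x ⟨I, hx, hI⟩
    obtain ⟨b, hb, hsub⟩ := hcov I hI
    refine mem_iUnion₂.2 ⟨b, hb, hsub ?_⟩
    rw [Metric.mem_closedBall, Real.dist_eq]
    have := abs_sub_dcen hx
    have := (hr I hI).1
    have := dlen_pos I
    linarith
  calc c * volume (dsup g (8 * c)) ≤ c * ∑' I : u, volume (Metric.closedBall (dcen I) (5 * r I)) := by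
        refine mul_le_mul_right ((measure_mono hsub).trans ?_) _
        exact measure_biUnion_le _ (to_countable u) _
    _ = ∑' I : u, 10 * (c * ENNReal.ofReal (r I)) := by
        rw [← ENNReal.tsum_mul_left]
        refine tsum_congr fun I => ?_
        rw [Real.volume_closedBall, show 2 * (5 * r I) = 10 * r I by ring, ENNReal.ofReal_mul (by norm_num)]
        simp only [ENNReal.ofReal_ofNat]
        ring
    _ ≤ ∑' I : u, 10 * ∫⁻ y in Metric.closedBall (dcen I) (r I), g y :=
        ENNReal.tsum_le_tsum fun I => mul_le_mul_right (hr I (hut I.2)).2 _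
    _ = 10 * ∫⁻ y in ⋃ I ∈ u, Metric.closedBall (dcen I) (r I), g y := by
        rw [ENNReal.tsum_mul_left, lintegral_biUnion (to_countable u)
          (fun I _ => Metric.isClosed_closedBall.measurableSet) hdis]
    _ ≤ 10 * ∫⁻ y, g y := mul_le_mul_right (setLIntegral_le_lintegral _ _) _

section Covering
variable {V : Type*} [NormedAddCommGroup V]

lemma lintegral_mul_dw {f : ℝ → V} (hf : Integrable f) (I : ℤ × ℤ) :
    ∫⁻ y, ‖f y‖ₑ * ENNReal.ofReal (dw I y) = ENNReal.ofReal (∫ y, ‖f y‖ * dw I y) := by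
  rw [ofReal_integral_eq_lintegral_ofReal (integrable_mul_dw hf I)
    (ae_of_all _ fun y => mul_nonneg (norm_nonneg _) (dw_pos I y).le)]
  refine lintegral_congr fun y => ?_
  rw [ENNReal.ofReal_mul (norm_nonneg _), ofReal_norm]

/-- The total length of disjoint dyadic intervals contained in intervals of high density. -/
lemma sum_dlen_le_of_density {f : ℝ → V} (hf : Integrable f) {c : ℝ} (hc : 0 < c) (F : Finset (ℤ × ℤ))
    (hd : ∀ I ∈ F, ∀ J ∈ F, I ≠ J → Disjoint (dint I) (dint J))
    (h : ∀ J ∈ F, ∃ I, dint J ⊆ dint I ∧ c * dlen I < ∫ y, ‖f y‖ * dw I y) :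
    ∑ J ∈ F, dlen J ≤ 80 * c⁻¹ * ∫ y, ‖f y‖ := by
  have hsub : (⋃ J ∈ F, dint J) ⊆ dsup (fun y => ‖f y‖ₑ) (8 * ENNReal.ofReal (c / 8)) := by
    intro x hx
    obtain ⟨J, hJ, hxJ⟩ := mem_iUnion₂.1 hx
    obtain ⟨I, hI, hlt⟩ := h J hJ
    refine ⟨I, hI hxJ, ?_⟩
    have e8 : (8 : ℝ≥0∞) = ENNReal.ofReal 8 := by simp
    rw [lintegral_mul_dw hf, e8, ← ENNReal.ofReal_mul (by norm_num), ← ENNReal.ofReal_mul (by positivity)]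
    have := dlen_pos I
    refine (ENNReal.ofReal_lt_ofReal_iff (lt_of_le_of_lt (by positivity) hlt)).2 ?_
    linarith
  have hint : ∫⁻ y, ‖f y‖ₑ = ENNReal.ofReal (∫ y, ‖f y‖) := by
    rw [ofReal_integral_eq_lintegral_ofReal hf.norm (ae_of_all _ fun y => norm_nonneg _)]
    exact lintegral_congr fun y => by rw [ofReal_norm]
  have hv := volume_dsup_le (g := fun y => ‖f y‖ₑ) hf.aestronglyMeasurable.enorm
    (c := ENNReal.ofReal (c / 8)) (by simpa using hc) ENNReal.ofReal_ne_top
    (by rw [hint]; exact ENNReal.ofReal_ne_top)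
  have hvol : ENNReal.ofReal (∑ J ∈ F, dlen J) = volume (⋃ J ∈ F, dint J) := by
    rw [measure_biUnion_finset (fun I hI J hJ hne => hd I hI J hJ hne) (fun I _ => measurableSet_dint I),
      ENNReal.ofReal_sum_of_nonneg fun I _ => (dlen_pos I).le]
    exact Finset.sum_congr rfl fun I _ => (volume_dint I).symm
  have h1 : ENNReal.ofReal (c / 8) * ENNReal.ofReal (∑ J ∈ F, dlen J) ≤ 10 * ENNReal.ofReal (∫ y, ‖f y‖) := by
    rw [hvol, ← hint]
    exact (mul_le_mul_right (measure_mono hsub) _).trans hv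
  have e10 : (10 : ℝ≥0∞) = ENNReal.ofReal 10 := by simp
  have hn : 0 ≤ ∫ y, ‖f y‖ := integral_nonneg fun y => norm_nonneg _
  rw [e10, ← ENNReal.ofReal_mul (by positivity), ← ENNReal.ofReal_mul (by norm_num),
    ENNReal.ofReal_le_ofReal_iff (by positivity)] at h1
  rw [mul_assoc, mul_comm c⁻¹, ← mul_assoc, ← div_eq_mul_inv, le_div_iff₀ hc]
  linarith

end Covering

lemma sum_dlen_tree_le {T : Finset Tl} (hs : Sparse T) {ξ : ℝ} (hf : ∀ P ∈ T, Full ξ P) {I0 : ℤ × ℤ}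
    (hI : ∀ P ∈ T, dint P.1 ⊆ dint I0) :
    ∑ P ∈ T, dlen P.1 * (dlen P.1 / dlen I0) ≤ 2 * dlen I0 := by
  classical
  have l0 := dlen_pos I0
  rw [← Finset.sum_fiberwise_of_maps_to (g := fun P : Tl => P.1.1) (t := T.image fun P => P.1.1)
    (fun P hP => Finset.mem_image_of_mem _ hP)]
  have h1 : ∀ k ∈ T.image (fun P : Tl => P.1.1),
      ∑ P ∈ T with P.1.1 = k, dlen P.1 * (dlen P.1 / dlen I0) ≤ (2 : ℝ) ^ k := by
    intro k _
    have e : ∀ P ∈ T.filter (fun P => P.1.1 = k), dlen P.1 * (dlen P.1 / dlen I0) =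
        (2 : ℝ) ^ k / dlen I0 * ∫ _y in dint P.1, Set.indicator (dint I0) (fun _ => (1 : ℝ)) _y := by
      intro P hP
      have hP' := Finset.mem_filter.1 hP
      rw [setIntegral_congr_fun (g := fun _ => (1 : ℝ)) (measurableSet_dint P.1)
        (fun y hy => indicator_of_mem (hI P hP'.1 hy) _)]
      rw [setIntegral_const, volume_real_dint, smul_eq_mul, mul_one]
      have : dlen P.1 = 2 ^ k := by unfold dlen; rw [hP'.2]
      rw [this]; ring
    rw [Finset.sum_congr rfl e, ← Finset.mul_sum]
    have h2 := sum_setIntegral_le (T.filter fun P => P.1.1 = k) (fun P => P.1)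
      ((dint I0).indicator fun _ => (1 : ℝ))
      ((integrable_indicator_iff (measurableSet_dint I0)).2 (by simp [volume_dint]))
      (fun x => indicator_nonneg (fun _ _ => zero_le_one) _) (dint I0) (measurableSet_dint I0)
      (fun P hP => hI P (Finset.mem_filter.1 hP).1) (fun P hP P' hP' hne => by
        have hP := Finset.mem_filter.1 hP
        have hP' := Finset.mem_filter.1 hP'
        have hk := hP.2.trans hP'.2.symm
        refine disjoint_of_same_scale hk fun h => hne ?_
        exact Prod.ext h (full_scale_unique hs hP.1 hP'.1 (hf P hP.1) (hf P' hP'.1) hk))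
    rw [setIntegral_congr_fun (g := fun _ => (1 : ℝ)) (measurableSet_dint I0)
        (fun y hy => indicator_of_mem hy _), setIntegral_const, volume_real_dint, smul_eq_mul, mul_one] at h2
    calc _ ≤ (2 : ℝ) ^ k / dlen I0 * dlen I0 := by gcongr
      _ = _ := by field_simp
  refine (Finset.sum_le_sum h1).trans (sum_two_zpow_le _ I0.1 fun k hk => ?_)
  obtain ⟨P, hP, rfl⟩ := Finset.mem_image.1 hk
  exact dint_sub_scale (hI P hP)

section Far
variable {V : Type*} [NormedAddCommGroup V] [InnerProductSpace ℂ V]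
variable {κ B : ℝ} {Cd : ℕ → ℝ} {Cl : ℝ} {ph : Tl → ℝ → ℂ} {ν : Tl → ℝ}

lemma WP.norm_cf_far (hW : WP κ B Cd Cl ph ν) {f : ℝ → V} (hf1 : ∀ x, ‖f x‖ ≤ 1) {I0 : ℤ × ℤ} {D : ℝ} (hD : 1 ≤ D)
    (hfar : ∀ x, f x ≠ 0 → D * dlen I0 ≤ |x - dcen I0|) {P : Tl} (hP : dint P.1 ⊆ dint I0) (N : ℕ)
    (hN : 1 ≤ N) :
    ‖cf ph f P‖ ≤ π * Cd (N + 1) * (2 / D) ^ (2 * N) * (dlen P.1 / dlen I0) := by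
  have l0 := dlen_pos I0
  have l := dlen_pos P.1
  have hC := hW.Cd_pos (N + 1)
  have hr : dlen P.1 / dlen I0 ≤ 1 := (div_le_one l0).2 (dint_sub_dlen hP)
  have hpt : ∀ x, ‖ph P x • f x‖ ≤
      Cd (N + 1) * (dlen P.1)⁻¹ * ((2 / D) ^ (2 * N) * (dlen P.1 / dlen I0)) * dw P.1 x := by
    intro x
    have hw := dw_pos P.1 x
    rw [norm_smul]
    by_cases h0 : f x = 0
    · rw [h0, norm_zero, mul_zero]; positivity
    have h1 := hfar x h0
    have h2 := dint_sub_dcen hP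
    have h3 : |x - dcen I0| ≤ |x - dcen P.1| + |dcen P.1 - dcen I0| := abs_sub_le _ _ _
    have h4 : D * dlen I0 / 2 ≤ |x - dcen P.1| := by nlinarith
    have h5 : dw P.1 x ≤ (2 / D * (dlen P.1 / dlen I0)) ^ 2 := by
      unfold dw wt
      have h6 : (2 / D * (dlen P.1 / dlen I0))⁻¹ ≤ |(x - dcen P.1) / dlen P.1| := by
        rw [abs_div, abs_of_pos l, le_div_iff₀ l]
        refine le_trans (le_of_eq ?_) h4
        field_simp
      have h7 : ((2 / D * (dlen P.1 / dlen I0)) ^ 2)⁻¹ ≤ ((x - dcen P.1) / dlen P.1) ^ 2 := by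
        rw [← inv_pow, ← sq_abs ((x - dcen P.1) / dlen P.1)]
        gcongr
      rw [inv_le_comm₀ (by positivity) (by positivity)]
      linarith
    calc ‖ph P x‖ * ‖f x‖ ≤ Cd (N + 1) * (dlen P.1)⁻¹ * dw P.1 x ^ (N + 1) * 1 := by
          gcongr
          · exact hW.decay _ _ _
          · exact hf1 x
      _ = Cd (N + 1) * (dlen P.1)⁻¹ * dw P.1 x ^ N * dw P.1 x := by ring
      _ ≤ Cd (N + 1) * (dlen P.1)⁻¹ * ((2 / D * (dlen P.1 / dlen I0)) ^ 2) ^ N * dw P.1 x := by gcongr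
      _ = Cd (N + 1) * (dlen P.1)⁻¹ * ((2 / D) ^ (2 * N) * (dlen P.1 / dlen I0) ^ (2 * N)) * dw P.1 x := by
          rw [← pow_mul, mul_pow]
      _ ≤ _ := by
          gcongr
          have : (dlen P.1 / dlen I0) ^ (2 * N) ≤ (dlen P.1 / dlen I0) ^ 1 :=
            pow_le_pow_of_le_one (by positivity) hr (by omega)
          simpa using this
  refine (norm_integral_le_of_norm_le ((integrable_wt _ l).const_mul _) (ae_of_all _ hpt)).trans
    (le_of_eq ?_)
  rw [integral_const_mul, integral_wt _ l]
  field_simp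

lemma WP.size_far (hW : WP κ B Cd Cl ph ν) {f : ℝ → V} (hf1 : ∀ x, ‖f x‖ ≤ 1) {I0 : ℤ × ℤ} {D : ℝ} (hD : 1 ≤ D)
    (hfar : ∀ x, f x ≠ 0 → D * dlen I0 ≤ |x - dcen I0|) {T : Finset Tl} (hs : Sparse T) {ξ : ℝ}
    (hF : ∀ P ∈ T, Full ξ P) (hT : ∀ P ∈ T, dint P.1 ⊆ dint I0) (N : ℕ) (hN : 1 ≤ N) :
    ∑ P ∈ T, dlen P.1 * ‖cf ph f P‖ ^ 2 ≤ (2 * (π * Cd (N + 1) * (2 / D) ^ (2 * N))) ^ 2 * dlen I0 := by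
  have l0 := dlen_pos I0
  have hC := hW.Cd_pos (N + 1)
  set A := π * Cd (N + 1) * (2 / D) ^ (2 * N) with hA
  have hA0 : 0 ≤ A := by positivity
  calc ∑ P ∈ T, dlen P.1 * ‖cf ph f P‖ ^ 2
      ≤ ∑ P ∈ T, A ^ 2 * (dlen P.1 * (dlen P.1 / dlen I0)) := by
        refine Finset.sum_le_sum fun P hP => ?_
        have l := dlen_pos P.1
        have h1 := hW.norm_cf_far hf1 hD hfar (hT P hP) N hN
        have hr : dlen P.1 / dlen I0 ≤ 1 := (div_le_one l0).2 (dint_sub_dlen (hT P hP))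
        have hr0 : 0 < dlen P.1 / dlen I0 := by positivity
        calc dlen P.1 * ‖cf ph f P‖ ^ 2 ≤ dlen P.1 * (A * (dlen P.1 / dlen I0)) ^ 2 := by gcongr
          _ = A ^ 2 * (dlen P.1 * ((dlen P.1 / dlen I0) * (dlen P.1 / dlen I0))) := by ring
          _ ≤ A ^ 2 * (dlen P.1 * ((dlen P.1 / dlen I0) * 1)) := by gcongr
          _ = _ := by ring
    _ ≤ A ^ 2 * (2 * dlen I0) := by
        rw [← Finset.mul_sum]
        gcongr
        exact sum_dlen_tree_le hs hF hT
    _ ≤ _ := by nlinarith [mul_nonneg (sq_nonneg A) l0.le]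

end Far

/-- Weights of equally long intervals are comparable up to the square of the distance. -/
lemma dw_translate {I J : ℤ × ℤ} (hk : I.1 = J.1) {D : ℝ} (hD : 1 ≤ D)
    (h : |dcen I - dcen J| ≤ D * dlen J) (x : ℝ) : dw I x ≤ 3 * D ^ 2 * dw J x := by
  have l := dlen_pos J
  have e : dlen I = dlen J := by unfold dlen; rw [hk]
  unfold dw wt
  rw [e, ← div_eq_mul_inv, inv_eq_one_div, div_le_div_iff₀ (by positivity) (by positivity)]
  set a := (x - dcen I) / dlen J
  set b := (dcen I - dcen J) / dlen J with hb
  have e2 : (x - dcen J) / dlen J = a + b := by simp only [a, b]; ring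
  have hb2 : b ^ 2 ≤ D ^ 2 := by
    rw [← sq_abs b]
    have : |b| ≤ D := by rw [hb, abs_div, abs_of_pos l, div_le_iff₀ l]; exact h
    gcongr
  rw [e2]
  have hD2 : 1 ≤ D ^ 2 := one_le_pow₀ hD
  nlinarith [sq_nonneg (a - b), mul_nonneg (sub_nonneg.2 hD2) (sq_nonneg a)]

/-- Three families of wave packets such that every tile close to a frequency is lacunary for at least
two of them. -/
structure TriWP (κ B : Fin 3 → ℝ) (Cd : Fin 3 → ℕ → ℝ) (Cl : Fin 3 → ℝ) (ph : Fin 3 → Tl → ℝ → ℂ)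
    (ν : Fin 3 → Tl → ℝ) : Prop where
  wp : ∀ j, WP (κ j) (B j) (Cd j) (Cl j) (ph j) (ν j)
  lac : ∀ P ξ, Full ξ P → ∃ i, ∀ j, j ≠ i → ∃ b, Lac (κ j) (ν j) (sg b) ξ P

/-- The model trilinear form, with absolute values inside. -/
noncomputable def form {V : Type*} [NormedAddCommGroup V] [InnerProductSpace ℂ V]
    (ph : Fin 3 → Tl → ℝ → ℂ) (f : Fin 3 → ℝ → V) (U : Finset Tl) : ℝ :=
  ∑ P ∈ U, dlen P.1 * (‖cf (ph 0) (f 0) P‖ * ‖cf (ph 1) (f 1) P‖ * ‖cf (ph 2) (f 2) P‖)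

lemma SizeLe.of_le {κ : ℝ} {ν : Tl → ℝ} {σ : ℝ} {a : Tl → ℝ} {Q : Finset Tl} {S S' : ℝ}
    (h : SizeLe κ ν σ a Q S) (hS : 0 ≤ S) (hSS : S ≤ S') : SizeLe κ ν σ a Q S' :=
  fun P0 h0 ξ T hT hl => (h P0 h0 ξ T hT hl).trans (by have := dlen_pos P0.1; gcongr)

lemma Sparse.mono {Q U : Finset Tl} (h : Sparse U) (hQ : Q ⊆ U) : Sparse Q :=
  fun P hP P' hP' => h P (hQ hP) P' (hQ hP')

lemma min_le_rpow_mul_rpow {x y s : ℝ} (hx : 0 < x) (hy : 0 < y) (hs0 : 0 ≤ s) (hs1 : s ≤ 1) :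
    min x y ≤ x ^ (1 - s) * y ^ s := by
  have hm : 0 < min x y := lt_min hx hy
  calc min x y = min x y ^ (1 - s) * min x y ^ s := by
        rw [← rpow_add hm, sub_add_cancel, rpow_one]
    _ ≤ _ := by
        gcongr
        · exact min_le_left _ _
        · exact min_le_right _ _

lemma sqrt_mul_rpow_eq {K A L lam ρ θ : ℝ} (hK : 0 < K) (hA : 0 < A) (hL : 0 < L) (hlam : 0 < lam)
    (hρ : 0 < ρ) : √(K * (lam * L)) * (A * ρ / √(K * (lam * L))) ^ θ =
      K ^ ((1 - θ) / 2) * A ^ θ * (L ^ ((1 - θ) / 2) * (lam ^ ((1 - θ) / 2) * ρ ^ θ)) := by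
  have h1 : 0 < K * (lam * L) := by positivity
  rw [sqrt_eq_rpow, div_rpow (by positivity) (by positivity), ← rpow_mul h1.le, ← mul_div_assoc,
    mul_comm, mul_div_assoc, ← rpow_sub h1, mul_rpow hA.le hρ.le,
    mul_rpow hK.le (by positivity), mul_rpow hlam.le hL.le]
  rw [show 1 / 2 - 1 / 2 * θ = (1 - θ) / 2 by ring]
  ring

/-- The local estimate for functions of prescribed densities. -/
theorem exists_local_density_le {θ : Fin 3 → ℝ} (hθ : ∀ j, 0 < θ j) (hsum : θ 0 + θ 1 + θ 2 = 1)
    (κ B : Fin 3 → ℝ) (Cd : Fin 3 → ℕ → ℝ) (Cl : Fin 3 → ℝ) (hCd : ∀ j n, 0 < Cd j n)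
    (hCl : ∀ j, 0 < Cl j) (N : ℕ) (hN : 1 ≤ N) {s : ℝ} (hs0 : 0 ≤ s) (hs1 : s ≤ 1) :
    ∃ C : ℝ, 0 < C ∧ ∀ (V : Type) [NormedAddCommGroup V] [InnerProductSpace ℂ V] [CompleteSpace V]
      (ph : Fin 3 → Tl → ℝ → ℂ) (ν : Fin 3 → Tl → ℝ), TriWP κ B Cd Cl ph ν →
      ∀ f : Fin 3 → ℝ → V, (∀ j, Integrable (f j)) → (∀ j x, ‖f j x‖ ≤ 1) →
      ∀ U : Finset Tl, Sparse U → ∀ J : ℤ × ℤ, (∀ P ∈ U, dint P.1 ⊆ dint J) → (∃ P ∈ U, P.1 = J) →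
      ∀ lam : Fin 3 → ℝ, (∀ j, 0 < lam j) → lam 2 ≤ 4 →
      (∀ j I, (∃ P ∈ U, dint P.1 ⊆ dint I) → ∫ x, ‖f j x‖ * dw I x ≤ lam j * dlen I) →
      ∀ D : ℝ, 1 ≤ D → (D = 1 ∨ ∀ P ∈ U, ∀ x, f 2 x ≠ 0 → D * dlen P.1 ≤ |x - dcen P.1|) →
      form ph f U ≤ C * (dlen J * (lam 0 ^ ((1 + θ 0) / 2) * lam 1 ^ ((1 + θ 1) / 2) *
        (lam 2 ^ ((1 + θ 2) / 2 - s * θ 2) * D ^ (-(2 * N * s * θ 2))))) := by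
  obtain ⟨C0, hC0, hloc⟩ := exists_local_form_le hθ hsum
  have hsz := fun j => exists_size_le (κ := κ j) (B := B j) (hCd j 4) (hCd j 1) (hCl j)
  choose Cs hCs hsz using hsz
  set K : Fin 3 → ℝ := fun j => 144 * π ^ 2 * Cd j 4 ^ 2 + 96 * π ^ 2 * (144 * π * Cd j 4 ^ 2) with hK
  have hKp : ∀ j, 0 < K j := fun j => by have := hCd j 4; simp only [hK]; positivity
  set A2 := 4 * (√(Cs 2) + 2 * (π * Cd 2 (N + 1) * 2 ^ (2 * N))) with hA2
  have hA2p : 0 < A2 := by have := hCd 2 (N + 1); positivity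
  set A : Fin 3 → ℝ := ![√(Cs 0), √(Cs 1), A2] with hA
  have hsq : ∀ j, 0 < √(Cs j) := fun j => sqrt_pos.2 (hCs j)
  have hAp : ∀ j, 0 < A j := by
    intro j; fin_cases j
    · exact hsq 0
    · exact hsq 1
    · exact hA2p
  refine ⟨C0 * ((K 0 ^ ((1 - θ 0) / 2) * A 0 ^ θ 0) * (K 1 ^ ((1 - θ 1) / 2) * A 1 ^ θ 1) *
    (K 2 ^ ((1 - θ 2) / 2) * A 2 ^ θ 2)), ?_, ?_⟩
  · have h0 := hKp 0
    have h1 := hKp 1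
    have h2 := hKp 2
    have a0 := hAp 0
    have a1 := hAp 1
    have a2 := hAp 2
    positivity
  intro V _ _ _ ph ν hW f hf hf1 U hs J hJ hJU lam hlam hlam4 hdens D hD hfar
  have lJ := dlen_pos J
  have hDp : 0 < D := by linarith
  set ρ : Fin 3 → ℝ := ![lam 0, lam 1, lam 2 ^ (1 - s) * (D ^ (-(2 * N : ℝ))) ^ s] with hρ
  have hρp : ∀ j, 0 < ρ j := by
    have := hlam 2
    intro j; fin_cases j
    · exact hlam 0
    · exact hlam 1
    · show 0 < lam 2 ^ (1 - s) * (D ^ (-(2 * N : ℝ))) ^ s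
      positivity
  have hsize : ∀ j b, SizeLe (κ j) (ν j) (sg b) (fun P => ‖cf (ph j) (f j) P‖) U (√(Cs j) * lam j) := by
    intro j b P0 h0 ξ T hT hl
    have := hsz j V (ph j) (ν j) (hW.wp j) (f j) (hf j) T (hs.mono hT) P0.1 (fun P hP => (hl P hP).1)
      (sg b) ξ (abs_sg b) (fun P hP => (hl P hP).2) (lam j) (hlam j)
      (fun I ⟨P, hP, hI⟩ => hdens j I ⟨P, hT hP, hI⟩)
    rwa [mul_pow, sq_sqrt (hCs j).le]
  have hsize2 : ∀ b, SizeLe (κ 2) (ν 2) (sg b) (fun P => ‖cf (ph 2) (f 2) P‖) U (A2 * D ^ (-(2 * N : ℝ))) := by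
    intro b
    rcases hfar with h1 | h1
    · refine (hsize 2 b).of_le (mul_nonneg (hsq 2).le (hlam 2).le) ?_
      rw [h1, one_rpow, mul_one, hA2, mul_comm]
      have := hCd 2 (N + 1)
      have := hsq 2
      have : 0 < 2 * (π * Cd 2 (N + 1) * 2 ^ (2 * N)) := by positivity
      nlinarith
    · intro P0 h0 ξ T hT hl
      refine ((hW.wp 2).size_far (hf1 2) hD (h1 P0 h0) (hs.mono hT) (fun P hP => (hl P hP).2.1)
        (fun P hP => (hl P hP).1) N hN).trans ?_
      have l0 := dlen_pos P0.1
      have hcd := hCd 2 (N + 1)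
      have e1 : D ^ (-(2 * N : ℝ)) = (D ^ (2 * N))⁻¹ := by
        rw [rpow_neg hDp.le, ← rpow_natCast]; push_cast; rfl
      have h3 := hsq 2
      have h5 : 0 < (D ^ (2 * N))⁻¹ := by positivity
      have h4 : 0 < π * Cd 2 (N + 1) * 2 ^ (2 * N) := by positivity
      have h6 : 2 * (π * Cd 2 (N + 1) * (2 / D) ^ (2 * N)) ≤ A2 * (D ^ (2 * N))⁻¹ := by
        calc 2 * (π * Cd 2 (N + 1) * (2 / D) ^ (2 * N))
            = 2 * (π * Cd 2 (N + 1) * 2 ^ (2 * N)) * (D ^ (2 * N))⁻¹ := by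
              rw [div_pow, div_eq_mul_inv]; ring
          _ ≤ _ := by
              refine mul_le_mul_of_nonneg_right ?_ h5.le
              rw [hA2]; linarith
      rw [e1]
      have h7 : 0 ≤ 2 * (π * Cd 2 (N + 1) * (2 / D) ^ (2 * N)) := by positivity
      exact mul_le_mul_of_nonneg_right (pow_le_pow_left₀ h7 h6 2) l0.le
  have hLD : LocalData κ ν (fun j P => ‖cf (ph j) (f j) P‖) U (fun j => A j * ρ j)
      (fun j => √(K j * (lam j * dlen J))) := by
    refine ⟨fun j P => norm_nonneg _, fun j => mul_pos (hAp j) (hρp j), fun j => ?_, ?_, ?_, ?_, ?_⟩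
    · have := hKp j
      have := hlam j
      positivity
    · intro j σ hσ Q hQ hS P hP
      exact (hW.wp j).single_le (σ := 1) (by simp) hσ hS hP
    · intro j σ hσ Q hQ l hl hS
      obtain ⟨Q', hQ', h1, h2⟩ := (hW.wp j).exists_select hσ (hs.mono hQ) (hf j) (hf1 j) hl
        (fun P hP => hJ P (hQ hP)) hS
      refine ⟨Q', hQ', h1, fun b Y hb hY hT => (h2 b Y hb hY hT).trans ?_⟩
      have hKl := hKp j
      have hlj := hlam j
      rw [sq_sqrt (by positivity)]
      have h3 : ∫ x, ‖f j x‖ * dw J x ≤ lam j * dlen J := by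
        obtain ⟨P, hP, hPJ⟩ := hJU
        exact hdens j J ⟨P, hP, hJ P hP⟩
      calc _ ≤ Y * (K j * (l ^ 2)⁻¹ * (lam j * dlen J)) := by gcongr
        _ = _ := by ring
    · intro j b
      have h0 := hsize 0 b
      have h1 := hsize 1 b
      have h2 := hsize 2 b
      fin_cases j
      · exact h0
      · exact h1
      · show SizeLe (κ 2) (ν 2) (sg b) _ U (A2 * (lam 2 ^ (1 - s) * (D ^ (-(2 * N : ℝ))) ^ s))
        have hl2 := hlam 2
        have hm := min_le_rpow_mul_rpow hl2 (rpow_pos_of_pos hDp (-(2 * N : ℝ))) hs0 hs1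
        rcases min_choice (lam 2) (D ^ (-(2 * N : ℝ))) with h | h
        · rw [h] at hm
          refine h2.of_le (mul_nonneg (hsq 2).le hl2.le) ?_
          have : √(Cs 2) ≤ A2 := by
            have := hCd 2 (N + 1)
            have := hsq 2
            have : 0 < 2 * (π * Cd 2 (N + 1) * 2 ^ (2 * N)) := by positivity
            rw [hA2]; linarith
          gcongr
        · rw [h] at hm
          refine (hsize2 b).of_le (by positivity) ?_
          gcongr
    · exact fun P _ ξ hF => hW.lac P ξ hF
  refine (hloc κ ν _ U _ _ hLD).trans (le_of_eq ?_)
  set R := fun j => √(K j * (lam j * dlen J)) * (A j * ρ j / √(K j * (lam j * dlen J))) ^ θ j with hR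
  have hprod : √(K 0 * (lam 0 * dlen J)) * √(K 1 * (lam 1 * dlen J)) * √(K 2 * (lam 2 * dlen J)) *
      ((A 0 * ρ 0 / √(K 0 * (lam 0 * dlen J))) ^ θ 0 * (A 1 * ρ 1 / √(K 1 * (lam 1 * dlen J))) ^ θ 1 *
        (A 2 * ρ 2 / √(K 2 * (lam 2 * dlen J))) ^ θ 2) = R 0 * R 1 * R 2 := by
    simp only [hR]; ring
  rw [hprod]
  have hRe : ∀ j, R j = K j ^ ((1 - θ j) / 2) * A j ^ θ j *
      (dlen J ^ ((1 - θ j) / 2) * (lam j ^ ((1 - θ j) / 2) * ρ j ^ θ j)) :=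
    fun j => sqrt_mul_rpow_eq (hKp j) (hAp j) lJ (hlam j) (hρp j)
  rw [hRe 0, hRe 1, hRe 2]
  have hl : dlen J ^ ((1 - θ 0) / 2) * dlen J ^ ((1 - θ 1) / 2) * dlen J ^ ((1 - θ 2) / 2) = dlen J := by
    rw [← rpow_add lJ, ← rpow_add lJ, show (1 - θ 0) / 2 + (1 - θ 1) / 2 + (1 - θ 2) / 2 = 1 by linarith,
      rpow_one]
  have hr0 : ∀ j, lam j ^ ((1 - θ j) / 2) * lam j ^ θ j = lam j ^ ((1 + θ j) / 2) := fun j => by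
    rw [← rpow_add (hlam j)]; congr 1; ring
  have hl2 := hlam 2
  have hr2 : lam 2 ^ ((1 - θ 2) / 2) * ρ 2 ^ θ 2 =
      lam 2 ^ ((1 + θ 2) / 2 - s * θ 2) * D ^ (-(2 * N * s * θ 2)) := by
    have : ρ 2 = lam 2 ^ (1 - s) * (D ^ (-(2 * N : ℝ))) ^ s := rfl
    rw [this, mul_rpow (by positivity) (by positivity), ← mul_assoc, ← rpow_mul hl2.le, ← rpow_add hl2,
      ← rpow_mul hDp.le, ← rpow_mul hDp.le]
    congr 2 <;> ring
  rw [hr2, show ρ 0 = lam 0 from rfl, show ρ 1 = lam 1 from rfl, hr0 0, hr0 1]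
  conv_rhs => rw [← hl]
  ring

lemma exists_maximal_intervals (U : Finset Tl) : ∃ (F : Finset (ℤ × ℤ)) (t : Tl → ℤ × ℤ),
    (∀ I ∈ F, ∀ J ∈ F, I ≠ J → Disjoint (dint I) (dint J)) ∧
    (∀ J ∈ F, ∃ P ∈ U, P.1 = J ∧ t P = J) ∧ ∀ P ∈ U, t P ∈ F ∧ dint P.1 ⊆ dint (t P) := by
  classical
  set G := U.image Prod.fst with hG
  have hex : ∀ P : Tl, ∃ J, P ∈ U → J ∈ G ∧ dint P.1 ⊆ dint J ∧ ∀ I ∈ G, dint J ⊆ dint I → I = J := by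
    intro P
    by_cases hP : P ∈ U
    · obtain ⟨J, hJ, hmax⟩ := (G.filter fun I => dint P.1 ⊆ dint I).exists_max_image (fun I => I.1)
        ⟨P.1, Finset.mem_filter.2 ⟨Finset.mem_image_of_mem _ hP, Subset.rfl⟩⟩
      obtain ⟨h1, h2⟩ := Finset.mem_filter.1 hJ
      refine ⟨J, fun _ => ⟨h1, h2, fun I hI hJI => ?_⟩⟩
      have h3 := hmax I (Finset.mem_filter.2 ⟨hI, h2.trans hJI⟩)
      by_contra hne
      have hk : I.1 = J.1 := le_antisymm h3 (dint_sub_scale hJI)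
      exact (Set.disjoint_left.1 (disjoint_of_same_scale hk hne)) (hJI (dcen_mem J)) (dcen_mem J)
    · exact ⟨P.1, fun h => absurd h hP⟩
  choose t ht using hex
  refine ⟨U.image t, t, ?_, ?_, fun P hP => ⟨Finset.mem_image_of_mem _ hP, (ht P hP).2.1⟩⟩
  · intro I hI J hJ hne
    obtain ⟨P, hP, rfl⟩ := Finset.mem_image.1 hI
    obtain ⟨Q, hQ, rfl⟩ := Finset.mem_image.1 hJ
    rcases le_total (t P).1 (t Q).1 with h | h
    · rcases dint_sub_or_disjoint h with h' | h'
      · exact absurd ((ht P hP).2.2 _ (ht Q hQ).1 h').symm hne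
      · exact h'
    · rcases dint_sub_or_disjoint h with h' | h'
      · exact absurd ((ht Q hQ).2.2 _ (ht P hP).1 h') hne
      · exact h'.symm
  · intro J hJ
    obtain ⟨P, hP, rfl⟩ := Finset.mem_image.1 hJ
    obtain ⟨Q, hQ, hQe⟩ := Finset.mem_image.1 (ht P hP).1
    refine ⟨Q, hQ, hQe, ?_⟩
    refine (ht P hP).2.2 _ (ht Q hQ).1 ?_
    rw [← hQe]; exact (ht Q hQ).2.1

/-- The estimate for tiles of prescribed densities. -/
theorem exists_class_le {θ : Fin 3 → ℝ} (hθ : ∀ j, 0 < θ j) (hsum : θ 0 + θ 1 + θ 2 = 1)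
    {β : Fin 3 → ℝ} (hβ : ∀ j, 0 ≤ β j) (hβs : β 0 + β 1 + β 2 = 1)
    (κ B : Fin 3 → ℝ) (Cd : Fin 3 → ℕ → ℝ) (Cl : Fin 3 → ℝ) (hCd : ∀ j n, 0 < Cd j n)
    (hCl : ∀ j, 0 < Cl j) (N : ℕ) (hN : 1 ≤ N) {s : ℝ} (hs0 : 0 ≤ s) (hs1 : s ≤ 1) :
    ∃ C : ℝ, 0 < C ∧ ∀ (V : Type) [NormedAddCommGroup V] [InnerProductSpace ℂ V] [CompleteSpace V]
      (ph : Fin 3 → Tl → ℝ → ℂ) (ν : Fin 3 → Tl → ℝ), TriWP κ B Cd Cl ph ν →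
      ∀ f : Fin 3 → ℝ → V, (∀ j, Integrable (f j)) → (∀ j x, ‖f j x‖ ≤ 1) →
      ∀ m : Fin 3 → ℝ, (∀ j, 0 < m j) → (∀ j, 0 < β j → ∫ x, ‖f j x‖ ≤ m j) →
      ∀ U : Finset Tl, Sparse U →
      ∀ lam : Fin 3 → ℝ, (∀ j, 0 < lam j) → lam 2 ≤ 4 →
      (∀ j, ∀ P ∈ U, ∀ I, dint P.1 ⊆ dint I → ∫ x, ‖f j x‖ * dw I x ≤ lam j * dlen I) →
      (∀ j, ∀ P ∈ U, ∃ I, dint P.1 ⊆ dint I ∧ lam j / 2 * dlen I < ∫ x, ‖f j x‖ * dw I x) →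
      ∀ D : ℝ, 1 ≤ D → (D = 1 ∨ ∀ P ∈ U, ∀ x, f 2 x ≠ 0 → D * dlen P.1 ≤ |x - dcen P.1|) →
      form ph f U ≤ C * ((m 0 / lam 0) ^ β 0 * (m 1 / lam 1) ^ β 1 * (m 2 / lam 2) ^ β 2 *
        (lam 0 ^ ((1 + θ 0) / 2) * lam 1 ^ ((1 + θ 1) / 2) *
        (lam 2 ^ ((1 + θ 2) / 2 - s * θ 2) * D ^ (-(2 * N * s * θ 2))))) := by
  classical
  obtain ⟨C, hC, hloc⟩ := exists_local_density_le hθ hsum κ B Cd Cl hCd hCl N hN hs0 hs1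
  refine ⟨C * 160, by positivity, ?_⟩
  intro V _ _ _ ph ν hW f hf hf1 m hm hfm U hs lam hlam hlam4 hup hlow D hD hfar
  obtain ⟨F, t, hd, hF, ht⟩ := exists_maximal_intervals U
  set W := lam 0 ^ ((1 + θ 0) / 2) * lam 1 ^ ((1 + θ 1) / 2) *
        (lam 2 ^ ((1 + θ 2) / 2 - s * θ 2) * D ^ (-(2 * N * s * θ 2))) with hWd
  have l0 := hlam 0
  have l1 := hlam 1
  have l2 := hlam 2
  have m0 := hm 0
  have m1 := hm 1
  have m2 := hm 2
  have hDp : 0 < D := by linarith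
  have hWp : 0 < W := by positivity
  have h1 : form ph f U ≤ C * W * ∑ J ∈ F, dlen J := by
    unfold form
    rw [← Finset.sum_fiberwise_of_maps_to (g := t) (t := F) (fun P hP => (ht P hP).1), Finset.mul_sum]
    refine Finset.sum_le_sum fun J hJ => ?_
    obtain ⟨P0, hP0, hPJ, htP⟩ := hF J hJ
    have hsub : U.filter (fun P => t P = J) ⊆ U := Finset.filter_subset _ _
    refine (hloc V ph ν hW f hf hf1 (U.filter fun P => t P = J) (hs.mono hsub) J ?_
      ⟨P0, Finset.mem_filter.2 ⟨hP0, htP⟩, hPJ⟩ lam hlam hlam4 ?_ D hD ?_).trans (le_of_eq ?_)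
    · intro P hP
      obtain ⟨h2, rfl⟩ := Finset.mem_filter.1 hP
      exact (ht P h2).2
    · rintro j I ⟨P, hP, hI⟩
      exact hup j P (hsub hP) I hI
    · exact hfar.imp_right fun h P hP => h P (hsub hP)
    · rw [← hWd]; ring
  refine h1.trans ?_
  have hX0 : 0 ≤ ∑ J ∈ F, dlen J := Finset.sum_nonneg fun J _ => (dlen_pos J).le
  have hX : ∀ j, (∑ J ∈ F, dlen J) ^ β j ≤ 160 ^ β j * (m j / lam j) ^ β j := by
    intro j
    have hlj := hlam j
    have hmj := hm j
    rcases (hβ j).eq_or_lt with h0 | h0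
    · rw [← h0]; simp
    · rw [← mul_rpow (by norm_num) (by positivity)]
      refine rpow_le_rpow hX0 ?_ (hβ j)
      have h2 := sum_dlen_le_of_density (hf j) (c := lam j / 2) (by positivity) F hd (fun J hJ => by
        obtain ⟨P, hP, hPJ, _⟩ := hF J hJ
        rw [← hPJ]; exact hlow j P hP)
      have h3 := hfm j h0
      calc _ ≤ 80 * (lam j / 2)⁻¹ * m j := h2.trans (by gcongr)
        _ = _ := by field_simp; norm_num
  have hX1 : ∑ J ∈ F, dlen J ≤ 160 * ((m 0 / lam 0) ^ β 0 * (m 1 / lam 1) ^ β 1 * (m 2 / lam 2) ^ β 2) := by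
    rcases hX0.eq_or_lt with h0 | h0
    · rw [← h0]; positivity
    · have e : ∑ J ∈ F, dlen J = (∑ J ∈ F, dlen J) ^ β 0 * (∑ J ∈ F, dlen J) ^ β 1 * (∑ J ∈ F, dlen J) ^ β 2 := by
        rw [← rpow_add h0, ← rpow_add h0, hβs, rpow_one]
      have e2 : (160 : ℝ) = 160 ^ β 0 * 160 ^ β 1 * 160 ^ β 2 := by
        rw [← rpow_add (by norm_num), ← rpow_add (by norm_num), hβs, rpow_one]
      calc ∑ J ∈ F, dlen J = _ := e
        _ ≤ (160 ^ β 0 * (m 0 / lam 0) ^ β 0) * (160 ^ β 1 * (m 1 / lam 1) ^ β 1) *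
            (160 ^ β 2 * (m 2 / lam 2) ^ β 2) := by
            gcongr
            · exact hX 0
            · exact hX 1
            · exact hX 2
        _ = (160 ^ β 0 * 160 ^ β 1 * 160 ^ β 2) *
            ((m 0 / lam 0) ^ β 0 * (m 1 / lam 1) ^ β 1 * (m 2 / lam 2) ^ β 2) := by ring
        _ = _ := by rw [← e2]
  calc C * W * ∑ J ∈ F, dlen J
      ≤ C * W * (160 * ((m 0 / lam 0) ^ β 0 * (m 1 / lam 1) ^ β 1 * (m 2 / lam 2) ^ β 2)) := by gcongr
    _ = _ := by ring

lemma exists_sum_geometric_le {a b c d : ℝ} (ha : 0 ≤ a) (ha1 : a < 1) (hb : 0 ≤ b) (hb1 : b < 1)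
    (hc : 0 ≤ c) (hc1 : c < 1) (hd : 0 ≤ d) (hd1 : d < 1) :
    ∃ C : ℝ, 0 < C ∧ ∀ S : Finset (ℕ × ℕ × ℕ × ℕ),
      ∑ x ∈ S, a ^ x.1 * (b ^ x.2.1 * (c ^ x.2.2.1 * d ^ x.2.2.2)) ≤ C := by
  have sc := summable_geometric_of_lt_one hc hc1
  have sd := summable_geometric_of_lt_one hd hd1
  have sb := summable_geometric_of_lt_one hb hb1
  have sa := summable_geometric_of_lt_one ha ha1
  have h1 := sc.mul_of_nonneg sd (fun n => by positivity) (fun n => by positivity)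
  have h2 := sb.mul_of_nonneg h1 (fun n => by positivity) (fun n => by simp only [Pi.zero_apply]; positivity)
  have h3 := sa.mul_of_nonneg h2 (fun n => by positivity) (fun n => by simp only [Pi.zero_apply]; positivity)
  have h0 : ∀ x : ℕ × ℕ × ℕ × ℕ, 0 ≤ a ^ x.1 * (b ^ x.2.1 * (c ^ x.2.2.1 * d ^ x.2.2.2)) :=
    fun x => by positivity
  refine ⟨(∑' x : ℕ × ℕ × ℕ × ℕ, a ^ x.1 * (b ^ x.2.1 * (c ^ x.2.2.1 * d ^ x.2.2.2))) + 1, ?_, fun S => ?_⟩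
  · exact add_pos_of_nonneg_of_pos (tsum_nonneg h0) one_pos
  · have := h3.sum_le_tsum S (fun x _ => h0 x)
    linarith

section
variable {V : Type*} [NormedAddCommGroup V]

/-- Dyadic size of the density of a function above an interval. -/
lemma exists_density_level {f : ℝ → V} (hf1 : ∀ x, ‖f x‖ ≤ 1) (hf : Integrable f)
    (h0 : ∫ x, ‖f x‖ ≠ 0) (J : ℤ × ℤ) : ∃ k : ℕ,
      (∀ I, dint J ⊆ dint I → ∫ x, ‖f x‖ * dw I x ≤ 4 * (1 / 2) ^ k * dlen I) ∧
      ∃ I, dint J ⊆ dint I ∧ 4 * (1 / 2) ^ k / 2 * dlen I < ∫ x, ‖f x‖ * dw I x := by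
  classical
  have hex : ∃ k : ℕ, ∃ I, dint J ⊆ dint I ∧ 4 * (1 / 2 : ℝ) ^ k / 2 * dlen I < ∫ x, ‖f x‖ * dw I x := by
    have hpos : 0 < ∫ x, ‖f x‖ * dw J x := by
      have hn : 0 ≤ ∫ x, ‖f x‖ * dw J x :=
        integral_nonneg fun x => mul_nonneg (norm_nonneg _) (dw_pos J x).le
      refine hn.lt_of_ne fun h => h0 ?_
      rw [eq_comm, integral_eq_zero_iff_of_nonneg (fun x => mul_nonneg (norm_nonneg _) (dw_pos J x).le)
        (integrable_mul_dw_of hf.norm J)] at h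
      rw [integral_eq_zero_iff_of_nonneg (fun x => norm_nonneg _) hf.norm]
      filter_upwards [h] with x hx
      exact (mul_eq_zero.1 hx).resolve_right (dw_pos J x).ne'
    have lJ := dlen_pos J
    obtain ⟨k, hk⟩ := exists_pow_lt_of_lt_one (show 0 < (∫ x, ‖f x‖ * dw J x) / (2 * dlen J) by positivity)
      (show (1 / 2 : ℝ) < 1 by norm_num)
    refine ⟨k, J, Subset.rfl, ?_⟩
    rw [lt_div_iff₀ (by positivity)] at hk
    linarith
  refine ⟨Nat.find hex, fun I hI => ?_, Nat.find_spec hex⟩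
  rcases Nat.eq_zero_or_pos (Nat.find hex) with h | h
  · rw [h, pow_zero, mul_one]
    calc ∫ x, ‖f x‖ * dw I x ≤ ∫ x, dw I x := by
          refine integral_mono (integrable_mul_dw_of hf.norm I) (integrable_wt _ (dlen_pos I)) fun x => ?_
          exact mul_le_of_le_one_left (dw_pos I x).le (hf1 x)
      _ = π * dlen I := integral_wt _ (dlen_pos I)
      _ ≤ 4 * dlen I := by
          have := dlen_pos I
          have := pi_lt_four
          gcongr
  · have h2 := Nat.find_min hex (Nat.sub_lt h one_pos)
    push Not at h2
    refine (h2 I hI).trans (le_of_eq ?_)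
    obtain ⟨n, hn⟩ : ∃ n, Nat.find hex = n + 1 := ⟨Nat.find hex - 1, by omega⟩
    rw [hn, Nat.add_sub_cancel, pow_succ]
    ring

/-- The density above an interval is controlled by the density at a nearby point. -/
lemma density_le_of_near {f : ℝ → V} (hf : Integrable f) {J I : ℤ × ℤ} (hJI : dint J ⊆ dint I) {x : ℝ}
    {d : ℕ} (hx : |x - dcen J| ≤ 2 ^ d * dlen J) {lam : ℝ}
    (h : ∀ I, x ∈ dint I → ∫ y, ‖f y‖ * dw I y ≤ lam * dlen I) :
    ∫ y, ‖f y‖ * dw I y ≤ 12 * 4 ^ d * lam * dlen I := by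
  have lI := dlen_pos I
  have hI' := h _ (mem_dat I.1 x)
  have e : dlen (dat I.1 x) = dlen I := rfl
  have hd1 : (1 : ℝ) ≤ 2 ^ d := one_le_pow₀ one_le_two
  have hdist : |dcen I - dcen (dat I.1 x)| ≤ 2 * 2 ^ d * dlen (dat I.1 x) := by
    rw [e]
    have h1 := abs_sub_dcen (mem_dat I.1 x)
    have h2 := dint_sub_dcen hJI
    have h3 := dint_sub_dlen hJI
    rw [e] at h1
    have h4 : dcen I - dcen (dat I.1 x) = -(dcen J - dcen I) + -(x - dcen J) + (x - dcen (dat I.1 x)) := by ring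
    rw [h4]
    refine (abs_add_three _ _ _).trans ?_
    rw [abs_neg, abs_neg]
    have h5 : (2 : ℝ) ^ d * dlen J ≤ 2 ^ d * dlen I := by gcongr
    nlinarith
  have hpt := dw_translate (I := I) (J := dat I.1 x) rfl (D := 2 * 2 ^ d) (by linarith) hdist
  calc ∫ y, ‖f y‖ * dw I y ≤ ∫ y, 3 * (2 * 2 ^ d) ^ 2 * (‖f y‖ * dw (dat I.1 x) y) := by
        refine integral_mono (integrable_mul_dw_of hf.norm I)
          ((integrable_mul_dw_of hf.norm _).const_mul _) fun y => ?_
        show ‖f y‖ * dw I y ≤ 3 * (2 * 2 ^ d) ^ 2 * (‖f y‖ * dw (dat I.1 x) y)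
        calc ‖f y‖ * dw I y ≤ ‖f y‖ * (3 * (2 * 2 ^ d) ^ 2 * dw (dat I.1 x) y) := by
              gcongr; exact hpt y
          _ = _ := by ring
    _ = 12 * 4 ^ d * ∫ y, ‖f y‖ * dw (dat I.1 x) y := by
        rw [integral_const_mul]
        congr 1
        rw [show (4 : ℝ) = 2 ^ 2 by norm_num, ← pow_mul, mul_pow, ← pow_mul]; ring
    _ ≤ 12 * 4 ^ d * (lam * dlen I) := mul_le_mul_of_nonneg_left hI' (by positivity)
    _ = _ := by ring

end

lemma form_eq_zero {V : Type*} [NormedAddCommGroup V] [InnerProductSpace ℂ V]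
    {ph : Fin 3 → Tl → ℝ → ℂ} {f : Fin 3 → ℝ → V} (hf : ∀ j, Integrable (f j)) {j : Fin 3}
    (h : ∫ x, ‖f j x‖ = 0) (U : Finset Tl) : form ph f U = 0 := by
  have h1 : ∀ P, cf (ph j) (f j) P = 0 := by
    intro P
    rw [integral_eq_zero_iff_of_nonneg (fun x => norm_nonneg _) (hf j).norm] at h
    refine integral_eq_zero_of_ae ?_
    filter_upwards [h] with x hx
    rw [norm_eq_zero.1 hx, smul_zero]; rfl
  refine Finset.sum_eq_zero fun P _ => ?_
  fin_cases j
  · rw [show cf (ph 0) (f 0) P = 0 from h1 P]; simp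
  · rw [show cf (ph 1) (f 1) P = 0 from h1 P]; simp
  · rw [show cf (ph 2) (f 2) P = 0 from h1 P]; simp

lemma rpow_half_pow {ε : ℝ} (k : ℕ) : (4 * (1 / 2 : ℝ) ^ k) ^ ε = 4 ^ ε * ((1 / 2 : ℝ) ^ ε) ^ k := by
  rw [mul_rpow (by norm_num) (by positivity), ← rpow_natCast, ← rpow_natCast, ← rpow_mul (by norm_num),
    ← rpow_mul (by norm_num), mul_comm (k : ℝ)]

lemma exists_dist_level {V : Type*} [NormedAddCommGroup V] {f : ℝ → V} (h0 : ∃ x, f x ≠ 0) (J : ℤ × ℤ) :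
    ∃ d : ℕ, (∃ x, f x ≠ 0 ∧ |x - dcen J| ≤ 2 ^ d * dlen J) ∧
      (d = 0 ∨ ∀ x, f x ≠ 0 → 2 ^ (d - 1) * dlen J ≤ |x - dcen J|) := by
  classical
  have lJ := dlen_pos J
  have hex : ∃ d : ℕ, ∃ x, f x ≠ 0 ∧ |x - dcen J| ≤ 2 ^ d * dlen J := by
    obtain ⟨x, hx⟩ := h0
    obtain ⟨n, hn⟩ := pow_unbounded_of_one_lt (|x - dcen J| / dlen J) one_lt_two
    exact ⟨n, x, hx, by rw [div_lt_iff₀ lJ] at hn; exact hn.le⟩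
  refine ⟨Nat.find hex, Nat.find_spec hex, ?_⟩
  rcases Nat.eq_zero_or_pos (Nat.find hex) with h | h
  · exact Or.inl h
  · refine Or.inr fun x hx => ?_
    have h2 := Nat.find_min hex (Nat.sub_lt h one_pos)
    push Not at h2
    exact (h2 x hx).le

set_option maxHeartbeats 2000000 in
/-- The restricted-type estimate for sparse families of tiles. -/
theorem exists_sparse_restricted_le {θ : Fin 3 → ℝ} (hθ : ∀ j, 0 < θ j) (hsum : θ 0 + θ 1 + θ 2 = 1)
    {β : Fin 3 → ℝ} (hβ : ∀ j, 0 ≤ β j) (hβs : β 0 + β 1 + β 2 = 1)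
    {γ₀ γ₁ : ℝ} (hγ₀ : 0 ≤ γ₀) (hγ₁ : 0 ≤ γ₁) (h₀ : γ₀ + β 0 < (1 + θ 0) / 2)
    (h₁ : γ₁ + β 1 < (1 + θ 1) / 2) (h₂ : β 2 < (1 + θ 2) / 2)
    (κ B : Fin 3 → ℝ) (Cd : Fin 3 → ℕ → ℝ) (Cl : Fin 3 → ℝ) (hCd : ∀ j n, 0 < Cd j n)
    (hCl : ∀ j, 0 < Cl j) :
    ∃ C : ℝ, 0 < C ∧ ∀ (V : Type) [NormedAddCommGroup V] [InnerProductSpace ℂ V] [CompleteSpace V]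
      (ph : Fin 3 → Tl → ℝ → ℂ) (ν : Fin 3 → Tl → ℝ), TriWP κ B Cd Cl ph ν →
      ∀ f : Fin 3 → ℝ → V, (∀ j, Integrable (f j)) → (∀ j x, ‖f j x‖ ≤ 1) →
      ∀ m : Fin 3 → ℝ, (∀ j, 0 < m j) → (∀ j, 0 < β j → ∫ x, ‖f j x‖ ≤ m j) →
      ∀ Λ₀ Λ₁ : ℝ, 0 < Λ₀ → 0 < Λ₁ →
      (∀ x, f 2 x ≠ 0 → ∀ I, x ∈ dint I → ∫ y, ‖f 0 y‖ * dw I y ≤ Λ₀ * dlen I) →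
      (∀ x, f 2 x ≠ 0 → ∀ I, x ∈ dint I → ∫ y, ‖f 1 y‖ * dw I y ≤ Λ₁ * dlen I) →
      ∀ U : Finset Tl, Sparse U →
      form ph f U ≤ C * (m 0 ^ β 0 * m 1 ^ β 1 * m 2 ^ β 2 * (Λ₀ ^ γ₀ * Λ₁ ^ γ₁)) := by
  classical
  have t2 := hθ 2
  set gap := (1 + θ 2) / 2 - β 2 with hgap
  have hgp : 0 < gap := by linarith
  obtain ⟨s, hs0, hs1, hsg⟩ : ∃ s : ℝ, 0 < s ∧ s ≤ 1 ∧ s * θ 2 < gap := by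
    refine ⟨min 1 (gap / (2 * θ 2)), lt_min one_pos (by positivity), min_le_left _ _, ?_⟩
    calc _ ≤ gap / (2 * θ 2) * θ 2 := by gcongr; exact min_le_right _ _
      _ = gap / 2 := by field_simp
      _ < gap := by linarith
  obtain ⟨N, hN1, hN⟩ : ∃ N : ℕ, 1 ≤ N ∧ 2 * γ₀ + 2 * γ₁ + 1 ≤ 2 * N * s * θ 2 := by
    obtain ⟨n, hn⟩ := exists_nat_gt ((2 * γ₀ + 2 * γ₁ + 1) / (2 * s * θ 2))
    refine ⟨n + 1, by omega, ?_⟩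
    rw [div_lt_iff₀ (by positivity)] at hn
    push_cast
    have : 0 < 2 * s * θ 2 := by positivity
    nlinarith
  obtain ⟨C, hC, hcl⟩ := exists_class_le hθ hsum hβ hβs κ B Cd Cl hCd hCl N hN1 hs0.le hs1
  set M := 2 * N * s * θ 2 with hM
  set ε₀ := (1 + θ 0) / 2 - β 0 - γ₀ with hε₀
  set ε₁ := (1 + θ 1) / 2 - β 1 - γ₁ with hε₁
  set ε₂ := gap - s * θ 2 with hε₂
  have e0 : 0 < ε₀ := by rw [hε₀]; linarith
  have e1 : 0 < ε₁ := by rw [hε₁]; linarith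
  have e2 : 0 < ε₂ := by rw [hε₂]; linarith
  have hhalf : ∀ ε : ℝ, 0 < ε → (1 / 2 : ℝ) ^ ε < 1 := fun ε h => rpow_lt_one (by norm_num) (by norm_num) h
  obtain ⟨G, hG, hgeo⟩ := exists_sum_geometric_le (a := 1 / 2) (b := (1 / 2) ^ ε₀) (c := (1 / 2) ^ ε₁)
    (d := (1 / 2) ^ ε₂) (by norm_num) (by norm_num) (by positivity) (hhalf _ e0) (by positivity)
    (hhalf _ e1) (by positivity) (hhalf _ e2)
  set A := (24 : ℝ) ^ γ₀ * 24 ^ γ₁ * 4 ^ ε₀ * 4 ^ ε₁ * 4 ^ ε₂ * 2 ^ M with hA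
  have hAp : 0 < A := by positivity
  refine ⟨C * A * G, by positivity, ?_⟩
  intro V _ _ _ ph ν hW f hf hf1 m hm hfm Λ₀ Λ₁ hΛ₀ hΛ₁ hΩ₀ hΩ₁ U hs
  have m0 := hm 0
  have m1 := hm 1
  have m2 := hm 2
  set R := m 0 ^ β 0 * m 1 ^ β 1 * m 2 ^ β 2 * (Λ₀ ^ γ₀ * Λ₁ ^ γ₁) with hR
  have hRp : 0 < R := by positivity
  by_cases hz : ∃ j, ∫ x, ‖f j x‖ = 0
  · obtain ⟨j, hj⟩ := hz
    rw [form_eq_zero hf hj]; positivity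
  push Not at hz
  have h2ne : ∃ x, f 2 x ≠ 0 := by
    by_contra! h
    exact hz 2 (by simp [h])
  have hk := fun (j : Fin 3) (P : Tl) => exists_density_level (hf1 j) (hf j) (hz j) P.1
  choose k hkup hklow using hk
  have hd := fun P : Tl => exists_dist_level h2ne P.1
  choose d hdn hdf using hd
  set lab : Tl → ℕ × ℕ × ℕ × ℕ := fun P => (d P, k 0 P, k 1 P, k 2 P) with hlab
  have key : ∀ c ∈ U.image lab, ∑ P ∈ U with lab P = c,
      dlen P.1 * (‖cf (ph 0) (f 0) P‖ * ‖cf (ph 1) (f 1) P‖ * ‖cf (ph 2) (f 2) P‖) ≤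
      C * A * R * ((1 / 2) ^ c.1 * (((1 / 2 : ℝ) ^ ε₀) ^ c.2.1 * (((1 / 2 : ℝ) ^ ε₁) ^ c.2.2.1 *
        ((1 / 2 : ℝ) ^ ε₂) ^ c.2.2.2))) := by
    rintro ⟨D, k0, k1, k2⟩ hc
    obtain ⟨P0, hP0, hP0c⟩ := Finset.mem_image.1 hc
    simp only [hlab, Prod.mk.injEq] at hP0c
    have hmem : ∀ P ∈ U.filter (fun P => lab P = (D, k0, k1, k2)),
        P ∈ U ∧ d P = D ∧ k 0 P = k0 ∧ k 1 P = k1 ∧ k 2 P = k2 := by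
      intro P hP
      obtain ⟨h1, h2⟩ := Finset.mem_filter.1 hP
      simp only [hlab, Prod.mk.injEq] at h2
      exact ⟨h1, h2⟩
    set kk : Fin 3 → ℕ := ![k0, k1, k2] with hkk
    have hkP : ∀ P, k 0 P = k0 ∧ k 1 P = k1 ∧ k 2 P = k2 → ∀ j, k j P = kk j := by
      rintro P ⟨h0, h1, h2⟩ j
      fin_cases j
      · exact h0
      · exact h1
      · exact h2
    set lam : Fin 3 → ℝ := fun j => 4 * (1 / 2) ^ kk j with hlam
    have hlp : ∀ j, 0 < lam j := fun j => by simp only [hlam]; positivity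
    have hmain := hcl V ph ν hW f hf hf1 m hm hfm (U.filter fun P => lab P = (D, k0, k1, k2))
      (hs.mono (Finset.filter_subset _ _)) lam hlp
      (by simp only [hlam]
          have : (1 / 2 : ℝ) ^ kk 2 ≤ 1 := pow_le_one₀ (by norm_num) (by norm_num)
          linarith)
      (fun j P hP I hI => by
        simp only [hlam]; rw [← hkP P (hmem P hP).2.2 j]; exact hkup j P I hI)
      (fun j P hP => by
        simp only [hlam]; rw [← hkP P (hmem P hP).2.2 j]; exact hklow j P)
      (2 ^ (D - 1)) (one_le_pow₀ one_le_two)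
      (by
        rcases Nat.eq_zero_or_pos D with h | h
        · left; rw [h]; norm_num
        · right
          intro P hP x hx
          have hdP := (hmem P hP).2.1
          rcases hdf P with h' | h'
          · omega
          · rw [hdP] at h'; exact h' x hx)
    unfold form at hmain
    refine hmain.trans ?_
    obtain ⟨x, hx, hxP⟩ := hdn P0
    rw [hP0c.1] at hxP
    have hl0 : lam 0 ≤ 24 * 4 ^ D * Λ₀ := by
      obtain ⟨I, hI, hlt⟩ := hklow 0 P0
      rw [hkP P0 hP0c.2 0] at hlt
      have h3 := density_le_of_near (hf 0) hI hxP (hΩ₀ x hx)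
      have := lt_of_mul_lt_mul_right (hlt.trans_le h3) (dlen_pos I).le
      simp only [hlam]; linarith
    have hl1 : lam 1 ≤ 24 * 4 ^ D * Λ₁ := by
      obtain ⟨I, hI, hlt⟩ := hklow 1 P0
      rw [hkP P0 hP0c.2 1] at hlt
      have h3 := density_le_of_near (hf 1) hI hxP (hΩ₁ x hx)
      have := lt_of_mul_lt_mul_right (hlt.trans_le h3) (dlen_pos I).le
      simp only [hlam]; linarith
    have lp0 := hlp 0
    have lp1 := hlp 1
    have lp2 := hlp 2
    have hD4 : (4 : ℝ) ^ D = 2 ^ ((2 : ℝ) * D) := by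
      rw [rpow_mul (by norm_num), rpow_natCast]; norm_num
    have hp0 : lam 0 ^ γ₀ ≤ 24 ^ γ₀ * 2 ^ (2 * D * γ₀) * Λ₀ ^ γ₀ := by
      calc lam 0 ^ γ₀ ≤ (24 * 4 ^ D * Λ₀) ^ γ₀ := by gcongr
        _ = _ := by
          rw [mul_rpow (by positivity) hΛ₀.le, mul_rpow (by norm_num) (by positivity), hD4,
            ← rpow_mul (by norm_num)]
    have hp1 : lam 1 ^ γ₁ ≤ 24 ^ γ₁ * 2 ^ (2 * D * γ₁) * Λ₁ ^ γ₁ := by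
      calc lam 1 ^ γ₁ ≤ (24 * 4 ^ D * Λ₁) ^ γ₁ := by gcongr
        _ = _ := by
          rw [mul_rpow (by positivity) hΛ₁.le, mul_rpow (by norm_num) (by positivity), hD4,
            ← rpow_mul (by norm_num)]
    have hDM : ((2 : ℝ) ^ (D - 1)) ^ (-M) ≤ 2 ^ M * 2 ^ (-(D * M)) := by
      have hMp : 0 ≤ M := by linarith
      rw [← rpow_natCast, ← rpow_mul (by norm_num), ← rpow_add (by norm_num)]
      refine rpow_le_rpow_of_exponent_le one_le_two ?_
      have : (D : ℝ) ≤ ((D - 1 : ℕ) : ℝ) + 1 := by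
        have h5 : D ≤ (D - 1) + 1 := by omega
        exact_mod_cast h5
      have h6 := mul_le_mul_of_nonneg_right this hMp
      rw [add_mul, one_mul] at h6
      rw [mul_neg]
      linarith
    have hDfin : (2 : ℝ) ^ (2 * D * γ₀) * 2 ^ (2 * D * γ₁) * 2 ^ (-(D * M)) ≤ (1 / 2) ^ D := by
      rw [← rpow_add (by norm_num), ← rpow_add (by norm_num), one_div, inv_pow, ← rpow_natCast,
        ← rpow_neg (by norm_num)]
      refine rpow_le_rpow_of_exponent_le one_le_two ?_
      have h6 := mul_le_mul_of_nonneg_left hN (Nat.cast_nonneg (α := ℝ) D)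
      have h7 : (D : ℝ) * (2 * γ₀ + 2 * γ₁ + 1) = 2 * D * γ₀ + 2 * D * γ₁ + D := by ring
      rw [h7] at h6
      linarith
    have s0 : lam 0 ^ ((1 + θ 0) / 2) = lam 0 ^ β 0 * lam 0 ^ γ₀ * lam 0 ^ ε₀ := by
      rw [← rpow_add lp0, ← rpow_add lp0]; congr 1; rw [hε₀]; ring
    have s1 : lam 1 ^ ((1 + θ 1) / 2) = lam 1 ^ β 1 * lam 1 ^ γ₁ * lam 1 ^ ε₁ := by
      rw [← rpow_add lp1, ← rpow_add lp1]; congr 1; rw [hε₁]; ring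
    have s2 : lam 2 ^ ((1 + θ 2) / 2 - s * θ 2) = lam 2 ^ β 2 * lam 2 ^ ε₂ := by
      rw [← rpow_add lp2]; congr 1; rw [hε₂, hgap]; ring
    have q0 : lam 0 ^ ε₀ = 4 ^ ε₀ * ((1 / 2 : ℝ) ^ ε₀) ^ k0 := rpow_half_pow k0
    have q1 : lam 1 ^ ε₁ = 4 ^ ε₁ * ((1 / 2 : ℝ) ^ ε₁) ^ k1 := rpow_half_pow k1
    have q2 : lam 2 ^ ε₂ = 4 ^ ε₂ * ((1 / 2 : ℝ) ^ ε₂) ^ k2 := rpow_half_pow k2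
    calc _ = C * (m 0 ^ β 0 * m 1 ^ β 1 * m 2 ^ β 2) * (lam 0 ^ γ₀ * lam 1 ^ γ₁ * ((2 : ℝ) ^ (D - 1)) ^ (-M)) *
          (lam 0 ^ ε₀ * lam 1 ^ ε₁ * lam 2 ^ ε₂) := by
          rw [s0, s1, s2, div_rpow m0.le lp0.le, div_rpow m1.le lp1.le, div_rpow m2.le lp2.le]
          have b0 := (rpow_pos_of_pos lp0 (β 0)).ne'
          have b1 := (rpow_pos_of_pos lp1 (β 1)).ne'
          have b2 := (rpow_pos_of_pos lp2 (β 2)).ne'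
          field_simp
      _ ≤ C * (m 0 ^ β 0 * m 1 ^ β 1 * m 2 ^ β 2) * ((24 ^ γ₀ * 2 ^ (2 * D * γ₀) * Λ₀ ^ γ₀) *
          (24 ^ γ₁ * 2 ^ (2 * D * γ₁) * Λ₁ ^ γ₁) * (2 ^ M * 2 ^ (-(D * M)))) *
          (lam 0 ^ ε₀ * lam 1 ^ ε₁ * lam 2 ^ ε₂) := by gcongr
      _ = C * R * (24 ^ γ₀ * 24 ^ γ₁ * 2 ^ M) * (lam 0 ^ ε₀ * lam 1 ^ ε₁ * lam 2 ^ ε₂) *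
          ((2 : ℝ) ^ (2 * D * γ₀) * 2 ^ (2 * D * γ₁) * 2 ^ (-(D * M))) := by rw [hR]; ring
      _ ≤ C * R * (24 ^ γ₀ * 24 ^ γ₁ * 2 ^ M) * (lam 0 ^ ε₀ * lam 1 ^ ε₁ * lam 2 ^ ε₂) * (1 / 2) ^ D := by
          gcongr
      _ = _ := by rw [q0, q1, q2, hA]; ring
  unfold form
  rw [← Finset.sum_fiberwise_of_maps_to (g := lab) (t := U.image lab)
    (fun P hP => Finset.mem_image_of_mem _ hP)]
  refine (Finset.sum_le_sum key).trans ?_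
  rw [← Finset.mul_sum]
  calc _ ≤ C * A * R * G := by
        gcongr
        exact hgeo _
    _ = _ := by ring

/-- The restricted-type estimate for arbitrary finite families of tiles. -/
theorem exists_restricted_le {θ : Fin 3 → ℝ} (hθ : ∀ j, 0 < θ j) (hsum : θ 0 + θ 1 + θ 2 = 1)
    {β : Fin 3 → ℝ} (hβ : ∀ j, 0 ≤ β j) (hβs : β 0 + β 1 + β 2 = 1)
    {γ₀ γ₁ : ℝ} (hγ₀ : 0 ≤ γ₀) (hγ₁ : 0 ≤ γ₁) (h₀ : γ₀ + β 0 < (1 + θ 0) / 2)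
    (h₁ : γ₁ + β 1 < (1 + θ 1) / 2) (h₂ : β 2 < (1 + θ 2) / 2)
    (κ B : Fin 3 → ℝ) (Cd : Fin 3 → ℕ → ℝ) (Cl : Fin 3 → ℝ) (hCd : ∀ j n, 0 < Cd j n)
    (hCl : ∀ j, 0 < Cl j) :
    ∃ C : ℝ, 0 < C ∧ ∀ (V : Type) [NormedAddCommGroup V] [InnerProductSpace ℂ V] [CompleteSpace V]
      (ph : Fin 3 → Tl → ℝ → ℂ) (ν : Fin 3 → Tl → ℝ), TriWP κ B Cd Cl ph ν →
      ∀ f : Fin 3 → ℝ → V, (∀ j, Integrable (f j)) → (∀ j x, ‖f j x‖ ≤ 1) →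
      ∀ m : Fin 3 → ℝ, (∀ j, 0 < m j) → (∀ j, 0 < β j → ∫ x, ‖f j x‖ ≤ m j) →
      ∀ Λ₀ Λ₁ : ℝ, 0 < Λ₀ → 0 < Λ₁ →
      (∀ x, f 2 x ≠ 0 → ∀ I, x ∈ dint I → ∫ y, ‖f 0 y‖ * dw I y ≤ Λ₀ * dlen I) →
      (∀ x, f 2 x ≠ 0 → ∀ I, x ∈ dint I → ∫ y, ‖f 1 y‖ * dw I y ≤ Λ₁ * dlen I) →
      ∀ U : Finset Tl,
      form ph f U ≤ C * (m 0 ^ β 0 * m 1 ^ β 1 * m 2 ^ β 2 * (Λ₀ ^ γ₀ * Λ₁ ^ γ₁)) := by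
  classical
  obtain ⟨C, hC, h⟩ := exists_sparse_restricted_le hθ hsum hβ hβs hγ₀ hγ₁ h₀ h₁ h₂ κ B Cd Cl hCd hCl
  refine ⟨896 * C, by positivity, ?_⟩
  intro V _ _ _ ph ν hW f hf hf1 m hm hfm Λ₀ Λ₁ hΛ₀ hΛ₁ hΩ₀ hΩ₁ U
  set lab : Tl → ℤ × ℤ := fun P => (P.1.1 % 7, P.2 % 128) with hlab
  have hmap : ∀ P ∈ U, lab P ∈ Finset.Ico (0 : ℤ) 7 ×ˢ Finset.Ico (0 : ℤ) 128 := by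
    intro P _
    simp only [hlab, Finset.mem_product, Finset.mem_Ico]
    omega
  have e : form ph f U = ∑ c ∈ Finset.Ico (0 : ℤ) 7 ×ˢ Finset.Ico (0 : ℤ) 128,
      form ph f (U.filter fun P => lab P = c) := by
    unfold form
    rw [Finset.sum_fiberwise_of_maps_to hmap]
  rw [e]
  refine (Finset.sum_le_card_nsmul _ _ (C * (m 0 ^ β 0 * m 1 ^ β 1 * m 2 ^ β 2 * (Λ₀ ^ γ₀ * Λ₁ ^ γ₁)))
    fun c _ => ?_).trans (le_of_eq ?_)
  · refine h V ph ν hW f hf hf1 m hm hfm Λ₀ Λ₁ hΛ₀ hΛ₁ hΩ₀ hΩ₁ _ fun P hP P' hP' => ?_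
    have h1 := (Finset.mem_filter.1 hP).2
    have h2 := (Finset.mem_filter.1 hP').2
    simp only [hlab] at h1 h2
    rw [← h2, Prod.mk.injEq] at h1
    constructor <;> intro hne
    · rw [le_abs']; omega
    · rw [le_abs']; omega
  · rw [Finset.card_product, nsmul_eq_mul]
    simp only [Int.card_Ico]
    rw [show (7 - 0 : ℤ).toNat = 7 from rfl, show (128 - 0 : ℤ).toNat = 128 from rfl]
    push_cast
    ring

/-- The frequency of the `j`-th packet at the parameter `(t, η, y)`. -/
noncomputable def fr (j : Fin 3) (z : ℝ × ℝ × ℝ) : ℝ :=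
  ![z.2.1 - 32 / z.1, z.2.1 + 32 / z.1, 2 * z.2.1] j

section
variable {V : Type*} [NormedAddCommGroup V] [InnerProductSpace ℂ V]

/-- The continuous wave packet transform. -/
noncomputable def pf (φ : ℝ → ℂ) (f : ℝ → V) (t ν y : ℝ) : V := ∫ x, pkt φ t ν y x • f x

/-- The product of the three wave packet transforms. -/
noncomputable def tri (φ : Fin 3 → SchwartzMap ℝ ℂ) (f : Fin 3 → ℝ → V) (z : ℝ × ℝ × ℝ) : ℝ≥0∞ :=
  ∏ j, ‖pf (φ j) (f j) z.1 (fr j z) z.2.2‖ₑ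

/-- The continuous trilinear model form, with absolute values inside. -/
noncomputable def triN (φ : Fin 3 → SchwartzMap ℝ ℂ) (f : Fin 3 → ℝ → V) : ℝ≥0∞ :=
  ∫⁻ z in Ioi 0 ×ˢ univ, tri φ f z

/-- The region of the parameter space attached to a tile. -/
def cell (P : Tl) : Set (ℝ × ℝ × ℝ) :=
  Ico (dlen P.1) (2 * dlen P.1) ×ˢ (Ico ((dlen P.1)⁻¹ * P.2) ((dlen P.1)⁻¹ * (P.2 + 1)) ×ˢ dint P.1)

lemma measurable_fr (j : Fin 3) : Measurable (fr j) := by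
  unfold fr
  fin_cases j
  · exact (measurable_fst.comp measurable_snd).sub (measurable_const.div measurable_fst)
  · exact (measurable_fst.comp measurable_snd).add (measurable_const.div measurable_fst)
  · exact (measurable_fst.comp measurable_snd).const_mul 2

lemma aestronglyMeasurable_pf (φ : SchwartzMap ℝ ℂ) {f : ℝ → V} (hf : AEStronglyMeasurable f) (j : Fin 3) :
    StronglyMeasurable fun z : ℝ × ℝ × ℝ => pf φ f z.1 (fr j z) z.2.2 := by
  have e : (fun z : ℝ × ℝ × ℝ => pf φ f z.1 (fr j z) z.2.2) =
      fun z => ∫ x, pkt φ z.1 (fr j z) z.2.2 x • hf.mk f x := by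
    ext z
    exact integral_congr_ae (by filter_upwards [hf.ae_eq_mk] with x hx; rw [hx])
  rw [e]
  refine StronglyMeasurable.integral_prod_right'
    (f := fun p : (ℝ × ℝ × ℝ) × ℝ => pkt φ p.1.1 (fr j p.1) p.1.2.2 p.2 • hf.mk f p.2) ?_
  refine StronglyMeasurable.smul ?_ (hf.stronglyMeasurable_mk.comp_measurable measurable_snd)
  refine Measurable.stronglyMeasurable ?_
  have h1 : Measurable fun p : (ℝ × ℝ × ℝ) × ℝ => fr j p.1 := (measurable_fr j).comp measurable_fst
  have h2 : Measurable (φ : ℝ → ℂ) := φ.continuous.measurable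
  have h3 : Measurable ee := continuous_ee.measurable
  unfold pkt
  fun_prop

lemma measurable_tri (φ : Fin 3 → SchwartzMap ℝ ℂ) {f : Fin 3 → ℝ → V}
    (hf : ∀ j, AEStronglyMeasurable (f j)) : Measurable (tri φ f) := by
  unfold tri
  exact Finset.measurable_prod _ fun j _ => (aestronglyMeasurable_pf (φ j) (hf j) j).enorm

lemma volume_cell (P : Tl) : volume (cell P) = ENNReal.ofReal (dlen P.1) := by
  have hl := dlen_pos P.1
  unfold cell
  rw [Measure.volume_eq_prod, Measure.prod_prod, Measure.volume_eq_prod, Measure.prod_prod, volume_dint,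
    Real.volume_Ico, Real.volume_Ico, ← ENNReal.ofReal_mul (by rw [← mul_sub]; ring_nf; positivity),
    ← ENNReal.ofReal_mul (by linarith)]
  congr 1
  field_simp
  ring

lemma measurableSet_cell (P : Tl) : MeasurableSet (cell P) :=
  measurableSet_Ico.prod (measurableSet_Ico.prod (measurableSet_dint _))

lemma subset_iUnion_cell : (Ioi 0 ×ˢ univ : Set (ℝ × ℝ × ℝ)) ⊆ ⋃ P, cell P := by
  rintro ⟨t, η, y⟩ ⟨ht, -⟩
  obtain ⟨k, hk⟩ := exists_mem_Ico_zpow (show 0 < t from ht) one_lt_two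
  have hp : (0 : ℝ) < 2 ^ k := by positivity
  have hd : dlen (dat k y) = 2 ^ k := rfl
  refine mem_iUnion.2 ⟨(dat k y, ⌊2 ^ k * η⌋), ?_⟩
  refine ⟨⟨by simpa [hd] using hk.1, ?_⟩, ⟨?_, ?_⟩, mem_dat k y⟩
  · have := hk.2
    rw [zpow_add_one₀ two_ne_zero] at this
    simp only [hd]; linarith
  · simp only [hd]
    rw [inv_mul_le_iff₀ hp]; exact Int.floor_le _
  · simp only [hd]
    rw [lt_inv_mul_iff₀ hp]; exact Int.lt_floor_add_one _

lemma exists_enorm_pf_le (φ : SchwartzMap ℝ ℂ) {f : ℝ → V} (hf : Integrable f) :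
    ∃ C : ℝ, 0 ≤ C ∧ ∀ t ν y : ℝ, 0 < t → ‖pf φ f t ν y‖ ≤ C * t⁻¹ := by
  obtain ⟨C, hC, h⟩ := schwartz_decay φ 0
  refine ⟨C * ∫ x, ‖f x‖, by positivity, fun t ν y ht => ?_⟩
  have e : C * (∫ x, ‖f x‖) * t⁻¹ = ∫ x, t⁻¹ * C * ‖f x‖ := by rw [integral_const_mul]; ring
  rw [e]
  refine norm_integral_le_of_norm_le (hf.norm.const_mul _) (ae_of_all _ fun x => ?_)
  rw [norm_smul]
  gcongr
  have := norm_pkt_le h ht ν y x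
  simpa using this

lemma exists_point (φ : Fin 3 → SchwartzMap ℝ ℂ) {f : Fin 3 → ℝ → V} (hf : ∀ j, Integrable (f j)) (P : Tl) :
    ∃ z ∈ cell P, ∫⁻ z in cell P, tri φ f z ≤ ENNReal.ofReal (dlen P.1) * tri φ f z := by
  have hl := dlen_pos P.1
  choose C hC hb using fun j => exists_enorm_pf_le (φ j) (hf j)
  have hbd : ∀ z ∈ cell P, tri φ f z ≤ ENNReal.ofReal (∏ j, (C j * (dlen P.1)⁻¹)) := by
    intro z hz
    have hz1 : dlen P.1 ≤ z.1 := hz.1.1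
    unfold tri
    rw [ENNReal.ofReal_prod_of_nonneg fun j _ => mul_nonneg (hC j) (inv_nonneg.2 hl.le)]
    refine Finset.prod_le_prod' fun j _ => ?_
    rw [← ofReal_norm]
    refine ENNReal.ofReal_le_ofReal ((hb j _ _ _ (hl.trans_le hz1)).trans ?_)
    have := hC j
    gcongr
  by_contra! hcon
  have hfin : ∫⁻ z in cell P, tri φ f z ≠ ∞ := by
    refine ne_of_lt (lt_of_le_of_lt (setLIntegral_mono measurable_const hbd) ?_)
    rw [setLIntegral_const, volume_cell]
    exact ENNReal.mul_lt_top ENNReal.ofReal_lt_top ENNReal.ofReal_lt_top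
  have hl' : ENNReal.ofReal (dlen P.1) ≠ 0 := by simpa using hl
  have hne : volume.restrict (cell P) ≠ 0 := by
    rw [Ne, Measure.restrict_eq_zero, volume_cell]; exact hl'
  obtain ⟨z, hz, h⟩ := exists_notMem_null_laverage_le hne hfin
    (N := (cell P)ᶜ) (by rw [Measure.restrict_apply (measurableSet_cell P).compl]; simp)
  have := hcon z (by simpa using hz)
  rw [setLAverage_eq, volume_cell] at h
  rw [ENNReal.div_le_iff hl' ENNReal.ofReal_ne_top, mul_comm] at h
  exact absurd h (not_le.2 this)

/-- The model form is controlled by the discrete forms. -/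
lemma triN_le {φ : Fin 3 → SchwartzMap ℝ ℂ} {f : Fin 3 → ℝ → V} (hf : ∀ j, Integrable (f j)) {M : ℝ}
    (h : ∀ z : Tl → ℝ × ℝ × ℝ, (∀ P, z P ∈ cell P) → ∀ U : Finset Tl,
      form (fun j P => pkt (φ j) (z P).1 (fr j (z P)) (z P).2.2) f U ≤ M) :
    triN φ f ≤ ENNReal.ofReal M := by
  choose z hz hle using exists_point φ hf
  calc triN φ f ≤ ∫⁻ z in ⋃ P, cell P, tri φ f z := lintegral_mono_set subset_iUnion_cell
    _ ≤ ∑' P, ∫⁻ z in cell P, tri φ f z := lintegral_iUnion_le _ _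
    _ ≤ ∑' P, ENNReal.ofReal (dlen P.1) * tri φ f (z P) := ENNReal.tsum_le_tsum hle
    _ ≤ _ := by
      rw [ENNReal.tsum_eq_iSup_sum]
      refine iSup_le fun U => ?_
      refine le_trans (le_of_eq ?_) (ENNReal.ofReal_le_ofReal (h z hz U))
      unfold form
      rw [ENNReal.ofReal_sum_of_nonneg fun P _ => by have := dlen_pos P.1; positivity]
      refine Finset.sum_congr rfl fun P _ => ?_
      rw [ENNReal.ofReal_mul (dlen_pos _).le, ENNReal.ofReal_mul (by positivity),
        ENNReal.ofReal_mul (by positivity)]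
      simp only [tri, Fin.prod_univ_three, ofReal_norm]
      rfl

end

/-- The packets attached to arbitrary points of the cells form an admissible family. -/
lemma exists_TriWP (φ : Fin 3 → SchwartzMap ℝ ℂ)
    (hφ : ∀ j ξ, 1 ≤ |ξ| → 𝓕 (φ j : ℝ → ℂ) ξ = 0) :
    ∃ (κ B : Fin 3 → ℝ) (Cd : Fin 3 → ℕ → ℝ) (Cl : Fin 3 → ℝ),
      ∀ z : Tl → ℝ × ℝ × ℝ, (∀ P, z P ∈ cell P) →
      TriWP κ B Cd Cl (fun j P => pkt (φ j) (z P).1 (fr j (z P)) (z P).2.2) (fun j P => fr j (z P)) := by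
  obtain ⟨Cd0, Cl0, h0⟩ := exists_WP (φ 0) (hφ 0) 1 33 (by norm_num) (by norm_num) (by norm_num) (by norm_num)
  obtain ⟨Cd1, Cl1, h1⟩ := exists_WP (φ 1) (hφ 1) 1 33 (by norm_num) (by norm_num) (by norm_num) (by norm_num)
  obtain ⟨Cd2, Cl2, h2⟩ := exists_WP (φ 2) (hφ 2) 2 2 (by norm_num) (by norm_num) (by norm_num) (by norm_num)
  refine ⟨![1, 1, 2], ![33, 33, 2], ![Cd0, Cd1, Cd2], ![Cl0, Cl1, Cl2], fun z hz => ?_⟩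
  have ht : ∀ P, dlen P.1 ≤ (z P).1 ∧ (z P).1 ≤ 2 * dlen P.1 := fun P => ⟨(hz P).1.1, (hz P).1.2.le⟩
  have hy : ∀ P, |(z P).2.2 - dcen P.1| ≤ dlen P.1 := fun P => by
    have := abs_sub_dcen (hz P).2.2
    linarith [dlen_pos P.1]
  have hη : ∀ P : Tl, P.2 ≤ dlen P.1 * (z P).2.1 ∧ dlen P.1 * (z P).2.1 ≤ P.2 + 1 := fun P => by
    obtain ⟨a, b⟩ := (hz P).2.1
    have hl := dlen_pos P.1
    rw [inv_mul_le_iff₀ hl] at a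
    rw [lt_inv_mul_iff₀ hl] at b
    exact ⟨a, b.le⟩
  have hs : ∀ P : Tl, 16 ≤ dlen P.1 * (32 / (z P).1) ∧ dlen P.1 * (32 / (z P).1) ≤ 32 := fun P => by
    obtain ⟨a, b⟩ := ht P
    have hl := dlen_pos P.1
    have hzp : 0 < (z P).1 := hl.trans_le a
    rw [← mul_div_assoc, le_div_iff₀ hzp, div_le_iff₀ hzp]
    constructor <;> linarith
  constructor
  · intro j
    fin_cases j
    · refine h0 _ _ _ ht hy fun P => ?_
      have := hη P; have := hs P
      show |((z P).2.1 - 32 / (z P).1) * dlen P.1 - 1 * P.2| ≤ 33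
      have e : ((z P).2.1 - 32 / (z P).1) * dlen P.1 - 1 * P.2 =
        dlen P.1 * (z P).2.1 - P.2 - dlen P.1 * (32 / (z P).1) := by ring
      rw [e, abs_le]; constructor <;> linarith
    · refine h1 _ _ _ ht hy fun P => ?_
      have := hη P; have := hs P
      show |((z P).2.1 + 32 / (z P).1) * dlen P.1 - 1 * P.2| ≤ 33
      have e : ((z P).2.1 + 32 / (z P).1) * dlen P.1 - 1 * P.2 =
        dlen P.1 * (z P).2.1 - P.2 + dlen P.1 * (32 / (z P).1) := by ring
      rw [e, abs_le]; constructor <;> linarith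
    · refine h2 _ _ _ ht hy fun P => ?_
      have := hη P
      show |(2 * (z P).2.1) * dlen P.1 - 2 * P.2| ≤ 2
      have e : (2 * (z P).2.1) * dlen P.1 - 2 * P.2 = 2 * (dlen P.1 * (z P).2.1 - P.2) := by ring
      rw [e, abs_le]; constructor <;> linarith
  · intro P ξ hF
    have hl := dlen_pos P.1
    have key : ∀ j, ¬ (|dlen P.1 * (fr j (z P) - (![1, 1, 2] : Fin 3 → ℝ) j * ξ)| < 4) →
        ∃ b, Lac ((![1, 1, 2] : Fin 3 → ℝ) j) (fun P => fr j (z P)) (sg b) ξ P := by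
      intro j hj
      rw [not_lt, le_abs] at hj
      rcases hj with h | h
      · refine ⟨true, hF, ?_⟩
        rw [← div_eq_mul_inv, div_le_iff₀ hl]
        simp only [sg, if_true]; linarith
      · refine ⟨false, hF, ?_⟩
        rw [← div_eq_mul_inv, div_le_iff₀ hl]
        simp only [sg, Bool.false_eq_true, if_false]; linarith
    have e0 : dlen P.1 * (fr 0 (z P) - (![1, 1, 2] : Fin 3 → ℝ) 0 * ξ) =
      dlen P.1 * (z P).2.1 - dlen P.1 * (32 / (z P).1) - dlen P.1 * ξ := by simp [fr]; ring
    have e1 : dlen P.1 * (fr 1 (z P) - (![1, 1, 2] : Fin 3 → ℝ) 1 * ξ) =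
      dlen P.1 * (z P).2.1 + dlen P.1 * (32 / (z P).1) - dlen P.1 * ξ := by simp [fr]; ring
    have e2 : dlen P.1 * (fr 2 (z P) - (![1, 1, 2] : Fin 3 → ℝ) 2 * ξ) =
      2 * (dlen P.1 * (z P).2.1) - 2 * (dlen P.1 * ξ) := by simp [fr]; ring
    have := hη P; have := hs P
    by_cases n0 : |dlen P.1 * (fr 0 (z P) - (![1, 1, 2] : Fin 3 → ℝ) 0 * ξ)| < 4
    · refine ⟨0, fun j hj => key j ?_⟩
      rw [e0, abs_lt] at n0
      fin_cases j
      · exact absurd rfl hj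
      · intro h
        erw [e1, abs_lt] at h
        linarith [h.1, h.2, n0.1, n0.2]
      · intro h
        erw [e2, abs_lt] at h
        linarith [h.1, h.2, n0.1, n0.2]
    by_cases n1 : |dlen P.1 * (fr 1 (z P) - (![1, 1, 2] : Fin 3 → ℝ) 1 * ξ)| < 4
    · refine ⟨1, fun j hj => key j ?_⟩
      rw [e1, abs_lt] at n1
      fin_cases j
      · exact n0
      · exact absurd rfl hj
      · intro h
        erw [e2, abs_lt] at h
        linarith [h.1, h.2, n1.1, n1.2]
    · refine ⟨2, fun j hj => key j ?_⟩
      fin_cases j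
      · exact n0
      · exact n1
      · exact absurd rfl hj

/-- The gain in the restricted-type estimate for a function supported on a set of relative size `x`. -/
noncomputable def gain (a ε x : ℝ) : ℝ := if x < 1 then x ^ (a + ε) else x ^ (a / 8)

lemma gain_nonneg (a ε : ℝ) {x : ℝ} (hx : 0 ≤ x) : 0 ≤ gain a ε x := by
  unfold gain; split_ifs <;> positivity

/-- The restricted-type estimate for the continuous model form. -/
lemma exists_tri_restricted_le (φ : Fin 3 → SchwartzMap ℝ ℂ)
    (hφ : ∀ j ξ, 1 ≤ |ξ| → 𝓕 (φ j : ℝ → ℂ) ξ = 0)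
    {θ : Fin 3 → ℝ} (hθ : ∀ j, 0 < θ j) (hsum : θ 0 + θ 1 + θ 2 = 1)
    {β : Fin 3 → ℝ} (hβ : ∀ j, 0 ≤ β j) (hβs : β 0 + β 1 + β 2 = 1)
    {γ₀ γ₁ : ℝ} (hγ₀ : 0 ≤ γ₀) (hγ₁ : 0 ≤ γ₁) (h₀ : γ₀ + β 0 < (1 + θ 0) / 2)
    (h₁ : γ₁ + β 1 < (1 + θ 1) / 2) (h₂ : β 2 < (1 + θ 2) / 2) :
    ∃ C : ℝ, 0 < C ∧ ∀ (V : Type) [NormedAddCommGroup V] [InnerProductSpace ℂ V] [CompleteSpace V]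
      (f : Fin 3 → ℝ → V), (∀ j, Integrable (f j)) → (∀ j x, ‖f j x‖ ≤ 1) →
      ∀ μ x y : ℝ, 0 < μ → 0 < x → 0 < y → (0 < β 0 → ∫ z, ‖f 0 z‖ ≤ x * μ) →
      (0 < β 1 → ∫ z, ‖f 1 z‖ ≤ y * μ) → (∫ z, ‖f 2 z‖ ≤ μ) →
      ∀ Λ₀ Λ₁ : ℝ, 0 < Λ₀ → 0 < Λ₁ →
      (∀ x, f 2 x ≠ 0 → ∀ I, x ∈ dint I → ∫ y, ‖f 0 y‖ * dw I y ≤ Λ₀ * dlen I) →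
      (∀ x, f 2 x ≠ 0 → ∀ I, x ∈ dint I → ∫ y, ‖f 1 y‖ * dw I y ≤ Λ₁ * dlen I) →
      triN φ f ≤ ENNReal.ofReal (C * (μ * (x ^ β 0 * Λ₀ ^ γ₀) * (y ^ β 1 * Λ₁ ^ γ₁))) := by
  obtain ⟨κ, B, Cd, Cl, hT⟩ := exists_TriWP φ hφ
  have hz0 : ∀ P : Tl, ((dlen P.1, (dlen P.1)⁻¹ * P.2, dcen P.1) : ℝ × ℝ × ℝ) ∈ cell P := fun P => by
    have hl := dlen_pos P.1
    exact ⟨⟨le_rfl, by simp only; linarith⟩, ⟨le_rfl, by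
      show (dlen P.1)⁻¹ * (P.2 : ℝ) < (dlen P.1)⁻¹ * (P.2 + 1)
      gcongr; linarith⟩, dcen_mem _⟩
  have hT0 := hT _ hz0
  obtain ⟨C, hC, h⟩ := exists_restricted_le hθ hsum hβ hβs hγ₀ hγ₁ h₀ h₁ h₂ κ B Cd Cl
    (fun j n => (hT0.wp j).Cd_pos n) (fun j => (hT0.wp j).Cl_pos)
  refine ⟨C, hC, ?_⟩
  intro V _ _ _ f hf hf1 μ x y hμ hx hy hm0 hm1 hm2 Λ₀ Λ₁ hΛ₀ hΛ₁ hΩ₀ hΩ₁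
  refine triN_le hf fun z hz U => ?_
  refine (h V _ _ (hT z hz) f hf hf1 ![x * μ, y * μ, μ] ?_ ?_ Λ₀ Λ₁ hΛ₀ hΛ₁ hΩ₀ hΩ₁ U).trans (le_of_eq ?_)
  · intro j
    fin_cases j
    · exact mul_pos hx hμ
    · exact mul_pos hy hμ
    · exact hμ
  · intro j hj
    fin_cases j
    · exact hm0 hj
    · exact hm1 hj
    · exact hm2
  · have e : μ = μ ^ β 0 * μ ^ β 1 * μ ^ β 2 := by
      rw [← rpow_add hμ, ← rpow_add hμ, hβs, rpow_one]
    show C * ((x * μ) ^ β 0 * (y * μ) ^ β 1 * μ ^ β 2 * (Λ₀ ^ γ₀ * Λ₁ ^ γ₁)) = _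
    rw [mul_rpow hx.le hμ.le, mul_rpow hy.le hμ.le]
    nth_rewrite 4 [e]
    ring

lemma rpow_mul_rpow_le_gain {a ε β γ K x : ℝ} (hx : 0 < x) (hx1 : x < 1) (hK : 0 < K)
    (hε : 0 ≤ ε) (hγ : γ ≤ 1) (h' : a + 2 * ε ≤ β + γ) : x ^ β * (K * x ^ (1 - ε)) ^ γ ≤ K ^ γ * gain a ε x := by
  have h : a + ε ≤ β + γ * (1 - ε) := by nlinarith
  rw [gain, if_pos hx1, mul_rpow hK.le (by positivity), ← rpow_mul hx.le]
  calc x ^ β * (K ^ γ * x ^ ((1 - ε) * γ)) = K ^ γ * x ^ (β + γ * (1 - ε)) := by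
        rw [rpow_add hx, mul_comm γ]; ring
    _ ≤ K ^ γ * x ^ (a + ε) := by
        gcongr ?_ * ?_
        exact rpow_le_rpow_of_exponent_ge hx hx1.le h

lemma mul_mul_mul_le_of_le {C μ X X' Y Y' : ℝ} (hC : 0 ≤ C) (hμ : 0 ≤ μ) (hX : 0 ≤ X) (hY : 0 ≤ Y)
    (h : X ≤ X') (h' : Y ≤ Y') : C * (μ * X * Y) ≤ C * (μ * X' * Y') := by
  have := hX.trans h
  gcongr

lemma integral_mul_dw_le {V : Type*} [NormedAddCommGroup V] {f : ℝ → V}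
    (h1 : ∀ x, ‖f x‖ ≤ 1) (I : ℤ × ℤ) : ∫ y, ‖f y‖ * dw I y ≤ 4 * dlen I := by
  calc ∫ y, ‖f y‖ * dw I y ≤ ∫ y, dw I y := by
        refine integral_mono_of_nonneg (ae_of_all _ fun y => mul_nonneg (norm_nonneg _) (dw_pos I y).le)
          (integrable_dw I) (ae_of_all _ fun y => ?_)
        exact mul_le_of_le_one_left (dw_pos I y).le (h1 y)
    _ = π * dlen I := integral_dw I
    _ ≤ _ := by
        have := dlen_pos I
        gcongr
        exact pi_le_four

set_option maxHeartbeats 2000000 in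
/-- The restricted weak-type estimate for the model form. -/
theorem exists_tri_le (φ : Fin 3 → SchwartzMap ℝ ℂ)
    (hφ : ∀ j ξ, 1 ≤ |ξ| → 𝓕 (φ j : ℝ → ℂ) ξ = 0) {a b : ℝ} (ha : 0 ≤ a) (ha1 : a < 1) (hb : 0 ≤ b)
    (hb1 : b < 1) (hab : 0 < a + b) (hab' : a + b < 3 / 2) :
    ∃ ε : ℝ, 0 < ε ∧ ε < 1 ∧ ∀ K : ℝ, 0 < K → ∃ C : ℝ, 0 < C ∧
      ∀ (V : Type) [NormedAddCommGroup V] [InnerProductSpace ℂ V] [CompleteSpace V]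
      (f : Fin 3 → ℝ → V), (∀ j, Integrable (f j)) → (∀ j x, ‖f j x‖ ≤ 1) →
      ∀ μ x y : ℝ, 0 < μ → 0 < x → 0 < y → (0 < a → ∫ z, ‖f 0 z‖ ≤ x * μ) →
      (0 < b → ∫ z, ‖f 1 z‖ ≤ y * μ) → (∫ z, ‖f 2 z‖ ≤ μ) →
      (x < 1 → 0 < a ∧ ∀ z, f 2 z ≠ 0 → ∀ I, z ∈ dint I →
        ∫ y, ‖f 0 y‖ * dw I y ≤ K * x ^ (1 - ε) * dlen I) →
      (y < 1 → 0 < b ∧ ∀ z, f 2 z ≠ 0 → ∀ I, z ∈ dint I →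
        ∫ x, ‖f 1 x‖ * dw I x ≤ K * y ^ (1 - ε) * dlen I) →
      triN φ f ≤ ENNReal.ofReal (C * (μ * gain a ε x * gain b ε y)) := by
  set A := max (2 * a - 1) 0 with hA
  set B := max (2 * b - 1) 0 with hB
  have A1 : 2 * a - 1 ≤ A := le_max_left _ _
  have A0 : 0 ≤ A := le_max_right _ _
  have B1 : 2 * b - 1 ≤ B := le_max_left _ _
  have B0 : 0 ≤ B := le_max_right _ _
  have AB : A + B < 1 := by
    rcases max_choice (2 * a - 1) 0 with h | h <;> rcases max_choice (2 * b - 1) 0 with h' | h' <;>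
      rw [← hA] at h <;> rw [← hB] at h' <;> linarith
  set d := (1 - A - B) / 3 with hd
  have hd0 : 0 < d := by rw [hd]; linarith
  have hd1 : d ≤ 1 / 3 := by rw [hd]; linarith
  have hABd : A + B + 3 * d = 1 := by rw [hd]; ring
  clear_value d A B
  obtain ⟨ε, hε0, hεd, hεa, hεb⟩ : ∃ ε : ℝ, 0 < ε ∧ ε ≤ d / 8 ∧ ε ≤ (1 - a) / 8 ∧ ε ≤ (1 - b) / 8 :=
    ⟨min (d / 8) (min ((1 - a) / 8) ((1 - b) / 8)),
      lt_min (by linarith) (lt_min (by linarith) (by linarith)), min_le_left _ _,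
      (min_le_right _ _).trans (min_le_left _ _), (min_le_right _ _).trans (min_le_right _ _)⟩
  refine ⟨ε, hε0, by linarith, fun K hK => ?_⟩
  set s₀ := (1 + (A + d)) / 2 - d / 4 with hs₀
  set s₁ := (1 + (B + d)) / 2 - d / 4 with hs₁
  obtain ⟨C1, hC1, H1⟩ := exists_tri_restricted_le φ hφ (θ := ![A + d, B + d, d])
    (by intro j; fin_cases j
        · show 0 < A + d; linarith
        · show 0 < B + d; linarith
        · exact hd0)
    (by show A + d + (B + d) + d = 1; linarith) (β := ![1 / 3, 1 / 3, 1 / 3])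
    (by intro j; fin_cases j <;> norm_num) (by show (1 / 3 : ℝ) + 1 / 3 + 1 / 3 = 1; norm_num)
    (γ₀ := s₀ - 1 / 3) (γ₁ := s₁ - 1 / 3) (by linarith) (by linarith)
    (by show s₀ - 1 / 3 + 1 / 3 < (1 + (A + d)) / 2; linarith)
    (by show s₁ - 1 / 3 + 1 / 3 < (1 + (B + d)) / 2; linarith)
    (by show (1 / 3 : ℝ) < (1 + d) / 2; linarith)
  set db := (1 - b) / 8 with hdb
  have hdb0 : 0 < db := by rw [hdb]; linarith
  have hdb1 : db ≤ 1 / 8 := by rw [hdb]; linarith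
  obtain ⟨C2, hC2, H2⟩ := exists_tri_restricted_le φ hφ (θ := ![db, 1 - 2 * db, db])
    (by intro j; fin_cases j
        · exact hdb0
        · show 0 < 1 - 2 * db; linarith
        · exact hdb0)
    (by show db + (1 - 2 * db) + db = 1; ring) (β := ![a / 8, 3 / 4, 1 / 4 - a / 8])
    (by intro j; fin_cases j
        · show 0 ≤ a / 8; linarith
        · show (0 : ℝ) ≤ 3 / 4; norm_num
        · show 0 ≤ 1 / 4 - a / 8; linarith)
    (by show a / 8 + 3 / 4 + (1 / 4 - a / 8) = 1; ring)
    (γ₀ := 0) (γ₁ := 1 - 2 * db - 3 / 4) le_rfl (by linarith)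
    (by show 0 + a / 8 < (1 + db) / 2; linarith)
    (by show 1 - 2 * db - 3 / 4 + 3 / 4 < (1 + (1 - 2 * db)) / 2; linarith)
    (by show 1 / 4 - a / 8 < (1 + db) / 2; linarith)
  set da := (1 - a) / 8 with hda
  have hda0 : 0 < da := by rw [hda]; linarith
  have hda1 : da ≤ 1 / 8 := by rw [hda]; linarith
  obtain ⟨C3, hC3, H3⟩ := exists_tri_restricted_le φ hφ (θ := ![1 - 2 * da, da, da])
    (by intro j; fin_cases j
        · show 0 < 1 - 2 * da; linarith
        · exact hda0
        · exact hda0)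
    (by show 1 - 2 * da + da + da = 1; ring) (β := ![3 / 4, b / 8, 1 / 4 - b / 8])
    (by intro j; fin_cases j
        · show (0 : ℝ) ≤ 3 / 4; norm_num
        · show 0 ≤ b / 8; linarith
        · show 0 ≤ 1 / 4 - b / 8; linarith)
    (by show 3 / 4 + b / 8 + (1 / 4 - b / 8) = 1; ring)
    (γ₀ := 1 - 2 * da - 3 / 4) (γ₁ := 0) (by linarith) le_rfl
    (by show 1 - 2 * da - 3 / 4 + 3 / 4 < (1 + (1 - 2 * da)) / 2; linarith)
    (by show 0 + b / 8 < (1 + da) / 2; linarith)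
    (by show 1 / 4 - b / 8 < (1 + da) / 2; linarith)
  set e := (a + b) / 16 with he
  have he0 : 0 < e := by rw [he]; linarith
  have he1 : e ≤ 1 / 8 := by rw [he]; linarith
  obtain ⟨C4, hC4, H4⟩ := exists_tri_restricted_le φ hφ (θ := ![e, e, 1 - 2 * e])
    (by intro j; fin_cases j
        · exact he0
        · exact he0
        · show 0 < 1 - 2 * e; linarith)
    (by show e + e + (1 - 2 * e) = 1; ring) (β := ![a / 8, b / 8, 1 - (a + b) / 8])
    (by intro j; fin_cases j
        · show 0 ≤ a / 8; linarith
        · show 0 ≤ b / 8; linarith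
        · show 0 ≤ 1 - (a + b) / 8; linarith)
    (by show a / 8 + b / 8 + (1 - (a + b) / 8) = 1; ring)
    (γ₀ := 0) (γ₁ := 0) le_rfl le_rfl
    (by show 0 + a / 8 < (1 + e) / 2; linarith)
    (by show 0 + b / 8 < (1 + e) / 2; linarith)
    (by show 1 - (a + b) / 8 < (1 + (1 - 2 * e)) / 2; linarith)
  set K1 := K ^ (s₀ - 1 / 3) with hK1
  set K2 := K ^ (s₁ - 1 / 3) with hK2
  set K3 := K ^ (1 - 2 * db - 3 / 4) with hK3
  set K4 := K ^ (1 - 2 * da - 3 / 4) with hK4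
  have K1p : 0 < K1 := by positivity
  have K2p : 0 < K2 := by positivity
  have K3p : 0 < K3 := by positivity
  have K4p : 0 < K4 := by positivity
  refine ⟨C1 * K1 * K2 + C2 * K3 + C3 * K4 + C4, by positivity, ?_⟩
  intro V _ _ _ f hf hf1 μ x y hμ hx hy hm0 hm1 hm2 hΩ0 hΩ1
  have gx := gain_nonneg a ε hx.le
  have gy := gain_nonneg b ε hy.le
  have hq : 0 ≤ μ * gain a ε x * gain b ε y := by positivity
  have hKx : 0 < K * x ^ (1 - ε) := by positivity
  have hKy : 0 < K * y ^ (1 - ε) := by positivity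
  have triv0 : ∀ z, f 2 z ≠ 0 → ∀ I, z ∈ dint I → ∫ y, ‖f 0 y‖ * dw I y ≤ 4 * dlen I :=
    fun _ _ I _ => integral_mul_dw_le (hf1 0) I
  have triv1 : ∀ z, f 2 z ≠ 0 → ∀ I, z ∈ dint I → ∫ y, ‖f 1 y‖ * dw I y ≤ 4 * dlen I :=
    fun _ _ I _ => integral_mul_dw_le (hf1 1) I
  have gplus : ∀ {c u : ℝ}, ¬ u < 1 → u ^ (c / 8) * (4 : ℝ) ^ (0 : ℝ) = gain c ε u := fun h => by
    rw [gain, if_neg h, rpow_zero, mul_one]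
  have fin : ∀ M C' : ℝ, M ≤ C' * (μ * gain a ε x * gain b ε y) → C' ≤ C1 * K1 * K2 + C2 * K3 + C3 * K4 + C4 →
      ENNReal.ofReal M ≤
      ENNReal.ofReal ((C1 * K1 * K2 + C2 * K3 + C3 * K4 + C4) * (μ * gain a ε x * gain b ε y)) :=
    fun M C' h1 h2 => ENNReal.ofReal_le_ofReal (h1.trans (mul_le_mul_of_nonneg_right h2 hq))
  have p1 : 0 < C1 * K1 * K2 := by positivity
  have p2 : 0 < C2 * K3 := by positivity
  have p3 : 0 < C3 * K4 := by positivity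
  by_cases hx1 : x < 1 <;> by_cases hy1 : y < 1
  · obtain ⟨ha', hΩ0⟩ := hΩ0 hx1
    obtain ⟨hb', hΩ1⟩ := hΩ1 hy1
    refine (H1 V f hf hf1 μ x y hμ hx hy (fun _ => hm0 ha') (fun _ => hm1 hb') hm2 _ _ hKx hKy hΩ0
      hΩ1).trans (fin _ (C1 * K1 * K2) ?_ (by linarith))
    have g1 := rpow_mul_rpow_le_gain (a := a) (β := 1 / 3) (γ := s₀ - 1 / 3) hx hx1 hK hε0.le (by linarith) (by linarith)
    have g2 := rpow_mul_rpow_le_gain (a := b) (β := 1 / 3) (γ := s₁ - 1 / 3) hy hy1 hK hε0.le (by linarith) (by linarith)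
    exact (mul_mul_mul_le_of_le (by positivity) hμ.le (by positivity) (by positivity) (g1) (g2)).trans_eq (by ring)
  · obtain ⟨ha', hΩ0⟩ := hΩ0 hx1
    refine (H3 V f hf hf1 μ x y hμ hx hy (fun _ => hm0 ha') (fun h => hm1 ?_) hm2 _ 4 hKx (by norm_num) hΩ0
      triv1).trans (fin _ (C3 * K4) ?_ (by linarith))
    · have : 0 < b / 8 := h
      linarith
    have g1 := rpow_mul_rpow_le_gain (a := a) (β := 3 / 4) (γ := 1 - 2 * da - 3 / 4) hx hx1 hK hε0.le
      (by linarith) (by linarith)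
    have g2 : y ^ (b / 8) * (4 : ℝ) ^ (0 : ℝ) = gain b ε y := gplus hy1
    exact (mul_mul_mul_le_of_le (by positivity) hμ.le (by positivity) (by positivity) (g1) (g2.le)).trans_eq (by ring)
  · obtain ⟨hb', hΩ1⟩ := hΩ1 hy1
    refine (H2 V f hf hf1 μ x y hμ hx hy (fun h => hm0 ?_) (fun _ => hm1 hb') hm2 4 _ (by norm_num) hKy triv0
      hΩ1).trans (fin _ (C2 * K3) ?_ (by linarith))
    · have : 0 < a / 8 := h
      linarith
    have g1 : x ^ (a / 8) * (4 : ℝ) ^ (0 : ℝ) = gain a ε x := gplus hx1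
    have g2 := rpow_mul_rpow_le_gain (a := b) (β := 3 / 4) (γ := 1 - 2 * db - 3 / 4) hy hy1 hK hε0.le
      (by linarith) (by linarith)
    exact (mul_mul_mul_le_of_le (by positivity) hμ.le (by positivity) (by positivity) (g1.le) (g2)).trans_eq (by ring)
  · refine (H4 V f hf hf1 μ x y hμ hx hy (fun h => hm0 ?_) (fun h => hm1 ?_) hm2 4 4 (by norm_num) (by norm_num)
      triv0 triv1).trans (fin _ C4 ?_ (by linarith))
    · have : 0 < a / 8 := h
      linarith
    · have : 0 < b / 8 := h
      linarith
    have g1 : x ^ (a / 8) * (4 : ℝ) ^ (0 : ℝ) = gain a ε x := gplus hx1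
    have g2 : y ^ (b / 8) * (4 : ℝ) ^ (0 : ℝ) = gain b ε y := gplus hy1
    exact (mul_mul_mul_le_of_le (by positivity) hμ.le (by positivity) (by positivity) (g1.le) (g2.le)).trans_eq (by ring)

/-- The measure on `ℤ` giving mass `2 ^ m` to `m`. -/
noncomputable def dy : Measure ℤ := Measure.sum fun m : ℤ => ENNReal.ofReal (2 ^ m) • Measure.dirac m

lemma lintegral_dy (f : ℤ → ℝ≥0∞) : ∫⁻ m, f m ∂dy = ∑' m : ℤ, ENNReal.ofReal (2 ^ m) * f m := by
  simp [dy, lintegral_sum_measure]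

lemma dy_apply (s : Set ℤ) : dy s = ∑' m : ℤ, s.indicator (fun m : ℤ => ENNReal.ofReal (2 ^ m)) m := by
  rw [dy, Measure.sum_apply _ (MeasurableSet.of_discrete)]
  congr 1 with m
  by_cases h : m ∈ s <;> simp [h]

lemma ofReal_two_zpow_le_dy {s : Set ℤ} {m : ℤ} (hm : m ∈ s) : ENNReal.ofReal (2 ^ m) ≤ dy s := by
  rw [dy_apply]
  refine le_trans ?_ (ENNReal.le_tsum m)
  rw [indicator_of_mem hm]

lemma exists_zpow_lt {d : ℝ≥0∞} (hd : d ≠ 0) : ∃ m : ℤ, ENNReal.ofReal (2 ^ m) < d := by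
  obtain ⟨n, hn⟩ := ENNReal.exists_inv_two_pow_lt hd
  refine ⟨-n, ?_⟩
  rwa [zpow_neg, zpow_natCast, ENNReal.ofReal_inv_of_pos (by positivity), ENNReal.ofReal_pow (by norm_num),
    ENNReal.ofReal_ofNat, ENNReal.inv_pow]

lemma exists_le_zpow {d : ℝ≥0∞} (hd : d ≠ ∞) : ∃ m : ℤ, d ≤ ENNReal.ofReal (2 ^ m) := by
  obtain ⟨n, hn⟩ := pow_unbounded_of_one_lt d.toReal (one_lt_two)
  refine ⟨n, ?_⟩
  rw [zpow_natCast]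
  exact (ENNReal.le_ofReal_iff_toReal_le hd (by positivity)).2 hn.le

lemma exists_zpow_lt_le {d : ℝ≥0∞} (hd : d ≠ 0) (hd' : d ≠ ∞) :
    ∃ m : ℤ, ENNReal.ofReal (2 ^ m) < d ∧ d ≤ ENNReal.ofReal (2 ^ (m + 1)) := by
  obtain ⟨m, h1, h2⟩ := exists_mem_Ioc_zpow (ENNReal.toReal_pos hd hd') one_lt_two
  exact ⟨m, (ENNReal.ofReal_lt_iff_lt_toReal (by positivity) hd').2 h1,
    (ENNReal.le_ofReal_iff_toReal_le hd' (by positivity)).2 h2⟩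

/-- A geometric sum over the dyadic scales below a given one. -/
lemma tsum_zpow_lt_le {d : ℝ≥0∞} {g : ℤ → ℝ≥0∞} {ρ : ℝ≥0∞} (M : ℤ → ℝ≥0∞)
    (hg : ∀ m₀ : ℤ, ENNReal.ofReal (2 ^ m₀) < d → ∀ n : ℕ, g (m₀ - n) ≤ M m₀ * ρ ^ n)
    {B : ℝ≥0∞} (hB : ∀ m₀ : ℤ, ENNReal.ofReal (2 ^ m₀) < d → M m₀ ≤ B) (hd : d ≠ ∞) :
    ∑' m : ℤ, {m : ℤ | ENNReal.ofReal (2 ^ m) < d}.indicator g m ≤ B * (1 - ρ)⁻¹ := by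
  rcases eq_or_ne d 0 with rfl | hd0
  · simp
  obtain ⟨m₀, h1, h2⟩ := exists_zpow_lt_le hd0 hd
  have inj : Function.Injective fun n : ℕ => m₀ - (n : ℤ) := fun x y h => by simpa using h
  rw [← inj.tsum_eq]
  · calc _ ≤ ∑' n : ℕ, B * ρ ^ n := by
          refine ENNReal.tsum_le_tsum fun n => ?_
          refine (indicator_le_self' (fun _ _ => zero_le) _).trans ((hg m₀ h1 n).trans ?_)
          gcongr
          exact hB m₀ h1
      _ = _ := by rw [ENNReal.tsum_mul_left, ENNReal.tsum_geometric]
  · intro m hm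
    have h : ENNReal.ofReal (2 ^ m) < d := by
      by_contra hc
      exact hm (indicator_of_notMem (s := {m : ℤ | ENNReal.ofReal (2 ^ m) < d}) hc _)
    have h3 := (ENNReal.ofReal_lt_ofReal_iff (by positivity)).1 (h.trans_le h2)
    have h4 := (zpow_lt_zpow_iff_right₀ one_lt_two).1 h3
    exact ⟨(m₀ - m).toNat, by simp only; omega⟩

lemma ofReal_zpow_sub (m : ℤ) (n : ℕ) :
    ENNReal.ofReal (2 ^ (m - n)) = ENNReal.ofReal (2 ^ m) * (2⁻¹ : ℝ≥0∞) ^ n := by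
  rw [zpow_sub₀ two_ne_zero, div_eq_mul_inv, ENNReal.ofReal_mul (by positivity), zpow_natCast,
    ENNReal.ofReal_inv_of_pos (by positivity), ENNReal.ofReal_pow (by norm_num), ENNReal.ofReal_ofNat,
    ← ENNReal.inv_pow]

lemma dy_lt_le (d : ℝ≥0∞) : dy {m : ℤ | ENNReal.ofReal (2 ^ m) < d} ≤ 2 * d := by
  rcases eq_or_ne d ∞ with rfl | hd
  · simp
  rw [dy_apply]
  refine (tsum_zpow_lt_le (ρ := 2⁻¹) (fun m => ENNReal.ofReal (2 ^ m)) (fun m _ n => (ofReal_zpow_sub m n).le)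
    (B := d) (fun m h => h.le) hd).trans_eq ?_
  rw [ENNReal.one_sub_inv_two, inv_inv, mul_comm]

/-- A function on the line whose distribution function is controlled at dyadic values by a sequence. -/
lemma lintegral_rpow_le_of_distr {H : ℝ → ℝ} (hH : Measurable H) (hH0 : ∀ x, 0 ≤ H x) {Λ : ℤ → ℝ}
    (hΛ : ∀ s, 0 ≤ Λ s) (h : ∀ s : ℤ, volume {x | Λ s < H x} ≤ ENNReal.ofReal (2 ^ s)) {r : ℝ} (hr : 0 < r) :
    ∫⁻ x, ENNReal.ofReal (H x ^ r) ≤ 2 * ∫⁻ s, ENNReal.ofReal (Λ s ^ r) ∂dy := by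
  rw [lintegral_rpow_eq_lintegral_meas_lt_mul _ (ae_of_all _ hH0) hH.aemeasurable hr,
    lintegral_rpow_eq_lintegral_meas_lt_mul _ (ae_of_all _ hΛ) (Measurable.of_discrete).aemeasurable hr,
    mul_left_comm, ← lintegral_const_mul' 2 _ (by norm_num)]
  refine mul_le_mul' le_rfl (lintegral_mono fun t => ?_)
  rw [← mul_assoc]
  refine mul_le_mul' ?_ le_rfl
  have key : ∀ s : ℤ, Λ s ≤ t → volume {x | t < H x} ≤ ENNReal.ofReal (2 ^ s) := fun s hs =>
    (measure_mono fun x hx => lt_of_le_of_lt hs hx).trans (h s)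
  by_contra hc
  push Not at hc
  have down : ∀ s : ℤ, Λ s ≤ t → Λ (s - 1) ≤ t := by
    intro s hs
    by_contra hn
    push Not at hn
    refine (hc.trans_le (key s hs)).not_ge ?_
    have e : ENNReal.ofReal ((2 : ℝ) ^ s) = 2 * ENNReal.ofReal (2 ^ (s - 1)) := by
      rw [← ENNReal.ofReal_ofNat, ← ENNReal.ofReal_mul (by norm_num), zpow_sub_one₀ two_ne_zero]
      congr 1; ring
    rw [e]
    gcongr
    exact ofReal_two_zpow_le_dy hn
  by_cases hex : ∃ s, Λ s ≤ t
  · obtain ⟨s, hs⟩ := hex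
    have all : ∀ n : ℕ, Λ (s - n) ≤ t := by
      intro n
      induction n with
      | zero => simpa using hs
      | succ n ih =>
        have := down _ ih
        rw [sub_sub] at this
        exact_mod_cast this
    have h0 : volume {x | t < H x} ≠ 0 := (pos_of_gt hc).ne'
    obtain ⟨m, hm⟩ := exists_zpow_lt h0
    rcases le_total m s with hms | hms
    · have h2 := key _ (all (s - m).toNat)
      rw [show s - ((s - m).toNat : ℤ) = m by omega] at h2
      exact hm.not_ge h2
    · refine hm.not_ge ((key s hs).trans (ENNReal.ofReal_le_ofReal ?_))
      exact zpow_le_zpow_right₀ one_le_two hms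
  · push Not at hex
    have : dy {a | t < Λ a} = ∞ := by
      rw [eq_top_iff]
      by_contra hn
      push Not at hn
      have h4 := hn.ne
      obtain ⟨m, hm⟩ := exists_le_zpow h4
      have h5 := (ofReal_two_zpow_le_dy (s := {a | t < Λ a}) (m := m + 1) (hex _)).trans hm
      have h6 := (ENNReal.ofReal_le_ofReal_iff (by positivity)).1 h5
      have := (zpow_le_zpow_iff_right₀ (one_lt_two (α := ℝ))).1 h6
      omega
    rw [this] at hc
    simp at hc

section
variable {V : Type*} [NormedAddCommGroup V]

/-- Decomposition of a function along the dyadic values of its decreasing rearrangement. -/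
lemma exists_levels {f : ℝ → V} (hf : StronglyMeasurable f) (hi : Integrable f) :
    ∃ (T : ℤ → ℝ) (E : ℤ → Set ℝ), (∀ m, 0 ≤ T m) ∧ (∀ m, MeasurableSet (E m)) ∧
      Pairwise (Function.onFun Disjoint E) ∧ (∀ᵐ x, f x ≠ 0 → x ∈ ⋃ m, E m) ∧
      (∀ m, ∀ x ∈ E m, ‖f x‖ ≤ T m) ∧ (∀ m, volume (E m) ≤ ENNReal.ofReal (2 ^ m)) ∧
      ∀ p : ℝ, 0 < p → ∫⁻ m, ENNReal.ofReal (T m ^ p) ∂dy ≤ 4 * ∫⁻ x, ENNReal.ofReal (‖f x‖ ^ p) := by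
  have hn : Measurable fun x => ‖f x‖ := hf.norm.measurable
  set S : ℤ → Set ℝ := fun m => {l | 0 ≤ l ∧ volume {x | l < ‖f x‖} ≤ ENNReal.ofReal (2 ^ m)} with hS
  set τ : ℤ → ℝ := fun m => sInf (S m) with hτ
  have bdd : ∀ m, BddBelow (S m) := fun m => ⟨0, fun l hl => hl.1⟩
  have D_anti : Antitone fun l : ℝ => volume {x | l < ‖f x‖} := fun l l' h =>
    measure_mono fun x hx => lt_of_le_of_lt h hx
  have up : ∀ m l l', l ∈ S m → l ≤ l' → l' ∈ S m := fun m l l' hl h =>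
    ⟨hl.1.trans h, (D_anti h).trans hl.2⟩
  have ne : ∀ m, (S m).Nonempty := by
    intro m
    have hI : ∫⁻ x, ‖f x‖ₑ ≠ ∞ := hi.2.ne
    refine ⟨(∫⁻ x, ‖f x‖ₑ).toReal / 2 ^ m, by positivity, ?_⟩
    rcases eq_or_ne (∫⁻ x, ‖f x‖ₑ) 0 with h0 | h0
    · rw [lintegral_eq_zero_iff hf.enorm] at h0
      refine le_of_eq_of_le ?_ zero_le
      refine measure_mono_null (fun x hx => ?_) (ae_iff.1 h0)
      have hx' : _ < ‖f x‖ := hx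
      have : 0 < ‖f x‖ := lt_of_le_of_lt (by positivity) hx'
      show ‖f x‖ₑ ≠ 0
      simpa using this
    · have hp := ENNReal.toReal_pos h0 hI
      set l := (∫⁻ x, ‖f x‖ₑ).toReal / 2 ^ m with hl
      have hl0 : 0 < l := by positivity
      have h1 := mul_meas_ge_le_lintegral (μ := volume) hf.enorm (ENNReal.ofReal l)
      have h2 : ENNReal.ofReal l * volume {x | l < ‖f x‖} ≤ ENNReal.ofReal l * ENNReal.ofReal (2 ^ m) := by
        calc _ ≤ ENNReal.ofReal l * volume {x | ENNReal.ofReal l ≤ ‖f x‖ₑ} := by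
              gcongr
              rename_i x
              intro hx
              rw [← ofReal_norm]
              exact ENNReal.ofReal_le_ofReal hx.le
          _ ≤ ∫⁻ x, ‖f x‖ₑ := h1
          _ = ENNReal.ofReal l * ENNReal.ofReal (2 ^ m) := by
              rw [← ENNReal.ofReal_mul hl0.le, hl, div_mul_cancel₀ _ (by positivity), ENNReal.ofReal_toReal hI]
      exact (ENNReal.mul_le_mul_iff_right (by simpa using hl0) ENNReal.ofReal_ne_top).1 h2
  have τ0 : ∀ m, 0 ≤ τ m := fun m => le_csInf (ne m) fun l hl => hl.1
  have Dτ : ∀ m, volume {x | τ m < ‖f x‖} ≤ ENNReal.ofReal (2 ^ m) := by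
    intro m
    have : {x | τ m < ‖f x‖} = ⋃ n : ℕ, {x | τ m + 1 / ((n : ℝ) + 1) < ‖f x‖} := by
      ext x
      simp only [Set.mem_ofPred_eq, mem_iUnion]
      constructor
      · intro h
        obtain ⟨n, hn⟩ := exists_nat_one_div_lt (sub_pos.2 h)
        exact ⟨n, by linarith⟩
      · rintro ⟨n, hn⟩
        have : (0 : ℝ) < 1 / ((n : ℝ) + 1) := by positivity
        linarith
    rw [this]
    refine le_of_tendsto (tendsto_measure_iUnion_atTop ?_) (Filter.Eventually.of_forall fun n => ?_)
    · intro n n' h x hx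
      have hx' : τ m + 1 / ((n : ℝ) + 1) < ‖f x‖ := hx
      show τ m + 1 / ((n' : ℝ) + 1) < ‖f x‖
      refine lt_of_le_of_lt ?_ hx'
      have : (1 : ℝ) / ((n' : ℝ) + 1) ≤ 1 / ((n : ℝ) + 1) := by gcongr
      linarith
    · have : (0 : ℝ) < 1 / ((n : ℝ) + 1) := by positivity
      obtain ⟨l, hl, hlt⟩ := exists_lt_of_csInf_lt (ne m) (show τ m < τ m + 1 / ((n : ℝ) + 1) by linarith)
      exact (up m _ _ hl hlt.le).2
  have lt_τ : ∀ m l, 0 ≤ l → l < τ m → ENNReal.ofReal (2 ^ m) < volume {x | l < ‖f x‖} := by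
    intro m l hl h
    by_contra hc
    push Not at hc
    exact (csInf_le (bdd m) ⟨hl, hc⟩).not_gt h
  have τ_anti : Antitone τ := fun m m' h => csInf_le_csInf (bdd m') (ne m) fun l hl =>
    ⟨hl.1, hl.2.trans (ENNReal.ofReal_le_ofReal (zpow_le_zpow_right₀ one_le_two h))⟩
  refine ⟨fun m => τ (m - 1), fun m => {x | τ m < ‖f x‖ ∧ ‖f x‖ ≤ τ (m - 1)}, fun m => τ0 _, fun m => ?_, ?_, ?_,
    fun m x hx => hx.2, fun m => (measure_mono fun x hx => hx.1).trans (Dτ m), ?_⟩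
  · exact (measurableSet_lt measurable_const hn).inter (measurableSet_le hn measurable_const)
  · have key : ∀ m m' : ℤ, m < m' → Disjoint {x | τ m < ‖f x‖ ∧ ‖f x‖ ≤ τ (m - 1)}
        {x | τ m' < ‖f x‖ ∧ ‖f x‖ ≤ τ (m' - 1)} := by
      intro m m' h
      rw [Set.disjoint_left]
      rintro x ⟨h1, -⟩ ⟨-, h2⟩
      have := τ_anti (show m ≤ m' - 1 by omega)
      linarith
    intro m m' h
    rcases lt_or_gt_of_ne h with h | h
    · exact key _ _ h
    · exact (key _ _ h).symm
  · have null : volume {x | ∀ m, τ m < ‖f x‖} = 0 := by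
      by_contra h0
      obtain ⟨m, hm⟩ := exists_zpow_lt h0
      exact hm.not_ge ((measure_mono fun x (hx : ∀ m, τ m < ‖f x‖) => hx m).trans (Dτ m))
    filter_upwards [measure_eq_zero_iff_ae_notMem.1 null] with x hx hfx
    have hx' : ¬ ∀ m, τ m < ‖f x‖ := hx
    push Not at hx'
    obtain ⟨m₁, h1⟩ := hx'
    have hpos : 0 < ‖f x‖ := norm_pos_iff.2 hfx
    obtain ⟨m₂, h2⟩ : ∃ m, τ m < ‖f x‖ := by
      obtain ⟨m, hm⟩ := exists_le_zpow (hi.measure_norm_gt_lt_top (half_pos hpos)).ne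
      exact ⟨m, (csInf_le (bdd m) ⟨by positivity, hm⟩).trans_lt (half_lt_self hpos)⟩
    obtain ⟨m, hm, hlub⟩ := Int.exists_least_of_bdd (P := fun m => τ m < ‖f x‖)
      ⟨m₁, fun z hz => by
        by_contra hc
        push Not at hc
        exact (h1.trans (τ_anti hc.le)).not_gt hz⟩ ⟨m₂, h2⟩
    refine mem_iUnion.2 ⟨m, hm, ?_⟩
    by_contra hc
    push Not at hc
    have := hlub _ hc
    omega
  · intro p hp
    have shift : ∫⁻ m, ENNReal.ofReal (τ (m - 1) ^ p) ∂dy = 2 * ∫⁻ m, ENNReal.ofReal (τ m ^ p) ∂dy := by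
      rw [lintegral_dy, lintegral_dy, ← ENNReal.tsum_mul_left, ← (Equiv.addRight (1 : ℤ)).tsum_eq]
      congr 1 with m
      simp only [Equiv.coe_addRight, add_sub_cancel_right]
      rw [zpow_add_one₀ two_ne_zero, mul_comm ((2 : ℝ) ^ m), ENNReal.ofReal_mul (by norm_num),
        ENNReal.ofReal_ofNat, mul_assoc]
    rw [shift, show (4 : ℝ≥0∞) = 2 * 2 by norm_num, mul_assoc]
    gcongr
    rw [lintegral_rpow_eq_lintegral_meas_lt_mul _ (ae_of_all _ τ0) (Measurable.of_discrete).aemeasurable hp,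
      lintegral_rpow_eq_lintegral_meas_lt_mul _ (ae_of_all _ fun x => norm_nonneg _) hn.aemeasurable hp,
      mul_left_comm, ← lintegral_const_mul' 2 _ (by norm_num)]
    refine mul_le_mul' le_rfl (setLIntegral_mono' measurableSet_Ioi fun t ht => ?_)
    rw [← mul_assoc]
    refine mul_le_mul' ?_ le_rfl
    refine (measure_mono ?_).trans (dy_lt_le _)
    intro m hm
    exact lt_τ m t (le_of_lt ht) hm
end

/-- Young's inequality on the integers. -/
lemma tsum_conv_rpow_le {p : ℝ} (hp : 1 < p) (t k : ℤ → ℝ≥0∞) :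
    ∑' s : ℤ, (∑' m : ℤ, t m * k (m - s)) ^ p ≤
      (∑' j, k j) ^ (p / p.conjExponent) * ((∑' j, k j) * ∑' m, t m ^ p) := by
  have hpq := Real.HolderConjugate.conjExponent hp
  have hp0 : 0 < p := by linarith
  have hq0 := hpq.symm.pos
  set q := p.conjExponent
  have sh : ∀ s : ℤ, ∑' m : ℤ, k (m - s) = ∑' j, k j := fun s => (Equiv.subRight s).tsum_eq k
  have sh' : ∀ m : ℤ, ∑' s : ℤ, k (m - s) = ∑' j, k j := fun m => (Equiv.subLeft m).tsum_eq k
  have one : ∀ s : ℤ, (∑' m : ℤ, t m * k (m - s)) ^ p ≤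
      (∑' j, k j) ^ (p / q) * ∑' m : ℤ, t m ^ p * k (m - s) := by
    intro s
    have h := ENNReal.lintegral_mul_le_Lp_mul_Lq (Measure.count : Measure ℤ) hpq
      (f := fun m => t m * k (m - s) ^ (1 / p)) (g := fun m => k (m - s) ^ (1 / q))
      (Measurable.of_discrete).aemeasurable (Measurable.of_discrete).aemeasurable
    simp only [lintegral_count, Pi.mul_apply] at h
    have e1 : ∀ m, t m * k (m - s) ^ (1 / p) * k (m - s) ^ (1 / q) = t m * k (m - s) := fun m => by
      rw [mul_assoc, ← ENNReal.rpow_add_of_nonneg _ _ (by positivity) (by positivity), one_div, one_div,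
        hpq.inv_add_inv_eq_one, ENNReal.rpow_one]
    have e2 : ∀ m, (t m * k (m - s) ^ (1 / p)) ^ p = t m ^ p * k (m - s) := fun m => by
      rw [ENNReal.mul_rpow_of_nonneg _ _ hp0.le, ← ENNReal.rpow_mul, one_div_mul_cancel hp0.ne', ENNReal.rpow_one]
    have e3 : ∀ m, (k (m - s) ^ (1 / q)) ^ q = k (m - s) := fun m => by
      rw [← ENNReal.rpow_mul, one_div_mul_cancel hq0.ne', ENNReal.rpow_one]
    simp only [e1, e2, e3, sh] at h
    calc _ ≤ ((∑' m : ℤ, t m ^ p * k (m - s)) ^ (1 / p) * (∑' j, k j) ^ (1 / q)) ^ p := by gcongr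
      _ = _ := by
        rw [ENNReal.mul_rpow_of_nonneg _ _ hp0.le, ← ENNReal.rpow_mul, one_div_mul_cancel hp0.ne',
          ENNReal.rpow_one, ← ENNReal.rpow_mul, mul_comm, one_div_mul_eq_div]
  calc _ ≤ ∑' s : ℤ, (∑' j, k j) ^ (p / q) * ∑' m : ℤ, t m ^ p * k (m - s) := ENNReal.tsum_le_tsum one
    _ = _ := by
      rw [ENNReal.tsum_mul_left, ENNReal.tsum_comm]
      simp only [ENNReal.tsum_mul_left, sh', ENNReal.tsum_mul_right]
      rw [mul_comm (∑' m, t m ^ p)]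

lemma gain_mono {a ε : ℝ} (ha : 0 ≤ a) (hε : 0 ≤ ε) {x y : ℝ} (hx : 0 ≤ x) (h : x ≤ y) :
    gain a ε x ≤ gain a ε y := by
  unfold gain
  split_ifs with h1 h2 h2
  · gcongr
  · push Not at h2
    exact (rpow_le_one hx h1.le (by positivity)).trans (one_le_rpow h2 (by positivity))
  · linarith
  · gcongr

/-- The relative size of the `m`-th level set; it plays no role when `a = 0`. -/
noncomputable def relSize (a μ : ℝ) (m : ℤ) : ℝ := if 0 < a then 2 ^ m / μ else 1

lemma relSize_pos (a : ℝ) {μ : ℝ} (hμ : 0 < μ) (m : ℤ) : 0 < relSize a μ m := by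
  unfold relSize; split_ifs <;> positivity

/-- The majorant of a level decomposition at the dyadic scale `2 ^ s`. -/
noncomputable def lsum (a ε : ℝ) (T : ℤ → ℝ) (s : ℤ) : ℝ≥0∞ :=
  ∑' m, ENNReal.ofReal (T m * gain a ε (relSize a (2 ^ s) m))

lemma summable_gain {a ε : ℝ} (ha : 0 < a) (hε : 0 < ε) :
    Summable fun j : ℤ => 2 ^ (-(j * a) : ℝ) * gain a ε (2 ^ j) := by
  have geo : ∀ c : ℝ, 0 < c → Summable fun n : ℕ => (2 : ℝ) ^ (-(n * c) : ℝ) := by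
    intro c hc
    have : ∀ n : ℕ, (2 : ℝ) ^ (-(n * c) : ℝ) = ((2 : ℝ) ^ (-c)) ^ n := fun n => by
      rw [← rpow_natCast, ← rpow_mul two_pos.le]; congr 1; ring
    simp only [this]
    exact summable_geometric_of_lt_one (by positivity) (rpow_lt_one_of_one_lt_of_neg one_lt_two (by linarith))
  refine Summable.of_nat_of_neg_add_one ?_ ?_
  · refine (geo (7 * a / 8) (by positivity)).congr fun n => ?_
    have : (1 : ℝ) ≤ 2 ^ n := one_le_pow₀ one_le_two
    rw [gain, zpow_natCast, if_neg this.not_gt, ← rpow_natCast, ← rpow_mul two_pos.le, ← rpow_add two_pos]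
    congr 1; push_cast; ring
  · refine ((summable_nat_add_iff 1).2 (geo ε hε)).congr fun n => ?_
    have : (2 : ℝ) ^ (-((n : ℤ) + 1)) < 1 := zpow_lt_one_of_neg₀ one_lt_two (by omega)
    rw [gain, if_pos this, ← rpow_intCast, ← rpow_mul two_pos.le, ← rpow_add two_pos]
    congr 1; push_cast; ring

lemma exists_lsum_le {p ε : ℝ} (hp : 1 < p) (hε : 0 < ε) : ∃ C : ℝ≥0∞, C ≠ ∞ ∧ ∀ T : ℤ → ℝ, (∀ m, 0 ≤ T m) →
    ∫⁻ s, lsum p⁻¹ ε T s ^ p ∂dy ≤ C * ∫⁻ m, ENNReal.ofReal (T m ^ p) ∂dy := by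
  have hp0 : 0 < p := by linarith
  have ha : 0 < p⁻¹ := by positivity
  set a := p⁻¹ with hap
  have hap' : a * p = 1 := inv_mul_cancel₀ hp0.ne'
  set k : ℤ → ℝ≥0∞ := fun j => ENNReal.ofReal (2 ^ (-(j * a) : ℝ) * gain a ε (2 ^ j)) with hk
  have hκ : ∑' j, k j ≠ ∞ := (summable_gain ha hε).tsum_ofReal_ne_top
  refine ⟨(∑' j, k j) ^ (p / p.conjExponent) * ∑' j, k j, ?_, fun T hT => ?_⟩
  · have := (Real.HolderConjugate.conjExponent hp).symm.pos
    exact ENNReal.mul_ne_top (ENNReal.rpow_ne_top_of_nonneg (by positivity) hκ) hκ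
  · set t : ℤ → ℝ≥0∞ := fun m => ENNReal.ofReal (2 ^ (m * a : ℝ) * T m) with ht
    have pw : ∀ m : ℤ, ENNReal.ofReal ((2 : ℝ) ^ m) = ENNReal.ofReal (2 ^ (m * a : ℝ)) ^ p := fun m => by
      rw [ENNReal.ofReal_rpow_of_nonneg (by positivity) hp0.le, ← rpow_mul two_pos.le, mul_assoc, hap', mul_one,
        rpow_intCast]
    have e1 : ∀ s, ENNReal.ofReal (2 ^ s) * lsum a ε T s ^ p = (∑' m : ℤ, t m * k (m - s)) ^ p := fun s => by
      rw [pw, ← ENNReal.mul_rpow_of_nonneg _ _ hp0.le, lsum, ← ENNReal.tsum_mul_left]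
      congr 2 with m
      have hTm := hT m
      rw [← ENNReal.ofReal_mul (by positivity), ← ENNReal.ofReal_mul (by positivity), relSize, if_pos ha,
        ← zpow_sub₀ two_ne_zero]
      have : (2 : ℝ) ^ ((s : ℝ) * a) = 2 ^ ((m : ℝ) * a) * 2 ^ (-(((m - s : ℤ) : ℝ) * a)) := by
        rw [← rpow_add two_pos]; congr 1; push_cast; ring
      rw [this]
      congr 1; ring
    have e2 : ∀ m, ENNReal.ofReal (2 ^ m) * ENNReal.ofReal (T m ^ p) = t m ^ p := fun m => by
      rw [ht, pw, ← ENNReal.ofReal_rpow_of_nonneg (hT m) hp0.le, ← ENNReal.mul_rpow_of_nonneg _ _ hp0.le,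
        ← ENNReal.ofReal_mul (by positivity)]
    simp only [lintegral_dy, e1, e2]
    exact (tsum_conv_rpow_le hp t k).trans_eq (by rw [mul_assoc])

/-- A decomposition of `f` into pieces with controlled height and support. -/
structure Levels {V : Type*} [NormedAddCommGroup V] (a : ℝ) (f : ℝ → V) (T : ℤ → ℝ) (E : ℤ → Set ℝ) : Prop where
  nonneg : ∀ m, 0 ≤ T m
  meas : ∀ m, MeasurableSet (E m)
  disj : Pairwise (Function.onFun Disjoint E)
  cover : ∀ᵐ x, f x ≠ 0 → x ∈ ⋃ m, E m
  norm_le : ∀ m, ∀ x ∈ E m, ‖f x‖ ≤ T m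
  vol : 0 < a → ∀ m, volume (E m) ≤ ENNReal.ofReal (2 ^ m)

lemma lintegral_ofReal_norm_rpow {V : Type*} [NormedAddCommGroup V] (f : ℝ → V) {p : ℝ} (hp : 0 < p) :
    ∫⁻ x, ENNReal.ofReal (‖f x‖ ^ p) = ∫⁻ x, ‖f x‖ₑ ^ p := by
  congr 1 with x
  rw [← ENNReal.ofReal_rpow_of_nonneg (norm_nonneg _) hp.le, ofReal_norm]

lemma exists_Levels (p : ℝ≥0∞) (hp : 1 < p) {ε : ℝ} (hε : 0 < ε) : ∃ C : ℝ≥0∞, C ≠ ∞ ∧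
    ∀ (V : Type) [NormedAddCommGroup V] (f : ℝ → V), StronglyMeasurable f → Integrable f → eLpNorm f p ≠ ∞ →
    ∃ T E, Levels p.toReal⁻¹ f T E ∧
      (p ≠ ∞ → (∫⁻ s, lsum p.toReal⁻¹ ε T s ^ p.toReal ∂dy) ^ (1 / p.toReal) ≤ C * eLpNorm f p) ∧
      (p = ∞ → ∀ s, lsum p.toReal⁻¹ ε T s ≤ eLpNorm f p) := by
  rcases eq_or_ne p ∞ with rfl | hpt
  · refine ⟨1, by simp, fun V _ f hf _ hfin => ?_⟩
    set M := (eLpNorm f ∞).toReal with hM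
    have hM0 : 0 ≤ M := ENNReal.toReal_nonneg
    refine ⟨fun m => if m = 0 then M else 0, fun m => if m = 0 then {x | ‖f x‖ ≤ M} else ∅,
      ⟨fun m => ?_, fun m => ?_, ?_, ?_, fun m x hx => ?_, fun h => by simp at h⟩, fun h => absurd rfl h,
      fun _ s => ?_⟩
    · split_ifs; exacts [hM0, le_rfl]
    · split_ifs
      · exact measurableSet_le hf.norm.measurable measurable_const
      · exact MeasurableSet.empty
    · intro m m' h
      show Disjoint (if m = 0 then _ else _) (if m' = 0 then _ else _)
      rcases eq_or_ne m 0 with rfl | h0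
      · rw [if_neg h.symm]; exact disjoint_bot_right
      · rw [if_neg h0]; exact disjoint_bot_left
    · filter_upwards [ae_le_eLpNormEssSup (f := f) (μ := volume)] with x hx _
      refine mem_iUnion.2 ⟨0, ?_⟩
      rw [if_pos rfl]
      rw [← eLpNorm_exponent_top] at hx
      have := ENNReal.toReal_mono hfin hx
      rwa [toReal_enorm] at this
    · rcases eq_or_ne m 0 with rfl | h0
      · rw [if_pos rfl] at hx ⊢; exact hx
      · rw [if_neg h0] at hx; exact absurd hx (by simp)
    · rw [lsum, tsum_eq_single 0]
      · rw [if_pos rfl]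
        have h1 : gain (∞ : ℝ≥0∞).toReal⁻¹ ε (relSize (∞ : ℝ≥0∞).toReal⁻¹ (2 ^ s) 0) = 1 := by simp [relSize, gain]
        rw [h1, mul_one, hM, ENNReal.ofReal_toReal hfin]
      · intro m hm
        rw [if_neg hm]; simp
  · have hp1 : 1 < p.toReal := by
      simpa using (ENNReal.toReal_lt_toReal ENNReal.one_ne_top hpt).2 hp
    have hp0 : 0 < p.toReal := by linarith
    obtain ⟨C, hC, h⟩ := exists_lsum_le hp1 hε
    refine ⟨(C * 4) ^ (1 / p.toReal), ENNReal.rpow_ne_top_of_nonneg (by positivity)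
      (ENNReal.mul_ne_top hC (by norm_num)), fun V _ f hf hi _ => ?_⟩
    obtain ⟨T, E, h1, h2, h3, h4, h5, h6, h7⟩ := exists_levels hf hi
    refine ⟨T, E, ⟨h1, h2, h3, h4, h5, fun _ => h6⟩, fun _ => ?_, fun h => absurd h hpt⟩
    rw [eLpNorm_eq_lintegral_rpow_enorm_toReal (by positivity) hpt, ← ENNReal.mul_rpow_of_nonneg _ _ (by positivity)]
    gcongr
    rw [mul_assoc]
    refine (h T h1).trans ?_
    gcongr
    rw [← lintegral_ofReal_norm_rpow f hp0]
    exact h7 _ hp0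

section
variable {V : Type} [NormedAddCommGroup V] [InnerProductSpace ℂ V]

/-- The normalized `m`-th piece of a level decomposition. -/
noncomputable def piece (f : ℝ → V) (T : ℤ → ℝ) (E : ℤ → Set ℝ) (m : ℤ) : ℝ → V :=
  (E m).indicator fun x => ((T m : ℂ))⁻¹ • f x

variable {a : ℝ} {f : ℝ → V} {T : ℤ → ℝ} {E : ℤ → Set ℝ}

lemma Levels.integrable_piece (h : Levels a f T E) (hf : Integrable f) (m : ℤ) : Integrable (piece f T E m) :=
  (hf.smul _).indicator (h.meas m)

lemma Levels.norm_piece_le (h : Levels a f T E) (m : ℤ) (x : ℝ) : ‖piece f T E m x‖ ≤ 1 := by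
  unfold piece
  by_cases hx : x ∈ E m
  · rw [indicator_of_mem hx, norm_smul, norm_inv, Complex.norm_real, norm_of_nonneg (h.nonneg m)]
    exact (mul_le_mul_of_nonneg_left (h.norm_le m x hx) (inv_nonneg.2 (h.nonneg m))).trans inv_mul_le_one
  · rw [indicator_of_notMem hx]; simp

lemma Levels.lintegral_piece_le (h : Levels a f T E) (ha : 0 < a) (m : ℤ) :
    ∫⁻ x, ‖piece f T E m x‖ₑ ≤ ENNReal.ofReal (2 ^ m) := by
  calc ∫⁻ x, ‖piece f T E m x‖ₑ ≤ ∫⁻ x, (E m).indicator 1 x := by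
        refine lintegral_mono fun x => ?_
        by_cases hx : x ∈ E m
        · rw [indicator_of_mem hx, Pi.one_apply, ← ofReal_norm]
          exact ENNReal.ofReal_le_one.2 (h.norm_piece_le m x)
        · unfold piece
          rw [indicator_of_notMem hx]; simp
    _ = volume (E m) := lintegral_indicator_one (h.meas m)
    _ ≤ _ := h.vol ha m

lemma Levels.integral_piece_le (h : Levels a f T E) (ha : 0 < a) (hf : Integrable f) (m : ℤ) :
    ∫ x, ‖piece f T E m x‖ ≤ 2 ^ m := by
  rw [← ENNReal.ofReal_le_ofReal_iff (by positivity),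
    ofReal_integral_norm_eq_lintegral_enorm (h.integrable_piece hf m)]
  exact h.lintegral_piece_le ha m

lemma Levels.enorm_pf_le (h : Levels a f T E) (hf : Integrable f) (φ : SchwartzMap ℝ ℂ) {t : ℝ} (ht : 0 < t)
    (ν y : ℝ) : ‖pf φ f t ν y‖ₑ ≤ ∑' m, ENNReal.ofReal (T m) * ‖pf φ (piece f T E m) t ν y‖ₑ := by
  obtain ⟨C, hC, hd⟩ := schwartz_decay φ 0
  have hint : Integrable fun x => pkt φ t ν y x • f x := by
    refine hf.bdd_smul (t⁻¹ * C) (continuous_pkt φ t ν y).aestronglyMeasurable (ae_of_all _ fun x => ?_)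
    simpa using norm_pkt_le hd ht ν y x
  have e : pf φ f t ν y = ∑' m, ∫ x in E m, pkt φ t ν y x • f x := by
    rw [← integral_iUnion h.meas h.disj hint.integrableOn, setIntegral_eq_integral_of_ae_compl_eq_zero]
    · rfl
    · filter_upwards [h.cover] with x hx hxE
      rw [not_imp_comm.1 hx hxE, smul_zero]
  rw [e]
  refine enorm_tsum_le_tsum_enorm.trans (ENNReal.tsum_le_tsum fun m => ?_)
  have e2 : ∫ x in E m, pkt φ t ν y x • f x = (T m : ℂ) • pf φ (piece f T E m) t ν y := by
    rw [pf, ← integral_smul, ← integral_indicator (h.meas m)]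
    congr 1 with x
    unfold piece
    by_cases hx : x ∈ E m
    · rw [indicator_of_mem hx, indicator_of_mem hx]
      rcases eq_or_ne (T m) 0 with h0 | h0
      · have := h.norm_le m x hx
        rw [h0] at this
        rw [norm_le_zero_iff.1 this]; simp
      · rw [smul_comm, smul_smul (T m : ℂ), mul_inv_cancel₀ (by exact_mod_cast h0), one_smul]
    · rw [indicator_of_notMem hx, indicator_of_notMem hx]; simp
  rw [e2, enorm_smul]
  gcongr
  rw [← ofReal_norm, Complex.norm_real, norm_of_nonneg (h.nonneg m)]

lemma tri_vec (φ : Fin 3 → SchwartzMap ℝ ℂ) (f g h : ℝ → V) (z : ℝ × ℝ × ℝ) :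
    tri φ ![f, g, h] z = ‖pf (φ 0) f z.1 (fr 0 z) z.2.2‖ₑ * ‖pf (φ 1) g z.1 (fr 1 z) z.2.2‖ₑ *
      ‖pf (φ 2) h z.1 (fr 2 z) z.2.2‖ₑ := by
  rw [tri, Fin.prod_univ_three]; rfl

lemma triN_le_tsum (φ : Fin 3 → SchwartzMap ℝ ℂ) {b : ℝ} {g h : ℝ → V} {T' : ℤ → ℝ} {E' : ℤ → Set ℝ}
    (hf : Integrable f) (hg : Integrable g) (hh : Integrable h) (hL : Levels a f T E) (hL' : Levels b g T' E') :
    triN φ ![f, g, h] ≤ ∑' m, ∑' n, ENNReal.ofReal (T m) * ENNReal.ofReal (T' n) *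
      triN φ ![piece f T E m, piece g T' E' n, h] := by
  have hm : ∀ m n, Measurable (tri φ ![piece f T E m, piece g T' E' n, h]) := fun m n => by
    refine measurable_tri φ fun j => ?_
    fin_cases j
    · exact (hL.integrable_piece hf m).aestronglyMeasurable
    · exact (hL'.integrable_piece hg n).aestronglyMeasurable
    · exact hh.aestronglyMeasurable
  calc triN φ ![f, g, h] ≤ ∫⁻ z in Ioi 0 ×ˢ univ, ∑' m, ∑' n, ENNReal.ofReal (T m) * ENNReal.ofReal (T' n) *
        tri φ ![piece f T E m, piece g T' E' n, h] z := by
        refine setLIntegral_mono' (measurableSet_Ioi.prod MeasurableSet.univ) fun z hz => ?_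
        have ht : 0 < z.1 := hz.1
        simp only [tri_vec]
        refine (mul_le_mul' (mul_le_mul' (hL.enorm_pf_le hf (φ 0) ht _ _) (hL'.enorm_pf_le hg (φ 1) ht _ _))
          le_rfl).trans_eq ?_
        rw [← ENNReal.tsum_mul_right, ← ENNReal.tsum_mul_right]
        congr 1 with m
        rw [← ENNReal.tsum_mul_left, ← ENNReal.tsum_mul_right]
        congr 1 with n
        ring
    _ = _ := by
        rw [lintegral_tsum fun m => (Measurable.tsum fun n => (hm m n).const_mul _).aemeasurable]
        congr 1 with m
        rw [lintegral_tsum fun n => ((hm m n).const_mul _).aemeasurable]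
        congr 1 with n
        rw [lintegral_const_mul _ (hm m n)]
        rfl

lemma measurableSet_dsup (g : ℝ → ℝ≥0∞) (c : ℝ≥0∞) : MeasurableSet (dsup g c) := by
  have : dsup g c = ⋃ I ∈ {I | c * ENNReal.ofReal (dlen I) < ∫⁻ y, g y * ENNReal.ofReal (dw I y)}, dint I := by
    ext x
    simp only [mem_iUnion, exists_prop]
    exact exists_congr fun I => and_comm
  rw [this]
  exact MeasurableSet.biUnion (to_countable _) fun I _ => measurableSet_dint I

lemma exists_exceptional {ε : ℝ} (hε : 0 < ε) : ∃ K : ℝ, 0 < K ∧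
    ∀ (V : Type) [NormedAddCommGroup V] [InnerProductSpace ℂ V] (a : ℝ) (f : ℝ → V) (T : ℤ → ℝ) (E : ℤ → Set ℝ),
    Levels a f T E → Integrable f → ∀ μ : ℝ, 0 < μ → ∃ Ω : Set ℝ, MeasurableSet Ω ∧
      volume Ω ≤ ENNReal.ofReal (μ / 4) ∧ ∀ m, relSize a μ m < 1 → 0 < a ∧ ∀ z, z ∉ Ω → ∀ I, z ∈ dint I →
        ∫ y, ‖piece f T E m y‖ * dw I y ≤ K * relSize a μ m ^ (1 - ε) * dlen I := by
  have hρ : (2 : ℝ) ^ (-ε) < 1 := rpow_lt_one_of_one_lt_of_neg one_lt_two (by linarith)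
  have hρ' : 0 < 1 - (2 : ℝ) ^ (-ε) := by linarith
  set K := 320 * (1 - (2 : ℝ) ^ (-ε))⁻¹ with hK
  have hK0 : 0 < K := by positivity
  refine ⟨K, hK0, fun V _ _ a f T E hL hf μ hμ => ?_⟩
  by_cases ha : 0 < a
  · set c : ℤ → ℝ := fun m => K * (2 ^ m / μ) ^ (1 - ε) / 8 with hc
    have hc0 : ∀ m, 0 < c m := fun m => by positivity
    set D : ℤ → Set ℝ := fun m => dsup (fun x => ‖piece f T E m x‖ₑ) (8 * ENNReal.ofReal (c m)) with hD
    set P : Set ℤ := {m | ENNReal.ofReal (2 ^ m) < ENNReal.ofReal μ} with hP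
    have mD : ∀ m, MeasurableSet (D m) := fun m => measurableSet_dsup _ _
    refine ⟨⋃ m ∈ P, D m, MeasurableSet.biUnion (to_countable _) fun m _ => mD m, ?_, ?_⟩
    · have one : ∀ m, volume (D m) ≤ ENNReal.ofReal (80 / K * μ * (2 ^ m / μ) ^ ε) := by
        intro m
        have hi := hL.integrable_piece hf m
        have h1 := volume_dsup_le hi.aestronglyMeasurable.enorm (c := ENNReal.ofReal (c m))
          (by simpa using hc0 m) ENNReal.ofReal_ne_top hi.2.ne
        have h2 : ENNReal.ofReal (c m) * volume (D m) ≤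
            ENNReal.ofReal (c m) * ENNReal.ofReal (80 / K * μ * (2 ^ m / μ) ^ ε) := by
          refine h1.trans ((mul_le_mul' le_rfl (hL.lintegral_piece_le ha m)).trans_eq ?_)
          rw [← ENNReal.ofReal_mul (hc0 m).le, ← ENNReal.ofReal_ofNat, ← ENNReal.ofReal_mul (by norm_num)]
          congr 1
          have : (2 : ℝ) ^ m = (2 ^ m / μ) ^ (1 - ε) * (2 ^ m / μ) ^ ε * μ := by
            rw [← rpow_add (by positivity), sub_add_cancel, rpow_one, div_mul_cancel₀ _ hμ.ne']
          rw [hc]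
          simp only
          nth_rewrite 1 [this]
          field_simp
          norm_num
        exact (ENNReal.mul_le_mul_iff_right (by simpa using hc0 m) ENNReal.ofReal_ne_top).1 h2
      calc volume (⋃ m ∈ P, D m) ≤ ∑' m, volume (⋃ _ : m ∈ P, D m) := measure_iUnion_le _
        _ ≤ ∑' m, P.indicator (fun m => ENNReal.ofReal (80 / K * μ * (2 ^ m / μ) ^ ε)) m := by
            refine ENNReal.tsum_le_tsum fun m => ?_
            by_cases hm : m ∈ P
            · rw [indicator_of_mem hm]; simpa [hm] using one m
            · simp [hm]
        _ ≤ ENNReal.ofReal (80 / K * μ) * (1 - ENNReal.ofReal (2 ^ (-ε)))⁻¹ := by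
            refine tsum_zpow_lt_le (fun m => ENNReal.ofReal (80 / K * μ * (2 ^ m / μ) ^ ε)) (fun m₀ _ n => ?_)
              (fun m₀ h => ENNReal.ofReal_le_ofReal ?_) ENNReal.ofReal_ne_top
            · rw [← ENNReal.ofReal_pow (by positivity), ← ENNReal.ofReal_mul (by positivity)]
              refine (congrArg _ ?_).le
              have : (2 : ℝ) ^ (m₀ - n) / μ = 2 ^ m₀ / μ * 2 ^ (-(n : ℝ)) := by
                rw [zpow_sub₀ two_ne_zero, rpow_neg two_pos.le, rpow_natCast, zpow_natCast]; ring
              rw [this, mul_rpow (by positivity) (by positivity), ← rpow_mul two_pos.le, ← rpow_natCast (2 ^ (-ε)),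
                ← rpow_mul two_pos.le, show -(n : ℝ) * ε = -ε * n by ring]
              ring
            · have h' := (ENNReal.ofReal_lt_ofReal_iff hμ).1 h
              exact mul_le_of_le_one_right (by positivity)
                (rpow_le_one (by positivity) ((div_le_one hμ).2 h'.le) hε.le)
        _ = _ := by
            rw [← ENNReal.ofReal_one, ← ENNReal.ofReal_sub _ (by positivity), ← ENNReal.ofReal_inv_of_pos hρ',
              ← ENNReal.ofReal_mul (by positivity)]
            congr 1
            rw [hK]; field_simp; norm_num
    · intro m hm
      refine ⟨ha, fun z hz I hI => ?_⟩
      rw [relSize, if_pos ha] at hm ⊢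
      have hmP : m ∈ P := (ENNReal.ofReal_lt_ofReal_iff hμ).2 ((div_lt_one hμ).1 hm)
      have hzD : z ∉ D m := fun h => hz (mem_biUnion hmP h)
      have h1 : ¬ (8 * ENNReal.ofReal (c m) * ENNReal.ofReal (dlen I) <
          ∫⁻ y, ‖piece f T E m y‖ₑ * ENNReal.ofReal (dw I y)) := fun h => hzD ⟨I, hI, h⟩
      push Not at h1
      rw [lintegral_mul_dw (hL.integrable_piece hf m), ← ENNReal.ofReal_ofNat, ← ENNReal.ofReal_mul (by norm_num),
        ← ENNReal.ofReal_mul (by have := hc0 m; positivity), ENNReal.ofReal_le_ofReal_iff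
          (by have := hc0 m; have := dlen_pos I; positivity)] at h1
      refine h1.trans_eq ?_
      simp only [hc]; ring
  · refine ⟨∅, MeasurableSet.empty, by simp, fun m hm => ?_⟩
    rw [relSize, if_neg ha] at hm
    exact absurd hm (lt_irrefl _)

end

lemma relSize_le_relSize {a μ μ' : ℝ} (hμ : 0 < μ) (h : μ ≤ μ') (m : ℤ) : relSize a μ' m ≤ relSize a μ m := by
  unfold relSize
  split_ifs
  · gcongr
  · exact le_rfl

/-- The weak-type estimate for an operator dominated by the model form. -/
theorem exists_distr_le (φ : Fin 3 → SchwartzMap ℝ ℂ)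
    (hφ : ∀ j ξ, 1 ≤ |ξ| → 𝓕 (φ j : ℝ → ℂ) ξ = 0) {a b c₀ : ℝ} (ha : 0 ≤ a) (ha1 : a < 1) (hb : 0 ≤ b)
    (hb1 : b < 1) (hab : 0 < a + b) (hab' : a + b < 3 / 2) (hc₀ : 0 < c₀) :
    ∃ ε : ℝ, 0 < ε ∧ ∃ C : ℝ, 0 < C ∧
      ∀ (V : Type) [NormedAddCommGroup V] [InnerProductSpace ℂ V] [CompleteSpace V]
      (f g H : ℝ → V) (T T' : ℤ → ℝ) (E E' : ℤ → Set ℝ), Integrable f → Integrable g → Continuous H →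
      Levels a f T E → Levels b g T' E' →
      (∀ h : ℝ → V, Integrable h → (∀ x, ‖h x‖ ≤ 1) →
        ENNReal.ofReal c₀ * ‖∫ x, ⟪h x, H x⟫_ℂ‖ₑ ≤ triN φ ![f, g, h]) →
      ∀ s : ℤ, volume {x | ENNReal.ofReal C * (lsum a ε T s * lsum b ε T' s) < ‖H x‖ₑ} ≤
        ENNReal.ofReal (2 ^ s) := by
  obtain ⟨ε, hε0, hε1, hmain⟩ := exists_tri_le φ hφ ha ha1 hb hb1 hab hab'
  obtain ⟨K, hK, hexc⟩ := exists_exceptional hε0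
  obtain ⟨C, hC, hmain⟩ := hmain K hK
  refine ⟨ε, hε0, 2 * C / c₀, by positivity, ?_⟩
  intro V _ _ _ f g H T T' E E' hf hg hH hL hL' hdual s
  by_contra hcon
  push Not at hcon
  set Λ : ℝ≥0∞ := ENNReal.ofReal (2 * C / c₀) * (lsum a ε T s * lsum b ε T' s) with hΛ
  set S : Set ℝ := {x | Λ < ‖H x‖ₑ} with hS
  have mH : Measurable fun x => ‖H x‖ₑ := hH.enorm.measurable
  have mS : MeasurableSet S := measurableSet_lt measurable_const mH
  obtain ⟨R, hR⟩ : ∃ R : ℕ, ENNReal.ofReal (2 ^ s) < volume (S ∩ Icc (-R : ℝ) R) := by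
    have mono : Monotone fun R : ℕ => S ∩ Icc (-R : ℝ) R := fun R R' h => by
      have : (R : ℝ) ≤ R' := by exact_mod_cast h
      exact inter_subset_inter_right _ (Icc_subset_Icc (by linarith) this)
    have un : ⋃ R : ℕ, S ∩ Icc (-R : ℝ) R = S := by
      rw [← inter_iUnion, inter_eq_left]
      intro x _
      obtain ⟨n, hn⟩ := exists_nat_ge |x|
      exact mem_iUnion.2 ⟨n, abs_le.1 hn⟩
    rw [← un, mono.measure_iUnion] at hcon
    exact lt_iSup_iff.1 hcon
  set G := S ∩ Icc (-R : ℝ) R with hG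
  have mG : MeasurableSet G := mS.inter measurableSet_Icc
  have Gfin : volume G ≠ ∞ := ((measure_mono inter_subset_right).trans_lt measure_Icc_lt_top).ne
  set μ := (volume G).toReal with hμd
  have hGμ : volume G = ENNReal.ofReal μ := (ENNReal.ofReal_toReal Gfin).symm
  have hsμ : (2 : ℝ) ^ s ≤ μ := ((ENNReal.ofReal_lt_iff_lt_toReal (by positivity) Gfin).1 hR).le
  have hμ : 0 < μ := lt_of_lt_of_le (by positivity) hsμ
  obtain ⟨Ω₀, mΩ₀, vΩ₀, hΩ₀⟩ := hexc V a f T E hL hf μ hμ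
  obtain ⟨Ω₁, mΩ₁, vΩ₁, hΩ₁⟩ := hexc V b g T' E' hL' hg μ hμ
  set G' := G \ (Ω₀ ∪ Ω₁) with hG'
  have mG' : MeasurableSet G' := mG.diff (mΩ₀.union mΩ₁)
  have vG' : ENNReal.ofReal (μ / 2) ≤ volume G' := by
    have h1 : volume (Ω₀ ∪ Ω₁) ≤ ENNReal.ofReal (μ / 2) := by
      refine (measure_union_le _ _).trans ((add_le_add vΩ₀ vΩ₁).trans_eq ?_)
      rw [← ENNReal.ofReal_add (by positivity) (by positivity)]
      congr 1; ring
    have h2 : volume G ≤ volume G' + volume (Ω₀ ∪ Ω₁) := by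
      refine (measure_mono ?_).trans (measure_union_le _ _)
      rw [hG', sdiff_union_self]; exact subset_union_left
    have h3 : ENNReal.ofReal (μ / 2) + ENNReal.ofReal (μ / 2) ≤ volume G' + ENNReal.ofReal (μ / 2) := by
      rw [← ENNReal.ofReal_add (by positivity) (by positivity), add_halves, ← hGμ]
      exact h2.trans (add_le_add le_rfl h1)
    exact (ENNReal.add_le_add_iff_right ENNReal.ofReal_ne_top).1 h3
  have vG'0 : volume G' ≠ 0 := (lt_of_lt_of_le (by simpa using hμ) vG').ne'
  have G'fin : volume G' ≠ ∞ := ((measure_mono sdiff_subset).trans_lt Gfin.lt_top).ne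
  set h : ℝ → V := G'.indicator fun x => ((‖H x‖ : ℂ))⁻¹ • H x with hh
  have h1 : ∀ x, ‖h x‖ ≤ 1 := by
    intro x
    rw [hh]
    by_cases hx : x ∈ G'
    · rw [indicator_of_mem hx, norm_smul, norm_inv, Complex.norm_real, norm_norm]
      exact inv_mul_le_one
    · rw [indicator_of_notMem hx]; simp
  have hle : ∀ x, ‖h x‖ₑ ≤ G'.indicator 1 x := by
    intro x
    by_cases hx : x ∈ G'
    · rw [indicator_of_mem hx, Pi.one_apply, ← ofReal_norm]
      exact ENNReal.ofReal_le_one.2 (h1 x)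
    · rw [hh, indicator_of_notMem hx]; simp
  have hlint : ∫⁻ x, ‖h x‖ₑ ≤ ENNReal.ofReal μ := by
    rw [← hGμ]
    refine (lintegral_mono hle).trans ?_
    rw [lintegral_indicator_one mG']
    exact measure_mono sdiff_subset
  have hi : Integrable h := by
    refine ⟨?_, hlint.trans_lt ENNReal.ofReal_lt_top⟩
    have m1 : Measurable fun x => ((‖H x‖ : ℂ))⁻¹ := by
      have := hH.norm.measurable
      fun_prop
    exact ((m1.stronglyMeasurable.smul hH.stronglyMeasurable).indicator mG').aestronglyMeasurable
  have pair : ENNReal.ofReal c₀ * ∫⁻ x in G', ‖H x‖ₑ ≤ triN φ ![f, g, h] := by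
    have e : ∫ x, ⟪h x, H x⟫_ℂ = ((∫ x in G', ‖H x‖ : ℝ) : ℂ) := by
      rw [← integral_complex_ofReal, ← integral_indicator mG']
      congr 1 with x
      rw [hh]
      by_cases hx : x ∈ G'
      · rw [indicator_of_mem hx, indicator_of_mem hx, inner_smul_left, inner_self_eq_norm_sq_to_K, map_inv₀,
          Complex.conj_ofReal]
        rcases eq_or_ne (‖H x‖ : ℂ) 0 with h0 | h0
        · simp [h0]
        · simp only [Complex.coe_algebraMap]
          field_simp
      · rw [indicator_of_notMem hx, indicator_of_notMem hx]; simp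
    have hHi : IntegrableOn H G' :=
      (hH.integrableOn_Icc (a := -(R : ℝ)) (b := (R : ℝ))).mono_set (sdiff_subset.trans inter_subset_right)
    have := hdual h hi h1
    rwa [e, ← ofReal_norm, Complex.norm_real, norm_of_nonneg (by positivity),
      ofReal_integral_norm_eq_lintegral_enorm hHi] at this
  have upper : triN φ ![f, g, h] ≤ ENNReal.ofReal (C * μ) * (lsum a ε T s * lsum b ε T' s) := by
    refine (triN_le_tsum φ hf hg hi hL hL').trans ?_
    have one : ∀ m n, triN φ ![piece f T E m, piece g T' E' n, h] ≤
        ENNReal.ofReal (C * (μ * gain a ε (relSize a (2 ^ s) m) * gain b ε (relSize b (2 ^ s) n))) := by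
      intro m n
      have px := relSize_pos a hμ m
      have py := relSize_pos b hμ n
      have hnot : ∀ z, h z ≠ 0 → z ∉ Ω₀ ∧ z ∉ Ω₁ := by
        intro z hz
        have : z ∈ G' := by
          by_contra hc
          exact hz (indicator_of_notMem hc _)
        have := this.2
        rw [mem_union, not_or] at this
        exact this
      refine (hmain V ![piece f T E m, piece g T' E' n, h] ?_ ?_ μ (relSize a μ m) (relSize b μ n) hμ px py ?_ ?_
        ?_ ?_ ?_).trans (ENNReal.ofReal_le_ofReal ?_)
      · intro j
        fin_cases j
        exacts [hL.integrable_piece hf m, hL'.integrable_piece hg n, hi]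
      · intro j
        fin_cases j
        exacts [hL.norm_piece_le m, hL'.norm_piece_le n, h1]
      · intro ha'
        refine (hL.integral_piece_le ha' hf m).trans_eq ?_
        rw [relSize, if_pos ha', div_mul_cancel₀ _ hμ.ne']
      · intro hb'
        refine (hL'.integral_piece_le hb' hg n).trans_eq ?_
        rw [relSize, if_pos hb', div_mul_cancel₀ _ hμ.ne']
      · show ∫ z, ‖h z‖ ≤ μ
        rw [← ENNReal.ofReal_le_ofReal_iff hμ.le, ofReal_integral_norm_eq_lintegral_enorm hi]
        exact hlint
      · intro hx
        obtain ⟨ha', h2⟩ := hΩ₀ m hx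
        exact ⟨ha', fun z hz I hI => h2 z (hnot z hz).1 I hI⟩
      · intro hy
        obtain ⟨hb', h2⟩ := hΩ₁ n hy
        exact ⟨hb', fun z hz I hI => h2 z (hnot z hz).2 I hI⟩
      · have p2 : (0 : ℝ) < 2 ^ s := by positivity
        exact mul_mul_mul_le_of_le hC.le hμ.le (gain_nonneg _ _ px.le) (gain_nonneg _ _ py.le)
          (gain_mono ha hε0.le px.le (relSize_le_relSize p2 hsμ m))
          (gain_mono hb hε0.le py.le (relSize_le_relSize p2 hsμ n))
    rw [lsum, lsum, ← ENNReal.tsum_mul_right, ← ENNReal.tsum_mul_left]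
    refine ENNReal.tsum_le_tsum fun m => ?_
    rw [← ENNReal.tsum_mul_left, ← ENNReal.tsum_mul_left]
    refine ENNReal.tsum_le_tsum fun n => ?_
    refine (mul_le_mul' le_rfl (one m n)).trans_eq ?_
    have p2 : (0 : ℝ) < 2 ^ s := by positivity
    have g1 := gain_nonneg a ε (relSize_pos a p2 m).le
    have g2 := gain_nonneg b ε (relSize_pos b p2 n).le
    have t1 := hL.nonneg m
    have t2 := hL'.nonneg n
    rw [← ENNReal.ofReal_mul t1, ← ENNReal.ofReal_mul (by positivity), ← ENNReal.ofReal_mul (by positivity),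
      ← ENNReal.ofReal_mul (by positivity)]
    congr 1; ring
  have Λfin : Λ ≠ ∞ := by
    obtain ⟨x, hx⟩ : G'.Nonempty := nonempty_of_measure_ne_zero vG'0
    exact (hx.1.1.trans_le le_top).ne
  have strict : Λ * volume G' < ∫⁻ x in G', ‖H x‖ₑ := by
    rw [← setLIntegral_const]
    refine setLIntegral_strict_mono mG' vG'0 mH ?_ (ae_of_all _ fun x hx => hx.1.1)
    rw [setLIntegral_const]
    exact ENNReal.mul_ne_top Λfin G'fin
  have c0 : ENNReal.ofReal c₀ ≠ 0 := by simpa using hc₀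
  refine ((ENNReal.mul_lt_mul_iff_right c0 ENNReal.ofReal_ne_top).2 strict).not_ge ?_
  refine (pair.trans upper).trans ?_
  calc _ = ENNReal.ofReal c₀ * (Λ * ENNReal.ofReal (μ / 2)) := by
        rw [hΛ, mul_right_comm, ← ENNReal.ofReal_mul (by positivity), ← mul_assoc (ENNReal.ofReal c₀),
          ← ENNReal.ofReal_mul hc₀.le]
        congr 2
        field_simp
    _ ≤ _ := by gcongr

lemma lintegral_enorm_rpow_le_of_distr {V : Type*} [NormedAddCommGroup V] {H : ℝ → V} (hH : Continuous H)
    {Λ : ℤ → ℝ≥0∞} (h : ∀ s : ℤ, volume {x | Λ s < ‖H x‖ₑ} ≤ ENNReal.ofReal (2 ^ s)) {r : ℝ} (hr : 0 < r) :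
    ∫⁻ x, ‖H x‖ₑ ^ r ≤ 2 * ∫⁻ s, Λ s ^ r ∂dy := by
  by_cases hf : ∃ s, Λ s = ∞
  · obtain ⟨s, hs⟩ := hf
    refine le_top.trans_eq (Eq.symm ?_)
    have : ∫⁻ s, Λ s ^ r ∂dy = ∞ := by
      rw [lintegral_dy]
      refine ENNReal.tsum_eq_top_of_eq_top ⟨s, ?_⟩
      rw [hs, ENNReal.top_rpow_of_pos hr, ENNReal.mul_top]
      simp only [ne_eq, ENNReal.ofReal_eq_zero, not_le]
      positivity
    rw [this, ENNReal.mul_top (by simp)]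
  · push Not at hf
    rw [← lintegral_ofReal_norm_rpow H hr]
    refine (lintegral_rpow_le_of_distr hH.norm.measurable (fun x => norm_nonneg _)
      (Λ := fun s => (Λ s).toReal) (fun s => ENNReal.toReal_nonneg) (fun s => ?_) hr).trans_eq ?_
    · refine (measure_mono fun x hx => ?_).trans (h s)
      rw [Set.mem_ofPred_eq] at hx ⊢
      rw [← ofReal_norm]
      exact (ENNReal.lt_ofReal_iff_toReal_lt (hf s)).2 hx
    · congr 2 with s
      rw [← ENNReal.ofReal_rpow_of_nonneg ENNReal.toReal_nonneg hr.le, ENNReal.ofReal_toReal (hf s)]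

lemma lintegral_rpow_mul_le_of_bound {u v : ℤ → ℝ≥0∞} {A B : ℝ≥0∞} {p : ℝ} (hp : 0 < p)
    (hu : (∫⁻ s, u s ^ p ∂dy) ^ (1 / p) ≤ A) (hv : ∀ s, v s ≤ B) :
    (∫⁻ s, (u s * v s) ^ p ∂dy) ^ (1 / p) ≤ A * B := by
  have h : ∫⁻ s, (u s * v s) ^ p ∂dy ≤ (∫⁻ s, u s ^ p ∂dy) * B ^ p := by
    rw [← lintegral_mul_const _ (Measurable.of_discrete)]
    refine lintegral_mono fun s => ?_
    rw [ENNReal.mul_rpow_of_nonneg _ _ hp.le]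
    gcongr
    exact hv s
  refine (ENNReal.rpow_le_rpow h (by positivity)).trans ?_
  rw [ENNReal.mul_rpow_of_nonneg _ _ (by positivity), ← ENNReal.rpow_mul, mul_one_div_cancel hp.ne', ENNReal.rpow_one]
  gcongr

lemma lintegral_rpow_mul_le {u v : ℤ → ℝ≥0∞} {A B p q r : ℝ≥0∞} (hp : 1 < p) (hq : 1 < q)
    (hr : 1 / r = 1 / p + 1 / q) (hr0 : 0 < 1 / r)
    (hu : p ≠ ∞ → (∫⁻ s, u s ^ p.toReal ∂dy) ^ (1 / p.toReal) ≤ A) (hu' : p = ∞ → ∀ s, u s ≤ A)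
    (hv : q ≠ ∞ → (∫⁻ s, v s ^ q.toReal ∂dy) ^ (1 / q.toReal) ≤ B) (hv' : q = ∞ → ∀ s, v s ≤ B) :
    (∫⁻ s, (u s * v s) ^ r.toReal ∂dy) ^ (1 / r.toReal) ≤ A * B := by
  simp only [one_div] at hr hr0
  rcases eq_or_ne p ∞ with rfl | hpt
  · rcases eq_or_ne q ∞ with rfl | hqt
    · simp [hr] at hr0
    · have : r = q := by simpa using hr
      subst this
      have := lintegral_rpow_mul_le_of_bound (ENNReal.toReal_pos (zero_lt_one.trans hq).ne' hqt) (hv hqt) (hu' rfl)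
      simpa only [mul_comm] using this
  · have pp : 0 < p.toReal := ENNReal.toReal_pos (zero_lt_one.trans hp).ne' hpt
    rcases eq_or_ne q ∞ with rfl | hqt
    · have : r = p := by simpa using hr
      subst this
      exact lintegral_rpow_mul_le_of_bound pp (hu hpt) (hv' rfl)
    · have pq : 0 < q.toReal := ENNReal.toReal_pos (zero_lt_one.trans hq).ne' hqt
      have e : 1 / r.toReal = 1 / p.toReal + 1 / q.toReal := by
        rw [one_div, one_div, one_div, ← ENNReal.toReal_inv, hr, ENNReal.toReal_add, ENNReal.toReal_inv,
          ENNReal.toReal_inv]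
        · exact ENNReal.inv_ne_top.2 (zero_lt_one.trans hp).ne'
        · exact ENNReal.inv_ne_top.2 (zero_lt_one.trans hq).ne'
      have pr : 0 < r.toReal := by
        refine one_div_pos.1 ?_
        rw [e]; positivity
      refine (ENNReal.lintegral_Lp_mul_le_Lq_mul_Lr pr ?_ e dy Measurable.of_discrete.aemeasurable
        Measurable.of_discrete.aemeasurable).trans (mul_le_mul' (hu hpt) (hv hqt))
      refine (one_div_lt_one_div pp pr).1 ?_
      rw [e]
      exact lt_add_of_pos_right _ (by positivity)

/-- The strong-type estimate for an operator dominated by the model form. -/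
theorem exists_eLpNorm_le (φ : Fin 3 → SchwartzMap ℝ ℂ)
    (hφ : ∀ j ξ, 1 ≤ |ξ| → 𝓕 (φ j : ℝ → ℂ) ξ = 0) {p q r : ℝ≥0∞} (hp : 1 < p) (hq : 1 < q)
    (hr : 1 / r = 1 / p + 1 / q) (hr0 : 0 < 1 / r) (hr1 : 1 / r < 3 / 2) {c₀ : ℝ} (hc₀ : 0 < c₀) :
    ∃ C : ℝ≥0∞, C ≠ ∞ ∧
      ∀ (V : Type) [NormedAddCommGroup V] [InnerProductSpace ℂ V] [CompleteSpace V]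
      (f g H : ℝ → V), StronglyMeasurable f → StronglyMeasurable g → Integrable f → Integrable g →
      eLpNorm f p ≠ ∞ → eLpNorm g q ≠ ∞ → Continuous H →
      (∀ h : ℝ → V, Integrable h → (∀ x, ‖h x‖ ≤ 1) →
        ENNReal.ofReal c₀ * ‖∫ x, ⟪h x, H x⟫_ℂ‖ₑ ≤ triN φ ![f, g, h]) →
      eLpNorm H r ≤ C * eLpNorm f p * eLpNorm g q := by
  have inv_lt : ∀ {p : ℝ≥0∞}, 1 < p → p.toReal⁻¹ < 1 := by
    intro p hp
    rcases eq_or_ne p ∞ with rfl | hpt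
    · simp
    · exact inv_lt_one_of_one_lt₀ (by simpa using (ENNReal.toReal_lt_toReal (by simp) hpt).2 hp)
  have hpi : p⁻¹ ≠ ∞ := ENNReal.inv_ne_top.2 (zero_lt_one.trans hp).ne'
  have hqi : q⁻¹ ≠ ∞ := ENNReal.inv_ne_top.2 (zero_lt_one.trans hq).ne'
  have e : p.toReal⁻¹ + q.toReal⁻¹ = (1 / r).toReal := by
    rw [hr, one_div, one_div, ENNReal.toReal_add hpi hqi, ENNReal.toReal_inv, ENNReal.toReal_inv]
  have hri : 1 / r ≠ ∞ := by
    rw [hr, one_div, one_div]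
    exact ENNReal.add_ne_top.2 ⟨hpi, hqi⟩
  have hab : 0 < p.toReal⁻¹ + q.toReal⁻¹ := by
    rw [e]; exact ENNReal.toReal_pos hr0.ne' hri
  have hab' : p.toReal⁻¹ + q.toReal⁻¹ < 3 / 2 := by
    rw [e]
    have := (ENNReal.toReal_lt_toReal hri (by simp [ENNReal.div_eq_top])).2 hr1
    simpa using this
  obtain ⟨ε, hε, C, hC, hdist⟩ := exists_distr_le φ hφ (inv_nonneg.2 ENNReal.toReal_nonneg) (inv_lt hp)
    (inv_nonneg.2 ENNReal.toReal_nonneg) (inv_lt hq) hab hab' hc₀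
  obtain ⟨C₁, hC₁, hlev₁⟩ := exists_Levels p hp hε
  obtain ⟨C₂, hC₂, hlev₂⟩ := exists_Levels q hq hε
  have hrt : r ≠ ∞ := by
    rintro rfl; simp at hr0
  have hrz : r ≠ 0 := by
    rintro rfl; simp at hri
  have pr := ENNReal.toReal_pos hrz hrt
  refine ⟨2 ^ (1 / r.toReal) * ENNReal.ofReal C * (max C₁ 1 * max C₂ 1), ?_, ?_⟩
  · have := max_lt hC₁.lt_top ENNReal.one_lt_top
    have := max_lt hC₂.lt_top ENNReal.one_lt_top
    have : (2 : ℝ≥0∞) ^ (1 / r.toReal) ≠ ∞ := ENNReal.rpow_ne_top_of_nonneg (by positivity) (by simp)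
    finiteness
  intro V _ _ _ f g H mf mg hf hg hfp hgq hH hdual
  obtain ⟨T, E, hL, h1, h2⟩ := hlev₁ V f mf hf hfp
  obtain ⟨T', E', hL', h1', h2'⟩ := hlev₂ V g mg hg hgq
  have key := lintegral_enorm_rpow_le_of_distr hH (hdist V f g H T T' E E' hf hg hH hL hL' hdual) pr
  have hold : (∫⁻ s, (lsum p.toReal⁻¹ ε T s * lsum q.toReal⁻¹ ε T' s) ^ r.toReal ∂dy) ^ (1 / r.toReal) ≤
      (max C₁ 1 * eLpNorm f p) * (max C₂ 1 * eLpNorm g q) := by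
    refine lintegral_rpow_mul_le hp hq hr hr0 (fun h => (h1 h).trans ?_) (fun h s => (h2 h s).trans ?_)
      (fun h => (h1' h).trans ?_) (fun h s => (h2' h s).trans ?_)
    · gcongr; exact le_max_left _ _
    · exact le_mul_of_one_le_left' (le_max_right _ _)
    · gcongr; exact le_max_left _ _
    · exact le_mul_of_one_le_left' (le_max_right _ _)
  rw [eLpNorm_eq_lintegral_rpow_enorm_toReal hrz hrt]
  refine (ENNReal.rpow_le_rpow key (by positivity)).trans ?_
  simp_rw [ENNReal.mul_rpow_of_nonneg (ENNReal.ofReal C) _ pr.le]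
  rw [lintegral_const_mul _ Measurable.of_discrete, ENNReal.mul_rpow_of_nonneg _ _ (by positivity),
    ENNReal.mul_rpow_of_nonneg _ _ (by positivity), ← ENNReal.rpow_mul, mul_one_div_cancel pr.ne', ENNReal.rpow_one]
  refine (mul_le_mul' le_rfl (mul_le_mul' le_rfl hold)).trans_eq ?_
  ring

lemma exists_schwartz_bump {a b : ℝ} (ha : 0 < a) (hab : a < b) :
    ∃ (φ : SchwartzMap ℝ ℂ) (θ : ℝ → ℝ), Continuous θ ∧ (∀ x, 0 ≤ θ x) ∧ (∀ x, |x| ≤ a → θ x = 1) ∧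
      (∀ x, b ≤ |x| → θ x = 0) ∧ (∀ x, θ x ≤ 1) ∧ ∀ ξ, 𝓕 (φ : ℝ → ℂ) ξ = θ ξ := by
  let B : ContDiffBump (0 : ℝ) := ⟨a, b, ha, hab⟩
  have h1 : HasCompactSupport fun x => ((B x : ℝ) : ℂ) := B.hasCompactSupport.comp_left (g := fun x : ℝ => (x : ℂ)) (by simp)
  have h2 : ContDiff ℝ (⊤ : ℕ∞) fun x => ((B x : ℝ) : ℂ) := Complex.ofRealCLM.contDiff.comp B.contDiff
  refine ⟨𝓕⁻ (h1.toSchwartzMap h2), B, B.continuous, fun x => B.nonneg, fun x hx => ?_, fun x hx => ?_,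
    fun x => B.le_one, fun ξ => ?_⟩
  · exact B.one_of_mem_closedBall (by simpa using hx)
  · exact B.zero_of_le_dist (by simpa using hx)
  · rw [← SchwartzMap.fourier_coe]
    simp

lemma integral_conj_pkt (φ : SchwartzMap ℝ ℂ) {t : ℝ} (ht : 0 < t) (ν x ζ : ℝ) :
    ∫ y, conj (pkt φ t ν y x) * ee (ζ * y) = ee (ζ * x) * conj (𝓕 (φ : ℝ → ℂ) (t * (ζ - ν))) := by
  have h2 : ∀ y, conj (pkt φ t ν y x) * ee (ζ * y) =
      (fun z => conj ((t⁻¹ : ℝ) * ee (-(ζ * x)) * (ee (-(z / t * (t * (ζ - ν)))) * φ (z / t)))) (y - x) := by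
    intro y
    unfold pkt
    simp only [map_mul, conj_ee, Complex.conj_ofReal, neg_neg]
    have : ee (-(ν * (y - x))) * ee (ζ * y) = ee (ζ * x) * ee ((y - x) / t * (t * (ζ - ν))) := by
      rw [← ee_add, ← ee_add]; congr 1; field_simp; ring
    linear_combination ((t⁻¹ : ℝ) : ℂ) * conj (φ ((y - x) / t)) * this
  simp_rw [h2]
  rw [integral_sub_right_eq_self (fun z => conj ((t⁻¹ : ℝ) * ee (-(ζ * x)) * (ee (-(z / t * (t * (ζ - ν)))) * φ (z / t)))),
    Measure.integral_comp_div (fun u => conj ((t⁻¹ : ℝ) * ee (-(ζ * x)) * (ee (-(u * (t * (ζ - ν)))) * φ u))),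
    abs_of_pos ht, integral_conj, integral_const_mul, fourier_eq_ee]
  simp only [smul_eq_mul, Complex.real_smul, map_mul, conj_ee, neg_neg, Complex.conj_ofReal]
  have : (t : ℂ) * (t⁻¹ : ℝ) = 1 := by rw [← Complex.ofReal_mul, mul_inv_cancel₀ ht.ne']; simp
  linear_combination (ee (ζ * x) * conj (∫ v, ee (-(v * (t * (ζ - ν)))) * φ v)) * this

lemma integral_prod_inner {α β V : Type*} [MeasurableSpace α] [MeasurableSpace β] {μ : Measure α} {ν : Measure β}
    [SFinite μ] [SFinite ν] [NormedAddCommGroup V] [InnerProductSpace ℂ V] [CompleteSpace V] {u : α → V} {w : β → V}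
    (hu : Integrable u μ) (hw : Integrable w ν) :
    ∫ z, ⟪u z.1, w z.2⟫_ℂ ∂(μ.prod ν) = ⟪∫ x, u x ∂μ, ∫ x, w x ∂ν⟫_ℂ := by
  rw [integral_prod]
  · simp_rw [integral_inner hw]
    rw [← inner_conj_symm, ← integral_inner hu, ← integral_conj]
    simp_rw [inner_conj_symm]
  · exact hu.op_fst_snd (op := fun a b => ⟪a, b⟫_ℂ) (by fun_prop) ⟨1, fun x y => by simpa using norm_inner_le_norm x y⟩ hw

/-- The symbol of a continuous family of frequency squares along the diagonal direction. -/
def thet (θ : ℝ → ℝ) (ξ τ : ℝ × ℝ) : ℝ :=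
  θ (τ.1 * (ξ.1 - τ.2) + 32) * θ (τ.1 * (ξ.2 - τ.2) - 32)

/-- The measure on pairs of a scale and a frequency. -/
noncomputable def scf : Measure (ℝ × ℝ) := (volume.restrict (Ioi 0)).prod volume

instance : SFinite scf := by unfold scf; infer_instance

section
variable {θ : ℝ → ℝ}

lemma abs_lt_of_thet_ne_zero (hb : ∀ x, 1 / 4 ≤ |x| → θ x = 0) {ξ τ : ℝ × ℝ} (h : thet θ ξ τ ≠ 0) :
    |τ.1 * (ξ.1 - τ.2) + 32| < 1 / 4 ∧ |τ.1 * (ξ.2 - τ.2) - 32| < 1 / 4 := by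
  unfold thet at h
  constructor
  · by_contra hc
    exact h (by rw [hb _ (not_lt.1 hc), zero_mul])
  · by_contra hc
    exact h (by rw [hb _ (not_lt.1 hc), mul_zero])

lemma continuous_thet (hc : Continuous θ) : Continuous fun z : (ℝ × ℝ) × (ℝ × ℝ) => thet θ z.1 z.2 := by
  unfold thet; fun_prop

lemma integrable_thet (hc : Continuous θ) (hb : ∀ x, 1 / 4 ≤ |x| → θ x = 0) (ξ : ℝ × ℝ) :
    Integrable (thet θ ξ) := by
  refine ((continuous_thet hc).comp (Continuous.prodMk_right ξ)).integrable_of_hasCompactSupport ?_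
  set D := |ξ.2 - ξ.1| with hD
  have hK : IsCompact (Icc (-(65 / D)) (65 / D) ×ˢ Icc (ξ.1 - D) (ξ.1 + D)) := isCompact_Icc.prod isCompact_Icc
  refine HasCompactSupport.intro hK fun τ hτ => ?_
  by_contra hne
  obtain ⟨h1, h2⟩ := abs_lt_of_thet_ne_zero hb hne
  apply hτ
  rw [abs_lt] at h1 h2
  have h3 : 63 < τ.1 * (ξ.2 - ξ.1) := by linarith
  have h4 : τ.1 * (ξ.2 - ξ.1) < 65 := by linarith
  have h5 : |τ.1| * D = τ.1 * (ξ.2 - ξ.1) := by rw [hD, ← abs_mul, abs_of_pos (by linarith)]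
  have D0 : 0 < D := by
    rcases (abs_nonneg (ξ.2 - ξ.1)).eq_or_lt with h | h
    · rw [hD, ← h] at h5; linarith
    · exact h
  have t1 : |τ.1| ≤ 65 / D := by rw [le_div_iff₀ D0]; linarith
  have t2 : |ξ.1 - τ.2| ≤ D := by
    have : |τ.1| * |ξ.1 - τ.2| ≤ 33 := by
      rw [← abs_mul, abs_le]; constructor <;> linarith
    have h0 : 0 < |τ.1| := by
      by_contra hc
      have := le_antisymm (not_lt.1 hc) (abs_nonneg _)
      rw [this] at h5; linarith
    nlinarith
  rw [abs_le] at t1 t2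
  exact ⟨⟨by linarith, t1.2⟩, ⟨by linarith, by linarith⟩⟩

lemma scf_eq : scf = (volume : Measure (ℝ × ℝ)).restrict (Ioi 0 ×ˢ univ) := by
  rw [scf, Measure.volume_eq_prod, ← Measure.prod_restrict, Measure.restrict_univ]

lemma exists_integral_thet (hc : Continuous θ) (h0 : ∀ x, 0 ≤ θ x) (h1 : θ 0 = 1)
    (hb : ∀ x, 1 / 4 ≤ |x| → θ x = 0) :
    ∃ c : ℝ, 0 < c ∧ ∀ ξ : ℝ × ℝ, ∫ τ, thet θ ξ τ ∂scf = if ξ.1 < ξ.2 then c else 0 := by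
  have hi : ∀ ξ, Integrable (thet θ ξ) scf := fun ξ => by
    rw [scf_eq]; exact (integrable_thet hc hb ξ).restrict
  have hnn : ∀ ξ τ, 0 ≤ thet θ ξ τ := fun ξ τ => mul_nonneg (h0 _) (h0 _)
  refine ⟨∫ τ, thet θ (0, 1) τ ∂scf, ?_, fun ξ => ?_⟩
  · rw [integral_pos_iff_support_of_nonneg (hnn _) (hi _)]
    have ho : IsOpen (Function.support (thet θ (0, 1))) :=
      isOpen_ne_fun ((continuous_thet hc).comp (Continuous.prodMk_right _)) continuous_const
    have hS : IsOpen (Ioi (0 : ℝ) ×ˢ (univ : Set ℝ)) := isOpen_Ioi.prod isOpen_univ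
    rw [scf_eq, Measure.restrict_apply ho.measurableSet]
    refine (ho.inter hS).measure_pos _ ⟨(64, 1 / 2), ?_, by simp⟩
    rw [Function.mem_support, thet]
    norm_num [h1]
  · rw [scf, integral_prod _ (hi ξ), integral_prod _ (hi (0, 1))]
    split_ifs with h
    · have hΔ : 0 < ξ.2 - ξ.1 := by linarith
      have inner : ∀ t, ∫ η, thet θ ξ (t, η) = (ξ.2 - ξ.1) • ∫ η, thet θ (0, 1) ((ξ.2 - ξ.1) * t, η) := by
        intro t
        have e : ∀ η, thet θ (0, 1) ((ξ.2 - ξ.1) * t, η) =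
            (fun u => thet θ ξ (t, u + ξ.1)) ((ξ.2 - ξ.1) * η) := by
          intro η
          simp only [thet]
          congr 2 <;> ring
        simp_rw [e]
        rw [Measure.integral_comp_mul_left (fun u => thet θ ξ (t, u + ξ.1)),
          integral_add_right_eq_self (fun u => thet θ ξ (t, u)), abs_of_pos (inv_pos.2 hΔ), smul_inv_smul₀ hΔ.ne']
      simp_rw [inner]
      rw [integral_smul, integral_comp_mul_left_Ioi (fun t => ∫ η, thet θ (0, 1) (t, η)) 0 hΔ, mul_zero,
        smul_inv_smul₀ hΔ.ne']
    · refine setIntegral_eq_zero_of_forall_eq_zero fun t ht => ?_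
      have : ∀ η, thet θ ξ (t, η) = 0 := by
        intro η
        by_contra hne
        obtain ⟨h2, h3⟩ := abs_lt_of_thet_ne_zero hb hne
        rw [abs_lt] at h2 h3
        have : t * (ξ.2 - ξ.1) ≤ 0 := mul_nonpos_of_nonneg_of_nonpos (le_of_lt (mem_Ioi.1 ht)) (by linarith)
        simp only at h2 h3
        linarith
      simp [this]
end

section
variable {V : Type*} [NormedAddCommGroup V] [InnerProductSpace ℂ V] [CompleteSpace V]

lemma pf_eq_integral (φ : SchwartzMap ℝ ℂ) {α f : ℝ → V} (hα : Integrable α) (hf : ∀ x, f x = ∫ ξ, ee (x * ξ) • α ξ)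
    {t : ℝ} (ht : 0 < t) (ν y : ℝ) :
    pf φ f t ν y = ∫ ξ, (ee (ξ * y) * 𝓕 (φ : ℝ → ℂ) (t * (ξ - ν))) • α ξ := by
  unfold pf
  simp_rw [hf, ← integral_smul, smul_smul]
  rw [integral_integral_swap]
  · simp_rw [integral_smul_const, ← fourier_conj_pkt φ ht]
    congr 1 with ξ
    congr 2 with x
    rw [mul_comm x]
  · have h1 := ((integrable_pkt φ ht ν y).smul_prod hα)
    have h2 : Continuous fun z : ℝ × ℝ => ee (z.1 * z.2) := continuous_ee.comp (by fun_prop)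
    refine (h1.bdd_smul 1 h2.aestronglyMeasurable (ae_of_all _ fun z => (norm_ee _).le)).congr (ae_of_all _ fun z => ?_)
    show ee _ • (pkt _ _ _ _ _ • α _) = (pkt _ _ _ _ _ * ee _) • α _
    rw [smul_smul, mul_comm]

lemma continuous_pkt_prod (φ : SchwartzMap ℝ ℂ) (t ν : ℝ) : Continuous fun z : ℝ × ℝ => pkt φ t ν z.1 z.2 := by
  unfold pkt
  have := φ.continuous
  have := continuous_ee
  fun_prop

lemma integrable_pkt_fst (φ : SchwartzMap ℝ ℂ) {t : ℝ} (ht : 0 < t) (ν x : ℝ) :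
    Integrable fun y => pkt φ t ν y x := by
  refine (((φ.integrable.comp_div ht.ne').comp_sub_right x).const_mul ((t⁻¹ : ℝ) : ℂ)).mono
    ((continuous_pkt_prod φ t ν).comp (Continuous.prodMk_left x)).aestronglyMeasurable (ae_of_all _ fun y => ?_)
  rw [pkt, norm_mul _ (ee _), norm_ee, mul_one]

lemma integral_norm_pkt_fst (φ : SchwartzMap ℝ ℂ) {t : ℝ} (ht : 0 < t) (ν x : ℝ) :
    ∫ y, ‖pkt φ t ν y x‖ = ∫ y, ‖φ y‖ := by
  simp_rw [norm_pkt φ ht]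
  rw [integral_const_mul, integral_sub_right_eq_self (fun y => ‖φ (y / t)‖), Measure.integral_comp_div (fun y => ‖φ y‖),
    abs_of_pos ht, smul_eq_mul, inv_mul_cancel_left₀ ht.ne']

lemma integral_thet_mul_eq {φ ψ : SchwartzMap ℝ ℂ} {θ : ℝ → ℝ} (hc : Continuous θ) (h0 : ∀ x, 0 ≤ θ x)
    (h1 : ∀ x, θ x ≤ 1) (hb : ∀ x, 1 / 4 ≤ |x| → θ x = 0) (hφ : ∀ ξ, 𝓕 (φ : ℝ → ℂ) ξ = θ ξ)
    (hψ : ∀ ξ, |ξ| ≤ 1 / 2 → 𝓕 (ψ : ℝ → ℂ) ξ = 1) {α : ℝ → V} {β : ℝ → ℂ} {h : ℝ → V} (hα : Integrable α)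
    (hβ : Integrable β) (hh : Integrable h) {t : ℝ} (ht : 0 < t) (η : ℝ) :
    ∫ p : ℝ × (ℝ × ℝ), (thet θ p.2 (t, η) : ℂ) * (ee (p.1 * (p.2.1 + p.2.2)) * ⟪h p.1, β p.2.2 • α p.2.1⟫_ℂ) =
      ∫ y, ⟪pf ψ h t (2 * η) y, (∫ ξ, ee (ξ * y) * 𝓕 (φ : ℝ → ℂ) (t * (ξ - (η + 32 / t))) * β ξ) •
        ∫ ξ, (ee (ξ * y) * 𝓕 (φ : ℝ → ℂ) (t * (ξ - (η - 32 / t)))) • α ξ⟫_ℂ := by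
  have hw : Integrable fun ξ : ℝ × ℝ => β ξ.2 • α ξ.1 := (hβ.smul_prod hα).swap
  have hT : Continuous fun ξ : ℝ × ℝ => (thet θ ξ (t, η) : ℂ) :=
    Complex.continuous_ofReal.comp ((continuous_thet hc).comp (Continuous.prodMk_left _))
  have nT : ∀ ξ : ℝ × ℝ, ‖(thet θ ξ (t, η) : ℂ)‖ ≤ 1 := fun ξ => by
    rw [Complex.norm_real, thet, norm_of_nonneg (mul_nonneg (h0 _) (h0 _))]
    exact mul_le_one₀ (h1 _) (h0 _) (h1 _)
  have hhw : Integrable fun p : ℝ × (ℝ × ℝ) => ⟪h p.1, β p.2.2 • α p.2.1⟫_ℂ :=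
    hh.op_fst_snd (op := fun a b => ⟪a, b⟫_ℂ) (by fun_prop)
      ⟨1, fun x y => by simpa using norm_inner_le_norm x y⟩ hw
  have hThw : Integrable fun p : ℝ × (ℝ × ℝ) => (thet θ p.2 (t, η) : ℂ) * ⟪h p.1, β p.2.2 • α p.2.1⟫_ℂ :=
    hhw.bdd_mul (c := 1) (hT.comp continuous_snd).aestronglyMeasurable (ae_of_all _ fun p => nT _)
  have e1 : ∀ p : ℝ × (ℝ × ℝ), (thet θ p.2 (t, η) : ℂ) * (ee (p.1 * (p.2.1 + p.2.2)) * ⟪h p.1, β p.2.2 • α p.2.1⟫_ℂ) =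
      ∫ y, (conj (pkt ψ t (2 * η) y p.1) * ee ((p.2.1 + p.2.2) * y)) *
        ((thet θ p.2 (t, η) : ℂ) * ⟪h p.1, β p.2.2 • α p.2.1⟫_ℂ) := by
    intro p
    rw [integral_mul_const, integral_conj_pkt ψ ht]
    rcases eq_or_ne (thet θ p.2 (t, η)) 0 with hz | hz
    · rw [hz]; simp
    · obtain ⟨a1, a2⟩ := abs_lt_of_thet_ne_zero hb hz
      rw [hψ]
      · rw [map_one, mul_comm p.1]; ring
      · rw [abs_lt] at a1 a2
        rw [abs_le]
        constructor <;> nlinarith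
  simp_rw [e1]
  rw [integral_integral_swap]
  · congr 1 with y
    have e2 : ∀ p : ℝ × (ℝ × ℝ), (conj (pkt ψ t (2 * η) y p.1) * ee ((p.2.1 + p.2.2) * y)) *
        ((thet θ p.2 (t, η) : ℂ) * ⟪h p.1, β p.2.2 • α p.2.1⟫_ℂ) =
        ⟪pkt ψ t (2 * η) y p.1 • h p.1, (ee (p.2.2 * y) * 𝓕 (φ : ℝ → ℂ) (t * (p.2.2 - (η + 32 / t))) * β p.2.2) •
        (ee (p.2.1 * y) * 𝓕 (φ : ℝ → ℂ) (t * (p.2.1 - (η - 32 / t)))) • α p.2.1⟫_ℂ := by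
      intro p
      simp only [inner_smul_left, inner_smul_right, hφ, thet, add_mul, ee_add]
      have a1 : t * (p.2.2 - (η + 32 / t)) = t * (p.2.2 - η) - 32 := by field_simp; ring
      have a2 : t * (p.2.1 - (η - 32 / t)) = t * (p.2.1 - η) + 32 := by field_simp; ring
      rw [a1, a2]
      push_cast
      ring
    simp_rw [e2]
    have nφ : ∀ ξ ν ζ, ‖ee ζ * 𝓕 (φ : ℝ → ℂ) (t * (ξ - ν))‖ ≤ 1 := fun ξ ν ζ => by
      rw [norm_mul, norm_ee, one_mul, hφ, Complex.norm_real, norm_of_nonneg (h0 _)]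
      exact h1 _
    have cφ : ∀ ν, Continuous fun ξ => ee (ξ * y) * 𝓕 (φ : ℝ → ℂ) (t * (ξ - ν)) := fun ν => by
      simp_rw [hφ]
      exact (continuous_ee.comp (by fun_prop)).mul (Complex.continuous_ofReal.comp (hc.comp (by fun_prop)))
    have i1 : Integrable fun x => pkt ψ t (2 * η) y x • h x := by
      obtain ⟨C, hC, hd⟩ := schwartz_decay ψ 0
      refine hh.bdd_smul (t⁻¹ * C) (continuous_pkt ψ t _ y).aestronglyMeasurable (ae_of_all _ fun x => ?_)
      simpa using norm_pkt_le hd ht (2 * η) y x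
    have i2 : Integrable fun ξ => ee (ξ * y) * 𝓕 (φ : ℝ → ℂ) (t * (ξ - (η + 32 / t))) * β ξ :=
      hβ.bdd_mul (c := 1) (cφ _).aestronglyMeasurable (ae_of_all _ fun ξ => nφ _ _ _)
    have i3 : Integrable fun ξ => (ee (ξ * y) * 𝓕 (φ : ℝ → ℂ) (t * (ξ - (η - 32 / t)))) • α ξ :=
      hα.bdd_smul 1 (cφ _).aestronglyMeasurable (ae_of_all _ fun ξ => nφ _ _ _)
    refine (integral_prod_inner i1 (i2.smul_prod i3).swap).trans ?_
    rw [← integral_prod_smul, ← integral_prod_swap]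
    rfl
  · have m1 : Continuous fun z : (ℝ × (ℝ × ℝ)) × ℝ =>
        conj (pkt ψ t (2 * η) z.2 z.1.1) * ee ((z.1.2.1 + z.1.2.2) * z.2) :=
      (Complex.continuous_conj.comp ((continuous_pkt_prod ψ t (2 * η)).comp (f := fun z : (ℝ × (ℝ × ℝ)) × ℝ => (z.2, z.1.1))
        (by fun_prop))).mul (continuous_ee.comp (by fun_prop))
    refine (integrable_prod_iff (m1.aestronglyMeasurable.mul hThw.aestronglyMeasurable.comp_fst)).2 ⟨ae_of_all _ fun p => ?_, ?_⟩
    · have i4 : Integrable fun y => conj (pkt ψ t (2 * η) y p.1) * ee ((p.2.1 + p.2.2) * y) := by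
        refine ((integrable_pkt_fst ψ ht (2 * η) p.1).mono (m1.comp (Continuous.prodMk_right p)).aestronglyMeasurable
          (ae_of_all _ fun y => ?_))
        rw [norm_mul, norm_ee, mul_one, RCLike.norm_conj]
      exact i4.mul_const ((thet θ p.2 (t, η) : ℂ) * ⟪h p.1, β p.2.2 • α p.2.1⟫_ℂ)
    · refine (hThw.norm.const_mul (∫ y, ‖ψ y‖)).congr (ae_of_all _ fun p => ?_)
      show _ = ∫ y, ‖(conj (pkt ψ t (2 * η) y p.1) * ee ((p.2.1 + p.2.2) * y)) *
        ((thet θ p.2 (t, η) : ℂ) * ⟪h p.1, β p.2.2 • α p.2.1⟫_ℂ)‖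
      simp only [norm_mul, norm_ee, mul_one, RCLike.norm_conj]
      rw [integral_mul_const, integral_norm_pkt_fst ψ ht]
end

/-- A bilinear multiplier whose symbol is the indicator of a half-plane is controlled by the model form. -/
theorem exists_model : ∃ φ : Fin 3 → SchwartzMap ℝ ℂ, (∀ j ξ, 1 ≤ |ξ| → 𝓕 (φ j : ℝ → ℂ) ξ = 0) ∧ ∃ c : ℝ, 0 < c ∧
    ∀ (V : Type) [NormedAddCommGroup V] [InnerProductSpace ℂ V] [CompleteSpace V] (α : ℝ → V) (β : ℝ → ℂ)
      (f g : ℝ → V) (v : V), ‖v‖ = 1 → Integrable α → Integrable β → Integrable f → Integrable g →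
      (∀ x, f x = ∫ ξ, ee (x * ξ) • α ξ) → (∀ x, g x = (∫ ξ, ee (x * ξ) * β ξ) • v) →
      ∀ h : ℝ → V, Integrable h →
      ENNReal.ofReal c * ‖∫ x, ⟪h x, ∫ ξ : ℝ × ℝ, {ξ : ℝ × ℝ | ξ.1 < ξ.2}.indicator
        (fun ξ => ee (x * (ξ.1 + ξ.2)) • β ξ.2 • α ξ.1) ξ⟫_ℂ‖ₑ ≤ triN φ ![f, g, h] := by
  obtain ⟨φ, θ, hc, h0, h1, hb, hle, hφ⟩ := exists_schwartz_bump (a := 1 / 8) (b := 1 / 4) (by norm_num) (by norm_num)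
  obtain ⟨ψ, θ', -, -, h1', hb', -, hψ⟩ := exists_schwartz_bump (a := 1 / 2) (b := 1) (by norm_num) (by norm_num)
  obtain ⟨c, hc0, hint⟩ := exists_integral_thet hc h0 (h1 0 (by norm_num)) hb
  refine ⟨![φ, φ, ψ], ?_, c, hc0, ?_⟩
  · intro j ξ hξ
    fin_cases j
    · show 𝓕 (φ : ℝ → ℂ) ξ = 0
      rw [hφ, hb _ (by linarith)]; simp
    · show 𝓕 (φ : ℝ → ℂ) ξ = 0
      rw [hφ, hb _ (by linarith)]; simp
    · show 𝓕 (ψ : ℝ → ℂ) ξ = 0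
      rw [hψ, hb' _ hξ]; simp
  intro V _ _ _ α β f g v hv hα hβ hf hg ef eg h hh
  have hw : Integrable fun ξ : ℝ × ℝ => β ξ.2 • α ξ.1 := (hβ.smul_prod hα).swap
  have hL : Integrable fun p : ℝ × (ℝ × ℝ) => ee (p.1 * (p.2.1 + p.2.2)) * ⟪h p.1, β p.2.2 • α p.2.1⟫_ℂ := by
    have hhw : Integrable fun p : ℝ × (ℝ × ℝ) => ⟪h p.1, β p.2.2 • α p.2.1⟫_ℂ :=
      hh.op_fst_snd (op := fun a b => ⟪a, b⟫_ℂ) (by fun_prop)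
        ⟨1, fun x y => by simpa using norm_inner_le_norm x y⟩ hw
    exact hhw.bdd_mul (c := 1) (continuous_ee.comp (by fun_prop)).aestronglyMeasurable (ae_of_all _ fun p => (norm_ee _).le)
  have mT := continuous_thet hc
  have hi : ∀ ξ, Integrable (thet θ ξ) scf := fun ξ => by
    rw [scf_eq]; exact (integrable_thet hc hb ξ).restrict
  have hnn : ∀ ξ τ, 0 ≤ thet θ ξ τ := fun ξ τ => mul_nonneg (h0 _) (h0 _)
  have mS : MeasurableSet {ξ : ℝ × ℝ | ξ.1 < ξ.2} := measurableSet_lt measurable_fst measurable_snd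
  have e1 : (c : ℂ) * ∫ x, ⟪h x, ∫ ξ : ℝ × ℝ, {ξ : ℝ × ℝ | ξ.1 < ξ.2}.indicator
        (fun ξ => ee (x * (ξ.1 + ξ.2)) • β ξ.2 • α ξ.1) ξ⟫_ℂ =
      ∫ p : ℝ × (ℝ × ℝ), ∫ τ, (thet θ p.2 τ : ℂ) * (ee (p.1 * (p.2.1 + p.2.2)) * ⟪h p.1, β p.2.2 • α p.2.1⟫_ℂ) ∂scf := by
    have e2 : ∀ p : ℝ × (ℝ × ℝ), ∫ τ, (thet θ p.2 τ : ℂ) * (ee (p.1 * (p.2.1 + p.2.2)) * ⟪h p.1, β p.2.2 • α p.2.1⟫_ℂ) ∂scf =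
        c * ((univ ×ˢ {ξ : ℝ × ℝ | ξ.1 < ξ.2}).indicator
          (fun p => ee (p.1 * (p.2.1 + p.2.2)) * ⟪h p.1, β p.2.2 • α p.2.1⟫_ℂ) p) := by
      intro p
      rw [integral_mul_const, integral_complex_ofReal, hint]
      by_cases hp : p.2.1 < p.2.2
      · rw [if_pos hp, indicator_of_mem (by exact ⟨trivial, hp⟩)]
      · rw [if_neg hp, indicator_of_notMem (by exact fun hh => hp hh.2)]; simp
    simp_rw [e2]
    rw [integral_const_mul]
    congr 1
    refine Eq.trans ?_ (integral_prod _ (hL.indicator (MeasurableSet.univ.prod mS))).symm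
    congr 1 with x
    rw [← integral_inner]
    · congr 1 with ξ
      by_cases hξ : ξ ∈ {ξ : ℝ × ℝ | ξ.1 < ξ.2}
      · rw [indicator_of_mem hξ, indicator_of_mem (by exact ⟨trivial, hξ⟩), inner_smul_right]
      · rw [indicator_of_notMem hξ, indicator_of_notMem (by exact fun hh => hξ hh.2), inner_zero_right]
    · exact (hw.bdd_smul 1 (continuous_ee.comp (by fun_prop)).aestronglyMeasurable
        (ae_of_all _ fun p => (norm_ee _).le)).indicator mS
  have e3 : ENNReal.ofReal c * ‖∫ x, ⟪h x, ∫ ξ : ℝ × ℝ, {ξ : ℝ × ℝ | ξ.1 < ξ.2}.indicator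
        (fun ξ => ee (x * (ξ.1 + ξ.2)) • β ξ.2 • α ξ.1) ξ⟫_ℂ‖ₑ =
      ‖(c : ℂ) * ∫ x, ⟪h x, ∫ ξ : ℝ × ℝ, {ξ : ℝ × ℝ | ξ.1 < ξ.2}.indicator
        (fun ξ => ee (x * (ξ.1 + ξ.2)) • β ξ.2 • α ξ.1) ξ⟫_ℂ‖ₑ := by
    rw [enorm_mul, ← ofReal_norm (c : ℂ), Complex.norm_real, norm_of_nonneg hc0.le]
  rw [e3, e1, integral_integral_swap]
  · have mt : Measurable (tri ![φ, φ, ψ] ![f, g, h]) := by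
      refine measurable_tri _ fun j => ?_
      fin_cases j
      exacts [hf.aestronglyMeasurable, hg.aestronglyMeasurable, hh.aestronglyMeasurable]
    have e4 : triN ![φ, φ, ψ] ![f, g, h] = ∫⁻ τ : ℝ × ℝ, (∫⁻ y : ℝ, tri ![φ, φ, ψ] ![f, g, h] (τ.1, τ.2, y)) ∂scf := by
      rw [triN, Measure.volume_eq_prod, ← Measure.prod_restrict, Measure.restrict_univ, lintegral_prod _ mt.aemeasurable,
        scf, lintegral_prod]
      · congr 1 with t
        exact lintegral_prod _ (mt.comp measurable_prodMk_left).aemeasurable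
      · exact (Measurable.lintegral_prod_right' (f := fun z : (ℝ × ℝ) × ℝ => tri ![φ, φ, ψ] ![f, g, h] (z.1.1, z.1.2, z.2))
          (mt.comp (by fun_prop))).aemeasurable
    rw [e4]
    refine (enorm_integral_le_lintegral_enorm _).trans ?_
    rw [scf_eq]
    refine setLIntegral_mono' (measurableSet_Ioi.prod MeasurableSet.univ) fun τ hτ => ?_
    have ht : 0 < τ.1 := hτ.1
    have := integral_thet_mul_eq hc h0 hle hb hφ (ψ := ψ) (fun ξ hξ => by rw [hψ, h1' _ hξ]; simp) hα hβ hh ht τ.2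
    refine (congrArg enorm this).trans_le ((enorm_integral_le_lintegral_enorm _).trans (lintegral_mono fun y => ?_))
    rw [tri_vec]
    show _ ≤ ‖pf φ f τ.1 (τ.2 - 32 / τ.1) y‖ₑ * ‖pf φ g τ.1 (τ.2 + 32 / τ.1) y‖ₑ * ‖pf ψ h τ.1 (2 * τ.2) y‖ₑ
    have hg' : ∀ x, g x = ∫ ξ, ee (x * ξ) • (β ξ • v) := fun x => by
      simp_rw [eg, smul_smul, integral_smul_const]
    rw [pf_eq_integral φ hα ef ht, pf_eq_integral φ (hβ.smul_const v) hg' ht]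
    simp_rw [smul_smul]
    rw [integral_smul_const, enorm_smul, ← ofReal_norm v, hv, ENNReal.ofReal_one, mul_one]
    simp only [← ofReal_norm, ← ENNReal.ofReal_mul (norm_nonneg _), ← ENNReal.ofReal_mul (mul_nonneg (norm_nonneg _) (norm_nonneg _))]
    refine ENNReal.ofReal_le_ofReal ((norm_inner_le_norm _ _).trans_eq ?_)
    rw [norm_smul]
    ring
  · have m2 : AEStronglyMeasurable (fun z : (ℝ × (ℝ × ℝ)) × (ℝ × ℝ) => (thet θ z.1.2 z.2 : ℂ) *
        (ee (z.1.1 * (z.1.2.1 + z.1.2.2)) * ⟪h z.1.1, β z.1.2.2 • α z.1.2.1⟫_ℂ)) (volume.prod scf) := by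
      have m3 : Continuous fun z : (ℝ × (ℝ × ℝ)) × (ℝ × ℝ) => (thet θ z.1.2 z.2 : ℂ) :=
        Complex.continuous_ofReal.comp (mT.comp (f := fun z : (ℝ × (ℝ × ℝ)) × (ℝ × ℝ) => (z.1.2, z.2)) (by fun_prop))
      have m4 := hL.aestronglyMeasurable.comp_fst (ν := scf)
      exact m3.aestronglyMeasurable.mul m4
    refine (integrable_prod_iff m2).2 ⟨ae_of_all _ fun p => (hi p.2).ofReal.mul_const
      (ee (p.1 * (p.2.1 + p.2.2)) * ⟪h p.1, β p.2.2 • α p.2.1⟫_ℂ), ?_⟩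
    · simp only [norm_mul, norm_ee, one_mul, Complex.norm_real]
      have e5 : ∀ p : ℝ × (ℝ × ℝ), ∫ τ, ‖thet θ p.2 τ‖ * ‖⟪h p.1, β p.2.2 • α p.2.1⟫_ℂ‖ ∂scf =
          (univ ×ˢ {ξ : ℝ × ℝ | ξ.1 < ξ.2}).indicator (fun p : ℝ × (ℝ × ℝ) => c * ‖ee (p.1 * (p.2.1 + p.2.2)) * ⟪h p.1, β p.2.2 • α p.2.1⟫_ℂ‖) p := by
        intro p
        simp_rw [norm_of_nonneg (hnn _ _)]
        rw [integral_mul_const, hint]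
        by_cases hp : p.2.1 < p.2.2
        · rw [if_pos hp, indicator_of_mem (by exact ⟨trivial, hp⟩), norm_mul, norm_ee, one_mul]
        · rw [if_neg hp, indicator_of_notMem (by exact fun hh => hp hh.2)]; simp
      simp_rw [e5]
      exact (hL.norm.const_mul c).indicator (MeasurableSet.univ.prod mS)

lemma FT_eq_fourier (f : SchwartzMap ℝ ℂ) : FT f = (𝓕 f : SchwartzMap ℝ ℂ) := by
  ext ξ
  rw [SchwartzMap.fourier_coe, fourier_eq_ee, FT]
  congr 1 with t
  rw [ee, smul_eq_mul]
  congr 4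
  ring

lemma integral_ee_mul_FT (f : SchwartzMap ℝ ℂ) (x : ℝ) : ∫ ξ, ee (x * ξ) * FT f ξ = f x := by
  have h : (𝓕⁻ (𝓕 f) : SchwartzMap ℝ ℂ) x = f x := by simp
  rw [SchwartzMap.fourierInv_coe, fourierInv_eq_ee] at h
  rw [← h, FT_eq_fourier]
  congr 1 with ξ
  rw [smul_eq_mul, mul_comm x]

lemma biMul_eq (A : Set ℝ) (f g : ℝ → ℂ) (x : ℝ) : biMul A f g x =
    ∫ ξ : ℝ × ℝ, (ee (x * (ξ.1 + ξ.2)) * A.indicator 1 (ξ.2 - ξ.1)) • (FT f ξ.1 * FT g ξ.2) := by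
  unfold biMul
  congr 1 with ξ
  rw [ee, smul_eq_mul, ← mul_assoc (2 * π)]
  ring

lemma norm_biMul_symbol_le (A : Set ℝ) (x ζ ξ : ℝ) : ‖ee x * A.indicator (1 : ℝ → ℂ) (ζ - ξ)‖ ≤ 1 := by
  rw [norm_mul, norm_ee, one_mul]
  exact (norm_indicator_le_norm_self _ _).trans (by simp)

lemma integrable_FT_prod (f g : SchwartzMap ℝ ℂ) : Integrable fun ξ : ℝ × ℝ => FT f ξ.1 * FT g ξ.2 := by
  rw [FT_eq_fourier, FT_eq_fourier]
  exact (SchwartzMap.integrable _).mul_prod (SchwartzMap.integrable _)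

lemma measurable_biMul_symbol {A : Set ℝ} (hA : MeasurableSet A) (x : ℝ) :
    Measurable fun ξ : ℝ × ℝ => ee (x * (ξ.1 + ξ.2)) * A.indicator (1 : ℝ → ℂ) (ξ.2 - ξ.1) := by
  have h1 : Measurable (A.indicator (1 : ℝ → ℂ)) := measurable_one.indicator hA
  exact (continuous_ee.comp (by fun_prop)).measurable.mul (h1.comp (by fun_prop))

lemma integrable_biMul {A : Set ℝ} (hA : MeasurableSet A) (f g : SchwartzMap ℝ ℂ) (x : ℝ) :
    Integrable fun ξ : ℝ × ℝ => (ee (x * (ξ.1 + ξ.2)) * A.indicator 1 (ξ.2 - ξ.1)) • (FT f ξ.1 * FT g ξ.2) :=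
  (integrable_FT_prod f g).bdd_smul 1 (measurable_biMul_symbol hA x).aestronglyMeasurable
    (ae_of_all _ fun _ => norm_biMul_symbol_le _ _ _ _)

lemma continuous_biMul {A : Set ℝ} (hA : MeasurableSet A) (f g : SchwartzMap ℝ ℂ) : Continuous (biMul A f g) := by
  simp_rw [funext (biMul_eq A f g)]
  refine continuous_of_dominated (bound := fun ξ => ‖FT f ξ.1 * FT g ξ.2‖)
    (fun x => (integrable_biMul hA f g x).aestronglyMeasurable) (fun x => ae_of_all _ fun ξ => ?_)
    (integrable_FT_prod f g).norm (ae_of_all _ fun ξ => ?_)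
  · rw [norm_smul]
    exact mul_le_of_le_one_left (norm_nonneg _) (norm_biMul_symbol_le _ _ _ _)
  · exact ((continuous_ee.comp (by fun_prop)).mul continuous_const).smul continuous_const

lemma tendsto_biMul {B : ℕ → Set ℝ} {A : Set ℝ} (hB : ∀ k, MeasurableSet (B k))
    (h : ∀ ξ, ∀ᶠ k in Filter.atTop, (ξ ∈ B k ↔ ξ ∈ A)) (f g : SchwartzMap ℝ ℂ) (x : ℝ) :
    Filter.Tendsto (fun k => biMul (B k) f g x) Filter.atTop (nhds (biMul A f g x)) := by
  simp_rw [biMul_eq]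
  refine tendsto_integral_of_dominated_convergence (fun ξ => ‖FT f ξ.1 * FT g ξ.2‖)
    (fun k => (integrable_biMul (hB k) f g x).aestronglyMeasurable) (integrable_FT_prod f g).norm
    (fun k => ae_of_all _ fun ξ => ?_) (ae_of_all _ fun ξ => ?_)
  · rw [norm_smul]
    exact mul_le_of_le_one_left (norm_nonneg _) (norm_biMul_symbol_le _ _ _ _)
  · refine tendsto_const_nhds.congr' ?_
    filter_upwards [h (ξ.2 - ξ.1)] with k hk
    by_cases hA : ξ.2 - ξ.1 ∈ A
    · rw [indicator_of_mem hA, indicator_of_mem (hk.2 hA)]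
    · rw [indicator_of_notMem hA, indicator_of_notMem (fun hh => hA (hk.1 hh))]

lemma biMul_diff {U W : Set ℝ} (hU : MeasurableSet U) (hW : MeasurableSet W) (h : W ⊆ U) (f g : SchwartzMap ℝ ℂ)
    (x : ℝ) : biMul (U \ W) f g x = biMul U f g x - biMul W f g x := by
  simp_rw [biMul_eq]
  rw [← integral_sub (integrable_biMul hU f g x) (integrable_biMul hW f g x)]
  congr 1 with ξ
  rw [indicator_sdiff h, Pi.sub_apply, ← sub_smul, ← mul_sub]

lemma biMul_zero (A : Set ℝ) (g : ℝ → ℂ) (x : ℝ) : biMul A 0 g x = 0 := by simp [biMul, FT]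

lemma biMul_Ioi (a : ℝ) (f g : ℝ → ℂ) (x : ℝ) : ee (x * a) * biMul (Ioi a) f g x =
    ∫ ξ : ℝ × ℝ, {ξ : ℝ × ℝ | ξ.1 < ξ.2}.indicator (fun ξ => ee (x * (ξ.1 + ξ.2)) * (FT g ξ.2 * FT f (ξ.1 - a))) ξ := by
  rw [biMul_eq, ← integral_const_mul, ← integral_sub_right_eq_self _ ((a, 0) : ℝ × ℝ)]
  congr 1 with ξ
  simp only [Prod.fst_sub, Prod.snd_sub, sub_zero, smul_eq_mul]
  by_cases h : ξ.1 < ξ.2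
  · rw [indicator_of_mem (show ξ.2 - (ξ.1 - a) ∈ Ioi a by rw [mem_Ioi]; linarith),
      indicator_of_mem (by exact h), show x * (ξ.1 + ξ.2) = x * a + x * (ξ.1 - a + ξ.2) by ring, ee_add, Pi.one_apply]
    ring
  · rw [indicator_of_notMem (show ξ.2 - (ξ.1 - a) ∉ Ioi a by rw [mem_Ioi]; linarith),
      indicator_of_notMem (by exact h)]
    ring

/-- The vector of the values at a point of finitely many functions. -/
noncomputable def vec (S : Finset ℤ) (u : ℤ → ℝ → ℂ) (x : ℝ) : EuclideanSpace ℂ S := WithLp.toLp 2 fun n => u n x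

lemma norm_vec (S : Finset ℤ) (u : ℤ → ℝ → ℂ) (x : ℝ) : ‖vec S u x‖ = √(∑ n ∈ S, ‖u n x‖ ^ 2) := by
  rw [vec, EuclideanSpace.norm_eq, ← Finset.sum_coe_sort S]

lemma continuous_vec {S : Finset ℤ} {u : ℤ → ℝ → ℂ} (h : ∀ n, Continuous (u n)) : Continuous (vec S u) :=
  (PiLp.continuous_toLp 2 _).comp (continuous_pi fun n => h n)

theorem exists_eLpNorm_vec_Ioi_le {p q r : ℝ≥0∞} (hp : 1 < p) (hq : 1 < q)
    (hr : 1 / r = 1 / p + 1 / q) (hr0 : 0 < 1 / r) (hr1 : 1 / r < 3 / 2) : ∃ C : ℝ≥0∞, C ≠ ∞ ∧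
    ∀ S : Finset ℤ, S.Nonempty → ∀ (a : ℤ → ℝ) (F : ℤ → SchwartzMap ℝ ℂ) (g : SchwartzMap ℝ ℂ),
      eLpNorm (vec S fun n => biMul (Ioi (a n)) (F n) g) r ≤ C * eLpNorm (vec S fun n => F n) p * eLpNorm g q := by
  obtain ⟨φ, hφ, c, hc, hm⟩ := exists_model
  obtain ⟨C, hC, hb⟩ := exists_eLpNorm_le φ hφ hp hq hr hr0 hr1 hc
  refine ⟨C, hC, fun S ⟨i, hi⟩ a F g => ?_⟩
  set v : EuclideanSpace ℂ S := EuclideanSpace.single ⟨i, hi⟩ 1 with hv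
  have nv : ‖v‖ = 1 := by simp [hv]
  set u : ℤ → ℝ → ℂ := fun n x => ee (x * a n) * F n x with hu
  have cu : ∀ n, Continuous (u n) := fun n => (continuous_ee.comp (by fun_prop)).mul (F n).continuous
  have Lu : ∀ n s, MemLp (u n) s := fun n s => ((F n).memLp s).of_le (cu n).aestronglyMeasurable
    (ae_of_all _ fun x => by simp [hu])
  set w : ℤ → ℝ → ℂ := fun n x => ee (x * a n) * biMul (Ioi (a n)) (F n) g x with hw
  have cw : ∀ n, Continuous (w n) := fun n => (continuous_ee.comp (by fun_prop)).mul (continuous_biMul measurableSet_Ioi _ _)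
  have LV : ∀ s, MemLp (vec S u) s := fun s => memLp_piLp_iff.2 fun n => Lu n s
  have Lg : ∀ s, MemLp (fun x => g x • v) s := fun s => by
    have cg : Continuous fun x => g x • v := g.continuous.smul continuous_const
    refine (g.memLp s).norm.of_le cg.aestronglyMeasurable (ae_of_all _ fun x => ?_)
    rw [norm_smul, nv, mul_one, norm_norm]
  have iα : ∀ n : S, Integrable fun ξ => FT (F n) (ξ - a n) := fun n => by
    rw [FT_eq_fourier]; exact (SchwartzMap.integrable _).comp_sub_right _
  have iβ : Integrable (FT g) := by rw [FT_eq_fourier]; exact SchwartzMap.integrable _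
  have Iα : Integrable (vec S fun n ξ => FT (F n) (ξ - a n)) := integrable_piLp_iff.2 iα
  have key := hb (EuclideanSpace ℂ S) (vec S u) (fun x => g x • v) (vec S w) (continuous_vec cu).stronglyMeasurable
    (g.continuous.smul continuous_const).stronglyMeasurable (memLp_one_iff_integrable.1 (LV 1))
    (memLp_one_iff_integrable.1 (Lg 1)) (LV p).2.ne (Lg q).2.ne (continuous_vec cw) (fun h ih hh => ?_)
  · have e1 : eLpNorm (vec S w) r = eLpNorm (vec S fun n => biMul (Ioi (a n)) (F n) g) r :=
      eLpNorm_congr_norm_ae (ae_of_all _ fun x => by simp [norm_vec, hw])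
    have e2 : eLpNorm (vec S u) p = eLpNorm (vec S fun n => F n) p :=
      eLpNorm_congr_norm_ae (ae_of_all _ fun x => by simp [norm_vec, hu])
    have e3 : eLpNorm (fun x => g x • v) q = eLpNorm g q :=
      eLpNorm_congr_norm_ae (ae_of_all _ fun x => by rw [norm_smul, nv, mul_one])
    rwa [e1, e2, e3] at key
  · have e1 : ∀ x, vec S u x = ∫ ξ, ee (x * ξ) • vec S (fun n ξ => FT (F n) (ξ - a n)) ξ := by
      intro x
      ext n
      rw [eval_integral_piLp]
      · show ee (x * a n) * F n x = ∫ ξ, ee (x * ξ) * FT (F n) (ξ - a n)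
        rw [← integral_ee_mul_FT, ← integral_const_mul, ← integral_sub_right_eq_self _ (a n)]
        congr 1 with ξ
        rw [← mul_assoc, ← ee_add]
        congr 2
        ring
      · exact fun n => (iα n).bdd_mul (c := 1) (continuous_ee.comp (by fun_prop)).aestronglyMeasurable
          (ae_of_all _ fun ξ => (norm_ee _).le)
    have e2 := hm (EuclideanSpace ℂ S) _ (FT g) (vec S u) (fun x => g x • v) v nv Iα iβ
      (memLp_one_iff_integrable.1 (LV 1)) (memLp_one_iff_integrable.1 (Lg 1)) e1
      (fun x => by rw [integral_ee_mul_FT]) h ih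
    have e3 : ∀ x, vec S w x = ∫ ξ : ℝ × ℝ, {ξ : ℝ × ℝ | ξ.1 < ξ.2}.indicator
        (fun ξ => ee (x * (ξ.1 + ξ.2)) • FT g ξ.2 • vec S (fun n ξ => FT (F n) (ξ - a n)) ξ.1) ξ := by
      intro x
      have mS : MeasurableSet {ξ : ℝ × ℝ | ξ.1 < ξ.2} := measurableSet_lt measurable_fst measurable_snd
      have e4 : ∀ (n : S) (ξ : ℝ × ℝ), ({ξ : ℝ × ℝ | ξ.1 < ξ.2}.indicator
        (fun ξ => ee (x * (ξ.1 + ξ.2)) • FT g ξ.2 • vec S (fun n ξ => FT (F n) (ξ - a n)) ξ.1) ξ) n =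
        {ξ : ℝ × ℝ | ξ.1 < ξ.2}.indicator (fun ξ => ee (x * (ξ.1 + ξ.2)) * (FT g ξ.2 * FT (F n) (ξ.1 - a n))) ξ := by
        intro n ξ
        by_cases h : ξ ∈ {ξ : ℝ × ℝ | ξ.1 < ξ.2}
        · rw [indicator_of_mem h, indicator_of_mem h]; rfl
        · rw [indicator_of_notMem h, indicator_of_notMem h]; rfl
      ext n
      rw [eval_integral_piLp]
      · simp_rw [e4]
        exact biMul_Ioi _ _ _ _
      · intro n
        simp_rw [e4]
        exact (((iβ.mul_prod (iα n)).swap).bdd_mul (c := 1) (continuous_ee.comp (by fun_prop)).aestronglyMeasurable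
          (ae_of_all _ fun ξ => (norm_ee _).le)).indicator mS
    simp_rw [e3]
    exact e2

lemma exists_tendsto_Ioi {U : Set ℝ} (hU : IsUpperSet U) : ∃ a : ℕ → ℝ, ∀ ξ, ∀ᶠ k in Filter.atTop, (ξ ∈ Ioi (a k) ↔ ξ ∈ U) := by
  rcases U.eq_empty_or_nonempty with rfl | hne
  · refine ⟨fun k => k, fun ξ => ?_⟩
    filter_upwards [Filter.eventually_ge_atTop ⌈ξ⌉₊] with k hk
    simpa using Nat.ceil_le.1 hk
  by_cases hbd : BddBelow U
  · have hI : ∀ ξ, sInf U < ξ → ξ ∈ U := fun ξ h => by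
      obtain ⟨y, hy, hlt⟩ := exists_lt_of_csInf_lt hne h
      exact hU hlt.le hy
    by_cases hm : sInf U ∈ U
    · refine ⟨fun k => sInf U - 1 / ((k : ℝ) + 1), fun ξ => ?_⟩
      rcases lt_or_ge ξ (sInf U) with h | h
      · have hn : ξ ∉ U := fun hh => absurd (csInf_le hbd hh) (not_le.2 h)
        have := (tendsto_one_div_add_atTop_nhds_zero_nat (𝕜 := ℝ)).eventually_lt_const (sub_pos.2 h)
        filter_upwards [this] with k hk
        simp only [hn, iff_false, mem_Ioi]
        linarith
      · refine Filter.Eventually.of_forall fun k => ⟨fun _ => hU h hm, fun _ => ?_⟩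
        have : 0 < 1 / ((k : ℝ) + 1) := by positivity
        rw [mem_Ioi]; linarith
    · refine ⟨fun _ => sInf U, fun ξ => Filter.Eventually.of_forall fun k => ⟨hI ξ, fun h => ?_⟩⟩
      exact (csInf_le hbd h).lt_of_ne fun he => hm (he ▸ h)
  · refine ⟨fun k => -k, fun ξ => ?_⟩
    have hξ : ξ ∈ U := by
      rw [not_bddBelow_iff] at hbd
      obtain ⟨y, hy, hlt⟩ := hbd ξ
      exact hU hlt.le hy
    filter_upwards [Filter.eventually_gt_atTop ⌈-ξ⌉₊] with k hk
    have := Nat.lt_of_ceil_lt hk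
    simp only [hξ, iff_true, mem_Ioi]
    linarith

/-- A vector-valued bound for bilinear multipliers given by indicators of intervals. -/
theorem exists_eLpNorm_vec_le {p q r : ℝ≥0∞} (hp : 1 < p) (hq : 1 < q)
    (hr : 1 / r = 1 / p + 1 / q) (hr0 : 0 < 1 / r) (hr1 : 1 / r < 3 / 2) : ∃ C : ℝ≥0∞, C ≠ ∞ ∧
    ∀ S : Finset ℤ, S.Nonempty → ∀ I : ℤ → Set ℝ, (∀ n, (I n).OrdConnected) →
      ∀ (F : ℤ → SchwartzMap ℝ ℂ) (g : SchwartzMap ℝ ℂ),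
      eLpNorm (vec S fun n => biMul (I n) (F n) g) r ≤ C * eLpNorm (vec S fun n => F n) p * eLpNorm g q := by
  obtain ⟨C, hC, hb⟩ := exists_eLpNorm_vec_Ioi_le hp hq hr hr0 hr1
  have up : ∀ S : Finset ℤ, S.Nonempty → ∀ U : ℤ → Set ℝ, (∀ n, IsUpperSet (U n)) →
      ∀ (F : ℤ → SchwartzMap ℝ ℂ) (g : SchwartzMap ℝ ℂ),
      eLpNorm (vec S fun n => biMul (U n) (F n) g) r ≤ C * eLpNorm (vec S fun n => F n) p * eLpNorm g q := by
    intro S hS U hU F g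
    choose a ha using fun n => exists_tendsto_Ioi (hU n)
    refine (Lp.eLpNorm_lim_le_liminf_eLpNorm (f := fun k => vec S fun n => biMul (Ioi (a n k)) (F n) g)
      (fun k => (continuous_vec fun n => continuous_biMul measurableSet_Ioi _ _).aestronglyMeasurable) _
      (ae_of_all _ fun x => ?_)).trans ?_
    · refine ((PiLp.continuous_toLp 2 _).tendsto _).comp (tendsto_pi_nhds.2 fun n => ?_)
      exact tendsto_biMul (fun k => measurableSet_Ioi) (ha n) _ _ _
    · exact Filter.liminf_le_of_frequently_le' (Filter.Frequently.of_forall fun k => hb S hS _ F g)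
  refine ⟨ENNReal.LpAddConst r * (C + C), ENNReal.mul_ne_top (ENNReal.LpAddConst_lt_top r).ne (by simp [hC]), fun S hS I hI F g => ?_⟩
  set U : ℤ → Set ℝ := fun n => {x | ∃ y ∈ I n, y ≤ x} with hUd
  set W : ℤ → Set ℝ := fun n => {x | (∃ y ∈ I n, y ≤ x) ∧ ∀ y ∈ I n, y < x} with hWd
  have hU : ∀ n, IsUpperSet (U n) := fun n x z hxz ⟨y, hy, hyx⟩ => ⟨y, hy, hyx.trans hxz⟩
  have hW : ∀ n, IsUpperSet (W n) := fun n x z hxz ⟨⟨y, hy, hyx⟩, h⟩ =>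
    ⟨⟨y, hy, hyx.trans hxz⟩, fun y hy => (h y hy).trans_le hxz⟩
  have mU : ∀ n, MeasurableSet (U n) := fun n => (hU n).ordConnected.measurableSet
  have mW : ∀ n, MeasurableSet (W n) := fun n => (hW n).ordConnected.measurableSet
  have hWU : ∀ n, W n ⊆ U n := fun n x hx => hx.1
  have hIeq : ∀ n, I n = U n \ W n := fun n => by
    ext x
    refine ⟨fun hx => ⟨⟨x, hx, le_rfl⟩, fun h => lt_irrefl _ (h.2 x hx)⟩, fun ⟨⟨y, hy, hyx⟩, h⟩ => ?_⟩
    have : ¬ ∀ y ∈ I n, y < x := fun hh => h ⟨⟨y, hy, hyx⟩, hh⟩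
    push Not at this
    obtain ⟨z, hz, hxz⟩ := this
    exact (hI n).out hy hz ⟨hyx, hxz⟩
  have e1 : (vec S fun n => biMul (I n) (F n) g) = (vec S fun n => biMul (U n) (F n) g) - vec S fun n => biMul (W n) (F n) g := by
    ext x n
    show biMul (I n) (F n) g x = biMul (U n) (F n) g x - biMul (W n) (F n) g x
    rw [hIeq n, biMul_diff (mU n) (mW n) (hWU n)]
  rw [e1]
  refine (eLpNorm_sub_le' (continuous_vec fun n => continuous_biMul (mU n) _ _).aestronglyMeasurable
    (continuous_vec fun n => continuous_biMul (mW n) _ _).aestronglyMeasurable r).trans ?_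
  rw [mul_assoc, mul_assoc, add_mul]
  refine mul_le_mul_right (add_le_add ?_ ?_) _
  · rw [← mul_assoc]; exact up S hS U hU F g
  · rw [← mul_assoc]; exact up S hS W hW F g

end

/-- **corollary, bounded-overlap families.** For `1 < p, q ≤ ∞`,
`1/r = 1/p + 1/q` with `0 < 1/r < 3/2`, and any countable family of intervals
`(I_n)` with overlap at most `A`, the square function
`(Σ_n |π_{I_n}(f_n, g)|²)^{1/2}` is controlled by `‖(Σ_n |f_n|²)^{1/2}‖_p ‖g‖_q`. -/
theorem bilinear_square_function_bounded_overlap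
    (p q r : ℝ≥0∞) (hp : 1 < p) (hq : 1 < q)
    (hr : 1 / r = 1 / p + 1 / q) (hr0 : 0 < 1 / r) (hr1 : 1 / r < 3 / 2)
    (A : ℝ) (hA : 1 ≤ A) :
    ∃ C : ℝ, 0 < C ∧ ∀ I : ℤ → Set ℝ,
      (∀ n : ℤ, (I n).OrdConnected) →
      (∀ ξ : ℝ, (∑' n : ℤ, (I n).indicator (1 : ℝ → ℝ) ξ) ≤ A) →
      ∀ F : ℤ → SchwartzMap ℝ ℂ, (Function.support F).Finite →
      ∀ g : SchwartzMap ℝ ℂ,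
        eLpNorm (fun x : ℝ =>
            Real.sqrt (∑' n : ℤ, ‖biMul (I n) (⇑(F n)) (⇑g) x‖ ^ 2)) r volume ≤
          ENNReal.ofReal C *
            eLpNorm (fun x : ℝ => Real.sqrt (∑' n : ℤ, ‖F n x‖ ^ 2)) p volume *
            eLpNorm (⇑g) q volume := by
  obtain ⟨C, hC, hb⟩ := exists_eLpNorm_vec_le hp hq hr hr0 hr1
  refine ⟨C.toReal + 1, by positivity, fun I hI _ F hF g => ?_⟩
  set S : Finset ℤ := insert 0 hF.toFinset with hS
  have h0 : ∀ n ∉ S, F n = 0 := fun n hn => by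
    by_contra hne
    exact hn (Finset.mem_insert_of_mem (hF.mem_toFinset.2 hne))
  have e1 : eLpNorm (fun x : ℝ => Real.sqrt (∑' n : ℤ, ‖biMul (I n) (⇑(F n)) (⇑g) x‖ ^ 2)) r volume =
      eLpNorm (vec S fun n => biMul (I n) (F n) g) r := by
    refine eLpNorm_congr_norm_ae (ae_of_all _ fun x => ?_)
    rw [norm_vec, norm_of_nonneg (sqrt_nonneg _), tsum_eq_sum (s := S)]
    intro n hn
    rw [h0 n hn, FunLike.coe_zero, biMul_zero]
    simp
  have e2 : eLpNorm (fun x : ℝ => Real.sqrt (∑' n : ℤ, ‖F n x‖ ^ 2)) p volume = eLpNorm (vec S fun n => F n) p := by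
    refine eLpNorm_congr_norm_ae (ae_of_all _ fun x => ?_)
    rw [norm_vec, norm_of_nonneg (sqrt_nonneg _), tsum_eq_sum (s := S)]
    intro n hn
    rw [h0 n hn]
    simp
  rw [e1, e2]
  refine (hb S (Finset.insert_nonempty _ _) I hI F g).trans ?_
  gcongr
  rw [← ENNReal.ofReal_toReal hC]
  exact ENNReal.ofReal_le_ofReal (by simp)
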